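/- Let p>1, let a∈C^1([0,1]) with a(x)>0 on [0,1], and let W satisfy (W1) and (W2). For every solution E:[0,1]→[0,W_0] of E'(x)=(a'(x)/a(x))K(E(x)) there exists a family {u_ε}_{ε>0 small} of solutions of the Neumann problem (P_ε) such that the energies E_ε of u_ε converge uniformly on [0,1] to E as ε→0^+. -/

import Mathlib

open Real Set Filter Topology MeasureTheory intervalIntegral Asymptotics

noncomputable section

/-- `φ_p(s) = |s|^{p-2} s`. -/
def phip (p s : ℝ) : ℝ := |s| ^ (p - 2) * s

/-- `L(s) = |s|^p / p*` with `p* = p/(p-1)`. -/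
def Lfun (p s : ℝ) : ℝ := |s| ^ p / (p / (p - 1))

/-- condition (W1) -/
def W1cond (p : ℝ) (W : ℝ → ℝ) (Cm1 C0 C1 W0 : ℝ) : Prop :=
  0 < Cm1 ∧ 0 < C0 ∧ 0 < C1 ∧ 0 < W0 ∧
  (fun u => W u - C1 / p * |u - 1| ^ p) =o[𝓝[Set.Icc (-1:ℝ) 1] 1] (fun u => |u - 1| ^ p) ∧
  (fun u => W u - Cm1 / p * |u + 1| ^ p) =o[𝓝[Set.Icc (-1:ℝ) 1] (-1)] (fun u => |u + 1| ^ p) ∧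
  (fun u => W u - (W0 - C0 / p * |u| ^ p)) =o[𝓝[Set.Icc (-1:ℝ) 1] 0] (fun u => |u| ^ p)

/-- condition (W2) -/
def W2cond (p : ℝ) (W : ℝ → ℝ) : Prop :=
  StrictAntiOn (fun u => deriv W u / phip p u) (Set.Ico (-1:ℝ) 0) ∧
  StrictMonoOn (fun u => deriv W u / phip p u) (Set.Ioc (0:ℝ) 1)

/-- `v` (with derivative `v'`) is a global solution of `-(φ_p(v'))' + a W'(v) = 0`. -/
def IsSolAuto (p aa : ℝ) (W v v' : ℝ → ℝ) : Prop :=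
  Continuous v' ∧ (∀ x, HasDerivAt v (v' x) x) ∧
  ∃ g : ℝ → ℝ, Continuous g ∧ (∀ x, HasDerivAt (fun y => phip p (v' y)) (g x) x) ∧
    ∀ x, g x = aa * deriv W (v x)

/-- `v` (with derivative `v'`) solves `-(φ_p(v'))' + a W'(v) = 0` on the open set `I`. -/
def IsSolAutoOn (p aa : ℝ) (W v v' : ℝ → ℝ) (I : Set ℝ) : Prop :=
  ContinuousOn v' I ∧ (∀ x ∈ I, HasDerivAt v (v' x) x) ∧
  ∃ g : ℝ → ℝ, ContinuousOn g I ∧ (∀ x ∈ I, HasDerivAt (fun y => phip p (v' y)) (g x) x) ∧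
    ∀ x ∈ I, g x = aa * deriv W (v x)

/-- `u` (with derivative `u'`) solves `-ε(φ_p(εu'))' + a(x) W'(u) = 0` on `S`. -/
def IsSolOn (p ε : ℝ) (a W u u' : ℝ → ℝ) (S : Set ℝ) : Prop :=
  ContinuousOn u' S ∧ (∀ x ∈ S, HasDerivWithinAt u (u' x) S x) ∧
  ∃ g : ℝ → ℝ, ContinuousOn g S ∧
    (∀ x ∈ S, HasDerivWithinAt (fun y => phip p (ε * u' y)) (g x) S x) ∧
    ∀ x ∈ S, ε * g x = a x * deriv W (u x)

/-- `u` is a solution of the Neumann problem `(P_ε)`. -/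
def IsNeumann (p ε : ℝ) (a W u u' : ℝ → ℝ) : Prop :=
  IsSolOn p ε a W u u' (Set.Icc 0 1) ∧ u' 0 = 0 ∧ u' 1 = 0

/-- energy of a solution of `(P_ε)` -/
def Ener (p ε : ℝ) (a W u u' : ℝ → ℝ) (x : ℝ) : ℝ :=
  -(1 / a x) * Lfun p (ε * u' x) + W (u x)

/-- `π_p` -/
def pip (p : ℝ) : ℝ := 2 * (p - 1) ^ (1 / p) * ∫ s in (0:ℝ)..1, ((1:ℝ) - s ^ p) ^ (-(1 / p))

lemma phip_zero (p : ℝ) : phip p 0 = 0 := by simp [phip]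

lemma phip_neg (p s : ℝ) : phip p (-s) = -phip p s := by simp [phip]

lemma phip_of_pos {p s : ℝ} (hs : 0 < s) : phip p s = s ^ (p - 1) := by
  rw [phip, abs_of_pos hs, show p - 1 = p - 2 + 1 by ring, rpow_add hs, rpow_one]

lemma phip_pos {p s : ℝ} (hs : 0 < s) : 0 < phip p s := by
  rw [phip_of_pos hs]; positivity

lemma phip_of_neg {p s : ℝ} (hs : s < 0) : phip p s = -(-s) ^ (p - 1) := by
  have := phip_of_pos (p := p) (neg_pos.2 hs)
  rw [phip_neg] at this
  linarith

lemma phip_neg_of_neg {p s : ℝ} (hs : s < 0) : phip p s < 0 := by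
  have := phip_pos (p := p) (neg_pos.2 hs)
  rw [phip_neg] at this
  linarith

lemma phip_mul_self {p : ℝ} (hp : 1 < p) (s : ℝ) : s * phip p s = |s| ^ p := by
  rcases lt_trichotomy s 0 with h | h | h
  · rw [phip_of_neg h, abs_of_neg h, show p = p - 1 + 1 by ring, rpow_add (neg_pos.2 h), rpow_one]
    ring_nf
  · subst h; simp [phip, zero_rpow (by linarith : p ≠ 0)]
  · rw [phip_of_pos h, abs_of_pos h, show p = p - 1 + 1 by ring, rpow_add h, rpow_one]
    ring_nf

lemma abs_phip {p : ℝ} (hp : 1 < p) (s : ℝ) : |phip p s| = |s| ^ (p - 1) := by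
  rcases lt_trichotomy s 0 with h | h | h
  · rw [phip_of_neg h, abs_of_neg h, abs_neg, abs_of_pos (rpow_pos_of_pos (neg_pos.2 h) _)]
  · subst h; simp [phip, zero_rpow (by linarith : p - 1 ≠ 0)]
  · rw [phip_of_pos h, abs_of_pos h, abs_of_pos (rpow_pos_of_pos h _)]

lemma continuous_phip {p : ℝ} (hp : 1 < p) : Continuous (phip p) := by
  rw [continuous_iff_continuousAt]
  intro s
  rcases eq_or_ne s 0 with h | h
  · subst h
    rw [ContinuousAt, phip_zero, tendsto_zero_iff_abs_tendsto_zero]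
    have h1 : Continuous fun s : ℝ => |s| ^ (p - 1) :=
      continuous_abs.rpow_const fun _ => Or.inr (by linarith)
    have h2 := h1.tendsto 0
    simp only [abs_zero, zero_rpow (by linarith : p - 1 ≠ 0)] at h2
    exact h2.congr fun s => (abs_phip hp s).symm
  · unfold phip
    exact ((continuous_abs.continuousAt).rpow_const (Or.inl (abs_ne_zero.2 h))).mul continuousAt_id

lemma phip_mul_of_pos {p c : ℝ} (hc : 0 < c) (s : ℝ) :
    phip p (c * s) = c ^ (p - 1) * phip p s := by
  unfold phip
  rw [abs_mul, abs_of_pos hc, mul_rpow hc.le (abs_nonneg s), show p - 1 = p - 2 + 1 by ring,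
    rpow_add hc, rpow_one]
  ring

lemma conj_sub_one {p q : ℝ} (hp : 1 < p) (hq : q = p / (p - 1)) : (q - 1) * (p - 1) = 1 := by
  have : p - 1 ≠ 0 := by linarith
  subst hq; field_simp; ring

lemma one_lt_conj {p q : ℝ} (hp : 1 < p) (hq : q = p / (p - 1)) : 1 < q := by
  subst hq; rw [lt_div_iff₀ (by linarith)]; linarith

lemma conj_symm' {p q : ℝ} (hp : 1 < p) (hq : q = p / (p - 1)) : p = q / (q - 1) := by
  have h := conj_sub_one hp hq
  have h1 := one_lt_conj hp hq
  rw [eq_div_iff (by linarith)]; linarith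

lemma phip_phip {p q : ℝ} (hp : 1 < p) (hq : q = p / (p - 1)) (s : ℝ) :
    phip p (phip q s) = s := by
  have h := conj_sub_one hp hq
  rcases lt_trichotomy s 0 with hs | hs | hs
  · rw [phip_of_neg hs, phip_neg, phip_of_pos (rpow_pos_of_pos (neg_pos.2 hs) _),
      ← rpow_mul (neg_pos.2 hs).le, h, rpow_one, neg_neg]
  · subst hs; simp [phip_zero]
  · rw [phip_of_pos hs, phip_of_pos (rpow_pos_of_pos hs _), ← rpow_mul hs.le, h, rpow_one]

/-- The derivative of `|s|^q / q` is `φ_q`. -/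
lemma hasDerivAt_abs_rpow_div {q : ℝ} (hq : 1 < q) (s : ℝ) :
    HasDerivAt (fun s : ℝ => |s| ^ q / q) (phip q s) s := by
  have := (hasDerivAt_abs_rpow s hq).div_const q
  refine this.congr_deriv ?_
  unfold phip; field_simp

lemma Lfun_phip {p q : ℝ} (hp : 1 < p) (hq : q = p / (p - 1)) (m : ℝ) :
    Lfun p (phip q m) = |m| ^ q / q := by
  have h1 := one_lt_conj hp hq
  have h := conj_sub_one hp hq
  unfold Lfun
  rw [← hq, abs_phip h1, ← rpow_mul (abs_nonneg m)]
  congr 2; linarith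

lemma phip_strictMono {p : ℝ} (hp : 1 < p) : StrictMono (phip p) := by
  intro s t hst
  rcases lt_or_ge s 0 with hs | hs
  · rcases lt_or_ge t 0 with ht | ht
    · rw [phip_of_neg hs, phip_of_neg ht]
      exact neg_lt_neg (rpow_lt_rpow (by linarith) (by linarith) (by linarith))
    · refine (phip_neg_of_neg hs).trans_le ?_
      rcases ht.eq_or_lt with h | h
      · rw [← h, phip_zero]
      · exact (phip_pos h).le
  · rw [phip_of_pos (hs.trans_lt hst)]
    rcases hs.eq_or_lt with h | h
    · rw [← h, phip_zero]; exact rpow_pos_of_pos (by linarith) _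
    · rw [phip_of_pos h]; exact rpow_lt_rpow hs hst (by linarith)

/-- A double-well potential `F`, with derivative `f`, extended by `0` outside `[-1,1]`. -/
structure Well (p q W0 : ℝ) (f F : ℝ → ℝ) : Prop where
  hp : 1 < p
  hq : q = p / (p - 1)
  W0pos : 0 < W0
  fcont : Continuous f
  Fder : ∀ u, HasDerivAt F (f u) u
  F0 : F 0 = W0
  Fout : ∀ u, 1 ≤ |u| → F u = 0
  fout : ∀ u, 1 ≤ |u| → f u = 0
  f0 : f 0 = 0
  fneg : ∀ u ∈ Ioo (0:ℝ) 1, f u < 0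
  fpos : ∀ u ∈ Ioo (-1:ℝ) 0, 0 < f u
  hmono : ∀ u v, 0 < u → u < v → v ≤ 1 → f u / phip p u < f v / phip p v
  hanti : ∀ u v, -1 ≤ v → v < u → u < 0 → f u / phip p u < f v / phip p v
  upper : ∃ C, 0 < C ∧ ∀ u, |u| ≤ 1 → F u ≤ C * (1 - |u|) ^ p
  lower : ∃ c, 0 < c ∧ ∀ u, 1 / 2 ≤ |u| → |u| ≤ 1 → c * F u ^ (1 / q) ≤ |f u|

lemma value_and_deriv_of_isLittleO {p A B c : ℝ} (hp : 1 < p) {W : ℝ → ℝ}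
    (hW : Differentiable ℝ W) (hc : c ∈ Icc (-1:ℝ) 1)
    (h : (fun u => W u - (A + B * |u - c| ^ p)) =o[𝓝[Icc (-1:ℝ) 1] c] (fun u => |u - c| ^ p)) :
    W c = A ∧ deriv W c = 0 := by
  have hWc : W c = A := by
    have := (h.def one_pos).self_of_nhdsWithin hc
    simp [zero_rpow (by linarith : p ≠ 0)] at this
    linarith
  refine ⟨hWc, ?_⟩
  have hpow : HasDerivAt (fun u : ℝ => |u - c| ^ p) 0 c := by
    have := (hasDerivAt_abs_rpow (c - c) hp).comp_sub_const c c
    simpa using this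
  have hr : HasDerivWithinAt (fun u => W u - (A + B * |u - c| ^ p)) 0 (Icc (-1:ℝ) 1) c := by
    rw [hasDerivWithinAt_iff_isLittleO]
    have h2 := hpow.hasDerivWithinAt (s := Icc (-1:ℝ) 1)
    rw [hasDerivWithinAt_iff_isLittleO] at h2
    simp [zero_rpow (by linarith : p ≠ 0), hWc] at h2 ⊢
    exact h.trans h2
  have h3 : HasDerivWithinAt W 0 (Icc (-1:ℝ) 1) c := by
    have := hr.add ((hpow.const_mul B).const_add A).hasDerivWithinAt
    rw [mul_zero, add_zero] at this
    exact this.congr (fun u _ => by simp) (by simp)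
  have h4 := (hW c).hasDerivAt.hasDerivWithinAt (s := Icc (-1:ℝ) 1)
  exact (uniqueDiffOn_Icc (by norm_num : (-1:ℝ) < 1) c hc).eq_deriv _ h4 h3

/-- Behaviour near the right well of a one-sided potential. -/
lemma one_sided_bounds {p q C : ℝ} (hp : 1 < p) (hq : q = p / (p - 1)) (hC : 0 < C) {G g : ℝ → ℝ}
    (hG : ∀ u, HasDerivAt G (g u) u) (hneg : ∀ u ∈ Ioo (0:ℝ) 1, g u < 0) (hG1 : G 1 = 0)
    (hmono : ∀ u v, 0 < u → u < v → v ≤ 1 → g u / phip p u < g v / phip p v)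
    (h : (fun u => G u - C / p * |u - 1| ^ p) =o[𝓝[Icc (-1:ℝ) 1] 1] (fun u => |u - 1| ^ p)) :
    (∃ C, 0 < C ∧ ∀ u ∈ Icc (0:ℝ) 1, G u ≤ C * (1 - u) ^ p) ∧
    ∃ c, 0 < c ∧ ∀ u ∈ Icc (1/2:ℝ) 1, c * G u ^ (1 / q) ≤ |g u| := by
  have hp0 : 0 < p := by linarith
  have hq1 := one_lt_conj hp hq
  have hpq : 1 / q = 1 - 1 / p := by rw [hq]; field_simp
  have hcont : Continuous G := continuous_iff_continuousAt.2 fun u => (hG u).continuousAt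
  have hanti : StrictAntiOn G (Icc 0 1) := by
    refine strictAntiOn_of_deriv_neg (convex_Icc 0 1) hcont.continuousOn fun x hx => ?_
    rw [interior_Icc] at hx
    rw [(hG x).deriv]; exact hneg x hx
  have hGnn : ∀ u ∈ Icc (0:ℝ) 1, 0 ≤ G u := fun u hu => by
    rw [← hG1]; exact hanti.antitoneOn hu (right_mem_Icc.2 zero_le_one) hu.2
  have hev := h.def (by positivity : (0:ℝ) < C / (2 * p))
  rw [eventually_nhdsWithin_iff, Metric.eventually_nhds_iff] at hev
  obtain ⟨δ, hδ, hb⟩ := hev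
  obtain ⟨η, hη0, hη1, hηδ⟩ : ∃ η : ℝ, 0 < η ∧ η < 1 ∧ η < δ :=
    ⟨min (1/2) (δ/2), by positivity, (min_le_left _ _).trans_lt (by norm_num),
      (min_le_right _ _).trans_lt (by linarith)⟩
  have hnear : ∀ u, 1 - η ≤ u → u ≤ 1 →
      C / (2 * p) * (1 - u) ^ p ≤ G u ∧ G u ≤ 2 * (C / p) * (1 - u) ^ p := by
    intro u h1 h2
    have h3 := hb (y := u) (by rw [Real.dist_eq, abs_sub_comm, abs_of_nonneg (by linarith)]; linarith)
      ⟨by linarith, h2⟩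
    have h4 : |u - 1| = 1 - u := by rw [abs_sub_comm, abs_of_nonneg (by linarith)]
    rw [h4, Real.norm_eq_abs, Real.norm_eq_abs, abs_of_nonneg (rpow_nonneg (by linarith) p : 0 ≤ (1-u)^p),
      abs_le] at h3
    have h5 : C / p = 2 * (C / (2 * p)) := by field_simp
    have h6 : 0 ≤ C / (2 * p) * (1 - u) ^ p :=
      mul_nonneg (by positivity) (rpow_nonneg (by linarith) p)
    rw [h5] at h3 ⊢
    constructor <;> nlinarith
  constructor
  · refine ⟨max (2 * (C / p)) (G 0 / η ^ p), lt_max_of_lt_left (by positivity), fun u hu => ?_⟩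
    have h0 : 0 ≤ (1 - u) ^ p := rpow_nonneg (by linarith [hu.2]) p
    rcases le_or_gt (1 - η) u with h1 | h1
    · exact (hnear u h1 hu.2).2.trans (mul_le_mul_of_nonneg_right (le_max_left _ _) h0)
    · calc G u ≤ G 0 := hanti.antitoneOn (left_mem_Icc.2 zero_le_one) hu hu.1
        _ = G 0 / η ^ p * η ^ p := by
            rw [div_mul_cancel₀]; exact (rpow_pos_of_pos hη0 p).ne'
        _ ≤ G 0 / η ^ p * (1 - u) ^ p := by
            refine mul_le_mul_of_nonneg_left (rpow_le_rpow hη0.le (by linarith) hp0.le) ?_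
            exact div_nonneg (hGnn 0 (left_mem_Icc.2 zero_le_one)) (rpow_nonneg hη0.le _)
        _ ≤ _ := mul_le_mul_of_nonneg_right (le_max_right _ _) h0
  · obtain ⟨c, hc, hlow⟩ : ∃ c, 0 < c ∧ ∀ u ∈ Icc (0:ℝ) 1, c * (1 - u) ^ p ≤ G u := by
      have hpos : 0 < G (1 - η) := by
        rw [← hG1]; exact hanti ⟨by linarith, by linarith⟩ (right_mem_Icc.2 zero_le_one) (by linarith)
      refine ⟨min (C / (2 * p)) (G (1 - η)), lt_min (by positivity) hpos, fun u hu => ?_⟩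
      have h0 : 0 ≤ (1 - u) ^ p := rpow_nonneg (by linarith [hu.2]) p
      rcases le_or_gt (1 - η) u with h1 | h1
      · exact (mul_le_mul_of_nonneg_right (min_le_left _ _) h0).trans (hnear u h1 hu.2).1
      · calc _ ≤ G (1 - η) * 1 := mul_le_mul (min_le_right _ _)
              (rpow_le_one (by linarith [hu.2]) (by linarith [hu.1]) hp0.le) h0 hpos.le
          _ ≤ G u := by
            rw [mul_one]
            exact hanti.antitoneOn hu ⟨by linarith, by linarith⟩ h1.le
    refine ⟨(1/2) ^ (p - 1) * c ^ (1 / p), by positivity, fun u hu => ?_⟩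
    rcases hu.2.eq_or_lt with h1 | h1
    · rw [h1, hG1, zero_rpow (by positivity), mul_zero]; exact abs_nonneg _
    have hu0 : 0 < u := by linarith [hu.1]
    have huI : u ∈ Icc (0:ℝ) 1 := ⟨hu0.le, hu.2⟩
    obtain ⟨t, ht, hder⟩ := exists_hasDerivAt_eq_slope G g h1 hcont.continuousOn fun x _ => hG x
    have ht0 : 0 < t := hu0.trans ht.1
    have hgt := hneg t ⟨ht0, ht.2⟩
    have hgu := hneg u ⟨hu0, h1⟩
    have hm := hmono u t hu0 ht.1 ht.2.le
    have hGt : G u = -g t * (1 - u) := by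
      rw [hder, hG1]
      have : 1 - u ≠ 0 := by linarith
      field_simp; ring
    have hpt : phip p t ≤ 1 := by
      rw [phip_of_pos ht0]; exact rpow_le_one ht0.le ht.2.le (by linarith)
    have hpu : (1/2:ℝ) ^ (p - 1) ≤ phip p u := by
      rw [phip_of_pos hu0]; exact rpow_le_rpow (by norm_num) hu.1 (by linarith)
    have hpu0 := phip_pos (p := p) hu0
    have hpt0 := phip_pos (p := p) ht0
    have h5 : (1/2:ℝ) ^ (p - 1) * (-g t) ≤ -g u := by
      rw [div_lt_div_iff₀ hpu0 hpt0] at hm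
      calc (1/2:ℝ) ^ (p - 1) * (-g t) ≤ phip p u * (-g t) :=
            mul_le_mul_of_nonneg_right hpu (by linarith)
        _ ≤ -g u * phip p t := by nlinarith
        _ ≤ -g u := by nlinarith
    have h1u : 0 < 1 - u := by linarith
    have hGu : 0 < G u := by rw [hGt]; exact mul_pos (by linarith) h1u
    have h6 : c ^ (1 / p) * (1 - u) ≤ G u ^ (1 / p) := by
      have := rpow_le_rpow (by positivity) (hlow u huI) (by positivity : 0 ≤ 1 / p)
      rwa [mul_rpow hc.le (by positivity), ← rpow_mul h1u.le, mul_one_div_cancel hp0.ne',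
        rpow_one] at this
    have h7 : c ^ (1 / p) * G u ^ (1 / q) ≤ -g t := by
      rw [hpq, rpow_sub hGu, rpow_one]
      rw [mul_div_assoc', div_le_iff₀ (by positivity)]
      calc c ^ (1 / p) * G u = -g t * (c ^ (1 / p) * (1 - u)) := by rw [hGt]; ring
        _ ≤ _ := mul_le_mul_of_nonneg_left h6 (by linarith)
    rw [abs_of_neg hgu, mul_assoc]
    exact (mul_le_mul_of_nonneg_left h7 (by positivity)).trans h5

/-- The extension by `0` outside `[-1,1]`. -/
def extZero (g : ℝ → ℝ) (u : ℝ) : ℝ := if |u| ≤ 1 then g u else 0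

lemma extZero_of_le {g : ℝ → ℝ} {u : ℝ} (h : |u| ≤ 1) : extZero g u = g u := if_pos h

lemma well_of_conditions {p W0 Cm1 C0 C1 : ℝ} {W : ℝ → ℝ} (hp : 1 < p) (hW : ContDiff ℝ 1 W)
    (hW1 : W1cond p W Cm1 C0 C1 W0) (hW2 : W2cond p W) :
    Well p (p / (p - 1)) W0 (extZero (deriv W)) (extZero W) := by
  obtain ⟨hCm1, hC0, hC1, hW0, o1, om1, o0⟩ := hW1
  have hd : Differentiable ℝ W := hW.differentiable (by norm_num)
  have hdc : Continuous (deriv W) := hW.continuous_deriv (by norm_num)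
  obtain ⟨v1, d1⟩ := value_and_deriv_of_isLittleO (A := 0) (B := C1 / p) hp hd
    (c := 1) (by norm_num) (by simpa using o1)
  obtain ⟨vm1, dm1⟩ := value_and_deriv_of_isLittleO (A := 0) (B := Cm1 / p) hp hd
    (c := -1) (by norm_num) (by simpa using om1)
  obtain ⟨v0, d0⟩ := value_and_deriv_of_isLittleO (A := W0) (B := -(C0 / p)) hp hd
    (c := 0) (by norm_num) (by simpa [sub_eq_add_neg] using o0)
  have habs : ∀ u : ℝ, |u| = 1 → u = 1 ∨ u = -1 := fun u h => (abs_eq zero_le_one).1 h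
  have hmono : ∀ u v, 0 < u → u < v → v ≤ 1 → deriv W u / phip p u < deriv W v / phip p v :=
    fun u v h1 h2 h3 => hW2.2 ⟨h1, h2.le.trans h3⟩ ⟨h1.trans h2, h3⟩ h2
  have hanti : ∀ u v, -1 ≤ v → v < u → u < 0 → deriv W u / phip p u < deriv W v / phip p v :=
    fun u v h1 h2 h3 => hW2.1 ⟨h1, h2.trans h3⟩ ⟨h1.trans h2.le, h3⟩ h2
  have hneg : ∀ u ∈ Ioo (0:ℝ) 1, deriv W u < 0 := fun u hu => by
    have := hmono u 1 hu.1 hu.2 le_rfl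
    rw [d1, zero_div, div_lt_iff₀ (phip_pos hu.1), zero_mul] at this
    exact this
  have hpos : ∀ u ∈ Ioo (-1:ℝ) 0, 0 < deriv W u := fun u hu => by
    have := hanti u (-1) le_rfl hu.1 hu.2
    rw [dm1, zero_div, div_lt_iff_of_neg (phip_neg_of_neg hu.2), zero_mul] at this
    exact this
  have hWd : ∀ u, HasDerivAt W (deriv W u) u := fun u => (hd u).hasDerivAt
  obtain ⟨⟨A, hA, hA'⟩, c, hc, hc'⟩ := one_sided_bounds hp rfl hC1 hWd hneg v1 hmono o1
  have hWn : ∀ u, HasDerivAt (fun u => W (-u)) (-deriv W (-u)) u := fun u => by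
    exact (HasDerivAt.comp u (hWd (-u)) (hasDerivAt_neg u)).congr_deriv (by ring)
  have hmono' : ∀ u v, 0 < u → u < v → v ≤ 1 →
      -deriv W (-u) / phip p u < -deriv W (-v) / phip p v := fun u v h1 h2 h3 => by
    have := hanti (-u) (-v) (by linarith) (by linarith) (by linarith)
    rwa [phip_neg, phip_neg, div_neg, div_neg, ← neg_div, ← neg_div] at this
  have o1' : (fun u => W (-u) - Cm1 / p * |u - 1| ^ p) =o[𝓝[Icc (-1:ℝ) 1] 1]
      (fun u => |u - 1| ^ p) := by
    have ht : Tendsto (fun u : ℝ => -u) (𝓝[Icc (-1:ℝ) 1] 1) (𝓝[Icc (-1:ℝ) 1] (-1)) := by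
      refine tendsto_nhdsWithin_iff.2 ⟨(continuous_neg.tendsto (1:ℝ)).mono_left nhdsWithin_le_nhds, ?_⟩
      filter_upwards [self_mem_nhdsWithin] with u hu
      exact ⟨by linarith [hu.2], by linarith [hu.1]⟩
    have := om1.comp_tendsto ht
    refine (this.congr (fun u => ?_) fun u => ?_) <;>
    · simp only [Function.comp]
      rw [show |-u + 1| = |u - 1| by rw [← abs_neg]; congr 1; ring]
  obtain ⟨⟨B, hB, hB'⟩, d, hd', hd''⟩ := one_sided_bounds hp rfl hCm1 hWn
    (fun u hu => by have := hpos (-u) ⟨by linarith [hu.2], by linarith [hu.1]⟩; linarith)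
    vm1 hmono' o1'
  have hFder : ∀ u, HasDerivAt (extZero W) (extZero (deriv W) u) u := by
    intro u
    rcases lt_trichotomy |u| 1 with h | h | h
    · rw [extZero_of_le h.le]
      refine (hWd u).congr_of_eventuallyEq ?_
      filter_upwards [(continuous_abs.tendsto u).eventually (gt_mem_nhds h)] with v hv
      exact extZero_of_le (le_of_lt hv)
    · have hz : W u = 0 ∧ deriv W u = 0 := by
        rcases habs u h with rfl | rfl
        · exact ⟨v1, d1⟩
        · exact ⟨vm1, dm1⟩
      rw [extZero_of_le h.le, hz.2]
      have h1 := hWd u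
      rw [hz.2, hasDerivAt_iff_isLittleO] at h1
      rw [hasDerivAt_iff_isLittleO, extZero_of_le h.le]
      refine (IsLittleO.of_bound fun c hc => ?_)
      filter_upwards [h1.def hc] with v hv
      unfold extZero
      split_ifs
      · exact hv
      · simp only [hz.1, smul_zero, sub_zero, norm_zero]; positivity
    · have : extZero (deriv W) u = 0 := if_neg (not_le.2 h)
      rw [this]
      refine (hasDerivAt_const u (0:ℝ)).congr_of_eventuallyEq ?_
      filter_upwards [(continuous_abs.tendsto u).eventually (lt_mem_nhds h)] with v hv
      exact if_neg (not_le.2 hv)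
  refine ⟨hp, rfl, hW0, ?_, hFder, ?_, ?_, ?_, ?_, ?_, ?_, ?_, ?_, ?_, ?_⟩
  · refine Continuous.if_le hdc continuous_const continuous_abs continuous_const fun u h => ?_
    rcases habs u h with rfl | rfl
    · exact d1
    · exact dm1
  · rw [extZero_of_le (by simp), v0]
  · intro u hu
    unfold extZero
    split_ifs with h
    · rcases habs u (le_antisymm h hu) with rfl | rfl
      · exact v1
      · exact vm1
    · rfl
  · intro u hu
    unfold extZero
    split_ifs with h
    · rcases habs u (le_antisymm h hu) with rfl | rfl
      · exact d1
      · exact dm1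
    · rfl
  · rw [extZero_of_le (by simp), d0]
  · intro u hu
    rw [extZero_of_le (by rw [abs_of_pos hu.1]; exact hu.2.le)]; exact hneg u hu
  · intro u hu
    rw [extZero_of_le (by rw [abs_of_neg hu.2]; linarith [hu.1])]; exact hpos u hu
  · intro u v h1 h2 h3
    rw [extZero_of_le (by rw [abs_of_pos h1]; linarith),
      extZero_of_le (by rw [abs_of_pos (h1.trans h2)]; linarith)]
    exact hmono u v h1 h2 h3
  · intro u v h1 h2 h3
    rw [extZero_of_le (by rw [abs_of_neg h3]; linarith),
      extZero_of_le (by rw [abs_of_neg (h2.trans h3)]; linarith)]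
    exact hanti u v h1 h2 h3
  · refine ⟨max A B, lt_max_of_lt_left hA, fun u hu => ?_⟩
    rw [extZero_of_le hu]
    have h0 : 0 ≤ (1 - |u|) ^ p := rpow_nonneg (by linarith) p
    rcases le_total 0 u with h | h
    · rw [abs_of_nonneg h] at hu h0 ⊢
      exact (hA' u ⟨h, hu⟩).trans (mul_le_mul_of_nonneg_right (le_max_left _ _) h0)
    · rw [abs_of_nonpos h] at hu h0 ⊢
      have := hB' (-u) ⟨by linarith, hu⟩
      rw [neg_neg] at this
      exact this.trans (mul_le_mul_of_nonneg_right (le_max_right _ _) h0)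
  · refine ⟨min c d, lt_min hc hd', fun u hu1 hu2 => ?_⟩
    rw [extZero_of_le hu2, extZero_of_le hu2]
    rcases le_total 0 u with h | h
    · rw [abs_of_nonneg h] at hu1 hu2
      have h1 := hc' u ⟨hu1, hu2⟩
      refine le_trans (mul_le_mul_of_nonneg_right (min_le_left _ _) (rpow_nonneg ?_ _)) h1
      rcases hu2.eq_or_lt with rfl | h3
      · exact v1.ge
      have : AntitoneOn W (Icc 0 1) := antitoneOn_of_deriv_nonpos (convex_Icc 0 1)
        hd.continuous.continuousOn hd.differentiableOn fun x hx =>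
          (hneg x (by rwa [interior_Icc] at hx)).le
      rw [← v1]; exact this ⟨h, hu2⟩ (right_mem_Icc.2 zero_le_one) hu2
    · rw [abs_of_nonpos h] at hu1 hu2
      have h1 := hd'' (-u) ⟨hu1, hu2⟩
      simp only [neg_neg, abs_neg] at h1
      refine le_trans (mul_le_mul_of_nonneg_right (min_le_right _ _) (rpow_nonneg ?_ _)) h1
      have : MonotoneOn W (Icc (-1) 0) := monotoneOn_of_deriv_nonneg (convex_Icc (-1) 0)
        hd.continuous.continuousOn hd.differentiableOn fun x hx =>
          (hpos x (by rwa [interior_Icc] at hx)).le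
      rw [← vm1]; exact this (left_mem_Icc.2 (by norm_num)) ⟨by linarith, h⟩ (by linarith)

namespace Well

variable {p q W0 : ℝ} {f F : ℝ → ℝ}

lemma q1 (w : Well p q W0 f F) : 1 < q := one_lt_conj w.hp w.hq

lemma Fcont (w : Well p q W0 f F) : Continuous F :=
  continuous_iff_continuousAt.2 fun u => (w.Fder u).continuousAt

lemma mul_f_nonpos (w : Well p q W0 f F) (u : ℝ) : u * f u ≤ 0 := by
  rcases le_or_gt 1 |u| with h | h
  · rw [w.fout u h, mul_zero]
  rw [abs_lt] at h
  rcases lt_trichotomy u 0 with h1 | h1 | h1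
  · exact (mul_neg_of_neg_of_pos h1 (w.fpos u ⟨h.1, h1⟩)).le
  · simp [h1]
  · exact (mul_neg_of_pos_of_neg h1 (w.fneg u ⟨h1, h.2⟩)).le

lemma mul_f_neg (w : Well p q W0 f F) {u : ℝ} (h : |u| < 1) (h0 : u ≠ 0) : u * f u < 0 := by
  rw [abs_lt] at h
  rcases lt_or_gt_of_ne h0 with h1 | h1
  · exact mul_neg_of_neg_of_pos h1 (w.fpos u ⟨h.1, h1⟩)
  · exact mul_neg_of_pos_of_neg h1 (w.fneg u ⟨h1, h.2⟩)

lemma antitoneOn (w : Well p q W0 f F) : AntitoneOn F (Ici 0) :=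
  antitoneOn_of_deriv_nonpos (convex_Ici 0) w.Fcont.continuousOn
    (fun u _ => (w.Fder u).differentiableAt.differentiableWithinAt) fun u hu => by
      rw [interior_Ici] at hu
      rw [(w.Fder u).deriv]
      have := w.mul_f_nonpos u
      by_contra h
      exact absurd this (not_le.2 (mul_pos hu (not_le.1 h)))

lemma monotoneOn (w : Well p q W0 f F) : MonotoneOn F (Iic 0) :=
  monotoneOn_of_deriv_nonneg (convex_Iic 0) w.Fcont.continuousOn
    (fun u _ => (w.Fder u).differentiableAt.differentiableWithinAt) fun u hu => by
      rw [interior_Iic] at hu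
      rw [(w.Fder u).deriv]
      have := w.mul_f_nonpos u
      by_contra h
      exact absurd this (not_le.2 (mul_pos_of_neg_of_neg hu (not_le.1 h)))

lemma strictAntiOn (w : Well p q W0 f F) : StrictAntiOn F (Icc 0 1) :=
  strictAntiOn_of_deriv_neg (convex_Icc 0 1) w.Fcont.continuousOn fun u hu => by
      rw [interior_Icc] at hu
      rw [(w.Fder u).deriv]; exact w.fneg u hu

lemma strictMonoOn (w : Well p q W0 f F) : StrictMonoOn F (Icc (-1) 0) :=
  strictMonoOn_of_deriv_pos (convex_Icc (-1) 0) w.Fcont.continuousOn fun u hu => by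
      rw [interior_Icc] at hu
      rw [(w.Fder u).deriv]; exact w.fpos u hu

/-- `F` is nonincreasing along rays from the origin. -/
lemma ray_anti (w : Well p q W0 f F) (s : ℝ) {r t : ℝ} (hr : 0 ≤ r) (hrt : r ≤ t) :
    F (t * s) ≤ F (r * s) := by
  rcases le_total 0 s with h | h
  · exact w.antitoneOn (mul_nonneg hr h) (mul_nonneg (hr.trans hrt) h)
      (mul_le_mul_of_nonneg_right hrt h)
  · exact w.monotoneOn (mul_nonpos_of_nonneg_of_nonpos (hr.trans hrt) h)
      (mul_nonpos_of_nonneg_of_nonpos hr h) (mul_le_mul_of_nonpos_right hrt h)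

lemma F_nonneg (w : Well p q W0 f F) (u : ℝ) : 0 ≤ F u := by
  rcases le_total 1 |u| with h | h
  · exact (w.Fout u h).ge
  rw [abs_le] at h
  rcases le_total 0 u with h1 | h1
  · rw [← w.Fout 1 (by simp)]; exact w.antitoneOn h1 (zero_le_one : (0:ℝ) ≤ 1) h.2
  · rw [← w.Fout (-1) (by simp)]; exact w.monotoneOn (by norm_num : (-1:ℝ) ≤ 0) h1 h.1

lemma F_le (w : Well p q W0 f F) (u : ℝ) : F u ≤ W0 := by
  have := w.ray_anti u (r := 0) (t := 1) le_rfl zero_le_one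
  simpa [w.F0] using this

lemma abs_lt_one_of_pos (w : Well p q W0 f F) {u : ℝ} (h : 0 < F u) : |u| < 1 := by
  by_contra h1
  rw [w.Fout u (not_lt.1 h1)] at h
  exact lt_irrefl _ h

lemma F_pos (w : Well p q W0 f F) {u : ℝ} (h : |u| < 1) : 0 < F u := by
  rw [abs_lt] at h
  rcases le_total 0 u with h1 | h1
  · rw [← w.Fout 1 (by simp)]
    exact w.strictAntiOn ⟨h1, h.2.le⟩ (by norm_num) h.2
  · rw [← w.Fout (-1) (by simp)]
    exact w.strictMonoOn (by norm_num) ⟨h.1.le, h1⟩ h.1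

end Well

lemma exists_subseq_tendstoUniformlyOn {l r K M : ℝ} (g : ℕ → ℝ → ℝ)
    (hK : ∀ n, ∀ x ∈ Icc l r, ∀ y ∈ Icc l r, |g n x - g n y| ≤ K * |x - y|)
    (hM : ∀ n, ∀ x ∈ Icc l r, |g n x| ≤ M) :
    ∃ φ : ℕ → ℕ, StrictMono φ ∧ ∃ G : ℝ → ℝ,
      TendstoUniformlyOn (fun n => g (φ n)) G atTop (Icc l r) := by
  have hlip : ∀ n, LipschitzWith K.toNNReal (fun x : Icc l r => g n x) := fun n => by
    refine LipschitzWith.of_dist_le_mul fun x y => ?_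
    simp only [Real.dist_eq, Subtype.dist_eq]
    exact (hK n x x.2 y y.2).trans (mul_le_mul_of_nonneg_right (Real.le_coe_toNNReal K) (abs_nonneg _))
  let F : ℕ → BoundedContinuousFunction (Icc l r) ℝ := fun n =>
    BoundedContinuousFunction.mkOfCompact ⟨_, (hlip n).continuous⟩
  have hcomp : IsCompact (closure (range F)) := by
    refine BoundedContinuousFunction.arzela_ascoli (Metric.closedBall (0:ℝ) M)
      (isCompact_closedBall _ _) _ ?_ ?_
    · rintro _ x ⟨n, rfl⟩
      rw [mem_closedBall_zero_iff, Real.norm_eq_abs]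
      exact hM n x x.2
    · refine (LipschitzWith.uniformEquicontinuous _ K.toNNReal ?_).equicontinuous
      rintro ⟨_, n, rfl⟩
      exact hlip n
  obtain ⟨G, -, φ, hφ, hG⟩ := hcomp.tendsto_subseq fun n => subset_closure (mem_range_self n)
  rw [BoundedContinuousFunction.tendsto_iff_tendstoUniformly] at hG
  refine ⟨φ, hφ, fun x => if h : x ∈ Icc l r then G ⟨x, h⟩ else 0, ?_⟩
  rw [Metric.tendstoUniformlyOn_iff]
  rw [Metric.tendstoUniformly_iff] at hG
  intro ε hε
  filter_upwards [hG ε hε] with n hn x hx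
  rw [dif_pos hx]
  exact hn ⟨x, hx⟩

/-- Continuous convergence of a sequence of functions on a set. -/
def ContConv (g : ℕ → ℝ → ℝ) (G : ℝ → ℝ) (s : Set ℝ) : Prop :=
  ∀ x ∈ s, Tendsto (fun p : ℕ × ℝ => g p.1 p.2) (atTop ×ˢ 𝓝[s] x) (𝓝 (G x))

namespace ContConv

variable {g : ℕ → ℝ → ℝ} {G : ℝ → ℝ} {s : Set ℝ}

lemma of_uniform (h : TendstoUniformlyOn g G atTop s) (hG : ContinuousOn G s) :
    ContConv g G s := by
  intro x hx
  rw [Metric.tendsto_nhds]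
  rw [Metric.tendstoUniformlyOn_iff] at h
  intro ε hε
  have h1 : ∀ᶠ p : ℕ × ℝ in atTop ×ˢ 𝓝[s] x, ∀ x ∈ s, dist (G x) (g p.1 x) < ε / 2 :=
    (h (ε / 2) (by positivity)).prod_inl _
  have h2 : ∀ᶠ p : ℕ × ℝ in atTop ×ˢ 𝓝[s] x, dist (G p.2) (G x) < ε / 2 :=
    ((Metric.tendsto_nhds.1 (hG x hx)) (ε / 2) (by positivity)).prod_inr _
  have h3 : ∀ᶠ p : ℕ × ℝ in atTop ×ˢ 𝓝[s] x, p.2 ∈ s :=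
    (eventually_mem_nhdsWithin).prod_inr _
  filter_upwards [h1, h2, h3] with p a b c
  calc dist (g p.1 p.2) (G x) ≤ dist (g p.1 p.2) (G p.2) + dist (G p.2) (G x) := dist_triangle _ _ _
    _ < ε / 2 + ε / 2 := add_lt_add (by rw [dist_comm]; exact a _ c) b
    _ = ε := by ring

lemma seq (h : ContConv g G s) {x : ℝ} (hx : x ∈ s) {y : ℕ → ℝ} (hy : ∀ n, y n ∈ s)
    (hyx : Tendsto y atTop (𝓝 x)) : Tendsto (fun n => g n (y n)) atTop (𝓝 (G x)) :=
  (h x hx).comp (tendsto_id.prodMk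
    (tendsto_nhdsWithin_iff.2 ⟨hyx, Eventually.of_forall hy⟩))

lemma pointwise (h : ContConv g G s) {x : ℝ} (hx : x ∈ s) :
    Tendsto (fun n => g n x) atTop (𝓝 (G x)) := h.seq hx (fun _ => hx) tendsto_const_nhds

lemma subseq (h : ContConv g G s) {φ : ℕ → ℕ} (hφ : Tendsto φ atTop atTop) :
    ContConv (fun n => g (φ n)) G s := fun x hx =>
  (h x hx).comp ((hφ.comp tendsto_fst).prodMk tendsto_snd)

lemma mono (h : ContConv g G s) {t : Set ℝ} (ht : t ⊆ s) : ContConv g G t := fun x hx =>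
  (h x (ht hx)).mono_left (prod_mono le_rfl (nhdsWithin_mono x ht))

lemma const {G : ℝ → ℝ} (hG : ContinuousOn G s) : ContConv (fun _ => G) G s := fun x hx =>
  (hG x hx).tendsto.comp tendsto_snd

lemma comp {ψ : ℕ → ℝ → ℝ} {Ψ : ℝ → ℝ} (hψ : ContConv ψ Ψ univ) (h : ContConv g G s) :
    ContConv (fun n x => ψ n (g n x)) (fun x => Ψ (G x)) s := fun x hx => by
  have := hψ (G x) (mem_univ _)
  rw [nhdsWithin_univ] at this
  exact this.comp (tendsto_fst.prodMk (h x hx))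

lemma eventually_forall (h : ContConv g G s) (hs : IsCompact s) {U : Set ℝ} (hU : IsOpen U)
    (hG : ∀ x ∈ s, G x ∈ U) : ∀ᶠ n in atTop, ∀ x ∈ s, g n x ∈ U := by
  refine hs.induction_on (p := fun t => ∀ᶠ n in atTop, ∀ x ∈ t, g n x ∈ U) (by simp) ?_ ?_ ?_
  · intro t t' htt h
    filter_upwards [h] with n hn x hx using hn x (htt hx)
  · intro t t' h1 h2
    filter_upwards [h1, h2] with n a b x hx
    exact hx.elim (a x) (b x)
  · intro x hx
    have := h x hx (hU.mem_nhds (hG x hx))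
    rw [mem_map, mem_prod_iff] at this
    obtain ⟨A, hA, B, hB, hAB⟩ := this
    refine ⟨B, hB, ?_⟩
    filter_upwards [hA] with n hn y hy
    exact hAB (mk_mem_prod hn hy)

lemma continuousOn (h : ContConv g G s) : ContinuousOn G s := by
  intro x hx
  rw [ContinuousWithinAt, Metric.tendsto_nhds]
  intro ε hε
  have h1 := Metric.tendsto_nhds.1 (h x hx) (ε / 2) (by positivity)
  rw [eventually_prod_iff] at h1
  obtain ⟨pa, ha, pb, hb, hab⟩ := h1
  filter_upwards [hb, self_mem_nhdsWithin] with y hy hys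
  have h2 := Metric.tendsto_nhds.1 (h.pointwise hys) (ε / 2) (by positivity)
  obtain ⟨n, hn1, hn2⟩ := (ha.and h2).exists
  calc dist (G y) (G x) ≤ dist (G y) (g n y) + dist (g n y) (G x) := dist_triangle _ _ _
    _ < ε / 2 + ε / 2 := add_lt_add (by rw [dist_comm]; exact hn2) (hab hn1 hy)
    _ = ε := by ring

lemma tendstoUniformlyOn (h : ContConv g G s) (hs : IsCompact s) :
    TendstoUniformlyOn g G atTop s := by
  rw [Metric.tendstoUniformlyOn_iff]
  intro ε hε
  have : ContConv (fun n x => dist (G x) (g n x)) (fun _ => 0) s := fun x hx => by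
    have h1 : Tendsto (fun p : ℕ × ℝ => G p.2) (atTop ×ˢ 𝓝[s] x) (𝓝 (G x)) :=
      (h.continuousOn x hx).tendsto.comp tendsto_snd
    simpa using h1.dist (h x hx)
  exact this.eventually_forall hs (isOpen_gt' ε) (fun x _ => hε)

end ContConv

lemma exists_subseq_contConv {l r K M : ℝ} (g : ℕ → ℝ → ℝ)
    (hK : ∀ n, ∀ x ∈ Icc l r, ∀ y ∈ Icc l r, |g n x - g n y| ≤ K * |x - y|)
    (hM : ∀ n, ∀ x ∈ Icc l r, |g n x| ≤ M) :
    ∃ φ : ℕ → ℕ, StrictMono φ ∧ ∃ G : ℝ → ℝ, ContConv (fun n => g (φ n)) G (Icc l r) ∧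
      ∀ x ∈ Icc l r, ∀ y ∈ Icc l r, |G x - G y| ≤ K * |x - y| := by
  obtain ⟨φ, hφ, G, hG⟩ := exists_subseq_tendstoUniformlyOn g hK hM
  have hlip : ∀ x ∈ Icc l r, ∀ y ∈ Icc l r, |G x - G y| ≤ K * |x - y| := fun x hx y hy =>
    le_of_tendsto' ((hG.tendsto_at hx).sub (hG.tendsto_at hy)).abs fun n => hK (φ n) x hx y hy
  refine ⟨φ, hφ, G, ContConv.of_uniform hG ?_, hlip⟩
  have : LipschitzOnWith K.toNNReal G (Icc l r) := LipschitzOnWith.of_dist_le_mul fun x hx y hy => by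
    rw [Real.dist_eq, Real.dist_eq]
    exact (hlip x hx y hy).trans (mul_le_mul_of_nonneg_right (Real.le_coe_toNNReal K) (abs_nonneg _))
  exact this.continuousOn

lemma hasDerivWithinAt_of_contConv {l r : ℝ} {g d : ℕ → ℝ → ℝ} {G D : ℝ → ℝ}
    (hg : ∀ x ∈ Icc l r, Tendsto (fun n => g n x) atTop (𝓝 (G x)))
    (hd : ContConv d D (Icc l r))
    (hgd : ∀ n, ∀ x ∈ Icc l r, HasDerivWithinAt (g n) (d n x) (Icc l r) x)
    {x : ℝ} (hx : x ∈ Icc l r) : HasDerivWithinAt G (D x) (Icc l r) x := by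
  rw [hasDerivWithinAt_iff_isLittleO]
  refine IsLittleO.of_bound fun c hc => ?_
  have h1 := Metric.tendsto_nhds.1 (hd x hx) c hc
  rw [eventually_prod_iff] at h1
  obtain ⟨pa, ha, pb, hb, hab⟩ := h1
  rw [eventually_nhdsWithin_iff, Metric.eventually_nhds_iff_ball] at hb
  obtain ⟨δ, hδ, hb⟩ := hb
  filter_upwards [self_mem_nhdsWithin, mem_nhdsWithin_of_mem_nhds (Metric.ball_mem_nhds x hδ)]
    with y hy hyδ
  have hlim : Tendsto (fun n => ‖g n y - g n x - (y - x) • D x‖) atTop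
      (𝓝 ‖G y - G x - (y - x) • D x‖) :=
    (((hg y hy).sub (hg x hx)).sub tendsto_const_nhds).norm
  refine le_of_tendsto hlim ?_
  filter_upwards [ha] with n hn
  have hconv : Convex ℝ (Icc l r ∩ Metric.ball x δ) := (convex_Icc l r).inter (convex_ball x δ)
  have key := hconv.norm_image_sub_le_of_norm_hasDerivWithin_le
    (f := fun t => g n t - t * D x) (f' := fun t => d n t - D x) (C := c) (x := x) (y := y)
    (fun t ht => ((hgd n t ht.1).mono inter_subset_left).sub
      ((hasDerivWithinAt_id t _).mul_const (D x) |>.congr_deriv (by simp)))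
    (fun t ht => by
      have := hab hn (hb t ht.2 ht.1)
      rw [Real.dist_eq] at this
      exact this.le)
    ⟨hx, Metric.mem_ball_self hδ⟩ ⟨hy, hyδ⟩
  have e : g n y - g n x - (y - x) • D x = g n y - y * D x - (g n x - x * D x) := by
    rw [smul_eq_mul]; ring
  rw [e]
  exact key

/-- Trajectories of the planar system `u' = ψ(m)`, `m' = b f(u)`. -/
structure Traj0 (ψ f b : ℝ → ℝ) (l r : ℝ) (u m : ℝ → ℝ) : Prop where
  du : ∀ x ∈ Icc l r, HasDerivWithinAt u (ψ (m x)) (Icc l r) x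
  dm : ∀ x ∈ Icc l r, HasDerivWithinAt m (b x * f (u x)) (Icc l r) x

/-- Trajectories of the planar system together with a continuous polar angle. -/
structure Traj (ψ f b : ℝ → ℝ) (l r : ℝ) (u m θ : ℝ → ℝ) : Prop extends Traj0 ψ f b l r u m where
  nz : ∀ x ∈ Icc l r, 0 < u x ^ 2 + m x ^ 2
  dθ : ∀ x ∈ Icc l r, HasDerivWithinAt θ
    ((m x * ψ (m x) - b x * (u x * f (u x))) / (u x ^ 2 + m x ^ 2)) (Icc l r) x
  polu : ∀ x ∈ Icc l r, u x = √(u x ^ 2 + m x ^ 2) * sin (θ x)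
  polm : ∀ x ∈ Icc l r, m x = √(u x ^ 2 + m x ^ 2) * cos (θ x)

lemma lipschitz_of_deriv_bound {l r B : ℝ} {g d : ℝ → ℝ}
    (h : ∀ x ∈ Icc l r, HasDerivWithinAt g (d x) (Icc l r) x) (hB : ∀ x ∈ Icc l r, |d x| ≤ B) :
    ∀ x ∈ Icc l r, ∀ y ∈ Icc l r, |g x - g y| ≤ B * |x - y| := fun x hx y hy =>
  (convex_Icc l r).norm_image_sub_le_of_norm_hasDerivWithin_le h hB hy hx

lemma Traj0.compact {l r M B : ℝ} {ψ f b u m : ℕ → ℝ → ℝ} {Ψ f' b' : ℝ → ℝ}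
    (h : ∀ n, Traj0 (ψ n) (f n) (b n) l r (u n) (m n))
    (hψ : ContConv ψ Ψ univ) (hf : ContConv f f' univ) (hb : ContConv b b' (Icc l r))
    (hu : ∀ n, ∀ x ∈ Icc l r, |u n x| ≤ M) (hm : ∀ n, ∀ x ∈ Icc l r, |m n x| ≤ M)
    (hu' : ∀ n, ∀ x ∈ Icc l r, |ψ n (m n x)| ≤ B)
    (hm' : ∀ n, ∀ x ∈ Icc l r, |b n x * f n (u n x)| ≤ B) :
    ∃ φ : ℕ → ℕ, StrictMono φ ∧ ∃ U N : ℝ → ℝ, ContConv (fun n => u (φ n)) U (Icc l r) ∧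
      ContConv (fun n => m (φ n)) N (Icc l r) ∧ Traj0 Ψ f' b' l r U N := by
  obtain ⟨φ1, h1, U, hU, -⟩ := exists_subseq_contConv u
    (fun n => lipschitz_of_deriv_bound (h n).du (hu' n)) hu
  obtain ⟨φ2, h2, N, hN, -⟩ := exists_subseq_contConv (fun n => m (φ1 n))
    (fun n => lipschitz_of_deriv_bound (h (φ1 n)).dm (hm' (φ1 n))) (fun n => hm (φ1 n))
  have hU' := hU.subseq h2.tendsto_atTop
  have h12 := h1.comp h2
  refine ⟨fun n => φ1 (φ2 n), h12, U, N, hU', hN, fun x hx => ?_, fun x hx => ?_⟩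
  · exact hasDerivWithinAt_of_contConv (fun y hy => hU'.pointwise hy)
      ((hψ.subseq h12.tendsto_atTop).comp hN) (fun n => (h _).du) hx
  · refine hasDerivWithinAt_of_contConv (D := fun x => b' x * f' (U x))
      (fun y hy => hN.pointwise hy) (fun y hy => ?_) (fun n => (h _).dm) hx
    exact ((hb.subseq h12.tendsto_atTop) y hy).mul (((hf.subseq h12.tendsto_atTop).comp hU') y hy)

lemma Traj.compact {l r M B c : ℝ} {ψ f b u m θ : ℕ → ℝ → ℝ} {Ψ f' b' U N : ℝ → ℝ} (hlr : l ≤ r)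
    (h : ∀ n, Traj (ψ n) (f n) (b n) l r (u n) (m n) (θ n))
    (hψ : ContConv ψ Ψ univ) (hf : ContConv f f' univ) (hb : ContConv b b' (Icc l r))
    (hu : ∀ n, ∀ x ∈ Icc l r, |u n x| ≤ M) (hm : ∀ n, ∀ x ∈ Icc l r, |m n x| ≤ M)
    (hu' : ∀ n, ∀ x ∈ Icc l r, |ψ n (m n x)| ≤ B)
    (hm' : ∀ n, ∀ x ∈ Icc l r, |b n x * f n (u n x)| ≤ B)
    (hc : 0 < c) (hcn : ∀ n, ∀ x ∈ Icc l r, c ≤ u n x ^ 2 + m n x ^ 2)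
    (hθ : ∀ n, |θ n l| ≤ M)
    (hU : ContConv u U (Icc l r)) (hN : ContConv m N (Icc l r)) :
    ∃ φ : ℕ → ℕ, StrictMono φ ∧ ∃ Θ : ℝ → ℝ, ContConv (fun n => θ (φ n)) Θ (Icc l r) ∧
      Traj Ψ f' b' l r U N Θ := by
  have hll : l ∈ Icc l r := left_mem_Icc.2 hlr
  have hM : 0 ≤ M := (abs_nonneg _).trans (hθ 0)
  have hB : 0 ≤ B := (abs_nonneg _).trans (hu' 0 l hll)
  have hbd : ∀ n, ∀ x ∈ Icc l r,
      |(m n x * ψ n (m n x) - b n x * (u n x * f n (u n x))) / (u n x ^ 2 + m n x ^ 2)|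
        ≤ 2 * M * B / c := fun n x hx => by
    rw [abs_div, abs_of_pos ((h n).nz x hx)]
    refine div_le_div₀ (by positivity) ?_ hc (hcn n x hx)
    have e1 : |m n x * ψ n (m n x)| ≤ M * B := by
      rw [abs_mul]; exact mul_le_mul (hm n x hx) (hu' n x hx) (abs_nonneg _) hM
    have e2 : |b n x * (u n x * f n (u n x))| ≤ M * B := by
      rw [mul_left_comm, abs_mul]; exact mul_le_mul (hu n x hx) (hm' n x hx) (abs_nonneg _) hM
    rw [abs_le] at *
    constructor <;> linarith [e1.1, e1.2, e2.1, e2.2]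
  have hlip := fun n => lipschitz_of_deriv_bound (h n).dθ (hbd n)
  obtain ⟨φ, hφ, Θ, hΘ, -⟩ := exists_subseq_contConv (M := 2 * M * B / c * (r - l) + M) θ hlip
    (fun n x hx => by
      have h1 := hlip n x hx l hll
      rw [abs_of_nonneg (by linarith [hx.1] : 0 ≤ x - l)] at h1
      have h2 : 2 * M * B / c * (x - l) ≤ 2 * M * B / c * (r - l) :=
        mul_le_mul_of_nonneg_left (by linarith [hx.2]) (by positivity)
      have h3 := hθ n
      rw [abs_le] at *
      constructor <;> linarith [h1.1, h1.2, h3.1, h3.2])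
  have hU' := hU.subseq hφ.tendsto_atTop
  have hN' := hN.subseq hφ.tendsto_atTop
  have hψ' := (hψ.subseq hφ.tendsto_atTop).comp hN'
  have hf' := (hf.subseq hφ.tendsto_atTop).comp hU'
  have hb' := hb.subseq hφ.tendsto_atTop
  have hnz : ∀ x ∈ Icc l r, c ≤ U x ^ 2 + N x ^ 2 := fun x hx =>
    ge_of_tendsto' (((hU.pointwise hx).pow 2).add ((hN.pointwise hx).pow 2)) fun n => hcn n x hx
  have hnz' : ∀ x ∈ Icc l r, 0 < U x ^ 2 + N x ^ 2 := fun x hx => hc.trans_le (hnz x hx)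
  refine ⟨φ, hφ, Θ, hΘ, ⟨⟨fun x hx => ?_, fun x hx => ?_⟩, hnz', fun x hx => ?_, fun x hx => ?_,
    fun x hx => ?_⟩⟩
  · exact hasDerivWithinAt_of_contConv (fun y hy => hU'.pointwise hy) hψ' (fun n => (h _).du) hx
  · exact hasDerivWithinAt_of_contConv (D := fun x => b' x * f' (U x))
      (fun y hy => hN'.pointwise hy) (fun y hy => (hb' y hy).mul (hf' y hy)) (fun n => (h _).dm) hx
  · refine hasDerivWithinAt_of_contConv
      (D := fun x => (N x * Ψ (N x) - b' x * (U x * f' (U x))) / (U x ^ 2 + N x ^ 2))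
      (fun y hy => hΘ.pointwise hy) (fun y hy => ?_) (fun n => (h _).dθ) hx
    exact ((((hN' y hy).mul (hψ' y hy)).sub ((hb' y hy).mul ((hU' y hy).mul (hf' y hy))))).div
      (((hU' y hy).pow 2).add ((hN' y hy).pow 2)) (hnz' y hy).ne'
  · have h1 := hU'.pointwise hx
    have h2 := (((hU'.pointwise hx).pow 2).add ((hN'.pointwise hx).pow 2)).sqrt.mul
      ((continuous_sin.tendsto _).comp (hΘ.pointwise hx))
    exact tendsto_nhds_unique (h1.congr fun n => (h (φ n)).polu x hx) h2
  · have h1 := hN'.pointwise hx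
    have h2 := (((hU'.pointwise hx).pow 2).add ((hN'.pointwise hx).pow 2)).sqrt.mul
      ((continuous_cos.tendsto _).comp (hΘ.pointwise hx))
    exact tendsto_nhds_unique (h1.congr fun n => (h (φ n)).polm x hx) h2

lemma monotoneOn_Icc_of_deriv {l r : ℝ} {g d : ℝ → ℝ}
    (h : ∀ x ∈ Icc l r, HasDerivWithinAt g (d x) (Icc l r) x) (hd : ∀ x ∈ Ioo l r, 0 ≤ d x) :
    MonotoneOn g (Icc l r) := by
  refine monotoneOn_of_hasDerivWithinAt_nonneg (f' := d) (convex_Icc l r)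
    (fun x hx => (h x hx).continuousWithinAt) (fun x hx => (h x (interior_subset hx)).mono
      interior_subset) fun x hx => ?_
  rw [interior_Icc] at hx
  exact hd x hx

lemma strictMonoOn_Icc_of_deriv {l r : ℝ} {g d : ℝ → ℝ}
    (h : ∀ x ∈ Icc l r, HasDerivWithinAt g (d x) (Icc l r) x) (hd : ∀ x ∈ Ioo l r, 0 < d x) :
    StrictMonoOn g (Icc l r) := by
  refine strictMonoOn_of_hasDerivWithinAt_pos (f' := d) (convex_Icc l r)
    (fun x hx => (h x hx).continuousWithinAt) (fun x hx => (h x (interior_subset hx)).mono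
      interior_subset) fun x hx => ?_
  rw [interior_Icc] at hx
  exact hd x hx

lemma antitoneOn_Icc_of_deriv {l r : ℝ} {g d : ℝ → ℝ}
    (h : ∀ x ∈ Icc l r, HasDerivWithinAt g (d x) (Icc l r) x) (hd : ∀ x ∈ Ioo l r, d x ≤ 0) :
    AntitoneOn g (Icc l r) := by
  have := monotoneOn_Icc_of_deriv (fun x hx => (h x hx).neg) (fun x hx => neg_nonneg.2 (hd x hx))
  intro x hx y hy hxy
  exact neg_le_neg_iff.1 (this hx hy hxy)

lemma const_of_deriv_zero {l r : ℝ} {g d : ℝ → ℝ}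
    (h : ∀ x ∈ Icc l r, HasDerivWithinAt g (d x) (Icc l r) x) (hd : ∀ x ∈ Ioo l r, d x = 0)
    {x y : ℝ} (hx : x ∈ Icc l r) (hy : y ∈ Icc l r) : g x = g y := by
  have h1 := monotoneOn_Icc_of_deriv h (fun x hx => (hd x hx).ge)
  have h2 := antitoneOn_Icc_of_deriv h (fun x hx => (hd x hx).le)
  rcases le_total x y with hxy | hxy
  · exact le_antisymm (h1 hx hy hxy) (h2 hx hy hxy)
  · exact le_antisymm (h2 hy hx hxy) (h1 hy hx hxy)

/-- Lower bound on the increment from a lower bound on the derivative. -/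
lemma mul_sub_le_of_deriv {l r c : ℝ} {g d : ℝ → ℝ}
    (h : ∀ x ∈ Icc l r, HasDerivWithinAt g (d x) (Icc l r) x) (hd : ∀ x ∈ Ioo l r, c ≤ d x)
    {x y : ℝ} (hx : x ∈ Icc l r) (hy : y ∈ Icc l r) (hxy : x ≤ y) : c * (y - x) ≤ g y - g x := by
  have := monotoneOn_Icc_of_deriv (g := fun t => g t - c * t) (d := fun t => d t - c)
    (fun t ht => (h t ht).sub (((hasDerivWithinAt_id t _).const_mul c).congr_deriv (mul_one c)))
    (fun t ht => sub_nonneg.2 (hd t ht)) hx hy hxy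
  simp only at this
  linarith

lemma gronwall_two_sided {l r C : ℝ} {g d : ℝ → ℝ}
    (h : ∀ x ∈ Icc l r, HasDerivWithinAt g (d x) (Icc l r) x)
    (hd : ∀ x ∈ Icc l r, |d x| ≤ C * g x) {x y : ℝ} (hx : x ∈ Icc l r) (hy : y ∈ Icc l r)
    (hxy : x ≤ y) :
    g x * exp (-(C * (y - x))) ≤ g y ∧ g y ≤ g x * exp (C * (y - x)) := by
  have key : ∀ k t, t ∈ Icc l r → HasDerivWithinAt (fun t => g t * exp (k * t))
      (exp (k * t) * (d t + k * g t)) (Icc l r) t := fun k t ht => by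
    have h1 : HasDerivWithinAt (fun t => exp (k * t)) (exp (k * t) * k) (Icc l r) t :=
      (((hasDerivAt_id t).const_mul k).exp.congr_deriv (by simp)).hasDerivWithinAt
    exact ((h t ht).mul h1).congr_deriv (by ring)
  have h1 := monotoneOn_Icc_of_deriv (key C) (fun t ht => mul_nonneg (exp_pos _).le
    (by linarith [neg_le_of_abs_le (hd t (Ioo_subset_Icc_self ht))])) hx hy hxy
  have h2 := antitoneOn_Icc_of_deriv (key (-C)) (fun t ht => mul_nonpos_of_nonneg_of_nonpos
    (exp_pos _).le (by linarith [le_of_abs_le (hd t (Ioo_subset_Icc_self ht))])) hx hy hxy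
  simp only at h1 h2
  constructor
  · have : exp (-(C * (y - x))) = exp (C * x) * exp (-(C * y)) := by rw [← exp_add]; ring_nf
    rw [this, ← mul_assoc]
    calc _ ≤ g y * exp (C * y) * exp (-(C * y)) := mul_le_mul_of_nonneg_right h1 (exp_pos _).le
      _ = g y := by rw [mul_assoc, ← exp_add]; simp
  · have : exp (C * (y - x)) = exp (-C * x) * exp (C * y) := by rw [← exp_add]; ring_nf
    rw [this, ← mul_assoc]
    calc g y = g y * exp (-C * y) * exp (C * y) := by rw [mul_assoc, ← exp_add]; simp
      _ ≤ _ := mul_le_mul_of_nonneg_right h2 (exp_pos _).le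

/-- Propagation of polar coordinates along a convex set. -/
lemma polar_propagate {s : Set ℝ} (hs : Convex ℝ s) {u m u' m' θ : ℝ → ℝ} {x0 : ℝ} (hx0 : x0 ∈ s)
    (hu : ∀ x ∈ s, HasDerivWithinAt u (u' x) s x) (hm : ∀ x ∈ s, HasDerivWithinAt m (m' x) s x)
    (hnz : ∀ x ∈ s, 0 < u x ^ 2 + m x ^ 2)
    (hθ : ∀ x ∈ s, HasDerivWithinAt θ ((m x * u' x - u x * m' x) / (u x ^ 2 + m x ^ 2)) s x)
    (h0u : u x0 = √(u x0 ^ 2 + m x0 ^ 2) * sin (θ x0))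
    (h0m : m x0 = √(u x0 ^ 2 + m x0 ^ 2) * cos (θ x0)) :
    ∀ x ∈ s, u x = √(u x ^ 2 + m x ^ 2) * sin (θ x) ∧ m x = √(u x ^ 2 + m x ^ 2) * cos (θ x) := by
  set ρ : ℝ → ℝ := fun x => √(u x ^ 2 + m x ^ 2) with hρ
  have hρp : ∀ x ∈ s, 0 < ρ x := fun x hx => sqrt_pos.2 (hnz x hx)
  have hρ2 : ∀ x ∈ s, ρ x ^ 2 = u x ^ 2 + m x ^ 2 := fun x hx => sq_sqrt (hnz x hx).le
  have hdρ : ∀ x ∈ s, HasDerivWithinAt ρ ((u x * u' x + m x * m' x) / ρ x) s x := fun x hx => by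
    refine ((((hu x hx).pow 2).add ((hm x hx).pow 2)).sqrt (hnz x hx).ne').congr_deriv ?_
    have := hρp x hx
    simp only [hρ] at this ⊢
    simp; field_simp
  have hsn : ∀ x ∈ s, HasDerivWithinAt (fun x => sin (θ x)) _ s x := fun x hx => (hθ x hx).sin
  have hcs : ∀ x ∈ s, HasDerivWithinAt (fun x => cos (θ x)) _ s x := fun x hx => (hθ x hx).cos
  have hA : ∀ x ∈ s, HasDerivWithinAt (fun x => (u x * cos (θ x) - m x * sin (θ x)) / ρ x) 0 s x :=
    fun x hx => by
      refine ((((hu x hx).mul (hcs x hx)).sub ((hm x hx).mul (hsn x hx))).div (hdρ x hx)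
        (hρp x hx).ne').congr_deriv ?_
      have h1 := hρp x hx
      have h2 := hρ2 x hx
      simp only [← h2, Pi.mul_apply, Pi.sub_apply]
      field_simp
      linear_combination (u' x * cos (θ x) - m' x * sin (θ x)) * h2
  have hB : ∀ x ∈ s, HasDerivWithinAt (fun x => (u x * sin (θ x) + m x * cos (θ x)) / ρ x) 0 s x :=
    fun x hx => by
      refine ((((hu x hx).mul (hsn x hx)).add ((hm x hx).mul (hcs x hx))).div (hdρ x hx)
        (hρp x hx).ne').congr_deriv ?_
      have h1 := hρp x hx
      have h2 := hρ2 x hx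
      simp only [← h2, Pi.mul_apply, Pi.add_apply]
      field_simp
      linear_combination (u' x * sin (θ x) + m' x * cos (θ x)) * h2
  have hcA : ∀ x ∈ s, (u x * cos (θ x) - m x * sin (θ x)) / ρ x = 0 := fun x hx => by
    have h1 := hs.norm_image_sub_le_of_norm_hasDerivWithin_le hA (C := 0) (by simp) hx0 hx
    have h2 : u x0 * cos (θ x0) - m x0 * sin (θ x0) = 0 := by
      have e1 : u x0 = ρ x0 * sin (θ x0) := h0u
      have e2 : m x0 = ρ x0 * cos (θ x0) := h0m
      rw [e1, e2]; ring
    rw [zero_mul, norm_le_zero_iff, h2, zero_div, sub_zero] at h1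
    exact h1
  have hcB : ∀ x ∈ s, (u x * sin (θ x) + m x * cos (θ x)) / ρ x = 1 := fun x hx => by
    have h1 := hs.norm_image_sub_le_of_norm_hasDerivWithin_le hB (C := 0) (by simp) hx0 hx
    have h2 : (u x0 * sin (θ x0) + m x0 * cos (θ x0)) / ρ x0 = 1 := by
      have e1 : u x0 = ρ x0 * sin (θ x0) := h0u
      have e2 : m x0 = ρ x0 * cos (θ x0) := h0m
      rw [div_eq_one_iff_eq (hρp x0 hx0).ne', e1, e2]
      linear_combination ρ x0 * sin_sq_add_cos_sq (θ x0)
    rw [zero_mul, norm_le_zero_iff, h2, sub_eq_zero] at h1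
    exact h1
  intro x hx
  have e1 : u x * cos (θ x) - m x * sin (θ x) = 0 :=
    (div_eq_zero_iff.1 (hcA x hx)).resolve_right (hρp x hx).ne'
  have e2 : u x * sin (θ x) + m x * cos (θ x) = ρ x := (div_eq_one_iff_eq (hρp x hx).ne').1 (hcB x hx)
  have e3 := sin_sq_add_cos_sq (θ x)
  constructor
  · show u x = ρ x * sin (θ x)
    rw [← e2]; linear_combination -(u x) * e3 + cos (θ x) * e1
  · show m x = ρ x * cos (θ x)
    rw [← e2]; linear_combination -(m x) * e3 - sin (θ x) * e1

/-- The singularly perturbed system `ε u' = φ_q(m)`, `ε m' = a f(u)`. -/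
abbrev Sys (q : ℝ) (f a : ℝ → ℝ) (ε l r : ℝ) (u m : ℝ → ℝ) : Prop :=
  Traj0 (fun t => phip q t / ε) f (fun x => a x / ε) l r u m

/-- The energy. -/
def en (q : ℝ) (F a u m : ℝ → ℝ) (x : ℝ) : ℝ := F (u x) - |m x| ^ q / (q * a x)

lemma Well.neg {p q W0 : ℝ} {f F : ℝ → ℝ} (w : Well p q W0 f F) :
    Well p q W0 (fun u => -f (-u)) (fun u => F (-u)) where
  hp := w.hp
  hq := w.hq
  W0pos := w.W0pos
  fcont := (w.fcont.comp continuous_neg).neg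
  Fder := fun u => (HasDerivAt.comp u (w.Fder (-u)) (hasDerivAt_neg u)).congr_deriv (by ring)
  F0 := by simpa using w.F0
  Fout := fun u hu => w.Fout _ (by simpa using hu)
  fout := fun u hu => by rw [w.fout _ (by simpa using hu), neg_zero]
  f0 := by simp [w.f0]
  fneg := fun u hu => neg_lt_zero.2 (w.fpos (-u) ⟨by linarith [hu.2], by linarith [hu.1]⟩)
  fpos := fun u hu => neg_pos.2 (w.fneg (-u) ⟨by linarith [hu.2], by linarith [hu.1]⟩)
  hmono := fun u v h1 h2 h3 => by
    have := w.hanti (-u) (-v) (by linarith) (by linarith) (by linarith)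
    rwa [phip_neg, phip_neg, div_neg, div_neg, ← neg_div, ← neg_div] at this
  hanti := fun u v h1 h2 h3 => by
    have := w.hmono (-u) (-v) (by linarith) (by linarith) (by linarith)
    rwa [phip_neg, phip_neg, div_neg, div_neg, ← neg_div, ← neg_div] at this
  upper := by
    obtain ⟨C, hC, h⟩ := w.upper
    exact ⟨C, hC, fun u hu => by simpa using h (-u) (by simpa using hu)⟩
  lower := by
    obtain ⟨C, hC, h⟩ := w.lower
    exact ⟨C, hC, fun u hu hu' => by simpa using h (-u) (by simpa using hu) (by simpa using hu')⟩

lemma hasDerivWithinAt_reflect {l r c : ℝ} {g : ℝ → ℝ} {d x : ℝ}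
    (h : HasDerivWithinAt g d (Icc l r) (c - x)) :
    HasDerivWithinAt (fun y => g (c - y)) (-d) (Icc (c - r) (c - l)) x := by
  have h2 : HasDerivWithinAt (fun y => c - y) (-1) (Icc (c - r) (c - l)) x :=
    ((hasDerivAt_id x).const_sub c).hasDerivWithinAt
  exact (HasDerivWithinAt.comp x h h2 (fun y hy => ⟨by linarith [hy.2], by linarith [hy.1]⟩)).congr_deriv
    (by ring)

lemma reflect_mem {l r c x : ℝ} (h : x ∈ Icc (c - r) (c - l)) : c - x ∈ Icc l r :=
  ⟨by linarith [h.2], by linarith [h.1]⟩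

namespace Traj0

variable {ψ f b u m : ℝ → ℝ} {l r : ℝ}

lemma mono (h : Traj0 ψ f b l r u m) {l' r' : ℝ} (hl : l ≤ l') (hr : r' ≤ r) :
    Traj0 ψ f b l' r' u m :=
  ⟨fun x hx => (h.du x (Icc_subset_Icc hl hr hx)).mono (Icc_subset_Icc hl hr),
   fun x hx => (h.dm x (Icc_subset_Icc hl hr hx)).mono (Icc_subset_Icc hl hr)⟩

lemma ucont (h : Traj0 ψ f b l r u m) : ContinuousOn u (Icc l r) :=
  fun x hx => (h.du x hx).continuousWithinAt

lemma mcont (h : Traj0 ψ f b l r u m) : ContinuousOn m (Icc l r) :=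
  fun x hx => (h.dm x hx).continuousWithinAt

lemma neg (h : Traj0 ψ f b l r u m) (hψ : ∀ t, ψ (-t) = -ψ t) :
    Traj0 ψ (fun u => -f (-u)) b l r (fun x => -u x) (fun x => -m x) :=
  ⟨fun x hx => by rw [hψ]; exact (h.du x hx).neg,
   fun x hx => ((h.dm x hx).neg).congr_deriv (by simp)⟩

lemma reflect (h : Traj0 ψ f b l r u m) (hψ : ∀ t, ψ (-t) = -ψ t) (c : ℝ) :
    Traj0 ψ f (fun x => b (c - x)) (c - r) (c - l) (fun x => u (c - x)) (fun x => -m (c - x)) :=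
  ⟨fun x hx => by rw [hψ]; exact hasDerivWithinAt_reflect (h.du _ (reflect_mem hx)),
   fun x hx => (hasDerivWithinAt_reflect (h.dm _ (reflect_mem hx))).neg.congr_deriv (by ring)⟩

end Traj0

namespace Sys

variable {p q W0 : ℝ} {f F a a' u m : ℝ → ℝ} {ε l r : ℝ}

lemma odd_speed (q ε t : ℝ) : phip q (-t) / ε = -(phip q t / ε) := by rw [phip_neg, neg_div]

lemma neg (h : Sys q f a ε l r u m) : Sys q (fun u => -f (-u)) a ε l r (fun x => -u x) (fun x => -m x) :=
  Traj0.neg h (odd_speed q ε)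

lemma reflect (h : Sys q f a ε l r u m) (c : ℝ) :
    Sys q f (fun x => a (c - x)) ε (c - r) (c - l) (fun x => u (c - x)) (fun x => -m (c - x)) :=
  Traj0.reflect h (odd_speed q ε) c

/-- Blow-up at scale `ε`. -/
lemma rescale (h : Sys q f a ε l r u m) (hε : 0 < ε) {x0 R : ℝ} (hl : l ≤ x0) (hr : x0 + ε * R ≤ r) :
    Traj0 (phip q) f (fun y => a (x0 + ε * y)) 0 R (fun y => u (x0 + ε * y))
      (fun y => m (x0 + ε * y)) := by
  have hmap : MapsTo (fun y => x0 + ε * y) (Icc 0 R) (Icc l r) := fun y hy =>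
    ⟨by nlinarith [hy.1], by nlinarith [hy.2]⟩
  have hd : ∀ y, HasDerivWithinAt (fun y => x0 + ε * y) ε (Icc 0 R) y := fun y =>
    ((((hasDerivAt_id y).const_mul ε).const_add x0).congr_deriv (mul_one ε)).hasDerivWithinAt
  refine ⟨fun y hy => ?_, fun y hy => ?_⟩
  · exact (HasDerivWithinAt.comp y (h.du _ (hmap hy)) (hd y) hmap).congr_deriv
      (by field_simp)
  · exact (HasDerivWithinAt.comp y (h.dm _ (hmap hy)) (hd y) hmap).congr_deriv
      (by field_simp)

lemma en_deriv (h : Sys q f a ε l r u m) (w : Well p q W0 f F)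
    (ha : ∀ x ∈ Icc l r, 0 < a x) (ha' : ∀ x ∈ Icc l r, HasDerivAt a (a' x) x)
    {x : ℝ} (hx : x ∈ Icc l r) :
    HasDerivWithinAt (en q F a u m) (a' x * |m x| ^ q / (q * a x ^ 2)) (Icc l r) x := by
  have hq := w.q1
  have hax := ha x hx
  have h1 := (w.Fder (u x)).comp_hasDerivWithinAt x (h.du x hx)
  have h2 := (hasDerivAt_abs_rpow_div hq (m x)).comp_hasDerivWithinAt x (h.dm x hx)
  have h3 := h1.sub (h2.div (ha' x hx).hasDerivWithinAt hax.ne')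
  refine (h3.congr (fun y hy => ?_) ?_).congr_deriv ?_
  · have := ha y hy
    simp only [en, Function.comp, Pi.sub_apply, Pi.div_apply]; field_simp
  · simp only [en, Function.comp, Pi.sub_apply, Pi.div_apply]; field_simp
  · simp only [Function.comp]
    by_cases hε : ε = 0
    · subst hε; simp; field_simp
    · field_simp; ring

end Sys

lemma pos_of_ne_zero_on {l r : ℝ} {g : ℝ → ℝ} (hg : ContinuousOn g (Icc l r)) (hl : 0 < g l)
    (h0 : ∀ x ∈ Icc l r, g x ≠ 0) {x : ℝ} (hx : x ∈ Icc l r) : 0 < g x := by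
  by_contra hneg
  obtain ⟨y, hy, hy0⟩ := intermediate_value_Icc' hx.1 (hg.mono (Icc_subset_Icc_right hx.2))
    (show (0:ℝ) ∈ Icc (g x) (g l) from ⟨not_lt.1 hneg, hl.le⟩)
  exact h0 y ⟨hy.1, hy.2.trans hx.2⟩ hy0

/-- A continuous function positive at the left end which vanishes somewhere has a first zero. -/
lemma exists_first_zero {l r : ℝ} {g : ℝ → ℝ} (hg : ContinuousOn g (Icc l r)) (hl : 0 < g l)
    (h0 : ∃ x ∈ Icc l r, g x = 0) :
    ∃ x ∈ Icc l r, g x = 0 ∧ l < x ∧ ∀ y ∈ Ico l x, 0 < g y := by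
  have hc : IsCompact (Icc l r ∩ g ⁻¹' {0}) :=
    isCompact_Icc.of_isClosed_subset (hg.preimage_isClosed_of_isClosed isClosed_Icc
      isClosed_singleton) inter_subset_left
  obtain ⟨x, ⟨hx, hx0⟩, hmin⟩ := hc.exists_isLeast (by
    obtain ⟨x, hx, hx0⟩ := h0
    exact ⟨x, hx, hx0⟩)
  refine ⟨x, hx, hx0, lt_of_le_of_ne hx.1 ?_, fun y hy => ?_⟩
  · rintro rfl
    exact hl.ne' hx0
  · refine pos_of_ne_zero_on (r := y) (hg.mono (Icc_subset_Icc_right (hy.2.le.trans hx.2))) hl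
      (fun t ht ht0 => ?_) ⟨hy.1, le_rfl⟩
    exact absurd (hmin ⟨⟨ht.1, (ht.2.trans hy.2.le).trans hx.2⟩, ht0⟩) (not_le.2 (ht.2.trans_lt hy.2))

lemma phip_nonneg {p s : ℝ} (hs : 0 ≤ s) : 0 ≤ phip p s :=
  mul_nonneg (rpow_nonneg (abs_nonneg _) _) hs

lemma phip_nonpos {p s : ℝ} (hs : s ≤ 0) : phip p s ≤ 0 :=
  mul_nonpos_of_nonneg_of_nonpos (rpow_nonneg (abs_nonneg _) _) hs

lemma Well.exists_bound_f {p q W0 : ℝ} {f F : ℝ → ℝ} (w : Well p q W0 f F) :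
    ∃ C, 0 < C ∧ ∀ u, |f u| ≤ C := by
  obtain ⟨C, hC⟩ := (isCompact_Icc (a := (-1:ℝ)) (b := 1)).exists_bound_of_continuousOn
    w.fcont.continuousOn
  have h0 : 0 ≤ C := (norm_nonneg _).trans (hC 0 (by norm_num))
  refine ⟨C + 1, by linarith, fun u => ?_⟩
  rcases le_total 1 |u| with h | h
  · rw [w.fout u h, abs_zero]; linarith
  · exact (hC u (abs_le.1 h)).trans (by linarith)

namespace Sys

variable {p q W0 : ℝ} {f F a a' u m : ℝ → ℝ} {ε l r : ℝ}

lemma after_exit_pos (h : Sys q f a ε l r u m) (w : Well p q W0 f F) (hε : 0 < ε) {x1 : ℝ}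
    (hx1 : x1 ∈ Icc l r) (hu : 1 ≤ u x1) (hm : 0 < m x1) :
    ∀ x ∈ Icc x1 r, m x = m x1 ∧ u x1 ≤ u x := by
  have h1 : Sys q f a ε x1 r u m := Traj0.mono h hx1.1 le_rfl
  have hcl : IsClosed ({x | m x = m x1 ∧ u x1 ≤ u x} ∩ Icc x1 r) := by
    have e : {x | m x = m x1 ∧ u x1 ≤ u x} ∩ Icc x1 r =
        (Icc x1 r ∩ m ⁻¹' {m x1}) ∩ (Icc x1 r ∩ u ⁻¹' Ici (u x1)) := by
      ext x; simp; tauto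
    rw [e]
    exact (h1.mcont.preimage_isClosed_of_isClosed isClosed_Icc isClosed_singleton).inter
      (h1.ucont.preimage_isClosed_of_isClosed isClosed_Icc isClosed_Ici)
  refine IsClosed.Icc_subset_of_forall_exists_gt hcl ⟨rfl, le_rfl⟩ ?_
  rintro x ⟨⟨hmx, hux⟩, hx⟩ y hy
  have hpos : ∀ᶠ t in 𝓝[Icc x1 r] x, 0 < m t :=
    (h1.mcont x ⟨hx.1, hx.2.le⟩).eventually (lt_mem_nhds (by rw [hmx]; exact hm))
  rw [eventually_nhdsWithin_iff, Metric.eventually_nhds_iff_ball] at hpos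
  obtain ⟨δ, hδ, hb⟩ := hpos
  obtain ⟨z, hz1, hz2⟩ := exists_between (lt_min (lt_min hy hx.2) (by linarith : x < x + δ))
  have hzy : z < y := hz2.trans_le ((min_le_left _ _).trans (min_le_left _ _))
  have hzr : z < r := hz2.trans_le ((min_le_left _ _).trans (min_le_right _ _))
  have hzd : z < x + δ := hz2.trans_le (min_le_right _ _)
  have h2 : Sys q f a ε x z u m := Traj0.mono h1 hx.1 hzr.le
  have hmono := monotoneOn_Icc_of_deriv h2.du fun t ht => div_nonneg (phip_nonneg
    (hb t (by rw [Metric.mem_ball, Real.dist_eq, abs_of_pos (by linarith [ht.1])]; linarith [ht.2])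
      ⟨hx.1.trans ht.1.le, ht.2.le.trans hzr.le⟩).le) hε.le
  have hu1 : ∀ t ∈ Icc x z, u x1 ≤ u t := fun t ht =>
    hux.trans (hmono ⟨le_rfl, hz1.le⟩ ht ht.1)
  have hmc := const_of_deriv_zero h2.dm (fun t ht => by
    rw [w.fout _ ((hu.trans (hu1 t (Ioo_subset_Icc_self ht))).trans (le_abs_self _)), mul_zero])
    ⟨hz1.le, le_rfl⟩ ⟨le_rfl, hz1.le⟩
  exact ⟨z, ⟨by rw [hmc, hmx], hu1 z ⟨hz1.le, le_rfl⟩⟩, hz1, hzy.le⟩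

lemma pos_of_exit (h : Sys q f a ε l r u m) (w : Well p q W0 f F) (hε : 0 < ε) {x1 : ℝ}
    (hx1 : x1 ∈ Icc l r) (hl : u l ≤ 1) (hu : 1 < u x1) : 0 < m x1 := by
  have h1 : Sys q f a ε l x1 u m := Traj0.mono h le_rfl hx1.2
  have hc : IsCompact (Icc l x1 ∩ u ⁻¹' Iic 1) :=
    isCompact_Icc.of_isClosed_subset (h1.ucont.preimage_isClosed_of_isClosed isClosed_Icc
      isClosed_Iic) inter_subset_left
  obtain ⟨x0, ⟨hx0, hx0u⟩, hmax⟩ := hc.exists_isGreatest ⟨l, ⟨le_rfl, hx1.1⟩, hl⟩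
  have hgt : ∀ x ∈ Ioc x0 x1, 1 < u x := fun x hx => by
    by_contra hle
    exact absurd (hmax ⟨⟨hx0.1.trans hx.1.le, hx.2⟩, not_lt.1 hle⟩) (not_le.2 hx.1)
  have h2 : Sys q f a ε x0 x1 u m := Traj0.mono h1 hx0.1 le_rfl
  have hmc : ∀ x ∈ Icc x0 x1, m x = m x1 := fun x hx =>
    const_of_deriv_zero h2.dm (fun t ht => by
      rw [w.fout _ ((hgt t ⟨ht.1, ht.2.le⟩).le.trans (le_abs_self _)), mul_zero]) hx
      ⟨hx0.2, le_rfl⟩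
  by_contra hm
  have := antitoneOn_Icc_of_deriv h2.du (fun t ht => by
    rw [hmc t (Ioo_subset_Icc_self ht)]
    exact div_nonpos_of_nonpos_of_nonneg (phip_nonpos (not_lt.1 hm)) hε.le)
    ⟨le_rfl, hx0.2⟩ ⟨hx0.2, le_rfl⟩ hx0.2
  have h3 : u x0 ≤ 1 := hx0u
  linarith

/-- Once `|u| > 1`, the trajectory never returns. -/
lemma after_exit (h : Sys q f a ε l r u m) (w : Well p q W0 f F) (hε : 0 < ε) {x1 : ℝ}
    (hx1 : x1 ∈ Icc l r) (hl : |u l| ≤ 1) (hu : 1 < |u x1|) :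
    ∀ x ∈ Icc x1 r, m x = m x1 ∧ |u x1| ≤ |u x| ∧ 0 < u x * m x := by
  rw [abs_le] at hl
  rcases lt_abs.1 hu with h1 | h1
  · have hm := h.pos_of_exit w hε hx1 hl.2 h1
    intro x hx
    obtain ⟨e1, e2⟩ := h.after_exit_pos w hε hx1 h1.le hm x hx
    refine ⟨e1, abs_le_abs_of_nonneg (by linarith) e2, ?_⟩
    rw [e1]; exact mul_pos (by linarith) hm
  · have hm := h.neg.pos_of_exit w.neg hε hx1 (by linarith) h1
    intro x hx
    obtain ⟨e1, e2⟩ := h.neg.after_exit_pos w.neg hε hx1 h1.le hm x hx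
    have e1' : m x = m x1 := by linarith
    refine ⟨e1', ?_, ?_⟩
    · rw [← abs_neg (u x1), ← abs_neg (u x)]
      exact abs_le_abs_of_nonneg (by linarith) e2
    · rw [e1', ← neg_mul_neg]; exact mul_pos (by linarith) hm

lemma abs_le_one_of_end (h : Sys q f a ε l r u m) (w : Well p q W0 f F) (hε : 0 < ε)
    (hl : |u l| ≤ 1) (hr : m r = 0) : ∀ x ∈ Icc l r, |u x| ≤ 1 := by
  intro x hx
  by_contra hgt
  have := (h.after_exit w hε hx hl (not_le.1 hgt) r ⟨hx.2, le_rfl⟩).2.2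
  rw [hr, mul_zero] at this
  exact lt_irrefl _ this

lemma neg_en (q : ℝ) (F a u m : ℝ → ℝ) :
    en q (fun u => F (-u)) a (fun x => -u x) (fun x => -m x) = en q F a u m := by
  funext x; simp [en]

lemma m_lipschitz {amax C : ℝ} (h : Sys q f a ε l r u m) (hε : 0 < ε) (hC : ∀ u, |f u| ≤ C)
    (ha : ∀ x ∈ Icc l r, 0 < a x ∧ a x ≤ amax) :
    ∀ x ∈ Icc l r, ∀ y ∈ Icc l r, |m x - m y| ≤ amax * C / ε * |x - y| :=
  lipschitz_of_deriv_bound h.dm fun x hx => by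
    obtain ⟨h1, h2⟩ := ha x hx
    rw [abs_mul, abs_div, abs_of_pos h1, abs_of_pos hε, div_mul_eq_mul_div]
    have h3 := hC (u x)
    have h4 := h1.trans_le h2
    gcongr

end Sys

/-- If `u` vanishes at nonpositive energy and `a` decreases there, `m` never vanishes afterwards. -/
lemma Well.exists_no_return {p q W0 : ℝ} {f F : ℝ → ℝ} (w : Well p q W0 f F) {amin amax lam η : ℝ}
    (hamin : 0 < amin) (hamax : amin ≤ amax) (hlam : 0 < lam) (hη : 0 < η) :
    ∃ ε1, 0 < ε1 ∧ ∀ (a a' : ℝ → ℝ) (ε z r : ℝ) (u m : ℝ → ℝ), 0 < ε → ε < ε1 → z + η ≤ r →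
      Sys q f a ε z r u m →
      (∀ x ∈ Icc z (z + η), amin ≤ a x ∧ a x ≤ amax ∧ HasDerivAt a (a' x) x ∧ a' x ≤ -lam) →
      u z = 0 → en q F a u m z ≤ 0 → ∀ x ∈ Icc z r, m x ≠ 0 := by
  have hq := w.q1
  have hq0 : 0 < q := by linarith
  have hamax0 : 0 < amax := hamin.trans_le hamax
  have hW0 := w.W0pos
  obtain ⟨C, hC0, hC⟩ := w.exists_bound_f
  set m0 := (q * amin * W0) ^ (1 / q) with hm0
  have hm0p : 0 < m0 := by positivity
  have hm0q : m0 ^ q = q * amin * W0 := by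
    rw [hm0, ← rpow_mul (by positivity), one_div_mul_cancel hq0.ne', rpow_one]
  set c := m0 / (2 * (amax * C)) with hc
  have hcp : 0 < c := by positivity
  set k := c * (lam * (m0 / 2) ^ q / (q * amax ^ 2)) with hk
  have hkp : 0 < k := by positivity
  set B := q * amin * k with hB
  have hBp : 0 < B := by positivity
  refine ⟨min (η / (2 * c)) ((η * B / 2) ^ q / B), by positivity, ?_⟩
  -- it suffices to treat the case where `m` is positive at the starting point
  have main : ∀ (f F : ℝ → ℝ), Well p q W0 f F → (∀ u, |f u| ≤ C) →
      ∀ (a a' : ℝ → ℝ) (ε z r : ℝ) (u m : ℝ → ℝ), 0 < ε →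
      ε < min (η / (2 * c)) ((η * B / 2) ^ q / B) → z + η ≤ r → Sys q f a ε z r u m →
      (∀ x ∈ Icc z (z + η), amin ≤ a x ∧ a x ≤ amax ∧ HasDerivAt a (a' x) x ∧ a' x ≤ -lam) →
      u z = 0 → en q F a u m z ≤ 0 → 0 < m z → ∀ x ∈ Icc z r, m x ≠ 0 := by
    intro f F w hC a a' ε z r u m hε hε1 hzr h ha huz hez hmz
    have hε2 : c * ε ≤ η / 2 := by
      have := hε1.le.trans (min_le_left _ _)
      rw [le_div_iff₀ (by positivity)] at this; linarith
    have hε3 : B * ε ≤ (η * B / 2) ^ q := by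
      have := hε1.le.trans (min_le_right _ _)
      rw [le_div_iff₀ hBp] at this; linarith
    have hloc : Sys q f a ε z (z + η) u m := Traj0.mono h le_rfl hzr
    have hapos : ∀ x ∈ Icc z (z + η), 0 < a x := fun x hx => hamin.trans_le (ha x hx).1
    have hzz : z ∈ Icc z (z + η) := ⟨le_rfl, by linarith⟩
    have hcε : 0 < c * ε := by positivity
    have hmz0 : m0 ≤ m z := by
      rw [en, huz, w.F0, sub_nonpos, le_div_iff₀ (mul_pos hq0 (hapos z hzz)), abs_of_pos hmz] at hez
      refine le_of_not_gt fun hlt => ?_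
      have h1 := rpow_lt_rpow hmz.le hlt hq0
      rw [hm0q] at h1
      have h2 := mul_le_mul_of_nonneg_left (ha z hzz).1 (mul_pos hW0 hq0).le
      linarith
    have hseed : ∀ x ∈ Icc z (z + c * ε), m0 / 2 ≤ m x := fun x hx => by
      have hx' : x ∈ Icc z (z + η) := ⟨hx.1, by linarith [hx.2]⟩
      have h1 := hloc.m_lipschitz hε hC (fun x hx => ⟨hapos x hx, (ha x hx).2.1⟩) x hx' z hzz
      have h2 : amax * C / ε * |x - z| ≤ m0 / 2 := by
        rw [abs_of_nonneg (by linarith [hx.1])]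
        calc amax * C / ε * (x - z) ≤ amax * C / ε * (c * ε) := by gcongr; linarith [hx.2]
          _ = m0 / 2 := by rw [hc]; field_simp
      have h3 := (abs_le.1 (h1.trans h2)).1
      linarith
    have hed := fun x hx => hloc.en_deriv w hapos (fun x hx => (ha x hx).2.2.1) (x := x) hx
    have hanti : AntitoneOn (en q F a u m) (Icc z (z + η)) :=
      antitoneOn_Icc_of_deriv hed fun x hx => by
        have := ha x (Ioo_subset_Icc_self hx)
        exact div_nonpos_of_nonpos_of_nonneg (mul_nonpos_of_nonpos_of_nonneg (by linarith [this.2.2.2])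
          (by positivity)) (by positivity)
    have hsub : Icc z (z + c * ε) ⊆ Icc z (z + η) := Icc_subset_Icc_right (by linarith)
    have hdrop : en q F a u m (z + c * ε) ≤ -(k * ε) := by
      have hd := mul_sub_le_of_deriv (c := lam * (m0 / 2) ^ q / (q * amax ^ 2))
        (fun x hx => ((hed x (hsub hx)).mono hsub).neg) (fun x hx => ?_)
        (left_mem_Icc.2 (by linarith : z ≤ z + c * ε)) (right_mem_Icc.2 (by linarith)) (by linarith)
      · simp only [Pi.neg_apply] at hd
        have e : lam * (m0 / 2) ^ q / (q * amax ^ 2) * (z + c * ε - z) = k * ε := by rw [hk]; ring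
        rw [e] at hd; linarith
      · have hx' := ha x (hsub (Ioo_subset_Icc_self hx))
        have hm' := hseed x (Ioo_subset_Icc_self hx)
        have hax := hamin.trans_le hx'.1
        rw [← neg_div, ← neg_mul]
        have h1 : lam ≤ -a' x := by linarith [hx'.2.2.2]
        have h2 : m0 / 2 ≤ |m x| := by linarith [le_abs_self (m x)]
        have h3 := hx'.2.1
        have h4 := hlam.trans_le h1
        gcongr
    intro x hx hmx
    obtain ⟨x0, hx0, hmx0, hzx0, hmpos⟩ := exists_first_zero h.mcont hmz ⟨x, hx, hmx⟩
    have hu1 : ∀ y ∈ Ico z x0, u y < 1 := fun y hy => by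
      by_contra hge
      have := (h.after_exit_pos w hε ⟨hy.1, hy.2.le.trans hx0.2⟩ (not_lt.1 hge) (hmpos y hy) x0
        ⟨hy.2.le, hx0.2⟩).1
      linarith [hmpos y hy]
    rcases le_or_gt x0 (z + η) with hcase | hcase
    · have h1 : z + c * ε ≤ x0 := by
        by_contra hlt
        linarith [hseed x0 ⟨hx0.1, (not_le.1 hlt).le⟩]
      have h2 := hanti ⟨by linarith, by linarith⟩ ⟨hx0.1, hcase⟩ h1
      have h3 : 0 ≤ en q F a u m x0 := by
        rw [en, hmx0, abs_zero, zero_rpow hq0.ne', zero_div, sub_zero]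
        exact w.F_nonneg _
      linarith [mul_pos hkp hε]
    · set ms := (B * ε) ^ (1 / q) with hms
      have hmsp : 0 < ms := by positivity
      have hmsq : ms ^ q = B * ε := by
        rw [hms, ← rpow_mul (by positivity), one_div_mul_cancel hq0.ne', rpow_one]
      have hms2 : ms ≤ η * B / 2 := by
        refine le_of_not_gt fun hlt => ?_
        have := rpow_lt_rpow (by positivity) hlt hq0
        linarith
      have hsub2 : Icc (z + c * ε) (z + η) ⊆ Icc z (z + η) := Icc_subset_Icc_left (by linarith)
      have hmlow : ∀ x ∈ Icc (z + c * ε) (z + η), ms ≤ m x := fun x hx => by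
        have hx' := ha x (hsub2 hx)
        have hp := hmpos x ⟨by linarith [hx.1], by linarith [hx.2]⟩
        have h1 := hanti ⟨by linarith, by linarith⟩ (hsub2 hx) hx.1
        have h2 : k * ε ≤ |m x| ^ q / (q * a x) := by
          have := w.F_nonneg (u x)
          rw [en] at h1; linarith
        rw [le_div_iff₀ (mul_pos hq0 (hapos x (hsub2 hx))), abs_of_pos hp] at h2
        refine le_of_not_gt fun hlt => ?_
        have h3 := rpow_lt_rpow hp.le hlt hq0
        rw [hmsq] at h3
        have h4 := mul_le_mul_of_nonneg_left hx'.1 (mul_pos (mul_pos hkp hε) hq0).le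
        rw [hB] at h3
        linarith
      have hgrow := mul_sub_le_of_deriv (c := 2 / η)
        (fun x hx => (hloc.du x (hsub2 hx)).mono hsub2) (fun x hx => ?_)
        (left_mem_Icc.2 (by linarith : z + c * ε ≤ z + η)) (right_mem_Icc.2 (by linarith))
        (by linarith)
      · have h1 := hu1 (z + η) ⟨by linarith, hcase⟩
        have h2 : 0 ≤ u (z + c * ε) := by
          have hmono := monotoneOn_Icc_of_deriv (fun x hx => (hloc.du x (hsub hx)).mono hsub)
            fun t ht => div_nonneg (phip_nonneg
              (hmpos t ⟨ht.1.le, by linarith [ht.2]⟩).le) hε.le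
          have := hmono (left_mem_Icc.2 (by linarith)) (right_mem_Icc.2 (by linarith))
            (by linarith : z ≤ z + c * ε)
          rwa [huz] at this
        have h3 : 2 / η * (η / 2) ≤ 2 / η * (z + η - (z + c * ε)) := by gcongr; linarith
        have h4 : 2 / η * (η / 2) = 1 := by field_simp
        linarith
      · have hx' := Ioo_subset_Icc_self hx
        have hmx := hmlow x hx'
        have h1 : phip q ms ≤ phip q (m x) := (phip_strictMono hq).monotone hmx
        have h2 : ms * phip q ms = B * ε := by
          rw [phip_mul_self hq, abs_of_pos hmsp, hmsq]
        rw [div_le_div_iff₀ hη hε]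
        have h3 : B * ε ≤ η * B / 2 * phip q ms := by
          rw [← h2]; exact mul_le_mul_of_nonneg_right hms2 (phip_nonneg hmsp.le)
        have h4 : 2 * ε ≤ η * phip q ms := by
          refine le_of_mul_le_mul_left ?_ hBp
          linarith
        nlinarith
  intro a a' ε z r u m hε hε1 hzr h ha huz hez
  have hzz : z ∈ Icc z (z + η) := ⟨le_rfl, by linarith⟩
  have hmz : m z ≠ 0 := by
    intro h0
    rw [en, huz, w.F0, h0, abs_zero, zero_rpow hq0.ne', zero_div, sub_zero] at hez
    linarith
  rcases lt_or_gt_of_ne hmz with hneg | hpos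
  · intro x hx
    have := main _ _ w.neg (fun u => by rw [abs_neg]; exact hC _) a a' ε z r _ _ hε hε1 hzr h.neg ha
      (by simp [huz]) (by rw [Sys.neg_en]; exact hez) (by linarith) x hx
    exact neg_ne_zero.1 this
  · exact main f F w hC a a' ε z r u m hε hε1 hzr h ha huz hez hpos

/-- Coercivity of the dissipation in terms of the energy. -/
lemma Well.exists_dissipation {p q W0 : ℝ} {f F : ℝ → ℝ} (w : Well p q W0 f F) {amin g : ℝ}
    (hamin : 0 < amin) (hg : 0 < g) :
    ∃ c, 0 < c ∧ ∀ u m α, amin ≤ α → 0 < F u - |m| ^ q / (q * α) →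
      F u - |m| ^ q / (q * α) ≤ W0 - g →
      c * (F u - |m| ^ q / (q * α)) ^ (1 / q) ≤ |m| ^ q - α * (u * f u) := by
  have hq := w.q1
  have hq0 : 0 < q := by linarith
  have hW0 := w.W0pos
  obtain ⟨c1, hc1, hlow⟩ := w.lower
  -- near `u = 0` the momentum is bounded below
  have hnear : ∀ᶠ u in 𝓝 (0:ℝ), W0 - g / 2 < F u :=
    (w.Fcont.tendsto 0).eventually (lt_mem_nhds (by rw [w.F0]; linarith))
  obtain ⟨ρ, hρ, hball⟩ := Metric.eventually_nhds_iff_ball.1 hnear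
  obtain ⟨c2, hc2, hmid⟩ : ∃ c2, 0 < c2 ∧ ∀ u, ρ ≤ |u| → |u| ≤ 1 / 2 → c2 ≤ -(u * f u) := by
    have hK : IsCompact {u : ℝ | ρ ≤ |u| ∧ |u| ≤ 1 / 2} := by
      refine Metric.isCompact_of_isClosed_isBounded ?_ ?_
      · exact (isClosed_le continuous_const continuous_abs).inter
          (isClosed_le continuous_abs continuous_const)
      · refine (Metric.isBounded_closedBall (x := (0:ℝ)) (r := 1 / 2)).subset fun u hu => ?_
        simpa using hu.2
    rcases Set.eq_empty_or_nonempty {u : ℝ | ρ ≤ |u| ∧ |u| ≤ 1 / 2} with h | h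
    · refine ⟨1, one_pos, fun u h1 h2 => ?_⟩
      have : u ∈ ({u : ℝ | ρ ≤ |u| ∧ |u| ≤ 1 / 2}) := ⟨h1, h2⟩
      rw [h] at this; exact this.elim
    · obtain ⟨u0, hu0, hmin⟩ := hK.exists_isMinOn h
        (continuous_id.mul w.fcont).neg.continuousOn
      refine ⟨-(u0 * f u0), ?_, fun u h1 h2 => hmin ⟨h1, h2⟩⟩
      have : u0 ≠ 0 := by
        rintro rfl
        have := hu0.1
        simp at this; linarith
      linarith [w.mul_f_neg (by linarith [hu0.2] : |u0| < 1) this]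
  set S := W0 ^ (1 / q) with hS
  have hSp : 0 < S := by positivity
  refine ⟨min (amin * c1 / 2) (min (amin * c2 / S) (q * amin * (g / 2) / S)), by positivity, ?_⟩
  intro u m α hα he heg
  have hα0 := hamin.trans_le hα
  set e := F u - |m| ^ q / (q * α) with hedef
  have hmq : 0 ≤ |m| ^ q := by positivity
  have huf := w.mul_f_nonpos u
  have heF : e ≤ F u := by
    have : 0 ≤ |m| ^ q / (q * α) := by positivity
    linarith
  have hu1 : |u| < 1 := w.abs_lt_one_of_pos (he.trans_le heF)
  have heS : e ^ (1 / q) ≤ S := rpow_le_rpow he.le (by linarith) (by positivity)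
  have hep : 0 ≤ e ^ (1 / q) := by positivity
  have hαuf : amin * -(u * f u) ≤ -(α * (u * f u)) := by
    have := mul_le_mul_of_nonneg_right hα (neg_nonneg.2 huf)
    linarith
  rcases le_or_gt (1 / 2) |u| with h | h
  · calc _ ≤ amin * c1 / 2 * e ^ (1 / q) := mul_le_mul_of_nonneg_right (min_le_left _ _) hep
      _ ≤ amin * c1 / 2 * F u ^ (1 / q) := by gcongr
      _ = amin * (1 / 2) * (c1 * F u ^ (1 / q)) := by ring
      _ ≤ amin * (1 / 2) * |f u| := by have := hlow u h hu1.le; gcongr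
      _ ≤ amin * |u| * |f u| := by gcongr
      _ = amin * -(u * f u) := by rw [mul_assoc, ← abs_mul, abs_of_nonpos huf]
      _ ≤ _ := by linarith
  rcases le_or_gt ρ |u| with h' | h'
  · calc _ ≤ amin * c2 / S * e ^ (1 / q) :=
          mul_le_mul_of_nonneg_right ((min_le_right _ _).trans (min_le_left _ _)) hep
      _ ≤ amin * c2 / S * S := by gcongr
      _ = amin * c2 := by field_simp
      _ ≤ amin * -(u * f u) := by have := hmid u h' h.le; gcongr
      _ ≤ _ := by linarith
  · have h1 := hball u (by simpa using h')
    have h2 : g / 2 ≤ |m| ^ q / (q * α) := by linarith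
    rw [le_div_iff₀ (by positivity)] at h2
    calc _ ≤ q * amin * (g / 2) / S * e ^ (1 / q) :=
          mul_le_mul_of_nonneg_right ((min_le_right _ _).trans (min_le_right _ _)) hep
      _ ≤ q * amin * (g / 2) / S * S := by gcongr
      _ = g / 2 * (q * amin) := by field_simp
      _ ≤ g / 2 * (q * α) := by gcongr
      _ ≤ |m| ^ q := h2
      _ ≤ _ := by nlinarith

/-- If `u` vanishes at nonnegative energy and `a` increases there, the energy becomes
uniformly positive. -/
lemma Well.exists_growth {p q W0 : ℝ} {f F : ℝ → ℝ} (w : Well p q W0 f F) {amin amax lam η g : ℝ}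
    (hamin : 0 < amin) (hamax : amin ≤ amax) (hlam : 0 < lam) (hη : 0 < η) (hg : 0 < g) :
    ∃ ε1 κ, 0 < ε1 ∧ 0 < κ ∧ ∀ (a a' : ℝ → ℝ) (ε z : ℝ) (u m : ℝ → ℝ), 0 < ε → ε < ε1 →
      Sys q f a ε z (z + η) u m →
      (∀ x ∈ Icc z (z + η), amin ≤ a x ∧ a x ≤ amax ∧ HasDerivAt a (a' x) x ∧ lam ≤ a' x) →
      (∀ x ∈ Icc z (z + η), en q F a u m x ≤ W0 - g) →
      u z = 0 → 0 ≤ en q F a u m z → κ ≤ en q F a u m (z + η) := by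
  have hq := w.q1
  have hq0 : 0 < q := by linarith
  have hp0 : 0 < p := by linarith [w.hp]
  have hpq : 1 / p - 1 = -(1 / q) := by
    have := w.hp
    rw [w.hq]; field_simp; ring
  have hamax0 : 0 < amax := hamin.trans_le hamax
  have hW0 := w.W0pos
  obtain ⟨C, hC0, hC⟩ := w.exists_bound_f
  obtain ⟨c0, hc0, hdis⟩ := w.exists_dissipation hamin hg
  set m1 := (q * amin * g) ^ (1 / q) with hm1
  have hm1p : 0 < m1 := by positivity
  have hm1q : m1 ^ q = q * amin * g := by
    rw [hm1, ← rpow_mul (by positivity), one_div_mul_cancel hq0.ne', rpow_one]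
  set M := (q * amax * W0) ^ (1 / q) with hM
  have hMp : 0 < M := by positivity
  have hMq : M ^ q = q * amax * W0 := by
    rw [hM, ← rpow_mul (by positivity), one_div_mul_cancel hq0.ne', rpow_one]
  set c := m1 / (2 * (amax * C)) with hc
  have hcp : 0 < c := by positivity
  set k2 := lam / (q * amax ^ 2) / 2 with hk2
  have hk2p : 0 < k2 := by positivity
  set c1 := 2 * k2 * (m1 / 2) ^ q * c with hc1
  have hc1p : 0 < c1 := by positivity
  set D := 1 + k2 * M / c1 with hD
  have hDp : 0 < D := by positivity
  set k3 := k2 * c0 * (1 / D) ^ (1 / q) / p with hk3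
  have hk3p : 0 < k3 := by positivity
  refine ⟨min (η / (2 * c)) ((k3 * (η / 2)) ^ p / (2 * (k2 * M))), (k3 * (η / 2)) ^ p / 2,
    by positivity, by positivity, ?_⟩
  intro a a' ε z u m hε hε1 h ha heW huz hez
  have hε2 : c * ε ≤ η / 2 := by
    have := hε1.le.trans (min_le_left _ _)
    rw [le_div_iff₀ (by positivity)] at this; linarith
  have hε3 : k2 * M * ε ≤ (k3 * (η / 2)) ^ p / 2 := by
    have := hε1.le.trans (min_le_right _ _)
    rw [le_div_iff₀ (by positivity)] at this; linarith
  have hapos : ∀ x ∈ Icc z (z + η), 0 < a x := fun x hx => hamin.trans_le (ha x hx).1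
  have hzz : z ∈ Icc z (z + η) := ⟨le_rfl, by linarith⟩
  have hcε : 0 < c * ε := by positivity
  set e := en q F a u m with he
  have hed : ∀ x ∈ Icc z (z + η), HasDerivWithinAt e (a' x * |m x| ^ q / (q * a x ^ 2))
      (Icc z (z + η)) x := fun x hx => h.en_deriv w hapos (fun x hx => (ha x hx).2.2.1) hx
  have hed2 : ∀ x ∈ Icc z (z + η), 2 * k2 * |m x| ^ q ≤ a' x * |m x| ^ q / (q * a x ^ 2) :=
    fun x hx => by
      obtain ⟨h1, h2, -, h4⟩ := ha x hx
      have h5 := hapos x hx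
      have h6 := hlam.trans_le h4
      have e1 : 2 * k2 * |m x| ^ q = lam * |m x| ^ q / (q * amax ^ 2) := by rw [hk2]; field_simp
      rw [e1]
      gcongr
  have hmono : MonotoneOn e (Icc z (z + η)) := monotoneOn_Icc_of_deriv hed fun x hx =>
    le_trans (by positivity) (hed2 x (Ioo_subset_Icc_self hx))
  have he0 : ∀ x ∈ Icc z (z + η), 0 ≤ e x := fun x hx => hez.trans (hmono hzz hx hx.1)
  have hmM : ∀ x ∈ Icc z (z + η), |m x| ≤ M := fun x hx => by
    refine le_of_not_gt fun hlt => ?_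
    have h1 := rpow_lt_rpow hMp.le hlt hq0
    have h2 := he0 x hx
    rw [he, en, sub_nonneg, div_le_iff₀ (mul_pos hq0 (hapos x hx))] at h2
    have h3 : F (u x) * (q * a x) ≤ W0 * (q * amax) := by
      have := w.F_le (u x)
      have := (ha x hx).2.1
      have := hapos x hx
      gcongr
    linarith
  have hmz1 : m1 ≤ |m z| := by
    have h1 := heW z hzz
    rw [he, en, huz, w.F0] at h1
    have h2 : g ≤ |m z| ^ q / (q * a z) := by linarith
    rw [le_div_iff₀ (mul_pos hq0 (hapos z hzz))] at h2
    refine le_of_not_gt fun hlt => ?_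
    have h3 := rpow_lt_rpow (abs_nonneg _) hlt hq0
    have h4 := mul_le_mul_of_nonneg_left (ha z hzz).1 (mul_pos hg hq0).le
    linarith
  have hseed : ∀ x ∈ Icc z (z + c * ε), m1 / 2 ≤ |m x| := fun x hx => by
    have hx' : x ∈ Icc z (z + η) := ⟨hx.1, by linarith [hx.2]⟩
    have h1 := h.m_lipschitz hε hC (fun x hx => ⟨hapos x hx, (ha x hx).2.1⟩) z hzz x hx'
    have h2 : amax * C / ε * |z - x| ≤ m1 / 2 := by
      rw [abs_sub_comm, abs_of_nonneg (by linarith [hx.1])]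
      calc amax * C / ε * (x - z) ≤ amax * C / ε * (c * ε) := by gcongr; linarith [hx.2]
        _ = m1 / 2 := by rw [hc]; field_simp
    have h3 := abs_sub_abs_le_abs_sub (m z) (m x)
    linarith
  have hsub : Icc z (z + c * ε) ⊆ Icc z (z + η) := Icc_subset_Icc_right (by linarith)
  have hsub2 : Icc (z + c * ε) (z + η) ⊆ Icc z (z + η) := Icc_subset_Icc_left (by linarith)
  have hz1 : z + c * ε ∈ Icc z (z + η) := ⟨by linarith, by linarith⟩
  have hseed2 : ∀ x ∈ Icc z (z + c * ε), (m1 / 2) ^ q ≤ |m x| ^ q := fun x hx =>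
    rpow_le_rpow (by positivity) (hseed x hx) hq0.le
  have he1 : c1 * ε ≤ e (z + c * ε) := by
    have hd := mul_sub_le_of_deriv (c := 2 * k2 * (m1 / 2) ^ q)
      (fun x hx => (hed x (hsub hx)).mono hsub) (fun x hx =>
        le_trans (mul_le_mul_of_nonneg_left (hseed2 x (Ioo_subset_Icc_self hx)) (by positivity))
          (hed2 x (hsub (Ioo_subset_Icc_self hx))))
      (left_mem_Icc.2 (by linarith : z ≤ z + c * ε)) (right_mem_Icc.2 (by linarith)) (by linarith)
    have e1 : 2 * k2 * (m1 / 2) ^ q * (z + c * ε - z) = c1 * ε := by rw [hc1]; ring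
    rw [e1] at hd; linarith
  set Y : ℝ → ℝ := fun x => e x - k2 * ε * (m x * u x) with hY
  have hYd : ∀ x ∈ Icc z (z + η), HasDerivWithinAt Y (a' x * |m x| ^ q / (q * a x ^ 2) -
      k2 * (a x * (u x * f (u x)) + |m x| ^ q)) (Icc z (z + η)) x := fun x hx => by
    refine ((hed x hx).sub (((h.dm x hx).mul (h.du x hx)).const_mul (k2 * ε))).congr_deriv ?_
    rw [← phip_mul_self hq (m x)]
    field_simp
  have hYd2 : ∀ x ∈ Icc z (z + η), k2 * (|m x| ^ q - a x * (u x * f (u x))) ≤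
      a' x * |m x| ^ q / (q * a x ^ 2) - k2 * (a x * (u x * f (u x)) + |m x| ^ q) :=
    fun x hx => by linarith [hed2 x hx]
  have huf : ∀ x ∈ Icc z (z + η), a x * (u x * f (u x)) ≤ 0 := fun x hx =>
    mul_nonpos_of_nonneg_of_nonpos (hapos x hx).le (w.mul_f_nonpos _)
  have hYz : Y z = e z := by simp [hY, huz]
  have hYmono : MonotoneOn Y (Icc z (z + η)) := monotoneOn_Icc_of_deriv hYd fun x hx => by
    have hx' := Ioo_subset_Icc_self hx
    refine le_trans (mul_nonneg hk2p.le ?_) (hYd2 x hx')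
    have : 0 ≤ |m x| ^ q := by positivity
    linarith [huf x hx']
  have hY1 : 0 < Y (z + c * ε) := by
    have hd := mul_sub_le_of_deriv (c := k2 * (m1 / 2) ^ q)
      (fun x hx => (hYd x (hsub hx)).mono hsub) (fun x hx => by
        have hx' := Ioo_subset_Icc_self hx
        refine le_trans ?_ (hYd2 x (hsub hx'))
        refine mul_le_mul_of_nonneg_left ?_ hk2p.le
        linarith [huf x (hsub hx'), hseed2 x hx'])
      (left_mem_Icc.2 (by linarith : z ≤ z + c * ε)) (right_mem_Icc.2 (by linarith)) (by linarith)
    have : 0 < k2 * (m1 / 2) ^ q * (z + c * ε - z) := by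
      have : z + c * ε - z = c * ε := by ring
      rw [this]; positivity
    rw [hYz] at hd; linarith
  have hYpos : ∀ x ∈ Icc (z + c * ε) (z + η), 0 < Y x := fun x hx =>
    hY1.trans_le (hYmono hz1 (hsub2 hx) hx.1)
  have hepos : ∀ x ∈ Icc (z + c * ε) (z + η), c1 * ε ≤ e x := fun x hx =>
    he1.trans (hmono hz1 (hsub2 hx) hx.1)
  have hYe : ∀ x ∈ Icc (z + c * ε) (z + η), |Y x - e x| ≤ k2 * M * ε := fun x hx => by
    have hpos : 0 < e x := lt_of_lt_of_le (by positivity) (hepos x hx)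
    have hu1 : |u x| ≤ 1 := by
      refine (w.abs_lt_one_of_pos ?_).le
      rw [he, en] at hpos
      have : 0 ≤ |m x| ^ q / (q * a x) := by have := hapos x (hsub2 hx); positivity
      linarith
    have : Y x - e x = -(k2 * ε * (m x * u x)) := by simp [hY]
    rw [this, abs_neg, abs_mul, abs_mul (m x), abs_of_pos (by positivity : 0 < k2 * ε)]
    calc k2 * ε * (|m x| * |u x|) ≤ k2 * ε * (M * 1) := by have := hmM x (hsub2 hx); gcongr
      _ = _ := by ring
  have hYroot := mul_sub_le_of_deriv (g := fun x => Y x ^ (1 / p)) (c := k3)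
    (fun x hx => ((hYd x (hsub2 hx)).mono hsub2).rpow_const (p := 1 / p) (Or.inl (hYpos x hx).ne'))
    (fun x hx => ?_) (left_mem_Icc.2 (by linarith : z + c * ε ≤ z + η))
    (right_mem_Icc.2 (by linarith)) (by linarith)
  · have hend : z + η ∈ Icc (z + c * ε) (z + η) := right_mem_Icc.2 (by linarith)
    have h1 : k3 * (η / 2) ≤ Y (z + η) ^ (1 / p) := by
      have h2 : 0 ≤ Y (z + c * ε) ^ (1 / p) := by positivity
      have h3 : k3 * (η / 2) ≤ k3 * (z + η - (z + c * ε)) := by gcongr; linarith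
      linarith
    have h2 : (k3 * (η / 2)) ^ p ≤ Y (z + η) := by
      calc _ ≤ (Y (z + η) ^ (1 / p)) ^ p := rpow_le_rpow (by positivity) h1 hp0.le
        _ = Y (z + η) := by
          rw [← rpow_mul (hYpos _ hend).le, one_div_mul_cancel hp0.ne', rpow_one]
    have h3 := (abs_le.1 (hYe _ hend)).2
    linarith
  · have hx' := Ioo_subset_Icc_self hx
    have hxx := hsub2 hx'
    have hpos : 0 < e x := lt_of_lt_of_le (by positivity) (hepos x hx')
    have hYp := hYpos x hx'
    have h1 : k2 * (c0 * e x ^ (1 / q)) ≤ _ :=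
      le_trans (mul_le_mul_of_nonneg_left (hdis (u x) (m x) (a x) (ha x hxx).1 hpos (heW x hxx))
        hk2p.le) (hYd2 x hxx)
    have h2 : Y x ≤ D * e x := by
      have h3 := (abs_le.1 (hYe x hx')).2
      have h4 : k2 * M * ε ≤ k2 * M / c1 * e x := by
        have := hepos x hx'
        calc k2 * M * ε = k2 * M / c1 * (c1 * ε) := by field_simp
          _ ≤ _ := by gcongr
      rw [hD]; linarith
    have h3 : (1 / D) ^ (1 / q) * Y x ^ (1 / q) ≤ e x ^ (1 / q) := by
      rw [← mul_rpow (by positivity) hYp.le]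
      refine rpow_le_rpow (by positivity) ?_ (by positivity)
      rw [one_div, inv_mul_le_iff₀ hDp]; exact h2
    have h4 : k2 * c0 * ((1 / D) ^ (1 / q) * Y x ^ (1 / q)) ≤
        a' x * |m x| ^ q / (q * a x ^ 2) - k2 * (a x * (u x * f (u x)) + |m x| ^ q) := by
      refine le_trans ?_ h1
      rw [mul_assoc]; gcongr
    have h5 : Y x ^ (1 / q) * Y x ^ (1 / p - 1) = 1 := by
      rw [← rpow_add hYp, hpq]; simp
    calc k3 = k2 * c0 * ((1 / D) ^ (1 / q) * Y x ^ (1 / q)) * (1 / p) * Y x ^ (1 / p - 1) := by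
          rw [hk3]; linear_combination (-(k2 * c0 * (1 / D) ^ (1 / q) / p)) * h5
      _ ≤ _ := by gcongr

/-- The energy strictly decreases along rays from the origin where it is positive. -/
lemma Well.ray_strict {p q W0 : ℝ} {f F : ℝ → ℝ} (w : Well p q W0 f F) {b s c ρ1 ρ2 : ℝ}
    (hb : 0 < b) (hsc : s ^ 2 + c ^ 2 = 1) (h1 : 0 < ρ1) (h12 : ρ1 < ρ2)
    (hpos : 0 < F (ρ2 * s) - |ρ2 * c| ^ q / (q * b)) :
    F (ρ2 * s) - |ρ2 * c| ^ q / (q * b) < F (ρ1 * s) - |ρ1 * c| ^ q / (q * b) := by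
  have hq := w.q1
  have hF := w.ray_anti s h1.le h12.le
  by_cases hc : c = 0
  · subst hc
    have h0 : (0:ℝ) ^ q = 0 := zero_rpow (by linarith)
    simp only [mul_zero, abs_zero, h0, zero_div, sub_zero] at hpos ⊢
    have habs := abs_lt.1 (w.abs_lt_one_of_pos hpos)
    rcases sq_eq_one_iff.1 (by nlinarith : s ^ 2 = 1) with rfl | rfl
    · exact w.strictAntiOn ⟨by linarith, by linarith⟩ ⟨by linarith, by linarith⟩ (by linarith)
    · exact w.strictMonoOn ⟨by linarith, by linarith⟩ ⟨by linarith, by linarith⟩ (by linarith)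
  · have hcp : 0 < |c| := abs_pos.2 hc
    have : |ρ1 * c| ^ q < |ρ2 * c| ^ q := by
      apply rpow_lt_rpow (abs_nonneg _) _ (by linarith)
      rw [abs_mul, abs_mul, abs_of_pos h1, abs_of_pos (h1.trans h12)]
      gcongr
    have : |ρ1 * c| ^ q / (q * b) < |ρ2 * c| ^ q / (q * b) := by gcongr
    linarith

/-- On a level of positive energy a state is determined by its angle. -/
lemma Well.state_of_angle {p q W0 : ℝ} {f F : ℝ → ℝ} (w : Well p q W0 f F)
    {b ξ s c ρ1 ρ2 : ℝ} (hb : 0 < b) (hξ : 0 < ξ) (hsc : s ^ 2 + c ^ 2 = 1) (h1 : 0 < ρ1)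
    (h2 : 0 < ρ2) (e1 : F (ρ1 * s) - |ρ1 * c| ^ q / (q * b) = ξ)
    (e2 : F (ρ2 * s) - |ρ2 * c| ^ q / (q * b) = ξ) : ρ1 = ρ2 := by
  rcases lt_trichotomy ρ1 ρ2 with h | h | h
  · have := w.ray_strict hb hsc h1 h (by linarith); linarith
  · exact h
  · have := w.ray_strict hb hsc h2 h (by linarith); linarith

/-- A global trajectory of the autonomous system with its polar angle. -/
structure Orbit (q : ℝ) (f F : ℝ → ℝ) (b ξ : ℝ) (V M θ : ℝ → ℝ) : Prop where
  dV : ∀ y, HasDerivAt V (phip q (M y)) y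
  dM : ∀ y, HasDerivAt M (b * f (V y)) y
  energy : ∀ y, F (V y) - |M y| ^ q / (q * b) = ξ
  nz : ∀ y, 0 < V y ^ 2 + M y ^ 2
  dθ : ∀ y, HasDerivAt θ ((M y * phip q (M y) - b * (V y * f (V y))) / (V y ^ 2 + M y ^ 2)) y
  polu : ∀ y, V y = √(V y ^ 2 + M y ^ 2) * sin (θ y)
  polm : ∀ y, M y = √(V y ^ 2 + M y ^ 2) * cos (θ y)

/-- States of equal angle (and equal positive energy) coincide. -/
lemma Well.eq_of_angle {p q W0 : ℝ} {f F : ℝ → ℝ} (w : Well p q W0 f F)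
    {b ξ u1 m1 u2 m2 θ : ℝ} (hb : 0 < b) (hξ : 0 < ξ)
    (n1 : 0 < u1 ^ 2 + m1 ^ 2) (n2 : 0 < u2 ^ 2 + m2 ^ 2)
    (e1 : F u1 - |m1| ^ q / (q * b) = ξ) (e2 : F u2 - |m2| ^ q / (q * b) = ξ)
    (pu1 : u1 = √(u1 ^ 2 + m1 ^ 2) * sin θ) (pm1 : m1 = √(u1 ^ 2 + m1 ^ 2) * cos θ)
    (pu2 : u2 = √(u2 ^ 2 + m2 ^ 2) * sin θ) (pm2 : m2 = √(u2 ^ 2 + m2 ^ 2) * cos θ) :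
    u1 = u2 ∧ m1 = m2 := by
  have := w.state_of_angle hb hξ (sin_sq_add_cos_sq θ) (sqrt_pos.2 n1) (sqrt_pos.2 n2)
    (by rw [← pu1, ← pm1]; exact e1) (by rw [← pu2, ← pm2]; exact e2)
  constructor
  · rw [pu1, this, ← pu2]
  · rw [pm1, this, ← pm2]

/-- The angular velocity is bounded below on energy bands. -/
lemma Well.exists_angular_speed_band {p q W0 : ℝ} {f F : ℝ → ℝ} (w : Well p q W0 f F)
    {amin amax κ g : ℝ} (hamin : 0 < amin) (hamax : amin ≤ amax) (hκ : 0 < κ) (hg : 0 < g) :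
    ∃ c, 0 < c ∧ ∀ u m b, amin ≤ b → b ≤ amax → 0 < u ^ 2 + m ^ 2 →
      κ ≤ F u - |m| ^ q / (q * b) → F u - |m| ^ q / (q * b) ≤ W0 - g →
      c ≤ (m * phip q m - b * (u * f u)) / (u ^ 2 + m ^ 2) := by
  have hq := w.q1
  have hq0 : 0 < q := by linarith
  have hW0 := w.W0pos
  have hamax0 := hamin.trans_le hamax
  obtain ⟨c, hc, hdis⟩ := w.exists_dissipation hamin hg
  set M := (q * amax * W0) ^ (1 / q) with hM
  have hMp : 0 < M := by positivity
  refine ⟨c * κ ^ (1 / q) / (1 + M ^ 2), by positivity, fun u m b hb1 hb2 hn he1 he2 => ?_⟩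
  have hb : 0 < b := hamin.trans_le hb1
  have h1 := hdis u m b hb1 (by linarith) he2
  rw [phip_mul_self w.q1 m]
  have hmn : 0 ≤ |m| ^ q / (q * b) := by positivity
  have hu : u ^ 2 ≤ 1 := by
    have := abs_le.1 (w.abs_lt_one_of_pos (u := u) (by linarith)).le
    nlinarith
  have hm : |m| ≤ M := by
    have h2 : |m| ^ q / (q * b) ≤ W0 := by linarith [w.F_le u]
    rw [div_le_iff₀ (by positivity)] at h2
    calc |m| = (|m| ^ q) ^ (1 / q) := by
          rw [← rpow_mul (abs_nonneg m), mul_one_div_cancel hq0.ne', rpow_one]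
      _ ≤ M := by
          refine rpow_le_rpow (by positivity) (h2.trans ?_) (by positivity)
          rw [mul_comm]; gcongr
  have hm2 : m ^ 2 ≤ M ^ 2 := by rw [← sq_abs]; gcongr
  have h3 : 0 ≤ c * κ ^ (1 / q) := by positivity
  have h4 : u ^ 2 + m ^ 2 ≤ 1 + M ^ 2 := by linarith
  have h5 : c * κ ^ (1 / q) ≤ c * (F u - |m| ^ q / (q * b)) ^ (1 / q) := by gcongr
  calc c * κ ^ (1 / q) / (1 + M ^ 2) ≤ c * κ ^ (1 / q) / (u ^ 2 + m ^ 2) := by gcongr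
    _ ≤ _ := by gcongr; linarith

lemma Well.exists_angular_speed {p q W0 : ℝ} {f F : ℝ → ℝ} (w : Well p q W0 f F)
    {b ξ : ℝ} (hb : 0 < b) (hξ : 0 < ξ) (hξW : ξ < W0) :
    ∃ c, 0 < c ∧ ∀ u m, 0 < u ^ 2 + m ^ 2 → F u - |m| ^ q / (q * b) = ξ →
      c ≤ (m * phip q m - b * (u * f u)) / (u ^ 2 + m ^ 2) := by
  obtain ⟨c, hc, h⟩ := w.exists_angular_speed_band hb le_rfl hξ (sub_pos.2 hξW)
  exact ⟨c, hc, fun u m hn he => h u m b le_rfl le_rfl hn he.ge (by linarith)⟩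

lemma Orbit.exists_iso {p q W0 : ℝ} {f F : ℝ → ℝ} (w : Well p q W0 f F)
    {b ξ : ℝ} {V M θ : ℝ → ℝ} (hb : 0 < b) (hξ : 0 < ξ) (hξW : ξ < W0)
    (o : Orbit q f F b ξ V M θ) : ∃ Φ : ℝ → ℝ, StrictMono θ ∧ (∀ t, θ (Φ t) = t) ∧
      (∀ y, Φ (θ y) = y) ∧ Continuous Φ := by
  obtain ⟨c, hc, hω⟩ := w.exists_angular_speed hb hξ hξW
  have hlow : ∀ x y, x ≤ y → c * (y - x) ≤ θ y - θ x := fun x y hxy =>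
    mul_sub_le_of_deriv (fun t _ => (o.dθ t).hasDerivWithinAt)
      (fun t _ => hω _ _ (o.nz t) (o.energy t)) (left_mem_Icc.2 hxy) (right_mem_Icc.2 hxy) hxy
  have hmono : StrictMono θ := fun x y hxy => by
    have := hlow x y hxy.le
    nlinarith
  have hcont : Continuous θ := continuous_iff_continuousAt.2 fun y => (o.dθ y).continuousAt
  have hsurj : Function.Surjective θ := by
    refine hcont.surjective ?_ ?_
    · refine tendsto_atTop_mono' _ ?_ (tendsto_atTop_add_const_left _ (θ 0)
        (Tendsto.const_mul_atTop hc tendsto_id))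
      filter_upwards [eventually_ge_atTop 0] with y hy
      have := hlow 0 y hy
      simp only [id]
      linarith
    · refine tendsto_atBot_mono' _ ?_ (tendsto_atBot_add_const_left _ (θ 0)
        (Tendsto.const_mul_atBot hc tendsto_id))
      filter_upwards [eventually_le_atBot 0] with y hy
      have := hlow y 0 hy
      simp only [id]
      linarith
  let I := hmono.orderIsoOfSurjective θ hsurj
  exact ⟨I.symm, hmono, fun t => I.apply_symm_apply t, fun y => I.symm_apply_apply y,
    I.symm.continuous⟩

/-- Every trajectory on the same positive energy level is a time shift of the orbit. -/
lemma Orbit.shift {p q W0 : ℝ} {f F : ℝ → ℝ} (w : Well p q W0 f F)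
    {b ξ : ℝ} {V M θ : ℝ → ℝ} (hb : 0 < b) (hξ : 0 < ξ) (hξW : ξ < W0)
    (o : Orbit q f F b ξ V M θ) {l r : ℝ} (hlr : l ≤ r) {u m ϑ : ℝ → ℝ}
    (t : Traj (phip q) f (fun _ => b) l r u m ϑ)
    (he : ∀ x ∈ Icc l r, F (u x) - |m x| ^ q / (q * b) = ξ) :
    ∃ s, θ (s + l) = ϑ l ∧ ∀ x ∈ Icc l r, ϑ x = θ (s + x) ∧ u x = V (s + x) ∧ m x = M (s + x) := by
  obtain ⟨Φ, hmono, h1, h2, hcont⟩ := o.exists_iso w hb hξ hξW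
  obtain ⟨c, hc, hω⟩ := w.exists_angular_speed hb hξ hξW
  have hst : ∀ x ∈ Icc l r, u x = V (Φ (ϑ x)) ∧ m x = M (Φ (ϑ x)) := fun x hx => by
    have hp := o.polu (Φ (ϑ x))
    have hm := o.polm (Φ (ϑ x))
    rw [h1] at hp hm
    exact w.eq_of_angle hb hξ (t.nz x hx) (o.nz _) (he x hx) (o.energy _) (t.polu x hx)
      (t.polm x hx) hp hm
  have hd : ∀ x ∈ Icc l r, HasDerivWithinAt (fun y => Φ (ϑ y) - y) 0 (Icc l r) x := fun x hx => by
    have hne := (hc.trans_le (hω _ _ (t.nz x hx) (he x hx))).ne'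
    have h3 := o.dθ (Φ (ϑ x))
    rw [← (hst x hx).1, ← (hst x hx).2] at h3
    have h4 := HasDerivAt.of_local_left_inverse (f := θ) (g := Φ) (a := ϑ x) hcont.continuousAt h3
      hne (Eventually.of_forall h1)
    have h5 := (h4.comp_hasDerivWithinAt x (t.dθ x hx)).sub (hasDerivWithinAt_id x (Icc l r))
    refine h5.congr_deriv ?_
    rw [inv_mul_cancel₀ hne, sub_self]
  have hl : l ∈ Icc l r := left_mem_Icc.2 hlr
  have hs : ∀ x ∈ Icc l r, Φ (ϑ x) = Φ (ϑ l) - l + x := fun x hx => by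
    have := const_of_deriv_zero hd (fun _ _ => rfl) hx hl
    linarith
  refine ⟨Φ (ϑ l) - l, by rw [sub_add_cancel, h1], fun x hx => ?_⟩
  rw [← hs x hx]
  exact ⟨(h1 _).symm, hst x hx⟩

lemma Orbit.Mcont {q : ℝ} {f F : ℝ → ℝ} {b ξ : ℝ} {V M θ : ℝ → ℝ} (o : Orbit q f F b ξ V M θ) :
    Continuous M := continuous_iff_continuousAt.2 fun y => (o.dM y).continuousAt

lemma continuous_abs_rpow {q : ℝ} (hq : 0 ≤ q) : Continuous fun s : ℝ => |s| ^ q :=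
  continuous_abs.rpow_const fun _ => Or.inr hq

/-- Polar lift of a nonvanishing global trajectory. -/
lemma exists_orbit {p q W0 : ℝ} {f F : ℝ → ℝ} (w : Well p q W0 f F) {b ξ : ℝ} {V M : ℝ → ℝ}
    (hξW : ξ < W0)
    (dV : ∀ y, HasDerivAt V (phip q (M y)) y) (dM : ∀ y, HasDerivAt M (b * f (V y)) y)
    (energy : ∀ y, F (V y) - |M y| ^ q / (q * b) = ξ) (hV : V 0 = 0) (hM : 0 < M 0) :
    ∃ θ, Orbit q f F b ξ V M θ ∧ θ 0 = 0 := by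
  have hq := w.q1
  have cV : Continuous V := continuous_iff_continuousAt.2 fun y => (dV y).continuousAt
  have cM : Continuous M := continuous_iff_continuousAt.2 fun y => (dM y).continuousAt
  have nz : ∀ y, 0 < V y ^ 2 + M y ^ 2 := fun y => by
    by_contra h
    have h1 : V y = 0 := by nlinarith [sq_nonneg (V y), sq_nonneg (M y)]
    have h2 : M y = 0 := by nlinarith [sq_nonneg (V y), sq_nonneg (M y)]
    have := energy y
    rw [h1, h2, w.F0, abs_zero, zero_rpow (by linarith)] at this
    simp at this
    linarith
  set ω : ℝ → ℝ := fun y => (M y * phip q (M y) - b * (V y * f (V y))) / (V y ^ 2 + M y ^ 2) with hω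
  have cω : Continuous ω := by
    refine Continuous.div ?_ (by fun_prop) fun y => (nz y).ne'
    exact (cM.mul ((continuous_phip hq).comp cM)).sub
      (continuous_const.mul (cV.mul (w.fcont.comp cV)))
  refine ⟨fun y => ∫ t in (0:ℝ)..y, ω t, ?_, by simp⟩
  have dθ : ∀ y, HasDerivAt (fun y => ∫ t in (0:ℝ)..y, ω t) (ω y) y := fun y =>
    (cω.integral_hasStrictDerivAt 0 y).hasDerivAt
  have hpol := polar_propagate (s := univ) convex_univ (mem_univ (0:ℝ))
    (fun x _ => (dV x).hasDerivWithinAt) (fun x _ => (dM x).hasDerivWithinAt) (fun x _ => nz x)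
    (θ := fun y => ∫ t in (0:ℝ)..y, ω t)
    (fun x _ => ((dθ x).congr_deriv (by simp only [hω]; ring)).hasDerivWithinAt)
    (by simp [hV]) (by simp [hV, sqrt_sq hM.le])
  exact ⟨dV, dM, energy, nz, dθ, fun y => (hpol y (mem_univ y)).1, fun y => (hpol y (mem_univ y)).2⟩

/-- Period and mean kinetic energy of the autonomous trajectories. -/
structure PK (p q W0 : ℝ) (f F : ℝ → ℝ) (T K : ℝ → ℝ) : Prop where
  Tpos : ∀ ξ ∈ Ioo 0 W0, 0 < T ξ
  orbit : ∀ ξ ∈ Ioo 0 W0, ∀ b, 0 < b → ∃ V M θ, Orbit q f F b ξ V M θ ∧ θ 0 = 0 ∧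
    (∀ y, θ (T ξ / b ^ (1 / p) + y) = θ y + 2 * π)
  per : ∀ ξ ∈ Ioo 0 W0, ∀ b, 0 < b → ∀ u m θ : ℝ → ℝ,
    Traj (phip q) f (fun _ => b) 0 (T ξ / b ^ (1 / p)) u m θ →
    (∀ x ∈ Icc 0 (T ξ / b ^ (1 / p)), F (u x) - |m x| ^ q / (q * b) = ξ) →
    θ (T ξ / b ^ (1 / p)) - θ 0 = 2 * π ∧
    ∫ y in (0:ℝ)..(T ξ / b ^ (1 / p)), |m y| ^ q / q = T ξ / b ^ (1 / p) * b * K ξ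

lemma Orbit.period {p q W0 : ℝ} {f F : ℝ → ℝ} (w : Well p q W0 f F) {b ξ P : ℝ} {V M θ : ℝ → ℝ}
    (hb : 0 < b) (hξ : 0 < ξ) (hξW : ξ < W0) (o : Orbit q f F b ξ V M θ) (h0 : θ 0 = 0)
    (hV : Function.Periodic V P) (hP : 0 < P)
    (hmin : ∀ c, 0 < c → Function.Periodic V c → P ≤ c) :
    ∀ y, θ (P + y) = θ y + 2 * π ∧ M (P + y) = M y := by
  have hq := w.q1
  obtain ⟨Φ, hmono, h1, h2, -⟩ := o.exists_iso w hb hξ hξW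
  have hV0 : V 0 = 0 := by rw [o.polu 0, h0]; simp
  have hM0 : 0 < M 0 := by
    rw [o.polm 0, h0, cos_zero, mul_one]; exact sqrt_pos.2 (o.nz 0)
  have hMeq : ∀ c, Function.Periodic V c → Function.Periodic M c := fun c hc y => by
    have e1 := (o.dV (y + c)).comp_add_const y c
    have e2 : HasDerivAt V (phip q (M (y + c))) y := by
      simpa [hc _] using e1
    exact (phip_strictMono hq).injective (e2.unique (o.dV y))
  set c := Φ (2 * π) with hc
  have hθc : θ c = 2 * π := h1 _
  have hcpos : 0 < c := hmono.lt_iff_lt.1 (by rw [hθc, h0]; positivity)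
  have hshift : ∀ y, V y = V (c + y) ∧ θ y + 2 * π = θ (c + y) := fun y => by
    have t : Traj (phip q) f (fun _ => b) (-|y|) |y| V M (fun x => θ x + 2 * π) :=
      ⟨⟨fun x _ => (o.dV x).hasDerivWithinAt, fun x _ => (o.dM x).hasDerivWithinAt⟩,
        fun x _ => o.nz x, fun x _ => ((o.dθ x).add_const _).hasDerivWithinAt,
        fun x _ => by rw [sin_add_two_pi]; exact o.polu x,
        fun x _ => by rw [cos_add_two_pi]; exact o.polm x⟩
    obtain ⟨s, -, hs⟩ := o.shift w hb hξ hξW (by linarith [abs_nonneg y]) t (fun x _ => o.energy x)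
    have hs0 := (hs 0 ⟨by linarith [abs_nonneg y], abs_nonneg y⟩).1
    rw [h0, zero_add, add_zero] at hs0
    have : s = c := by rw [hc, hs0, h2]
    have hsy := hs y ⟨neg_abs_le y, le_abs_self y⟩
    rw [this] at hsy
    exact ⟨hsy.2.1, hsy.1⟩
  have hcper : Function.Periodic V c := fun y => by rw [add_comm, ← (hshift y).1]
  have hPc : P = c := by
    apply le_antisymm (hmin c hcpos hcper)
    rw [← hmono.le_iff_le, hθc]
    have hMP : M P = M 0 := by have := hMeq P hV 0; rwa [zero_add] at this
    have hVP : V P = 0 := by have := hV 0; rw [zero_add] at this; rw [this, hV0]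
    have hs : sin (θ P) = 0 := by
      have := o.polu P
      rw [hVP] at this
      rcases mul_eq_zero.1 this.symm with h | h
      · have := sqrt_pos.2 (o.nz P); rw [hVP] at this; linarith
      · exact h
    have hcp : 0 < cos (θ P) := by
      have := o.polm P
      rw [hMP] at this
      by_contra h
      have h3 := mul_nonpos_of_nonneg_of_nonpos (sqrt_nonneg (V P ^ 2 + M 0 ^ 2)) (not_lt.1 h)
      linarith
    have hcos : cos (θ P) = 1 := by
      have := sin_sq_add_cos_sq (θ P)
      rw [hs] at this
      nlinarith
    obtain ⟨n, hn⟩ := (cos_eq_one_iff _).1 hcos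
    have hθP : 0 < θ P := by rw [← h0]; exact hmono hP
    rw [← hn] at hθP ⊢
    have hn0 : (0:ℝ) < n := by
      by_contra h
      have := mul_nonpos_of_nonpos_of_nonneg (not_lt.1 h) (by positivity : 0 ≤ 2 * π)
      linarith
    have hn1 : (1:ℝ) ≤ n := by
      have : 0 < n := by exact_mod_cast hn0
      exact_mod_cast this
    nlinarith [pi_pos]
  intro y
  rw [hPc]
  exact ⟨(hshift y).2.symm, by rw [add_comm]; exact hMeq c hcper y⟩

lemma pk_of_hypothesis {p W0 : ℝ} {W T K : ℝ → ℝ}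
    (w : Well p (p / (p - 1)) W0 (extZero (deriv W)) (extZero W))
    (hTK : ∀ ξ ∈ Ioo 0 W0, ∃ v v' : ℝ → ℝ, IsSolAuto p 1 W v v' ∧
      (∀ x, -(1 / 1) * Lfun p (v' x) + W (v x) = ξ) ∧ v 0 = 0 ∧ 0 < v' 0 ∧
      IsLeast {c | 0 < c ∧ Function.Periodic v c} (T ξ) ∧
      K ξ = (1 / T ξ) * ∫ y in (0:ℝ)..(T ξ), Lfun p (v' y)) :
    PK p (p / (p - 1)) W0 (extZero (deriv W)) (extZero W) T K := by
  set q := p / (p - 1) with hq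
  have hp := w.hp
  have hq1 := w.q1
  have hq0 : 0 < q := by linarith
  have hp0 : 0 < p := by linarith
  have hW1 : ∀ u, |u| = 1 → W u = 0 := fun u hu => by
    rw [← extZero_of_le (g := W) hu.le]; exact w.Fout u hu.ge
  have key : ∀ ξ ∈ Ioo 0 W0, 0 < T ξ ∧ ∀ b, 0 < b → ∃ V M θ,
      Orbit q (extZero (deriv W)) (extZero W) b ξ V M θ ∧ θ 0 = 0 ∧
      (∀ y, θ (T ξ / b ^ (1 / p) + y) = θ y + 2 * π) ∧
      (∀ y, M (T ξ / b ^ (1 / p) + y) = M y) ∧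
      ∫ y in (0:ℝ)..(T ξ / b ^ (1 / p)), |M y| ^ q / q = T ξ / b ^ (1 / p) * b * K ξ := by
    intro ξ hξ
    obtain ⟨v, v', ⟨cv', dv, g, -, dg, hg⟩, hen, hv0, hv'0, hT, hK⟩ := hTK ξ hξ
    have hTpos : 0 < T ξ := hT.1.1
    refine ⟨hTpos, fun b hb => ?_⟩
    have hLn : ∀ s, 0 ≤ Lfun p s := fun s => by
      have : 0 < p / (p - 1) := hq0
      rw [Lfun]; positivity
    have cv : Continuous v := continuous_iff_continuousAt.2 fun y => (dv y).continuousAt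
    have hv1 : ∀ y, |v y| < 1 := by
      by_contra! h
      obtain ⟨y, hy⟩ := h
      obtain ⟨z, -, hz⟩ := intermediate_value_uIcc (a := 0) (b := y) cv.abs.continuousOn
        (show (1:ℝ) ∈ uIcc |v 0| |v y| by
          rw [hv0, abs_zero]; exact mem_uIcc_of_le zero_le_one hy)
      have := hen z
      rw [hW1 _ hz] at this
      linarith [hLn (v' z), hξ.1]
    set β := b ^ (1 / p) with hβ
    have hβp : 0 < β := by positivity
    set γ := b ^ (1 / q) with hγ
    have hγp : 0 < γ := by positivity
    have hγq : γ ^ q = b := by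
      rw [hγ, ← rpow_mul hb.le, one_div_mul_cancel hq0.ne', rpow_one]
    have hγβ : γ ^ (q - 1) = β := by
      rw [hγ, hβ, ← rpow_mul hb.le]; congr 1; rw [hq]; have : p - 1 ≠ 0 := by linarith
      field_simp; ring
    have hγb : γ * β = b := by
      rw [← hγβ, ← hγq, rpow_sub_one hγp.ne']; field_simp
    have hlin : ∀ y, HasDerivAt (fun y => β * y) β y := fun y =>
      ((hasDerivAt_id y).const_mul β).congr_deriv (mul_one β)
    have hMq : ∀ y, |γ * phip p (v' (β * y))| ^ q / q = b * Lfun p (v' (β * y)) := fun y => by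
      have h := Lfun_phip hp hq (phip p (v' (β * y)))
      rw [phip_phip hq1 (conj_symm' hp hq)] at h
      rw [h, abs_mul, mul_rpow (abs_nonneg _) (abs_nonneg _), abs_of_pos hγp, hγq]; ring
    obtain ⟨θ, o, h0⟩ := exists_orbit w (b := b) (ξ := ξ) (V := fun y => v (β * y))
      (M := fun y => γ * phip p (v' (β * y))) hξ.2
      (fun y => ((dv (β * y)).comp y (hlin y)).congr_deriv (by
        rw [phip_mul_of_pos hγp, hγβ, phip_phip hq1 (conj_symm' hp hq)]; ring))
      (fun y => (((dg (β * y)).comp y (hlin y)).const_mul γ).congr_deriv (by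
        rw [hg, extZero_of_le (hv1 _).le, ← hγb]; ring))
      (fun y => by
        have h := hMq y
        rw [div_eq_iff hq0.ne'] at h
        rw [h, extZero_of_le (hv1 _).le, ← hen (β * y)]; field_simp; ring)
      (by simp [hv0]) (by simp only [mul_zero]; exact mul_pos hγp (phip_pos hv'0))
    have hTp : ∀ y, v (y + T ξ) = v y := hT.1.2
    have hper := o.period w hb hξ.1 hξ.2 h0 (P := T ξ / β)
      (fun y => by
        show v (β * (y + T ξ / β)) = v (β * y)
        rw [mul_add, mul_div_cancel₀ _ hβp.ne', hTp])
      (by positivity)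
      (fun c hc hcper => by
        rw [div_le_iff₀' hβp]
        refine hT.2 ⟨by positivity, fun y => ?_⟩
        have := hcper (y / β)
        simp only at this
        rw [mul_add, mul_div_cancel₀ _ hβp.ne'] at this
        exact this)
    refine ⟨_, _, θ, o, h0, fun y => (hper y).1, fun y => (hper y).2, ?_⟩
    simp only [hMq]
    rw [intervalIntegral.integral_const_mul,
      intervalIntegral.integral_comp_mul_left (fun y => Lfun p (v' y)) hβp.ne', mul_zero,
      mul_div_cancel₀ _ hβp.ne', hK, smul_eq_mul]
    field_simp
  refine ⟨fun ξ hξ => (key ξ hξ).1, fun ξ hξ b hb => ?_, fun ξ hξ b hb u m ϑ t he => ?_⟩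
  · obtain ⟨V, M, θ, o, h0, h1, -⟩ := (key ξ hξ).2 b hb
    exact ⟨V, M, θ, o, h0, h1⟩
  · obtain ⟨hTp, h⟩ := key ξ hξ
    obtain ⟨V, M, θ, o, -, hθ, hM, hInt⟩ := h b hb
    have hP : 0 < T ξ / b ^ (1 / p) := by positivity
    set P := T ξ / b ^ (1 / p) with hPdef
    obtain ⟨s, -, hs⟩ := o.shift w hb hξ.1 hξ.2 hP.le t he
    constructor
    · rw [(hs P (right_mem_Icc.2 hP.le)).1, (hs 0 (left_mem_Icc.2 hP.le)).1, add_zero, add_comm s P,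
        hθ]; ring
    · rw [← hInt]
      have hpm : Function.Periodic (fun y => |M y| ^ q / q) P := fun y => by
        simp only; rw [add_comm, hM]
      calc ∫ y in (0:ℝ)..P, |m y| ^ q / q = ∫ y in (0:ℝ)..P, |M (s + y)| ^ q / q := by
            refine intervalIntegral.integral_congr fun y hy => ?_
            rw [uIcc_of_le hP.le] at hy
            rw [(hs y hy).2.2]
        _ = ∫ y in s..(s + P), |M y| ^ q / q := by
            rw [intervalIntegral.integral_comp_add_left (fun y => |M y| ^ q / q), add_zero]
        _ = ∫ y in (0:ℝ)..(0 + P), |M y| ^ q / q := hpm.intervalIntegral_add_eq s 0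
        _ = _ := by rw [zero_add]

/-- A global solution of the autonomous system at energy `ξ`. -/
structure Glob (q : ℝ) (f F : ℝ → ℝ) (b ξ : ℝ) (V M : ℝ → ℝ) : Prop where
  dV : ∀ y, HasDerivAt V (phip q (M y)) y
  dM : ∀ y, HasDerivAt M (b * f (V y)) y
  energy : ∀ y, F (V y) - |M y| ^ q / (q * b) = ξ

lemma Orbit.glob {q : ℝ} {f F : ℝ → ℝ} {b ξ : ℝ} {V M θ : ℝ → ℝ} (o : Orbit q f F b ξ V M θ) :
    Glob q f F b ξ V M := ⟨o.dV, o.dM, o.energy⟩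

lemma Glob.shift {q : ℝ} {f F : ℝ → ℝ} {b ξ : ℝ} {V M : ℝ → ℝ} (o : Glob q f F b ξ V M) (c : ℝ) :
    Glob q f F b ξ (fun y => V (c + y)) (fun y => M (c + y)) :=
  ⟨fun y => (o.dV (c + y)).comp_const_add c y, fun y => (o.dM (c + y)).comp_const_add c y,
    fun y => o.energy (c + y)⟩

lemma Glob.reflect {q : ℝ} {f F : ℝ → ℝ} {b ξ : ℝ} {V M : ℝ → ℝ} (o : Glob q f F b ξ V M) (c : ℝ) :
    Glob q f F b ξ (fun y => V (c - y)) (fun y => -M (c - y)) :=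
  ⟨fun y => by rw [phip_neg]; exact (o.dV (c - y)).comp_const_sub c y,
    fun y => ((o.dM (c - y)).comp_const_sub c y).neg.congr_deriv (by ring),
    fun y => by rw [abs_neg]; exact o.energy (c - y)⟩

lemma Orbit.neg {q : ℝ} {f F : ℝ → ℝ} {b ξ : ℝ} {V M θ : ℝ → ℝ} (o : Orbit q f F b ξ V M θ) :
    Orbit q (fun u => -f (-u)) (fun u => F (-u)) b ξ (fun y => -V y) (fun y => -M y)
      (fun y => θ y - π) where
  dV y := by rw [phip_neg]; exact (o.dV y).neg
  dM y := (o.dM y).neg.congr_deriv (by simp)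
  energy y := by simpa using o.energy y
  nz y := by simpa using o.nz y
  dθ y := ((o.dθ y).sub_const π).congr_deriv (by rw [phip_neg]; simp)
  polu y := by rw [neg_sq, neg_sq, sin_sub_pi, mul_neg, ← o.polu]
  polm y := by rw [neg_sq, neg_sq, cos_sub_pi, mul_neg, ← o.polm]

/-- Lower energy means slower motion from a rest point to the next zero. -/
lemma Well.quarter {p q W0 : ℝ} {f F : ℝ → ℝ} (w : Well p q W0 f F) {b ξ1 ξ2 τ1 τ2 : ℝ}
    {V1 M1 V2 M2 : ℝ → ℝ} (hb : 0 < b) (hξ1 : 0 < ξ1) (hξ : ξ1 < ξ2)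
    (g1 : Glob q f F b ξ1 V1 M1) (g2 : Glob q f F b ξ2 V2 M2) (hM1 : M1 0 = 0) (hM2 : M2 0 = 0)
    (hτ1 : 0 < τ1) (hV1 : ∀ y ∈ Ico 0 τ1, 0 < V1 y) (hV2 : ∀ y ∈ Ico 0 τ2, 0 < V2 y)
    (hz1 : V1 τ1 = 0) : τ2 < τ1 := by
  have hp := w.hp
  have hq := w.q1
  have hq0 : 0 < q := by linarith
  by_contra! hle
  have hpq : (p - 1) * q = p := by
    rw [w.hq]; have : p - 1 ≠ 0 := by linarith
    field_simp
  -- the ratio `M / φ_p(V)` and its derivative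
  have hder : ∀ {ξ : ℝ} {V M : ℝ → ℝ}, Glob q f F b ξ V M → ∀ y, 0 < V y →
      HasDerivAt (fun y => M y / V y ^ (p - 1))
        (b * (f (V y) / phip p (V y)) - (p - 1) * |M y / V y ^ (p - 1)| ^ q) y := by
    intro ξ V M g y hy
    have h1 := (g.dM y).div ((g.dV y).rpow_const (p := p - 1) (Or.inl hy.ne'))
      (rpow_pos_of_pos hy _).ne'
    refine h1.congr_deriv ?_
    rw [abs_div, div_rpow (abs_nonneg _) (abs_nonneg _), abs_of_pos (rpow_pos_of_pos hy _),
      ← rpow_mul hy.le, hpq, ← phip_mul_self hq, phip_of_pos hy]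
    have e1 : V y ^ (p - 1 - 1) = V y ^ (p - 1) / V y := rpow_sub_one hy.ne' _
    have e2 : V y ^ p = V y ^ (p - 1) * V y := by
      rw [← rpow_add_one hy.ne']; congr 1; ring
    have h3 := rpow_pos_of_pos hy (p - 1)
    rw [e1, e2]
    field_simp
  have hstrict : ∀ {v1 m1 v2 m2 : ℝ}, 0 < v1 → 0 < v2 → F v1 - |m1| ^ q / (q * b) = ξ1 →
      F v2 - |m2| ^ q / (q * b) = ξ2 → m2 / v2 ^ (p - 1) = m1 / v1 ^ (p - 1) →
      b * (f v2 / phip p v2) - (p - 1) * |m2 / v2 ^ (p - 1)| ^ q <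
      b * (f v1 / phip p v1) - (p - 1) * |m1 / v1 ^ (p - 1)| ^ q := by
    intro v1 m1 v2 m2 h1 h2 e1 e2 hr
    have hform : ∀ {v m : ℝ}, 0 < v → |m| ^ q = |m / v ^ (p - 1)| ^ q * v ^ p := by
      intro v m hv
      rw [abs_div, div_rpow (abs_nonneg _) (abs_nonneg _), abs_of_pos (rpow_pos_of_pos hv _),
        ← rpow_mul hv.le, hpq]
      have := rpow_pos_of_pos hv p
      field_simp
    have hlt : v2 < v1 := by
      by_contra! hcon
      have h3 := w.antitoneOn (mem_Ici.2 h1.le) (mem_Ici.2 h2.le) hcon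
      have h4 : |m1| ^ q / (q * b) ≤ |m2| ^ q / (q * b) := by
        rw [hform (m := m1) h1, hform (m := m2) h2, hr]
        have : v1 ^ p ≤ v2 ^ p := rpow_le_rpow h1.le hcon (by linarith)
        gcongr
      linarith
    have hv1 : v1 ≤ 1 := by
      have h4 : 0 ≤ |m1| ^ q / (q * b) := by positivity
      exact (le_abs_self _).trans (w.abs_lt_one_of_pos (by linarith)).le
    rw [hr]
    have := w.hmono v2 v1 h2 hlt hv1
    have := mul_lt_mul_of_pos_left this hb
    linarith
  have hcomp : ∀ α β L, 0 ≤ L → (∀ y ∈ Icc 0 L, 0 < V1 (α + y)) → (∀ y ∈ Icc 0 L, 0 < V2 (β + y)) →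
      M2 β / V2 β ^ (p - 1) ≤ M1 α / V1 α ^ (p - 1) →
      M2 (β + L) / V2 (β + L) ^ (p - 1) ≤ M1 (α + L) / V1 (α + L) ^ (p - 1) := by
    intro α β L hL h1 h2 h0
    have d1 := fun y (hy : y ∈ Icc 0 L) => hder (g1.shift α) y (h1 y hy)
    have d2 := fun y (hy : y ∈ Icc 0 L) => hder (g2.shift β) y (h2 y hy)
    refine image_le_of_deriv_right_lt_deriv_boundary' (a := 0) (b := L)
      (fun y hy => (d2 y hy).continuousAt.continuousWithinAt)
      (fun y hy => (d2 y (Ico_subset_Icc_self hy)).hasDerivWithinAt) (by simpa using h0)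
      (fun y hy => (d1 y hy).continuousAt.continuousWithinAt)
      (fun y hy => (d1 y (Ico_subset_Icc_self hy)).hasDerivWithinAt)
      (fun y hy he => hstrict (h1 y (Ico_subset_Icc_self hy)) (h2 y (Ico_subset_Icc_self hy))
        (g1.energy _) (g2.energy _) he) (right_mem_Icc.2 hL)
  have hge : ∀ y ∈ Ico 0 τ1, M2 y / V2 y ^ (p - 1) ≤ M1 y / V1 y ^ (p - 1) := fun y hy => by
    have := hcomp 0 0 y hy.1 (fun t ht => hV1 _ ⟨by linarith [ht.1], by linarith [ht.2, hy.2]⟩)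
      (fun t ht => hV2 _ ⟨by linarith [ht.1], by linarith [ht.2, hy.2]⟩) (by rw [hM1, hM2]; simp)
    simpa using this
  obtain ⟨x0, hx0, hx0lt⟩ : ∃ x0 ∈ Ioo 0 τ1,
      M2 x0 / V2 x0 ^ (p - 1) < M1 x0 / V1 x0 ^ (p - 1) := by
    by_contra! hcon
    have heq : ∀ y ∈ Ioo 0 τ1, M2 y / V2 y ^ (p - 1) = M1 y / V1 y ^ (p - 1) := fun y hy =>
      le_antisymm (hge y ⟨hy.1.le, hy.2⟩) (hcon y hy)
    have hmid : τ1 / 2 ∈ Ioo 0 τ1 := ⟨by linarith, by linarith⟩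
    have hv1 := hV1 (τ1 / 2) ⟨by linarith, by linarith⟩
    have hv2 := hV2 (τ1 / 2) ⟨by linarith, by linarith⟩
    have d1 := hder g1 (τ1 / 2) hv1
    have d2 := (hder g2 (τ1 / 2) hv2).congr_of_eventuallyEq
      (f₁ := fun y => M1 y / V1 y ^ (p - 1)) (by
        filter_upwards [Ioo_mem_nhds hmid.1 hmid.2] with y hy using (heq y hy).symm)
    have := d1.unique d2
    have := hstrict hv1 hv2 (g1.energy _) (g2.energy _) (heq _ hmid)
    linarith
  obtain ⟨σ, hσ0, hσx, hσ⟩ : ∃ σ, 0 < σ ∧ σ < x0 ∧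
      M2 (x0 - σ) / V2 (x0 - σ) ^ (p - 1) < M1 x0 / V1 x0 ^ (p - 1) := by
    have hc := (hder g2 x0 (hV2 x0 ⟨hx0.1.le, by linarith [hx0.2]⟩)).continuousAt
    obtain ⟨ρ, hρ, hball⟩ := Metric.eventually_nhds_iff_ball.1 (hc.eventually (gt_mem_nhds hx0lt))
    have hm : 0 < min ρ x0 := lt_min hρ hx0.1
    refine ⟨min ρ x0 / 2, by linarith, by linarith [min_le_right ρ x0], hball _ ?_⟩
    rw [Metric.mem_ball, dist_eq, abs_lt]
    constructor <;> linarith [min_le_left ρ x0]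
  have hcross : ∀ x ∈ Ico x0 τ1, M2 (x - σ) * V1 x ^ (p - 1) ≤ M1 x * V2 (x - σ) ^ (p - 1) := by
    intro x hx
    have h1 : 0 < V1 x := hV1 x ⟨by linarith [hx0.1, hx.1], hx.2⟩
    have h2 : 0 < V2 (x - σ) := hV2 _ ⟨by linarith [hx.1], by linarith [hx.2]⟩
    have := hcomp x0 (x0 - σ) (x - x0) (by linarith [hx.1])
      (fun t ht => hV1 _ ⟨by linarith [ht.1, hx0.1], by linarith [ht.2, hx.2]⟩)
      (fun t ht => hV2 _ ⟨by linarith [ht.1], by linarith [ht.2, hx.2]⟩) hσ.le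
    rw [show x0 - σ + (x - x0) = x - σ by ring, show x0 + (x - x0) = x by ring,
      div_le_div_iff₀ (rpow_pos_of_pos h2 _) (rpow_pos_of_pos h1 _)] at this
    exact this
  have hlim : M2 (τ1 - σ) * V1 τ1 ^ (p - 1) ≤ M1 τ1 * V2 (τ1 - σ) ^ (p - 1) := by
    have cont : ∀ {g d : ℝ → ℝ}, (∀ y, HasDerivAt g (d y) y) → Continuous g := fun h =>
      continuous_iff_continuousAt.2 fun y => (h y).continuousAt
    have hp1 : 0 ≤ p - 1 := by linarith
    have c1 : Continuous fun x => M2 (x - σ) * V1 x ^ (p - 1) :=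
      ((cont g2.dM).comp (continuous_id.sub continuous_const)).mul
        ((cont g1.dV).rpow_const fun _ => Or.inr hp1)
    have c2 : Continuous fun x => M1 x * V2 (x - σ) ^ (p - 1) :=
      (cont g1.dM).mul (((cont g2.dV).comp (continuous_id.sub continuous_const)).rpow_const
        fun _ => Or.inr hp1)
    have hmem : τ1 ∈ closure (Ico x0 τ1) := by
      rw [closure_Ico hx0.2.ne]; exact right_mem_Icc.2 hx0.2.le
    exact le_on_closure hcross c1.continuousOn c2.continuousOn hmem
  have hM1neg : M1 τ1 < 0 := by
    have h1 : M1 τ1 ≤ M1 0 := antitoneOn_Icc_of_deriv (l := 0) (r := τ1)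
      (fun y _ => (g1.dM y).hasDerivWithinAt)
      (fun y hy => by
        have h1 := hV1 y (Ioo_subset_Ico_self hy)
        have h2 := w.mul_f_nonpos (V1 y)
        have h3 : f (V1 y) ≤ 0 := by
          by_contra! h; nlinarith [mul_pos h1 h]
        nlinarith)
      (left_mem_Icc.2 hτ1.le) (right_mem_Icc.2 hτ1.le) hτ1.le
    refine lt_of_le_of_ne (h1.trans hM1.le) fun h => ?_
    have e1 := g1.energy τ1
    have e2 := g2.energy 0
    rw [hz1, h, w.F0] at e1
    rw [hM2] at e2
    simp [zero_rpow hq0.ne'] at e1 e2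
    linarith [w.F_le (V2 0)]
  have hV2p : 0 < V2 (τ1 - σ) ^ (p - 1) :=
    rpow_pos_of_pos (hV2 _ ⟨by linarith [hx0.2], by linarith⟩) _
  rw [hz1, zero_rpow (by linarith : p - 1 ≠ 0), mul_zero] at hlim
  nlinarith

/-- Higher energy means a faster half turn. -/
lemma Well.half_turn {p q W0 : ℝ} {f F : ℝ → ℝ} (w : Well p q W0 f F) {b ξ1 ξ2 : ℝ}
    {V1 M1 θ1 V2 M2 θ2 : ℝ → ℝ} (hb : 0 < b) (hξ1 : 0 < ξ1) (hξ : ξ1 < ξ2) (hξ2 : ξ2 < W0)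
    (o1 : Orbit q f F b ξ1 V1 M1 θ1) (o2 : Orbit q f F b ξ2 V2 M2 θ2) {x1 y1 x2 y2 : ℝ}
    (hx1 : θ1 x1 = 0) (hy1 : θ1 y1 = π) (hx2 : θ2 x2 = 0) (hy2 : θ2 y2 = π) :
    y2 - x2 < y1 - x1 := by
  have data : ∀ {ξ : ℝ} {V M θ : ℝ → ℝ} {x y : ℝ}, 0 < ξ → ξ < W0 → Orbit q f F b ξ V M θ →
      θ x = 0 → θ y = π → ∃ t, x < t ∧ t < y ∧ M t = 0 ∧ V x = 0 ∧ V y = 0 ∧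
        ∀ s ∈ Ioo x y, 0 < V s := by
    intro ξ V M θ x y h1 h2 o hx hy
    obtain ⟨Φ, hmono, e1, e2, -⟩ := o.exists_iso w hb h1 h2
    refine ⟨Φ (π / 2), hmono.lt_iff_lt.1 (by rw [hx, e1]; positivity),
      hmono.lt_iff_lt.1 (by rw [hy, e1]; linarith [pi_pos]), by rw [o.polm, e1]; simp,
      by rw [o.polu, hx]; simp, by rw [o.polu, hy]; simp, fun s hs => ?_⟩
    rw [o.polu]
    refine mul_pos (sqrt_pos.2 (o.nz s)) (sin_pos_of_pos_of_lt_pi ?_ ?_)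
    · rw [← hx]; exact hmono hs.1
    · rw [← hy]; exact hmono hs.2
  obtain ⟨t1, hxt1, hty1, hM1, -, hVy1, hp1⟩ := data hξ1 (hξ.trans hξ2) o1 hx1 hy1
  obtain ⟨t2, hxt2, hty2, hM2, -, hVy2, hp2⟩ := data (hξ1.trans hξ) hξ2 o2 hx2 hy2
  have hVx1 : V1 x1 = 0 := by rw [o1.polu, hx1]; simp
  have q1 := w.quarter hb hξ1 hξ (o1.glob.shift t1) (o2.glob.shift t2) (by simpa using hM1)
    (by simpa using hM2) (τ1 := y1 - t1) (τ2 := y2 - t2) (by linarith)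
    (fun y hy => hp1 _ ⟨by linarith [hy.1], by linarith [hy.2]⟩)
    (fun y hy => hp2 _ ⟨by linarith [hy.1], by linarith [hy.2]⟩) (by simpa using hVy1)
  have q2 := w.quarter hb hξ1 hξ (o1.glob.reflect t1) (o2.glob.reflect t2) (by simpa using hM1)
    (by simpa using hM2) (τ1 := t1 - x1) (τ2 := t2 - x2) (by linarith)
    (fun y hy => hp1 _ ⟨by linarith [hy.2], by linarith [hy.1]⟩)
    (fun y hy => hp2 _ ⟨by linarith [hy.2], by linarith [hy.1]⟩) (by simpa using hVx1)
  linarith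

lemma PK.T_strictAnti {p q W0 : ℝ} {f F T K : ℝ → ℝ} (w : Well p q W0 f F)
    (k : PK p q W0 f F T K) : StrictAntiOn T (Ioo 0 W0) := by
  intro ξ1 h1 ξ2 h2 h12
  obtain ⟨V1, M1, θ1, o1, z1, per1⟩ := k.orbit ξ1 h1 1 one_pos
  obtain ⟨V2, M2, θ2, o2, z2, per2⟩ := k.orbit ξ2 h2 1 one_pos
  obtain ⟨Φ1, -, e1, -⟩ := o1.exists_iso w one_pos h1.1 h1.2
  obtain ⟨Φ2, -, e2, -⟩ := o2.exists_iso w one_pos h2.1 h2.2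
  have a1 := per1 0
  have a2 := per2 0
  simp only [one_rpow, div_one, add_zero, z1, z2, zero_add] at a1 a2
  have t1 := w.half_turn one_pos h1.1 h12 h2.2 o1 o2 z1 (e1 π) z2 (e2 π)
  have t2 := w.neg.half_turn one_pos h1.1 h12 h2.2 o1.neg o2.neg (x1 := Φ1 π) (x2 := Φ2 π)
    (y1 := T ξ1) (y2 := T ξ2) (by simp [e1]) (by simp [a1]; ring) (by simp [e2]) (by simp [a2]; ring)
  linarith

/-- Away from the maximal energy the state stays away from the origin. -/
lemma Well.exists_radius {p q W0 : ℝ} {f F : ℝ → ℝ} (w : Well p q W0 f F) {amin g : ℝ}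
    (hamin : 0 < amin) (hg : 0 < g) :
    ∃ c, 0 < c ∧ ∀ u m b, amin ≤ b → F u - |m| ^ q / (q * b) ≤ W0 - g → c ≤ u ^ 2 + m ^ 2 := by
  have hq0 : 0 < q := by linarith [w.q1]
  have hc : Continuous fun z : ℝ × ℝ => F z.1 - |z.2| ^ q / (q * amin) :=
    (w.Fcont.comp continuous_fst).sub
      (((continuous_abs_rpow hq0.le).comp continuous_snd).div_const _)
  have h0 : W0 - g < F (0, (0:ℝ)).1 - |((0:ℝ), (0:ℝ)).2| ^ q / (q * amin) := by
    simp [w.F0, zero_rpow hq0.ne']; exact hg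
  obtain ⟨ρ, hρ, hball⟩ := Metric.eventually_nhds_iff_ball.1
    ((hc.tendsto (0, 0)).eventually (lt_mem_nhds h0))
  refine ⟨ρ ^ 2, by positivity, fun u m b hb he => ?_⟩
  by_contra! hlt
  have hu : |u| < ρ := abs_lt_of_sq_lt_sq (by nlinarith [sq_nonneg m]) hρ.le
  have hm : |m| < ρ := abs_lt_of_sq_lt_sq (by nlinarith [sq_nonneg u]) hρ.le
  have h1 := hball (u, m) (by
    rw [Metric.mem_ball, Prod.dist_eq]; simpa [dist_eq] using ⟨hu, hm⟩)
  simp only at h1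
  have : |m| ^ q / (q * b) ≤ |m| ^ q / (q * amin) := by gcongr
  linarith

lemma Traj.add_turns {ψ f b : ℝ → ℝ} {l r : ℝ} {u m θ : ℝ → ℝ} (t : Traj ψ f b l r u m θ) (n : ℤ) :
    Traj ψ f b l r u m (fun x => θ x - n * (2 * π)) :=
  ⟨t.toTraj0, t.nz, fun x hx => (t.dθ x hx).sub_const _,
    fun x hx => by rw [sin_sub_int_mul_two_pi]; exact t.polu x hx,
    fun x hx => by rw [cos_sub_int_mul_two_pi]; exact t.polm x hx⟩

/-- Compactness of trajectories whose coefficients become constant. -/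
lemma Well.blowup {p q W0 : ℝ} {f F : ℝ → ℝ} (w : Well p q W0 f F) {R B amin amax g ξ β : ℝ}
    (hR : 0 ≤ R) (hamin : 0 < amin) (hg : 0 < g) {b u m θ : ℕ → ℝ → ℝ}
    (h : ∀ n, Traj (phip q) f (b n) 0 R (u n) (m n) (θ n))
    (hb : ContConv b (fun _ => β) (Icc 0 R))
    (hbb : ∀ n, ∀ y ∈ Icc 0 R, amin ≤ b n y ∧ b n y ≤ amax)
    (hu : ∀ n, ∀ y ∈ Icc 0 R, |u n y| ≤ B) (hm : ∀ n, ∀ y ∈ Icc 0 R, |m n y| ≤ B)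
    (heW : ∀ n, ∀ y ∈ Icc 0 R, F (u n y) - |m n y| ^ q / (q * b n y) ≤ W0 - g)
    (hlim : ∀ y ∈ Icc 0 R,
      Tendsto (fun n => F (u n y) - |m n y| ^ q / (q * b n y)) atTop (𝓝 ξ)) :
    ∃ φ : ℕ → ℕ, StrictMono φ ∧ ∃ U N Θ : ℝ → ℝ, ContConv (fun n => u (φ n)) U (Icc 0 R) ∧
      ContConv (fun n => m (φ n)) N (Icc 0 R) ∧
      (∀ y ∈ Icc 0 R, Tendsto (fun n => θ (φ n) y - θ (φ n) 0) atTop (𝓝 (Θ y - Θ 0))) ∧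
      Traj (phip q) f (fun _ => β) 0 R U N Θ ∧
      ∀ y ∈ Icc 0 R, F (U y) - |N y| ^ q / (q * β) = ξ := by
  have hq0 : 0 < q := by linarith [w.q1]
  have h0 : (0:ℝ) ∈ Icc 0 R := left_mem_Icc.2 hR
  have hB : 0 ≤ B := (abs_nonneg _).trans (hu 0 0 h0)
  have hβ : amin ≤ β := ge_of_tendsto' (hb.pointwise h0) fun n => (hbb n 0 h0).1
  obtain ⟨C, hC0, hC⟩ := w.exists_bound_f
  obtain ⟨D, hD⟩ := (isCompact_Icc (a := -B) (b := B)).exists_bound_of_continuousOn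
    (continuous_phip w.q1).continuousOn
  have hψb : ∀ n, ∀ y ∈ Icc 0 R, |phip q (m n y)| ≤ max D (amax * C) := fun n y hy =>
    (hD _ (abs_le.1 (hm n y hy))).trans (le_max_left _ _)
  have hfb : ∀ n, ∀ y ∈ Icc 0 R, |b n y * f (u n y)| ≤ max D (amax * C) := fun n y hy => by
    refine le_trans ?_ (le_max_right _ _)
    have h1 := hbb n y hy
    rw [abs_mul, abs_of_pos (by linarith)]
    have := hC (u n y)
    gcongr
    · linarith
    · exact h1.2
  obtain ⟨c, hc, hrad⟩ := w.exists_radius hamin hg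
  have cψ : ContConv (fun _ => phip q) (phip q) univ := .const (continuous_phip w.q1).continuousOn
  have cf : ContConv (fun _ => f) f univ := .const w.fcont.continuousOn
  obtain ⟨φ, hφ, U, N, hU, hN, t0⟩ := Traj0.compact (fun n => (h n).toTraj0) cψ cf hb hu hm hψb hfb
  have hfl : ∀ n, ∃ k : ℤ, |θ n 0 - k * (2 * π)| ≤ max B (2 * π) := fun n => by
    refine ⟨⌊θ n 0 / (2 * π)⌋, le_trans ?_ (le_max_right _ _)⟩
    have h1 := Int.floor_le (θ n 0 / (2 * π))
    have h2 := Int.lt_floor_add_one (θ n 0 / (2 * π))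
    have hpi : 0 < 2 * π := by positivity
    rw [le_div_iff₀ hpi] at h1
    rw [div_lt_iff₀ hpi] at h2
    rw [abs_le]; constructor <;> linarith
  choose k hk using hfl
  obtain ⟨φ', hφ', Θ, hΘ, t⟩ := Traj.compact (M := max B (2 * π)) hR
    (fun n => (h (φ n)).add_turns (k (φ n))) cψ cf
    (hb.subseq hφ.tendsto_atTop) (fun n y hy => (hu (φ n) y hy).trans (le_max_left _ _))
    (fun n y hy => (hm (φ n) y hy).trans (le_max_left _ _)) (fun n => hψb (φ n))
    (fun n => hfb (φ n)) hc
    (fun n y hy => hrad _ _ _ (hbb (φ n) y hy).1 (heW (φ n) y hy)) (fun n => hk (φ n)) hU hN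
  have hU' := hU.subseq hφ'.tendsto_atTop
  have hN' := hN.subseq hφ'.tendsto_atTop
  refine ⟨φ ∘ φ', hφ.comp hφ', U, N, Θ, hU', hN', fun y hy => ?_, t, fun y hy => ?_⟩
  · refine ((hΘ.pointwise hy).sub (hΘ.pointwise h0)).congr fun n => ?_
    simp only [Function.comp]; ring
  · have hs : Tendsto (φ ∘ φ') atTop atTop := (hφ.comp hφ').tendsto_atTop
    refine tendsto_nhds_unique ?_ ((hlim y hy).comp hs)
    exact ((w.Fcont.tendsto _).comp (hU'.pointwise hy)).sub
      (((continuous_abs_rpow hq0.le).tendsto _ |>.comp (hN'.pointwise hy)).div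
        (tendsto_const_nhds.mul ((hb.pointwise hy).comp hs))
        (mul_pos hq0 (hamin.trans_le hβ)).ne')

lemma ContConv.integral {g : ℕ → ℝ → ℝ} {G : ℝ → ℝ} {l r : ℝ} (h : ContConv g G (Icc l r))
    (hlr : l ≤ r) (hg : ∀ n, ContinuousOn (g n) (Icc l r)) :
    Tendsto (fun n => ∫ y in l..r, g n y) atTop (𝓝 (∫ y in l..r, G y)) := by
  refine TendstoUniformlyOn.tendsto_intervalIntegral_of_continuousOn ?_ ?_
  · rw [uIcc_of_le hlr]; exact Eventually.of_forall hg
  · rw [uIcc_of_le hlr]; exact h.tendstoUniformlyOn isCompact_Icc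

/-- Rotation and mean kinetic energy over one limiting period. -/
lemma PK.limit {p q W0 : ℝ} {f F T K : ℝ → ℝ} (w : Well p q W0 f F) (k : PK p q W0 f F T K)
    {B amin amax g ξ β P : ℝ} (hξ : ξ ∈ Ioo 0 W0) (hβ : 0 < β) (hP : P = T ξ / β ^ (1 / p))
    (hamin : 0 < amin) (hg : 0 < g) {b u m θ : ℕ → ℝ → ℝ}
    (h : ∀ n, Traj (phip q) f (b n) 0 P (u n) (m n) (θ n))
    (hb : ContConv b (fun _ => β) (Icc 0 P))
    (hbb : ∀ n, ∀ y ∈ Icc 0 P, amin ≤ b n y ∧ b n y ≤ amax)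
    (hu : ∀ n, ∀ y ∈ Icc 0 P, |u n y| ≤ B) (hm : ∀ n, ∀ y ∈ Icc 0 P, |m n y| ≤ B)
    (heW : ∀ n, ∀ y ∈ Icc 0 P, F (u n y) - |m n y| ^ q / (q * b n y) ≤ W0 - g)
    (hlim : ∀ y ∈ Icc 0 P,
      Tendsto (fun n => F (u n y) - |m n y| ^ q / (q * b n y)) atTop (𝓝 ξ)) :
    Tendsto (fun n => θ n P - θ n 0) atTop (𝓝 (2 * π)) ∧
    Tendsto (fun n => ∫ y in (0:ℝ)..P, |m n y| ^ q / q) atTop (𝓝 (P * β * K ξ)) := by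
  have hq0 : 0 < q := by linarith [w.q1]
  have hP0 : 0 ≤ P := by
    rw [hP]; exact div_nonneg (k.Tpos ξ hξ).le (by positivity)
  have key : ∀ ns : ℕ → ℕ, Tendsto ns atTop atTop → ∃ φ : ℕ → ℕ,
      Tendsto (fun n => θ (ns (φ n)) P - θ (ns (φ n)) 0) atTop (𝓝 (2 * π)) ∧
      Tendsto (fun n => ∫ y in (0:ℝ)..P, |m (ns (φ n)) y| ^ q / q) atTop (𝓝 (P * β * K ξ)) := by
    intro ns hns
    obtain ⟨φ, hφ, U, N, Θ, -, hN, hΘ, t, he⟩ := w.blowup hP0 hamin hg (fun n => h (ns n))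
      (hb.subseq hns) (fun n => hbb _) (fun n => hu _) (fun n => hm _) (fun n => heW _)
      (fun y hy => (hlim y hy).comp hns)
    have hper := k.per ξ hξ β hβ U N Θ (by rw [← hP]; exact t) (by rw [← hP]; exact he)
    rw [← hP] at hper
    refine ⟨φ, ?_, ?_⟩
    · rw [← hper.1]; exact hΘ P (right_mem_Icc.2 hP0)
    · rw [← hper.2]
      have cq : Continuous fun s : ℝ => |s| ^ q / q := (continuous_abs_rpow hq0.le).div_const _
      refine ContConv.integral (g := fun n y => |m (ns (φ n)) y| ^ q / q)
        (G := fun y => |N y| ^ q / q) ?_ hP0 fun n => ?_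
      · exact (ContConv.const (G := fun s : ℝ => |s| ^ q / q) cq.continuousOn).comp hN
      · exact cq.comp_continuousOn (h _).toTraj0.mcont
  constructor
  · exact tendsto_of_subseq_tendsto fun ns hns => (key ns hns).imp fun φ hφ => hφ.1
  · exact tendsto_of_subseq_tendsto fun ns hns => (key ns hns).imp fun φ hφ => hφ.2

lemma Orbit.traj {q : ℝ} {f F : ℝ → ℝ} {b ξ : ℝ} {V M θ : ℝ → ℝ} (o : Orbit q f F b ξ V M θ)
    (l r : ℝ) : Traj (phip q) f (fun _ => b) l r V M θ :=
  ⟨⟨fun x _ => (o.dV x).hasDerivWithinAt, fun x _ => (o.dM x).hasDerivWithinAt⟩,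
    fun x _ => o.nz x, fun x _ => (o.dθ x).hasDerivWithinAt, fun x _ => o.polu x,
    fun x _ => o.polm x⟩

section K

variable {p q W0 : ℝ} {f F T K : ℝ → ℝ}

lemma Orbit.kinetic_le (w : Well p q W0 f F) {b ξ : ℝ} {V M θ : ℝ → ℝ} (hb : 0 < b)
    (o : Orbit q f F b ξ V M θ) (y : ℝ) : |M y| ^ q / q ≤ b * (W0 - ξ) := by
  have hq0 : 0 < q := by linarith [w.q1]
  have h1 := o.energy y
  have h2 := w.F_le (V y)
  have h3 : |M y| ^ q / q = b * (|M y| ^ q / (q * b)) := by field_simp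
  rw [h3]; gcongr; linarith

lemma PK.kinetic (w : Well p q W0 f F) (k : PK p q W0 f F T K) {ξ : ℝ} (hξ : ξ ∈ Ioo 0 W0) :
    ∃ V M θ, Orbit q f F 1 ξ V M θ ∧ θ 0 = 0 ∧ θ (T ξ) = 2 * π ∧
      ∫ y in (0:ℝ)..(T ξ), |M y| ^ q / q = T ξ * K ξ := by
  obtain ⟨V, M, θ, o, h0, hper⟩ := k.orbit ξ hξ 1 one_pos
  have h := k.per ξ hξ 1 one_pos V M θ (o.traj _ _) fun x _ => o.energy x
  simp only [one_rpow, div_one, mul_one] at h hper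
  exact ⟨V, M, θ, o, h0, by simpa [h0] using hper 0, h.2⟩

lemma continuous_kinetic (w : Well p q W0 f F) : Continuous fun s : ℝ => |s| ^ q / q :=
  (continuous_abs_rpow (by linarith [w.q1])).div_const _

lemma PK.K_pos (w : Well p q W0 f F) (k : PK p q W0 f F T K) {ξ : ℝ} (hξ : ξ ∈ Ioo 0 W0) :
    0 < K ξ := by
  have hq0 : 0 < q := by linarith [w.q1]
  obtain ⟨V, M, θ, o, h0, -, hInt⟩ := k.kinetic w hξ
  have hT := k.Tpos ξ hξ
  have hpos : 0 < ∫ y in (0:ℝ)..(T ξ), |M y| ^ q / q := by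
    refine integral_pos hT ((continuous_kinetic w).comp o.Mcont).continuousOn
      (fun y _ => by positivity) ⟨0, left_mem_Icc.2 hT.le, ?_⟩
    have h1 := o.polu 0
    rw [h0, sin_zero, mul_zero] at h1
    have h2 := o.nz 0
    rw [h1] at h2
    have : M 0 ≠ 0 := fun h => by simp [h] at h2
    have := abs_pos.2 this
    positivity
  rw [hInt] at hpos
  exact (pos_iff_pos_of_mul_pos hpos).1 hT

lemma PK.K_le (w : Well p q W0 f F) (k : PK p q W0 f F T K) {ξ : ℝ} (hξ : ξ ∈ Ioo 0 W0) :
    K ξ ≤ W0 - ξ := by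
  obtain ⟨V, M, θ, o, h0, -, hInt⟩ := k.kinetic w hξ
  have hT := k.Tpos ξ hξ
  have : ∫ y in (0:ℝ)..(T ξ), |M y| ^ q / q ≤ ∫ y in (0:ℝ)..(T ξ), (W0 - ξ) := by
    refine integral_mono_on hT.le (((continuous_kinetic w).comp o.Mcont).intervalIntegrable _ _)
      intervalIntegrable_const fun y _ => ?_
    simpa using o.kinetic_le w one_pos y
  rw [hInt, intervalIntegral.integral_const, smul_eq_mul, sub_zero] at this
  exact le_of_mul_le_mul_left this hT

lemma PK.K_cont (w : Well p q W0 f F) (k : PK p q W0 f F T K) : ContinuousOn K (Ioo 0 W0) := by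
  rw [continuousOn_iff_continuous_domRestrict, continuous_iff_seqContinuous]
  intro xs ⟨ξ, hξ⟩ hxs
  have hq0 : 0 < q := by linarith [w.q1]
  have hx : Tendsto (fun n => (xs n : ℝ)) atTop (𝓝 ξ) := (continuous_subtype_val.tendsto _).comp hxs
  set κ := ξ / 2
  set g := (W0 - ξ) / 2
  have hκ : 0 < κ := half_pos hξ.1
  have hg : 0 < g := half_pos (sub_pos.2 hξ.2)
  obtain ⟨N, hN⟩ := eventually_atTop.1 ((hx.eventually (lt_mem_nhds (a := κ) (half_lt_self hξ.1))).and
    (hx.eventually_lt_const (u := W0 - g) (by simp only [g]; linarith [hξ.2])))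
  rw [← tendsto_add_atTop_iff_nat N]
  choose V M θ o h0 hT2 hInt using fun n => k.kinetic w (xs (n + N)).2
  have hT := k.Tpos ξ hξ
  have hMb : ∀ n y, |M n y| ^ q / q ≤ W0 := fun n y => by
    have := (o n).kinetic_le w one_pos y
    linarith [(xs (n + N)).2.1]
  obtain ⟨B, hB1, hB⟩ : ∃ B : ℝ, 1 ≤ B ∧ ∀ n y, |M n y| ≤ B := by
    refine ⟨max 1 ((q * W0) ^ (1 / q)), le_max_left _ _, fun n y => le_trans ?_ (le_max_right _ _)⟩
    rw [one_div, le_rpow_inv_iff_of_pos (abs_nonneg _) (by have := w.W0pos; positivity) hq0]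
    have := hMb n y
    rwa [div_le_iff₀ hq0, mul_comm] at this
  have hE : ∀ n y, F (V n y) - |M n y| ^ q / (q * 1) = xs (n + N) := fun n y => (o n).energy y
  obtain ⟨l1, l2⟩ := k.limit w (B := B) (amin := 1) (amax := 1) (g := g) (β := 1) (P := T ξ) hξ one_pos
    (by simp) one_pos hg (b := fun _ _ => 1) (fun n => (o n).traj 0 (T ξ))
    (.const continuousOn_const) (fun _ _ _ => ⟨le_rfl, le_rfl⟩)
    (fun n y _ => by
      have h1 : 0 < F (V n y) := by
        have h2 := hE n y
        have h3 : 0 ≤ |M n y| ^ q / (q * 1) := by positivity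
        linarith [(xs (n + N)).2.1]
      exact (w.abs_lt_one_of_pos h1).le.trans hB1)
    (fun n y _ => hB n y) (fun n y _ => by rw [hE]; exact (hN (n + N) (by omega)).2.le)
    (fun y _ => by simp only [hE]; exact hx.comp (tendsto_add_atTop_nat N))
  obtain ⟨c, hc, hsp⟩ := w.exists_angular_speed_band (amin := 1) (amax := 1) one_pos le_rfl hκ hg
  have hgap : ∀ n x y, x ≤ y → c * (y - x) ≤ θ n y - θ n x := fun n x y hxy => by
    refine mul_sub_le_of_deriv (l := x) (r := y) (fun z _ => ((o n).dθ z).hasDerivWithinAt)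
      (fun z _ => ?_) (left_mem_Icc.2 hxy) (right_mem_Icc.2 hxy) hxy
    refine hsp _ _ 1 le_rfl le_rfl ((o n).nz z) ?_ ?_ <;> rw [hE]
    · exact (hN (n + N) (by omega)).1.le
    · exact (hN (n + N) (by omega)).2.le
  have hTd : ∀ n, |T (xs (n + N)) - T ξ| ≤ |θ n (T ξ) - θ n 0 - 2 * π| / c := fun n => by
    rw [le_div_iff₀' hc, h0, sub_zero, ← hT2 n]
    rcases le_total (T ξ) (T (xs (n + N))) with h | h
    · rw [abs_of_nonneg (by linarith), abs_sub_comm]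
      exact (hgap n _ _ h).trans (le_abs_self _)
    · rw [abs_sub_comm, abs_of_nonneg (by linarith)]
      exact (hgap n _ _ h).trans (le_abs_self _)
  have hlim0 : Tendsto (fun n => |T (xs (n + N)) - T ξ|) atTop (𝓝 0) := by
    refine squeeze_zero (fun _ => abs_nonneg _) hTd ?_
    simpa using ((l1.sub_const (2 * π)).abs).div_const c
  have hTl : Tendsto (fun n => T (xs (n + N))) atTop (𝓝 (T ξ)) :=
    tendsto_iff_dist_tendsto_zero.2 hlim0
  have hTK : Tendsto (fun n => T (xs (n + N)) * K (xs (n + N))) atTop (𝓝 (T ξ * K ξ)) := by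
    have : ∀ n, T (xs (n + N)) * K (xs (n + N)) = (∫ y in (0:ℝ)..(T ξ), |M n y| ^ q / q) +
        ∫ y in (T ξ)..(T (xs (n + N))), |M n y| ^ q / q := fun n => by
      have hi : ∀ a b, IntervalIntegrable (fun y => |M n y| ^ q / q) volume a b := fun a b =>
        ((continuous_kinetic w).comp (o n).Mcont).intervalIntegrable _ _
      rw [integral_add_adjacent_intervals (hi _ _) (hi _ _), hInt]
    simp only [this]
    rw [← add_zero (T ξ * K ξ)]
    refine Tendsto.add (by simpa using l2) ?_
    refine squeeze_zero_norm (a := fun n => W0 * |T (xs (n + N)) - T ξ|) (fun n => ?_)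
      (by simpa using hlim0.const_mul W0)
    refine intervalIntegral.norm_integral_le_of_norm_le_const fun y _ => ?_
    rw [norm_of_nonneg (by positivity)]
    exact hMb n y
  have := hTK.div hTl hT.ne'
  rw [mul_div_cancel_left₀ _ hT.ne'] at this
  refine this.congr fun n => ?_
  exact mul_div_cancel_left₀ _ (k.Tpos _ (xs (n + N)).2).ne'

/-- The antiderivative of `1 / K`. -/
def Gfun (W0 : ℝ) (K : ℝ → ℝ) (ξ : ℝ) : ℝ := ∫ t in (W0 / 2)..ξ, 1 / K t

lemma PK.G_deriv (w : Well p q W0 f F) (k : PK p q W0 f F T K) {ξ : ℝ} (hξ : ξ ∈ Ioo 0 W0) :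
    HasDerivAt (Gfun W0 K) (1 / K ξ) ξ := by
  have hc : ContinuousOn (fun t => 1 / K t) (Ioo 0 W0) :=
    continuousOn_const.div (k.K_cont w) fun t ht => (k.K_pos w ht).ne'
  have hsub : uIcc (W0 / 2) ξ ⊆ Ioo 0 W0 :=
    ordConnected_Ioo.uIcc_subset ⟨by linarith [w.W0pos], by linarith [w.W0pos]⟩ hξ
  exact integral_hasDerivAt_right (hc.mono hsub).intervalIntegrable
    (hc.stronglyMeasurableAtFilter isOpen_Ioo _ hξ) (hc.continuousAt (isOpen_Ioo.mem_nhds hξ))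

lemma PK.G_gap (w : Well p q W0 f F) (k : PK p q W0 f F T K) {ξ η : ℝ} (hξ : ξ ∈ Ioo 0 W0)
    (hη : η ∈ Ioo 0 W0) (h : ξ ≤ η) : η - ξ ≤ W0 * (Gfun W0 K η - Gfun W0 K ξ) := by
  have hW := w.W0pos
  have hsub : Icc ξ η ⊆ Ioo 0 W0 := Icc_subset_Ioo hξ.1 hη.2
  have h1 := mul_sub_le_of_deriv (c := 1 / W0) (g := Gfun W0 K)
    (fun x hx => (k.G_deriv w (hsub hx)).hasDerivWithinAt) (fun x hx => ?_) (left_mem_Icc.2 h)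
    (right_mem_Icc.2 h) h
  · rwa [one_div, inv_mul_eq_div, div_le_iff₀' hW] at h1
  · have hx' := hsub (Ioo_subset_Icc_self hx)
    exact one_div_le_one_div_of_le (k.K_pos w hx') ((k.K_le w hx').trans (by linarith [hx'.1]))

lemma PK.G_strictMono (w : Well p q W0 f F) (k : PK p q W0 f F T K) :
    StrictMonoOn (Gfun W0 K) (Ioo 0 W0) := fun ξ hξ η hη h => by
  have := k.G_gap w hξ hη h.le
  have hW := w.W0pos
  by_contra! h'
  nlinarith

lemma PK.G_dist (w : Well p q W0 f F) (k : PK p q W0 f F T K) {ξ η : ℝ} (hξ : ξ ∈ Ioo 0 W0)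
    (hη : η ∈ Ioo 0 W0) : |ξ - η| ≤ W0 * |Gfun W0 K ξ - Gfun W0 K η| := by
  have hW := w.W0pos
  rcases le_total ξ η with h | h
  · rw [abs_sub_comm, abs_of_nonneg (sub_nonneg.2 h), abs_sub_comm]
    exact (k.G_gap w hξ hη h).trans (by gcongr; exact le_abs_self _)
  · rw [abs_of_nonneg (sub_nonneg.2 h)]
    exact (k.G_gap w hη hξ h).trans (by gcongr; exact le_abs_self _)

end K

/-- A well, its period and kinetic functions, and a positive weight on `[0, 1]`; `γ` is a lower
bound for the distance of the initial energies from the maximal one. -/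
structure Env where
  (p q W0 amin amax A γ : ℝ)
  (f F T K a a' : ℝ → ℝ)
  w : Well p q W0 f F
  k : PK p q W0 f F T K
  amin_pos : 0 < amin
  γ_pos : 0 < γ
  lo : ∀ x ∈ Icc (0:ℝ) 1, amin ≤ a x
  hi : ∀ x ∈ Icc (0:ℝ) 1, a x ≤ amax
  da : ∀ x ∈ Icc (0:ℝ) 1, HasDerivAt a (a' x) x
  a'cont : ContinuousOn a' (Icc 0 1)
  a'bd : ∀ x ∈ Icc (0:ℝ) 1, |a' x| ≤ A

/-- Solutions of the initial value problem, with polar angle. -/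
structure Sol (D : Env) (ε : ℝ) (u m θ : ℝ → ℝ) : Prop extends
    Traj (fun t => phip D.q t / ε) D.f (fun x => D.a x / ε) 0 1 u m θ where
  u0 : |u 0| ≤ 1
  m0 : m 0 = 0
  θ0 : θ 0 = π / 2
  e0 : en D.q D.F D.a u m 0 ≤ D.W0 - D.γ

namespace Env

variable (D : Env)

lemma q0 : 0 < D.q := by linarith [D.w.q1]
lemma a_pos {x : ℝ} (hx : x ∈ Icc (0:ℝ) 1) : 0 < D.a x := D.amin_pos.trans_le (D.lo x hx)
lemma amin_le_amax : D.amin ≤ D.amax :=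
  (D.lo 0 (by simp)).trans (D.hi 0 (by simp))
lemma amax_pos : 0 < D.amax := D.amin_pos.trans_le D.amin_le_amax
lemma A_nonneg : 0 ≤ D.A := (abs_nonneg _).trans (D.a'bd 0 (by simp))
lemma a_cont : ContinuousOn D.a (Icc 0 1) := fun x hx => (D.da x hx).continuousAt.continuousWithinAt

/-- Growth rate of `W0 - e`. -/
def rate : ℝ := D.A / D.amin
lemma rate_nonneg : 0 ≤ D.rate := div_nonneg D.A_nonneg D.amin_pos.le

/-- Uniform distance of the energy from its maximal value. -/
def gap : ℝ := D.γ * exp (-D.rate)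
lemma gap_pos : 0 < D.gap := mul_pos D.γ_pos (exp_pos _)

/-- Uniform bound for `W0 - e`. -/
def top : ℝ := D.W0 * exp D.rate
lemma top_pos : 0 < D.top := mul_pos D.w.W0pos (exp_pos _)

/-- Uniform bound for `|m|`. -/
def mB : ℝ := (D.q * D.amax * D.top) ^ (1 / D.q)

end Env

namespace Sol

variable {D : Env} {ε : ℝ} {u m θ : ℝ → ℝ}

lemma sys (S : Sol D ε u m θ) : Sys D.q D.f D.a ε 0 1 u m := S.toTraj0

lemma den (S : Sol D ε u m θ) {x : ℝ} (hx : x ∈ Icc (0:ℝ) 1) :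
    HasDerivWithinAt (en D.q D.F D.a u m) (D.a' x * |m x| ^ D.q / (D.q * D.a x ^ 2)) (Icc 0 1) x :=
  S.sys.en_deriv D.w (fun _ h => D.a_pos h) D.da hx

lemma kin_le (_S : Sol D ε u m θ) (x : ℝ) :
    |m x| ^ D.q / (D.q * D.a x) ≤ D.W0 - en D.q D.F D.a u m x := by
  have := D.w.F_le (u x)
  rw [en]; linarith

lemma den_eq {x : ℝ} (hx : x ∈ Icc (0:ℝ) 1) : D.a' x * |m x| ^ D.q / (D.q * D.a x ^ 2) =
    D.a' x / D.a x * (|m x| ^ D.q / (D.q * D.a x)) := by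
  have := D.a_pos hx
  have := D.q0
  field_simp

lemma abs_den_le (S : Sol D ε u m θ) {x : ℝ} (hx : x ∈ Icc (0:ℝ) 1) :
    |D.a' x * |m x| ^ D.q / (D.q * D.a x ^ 2)| ≤ D.rate * (D.W0 - en D.q D.F D.a u m x) := by
  have ha := D.a_pos hx
  have hq := D.q0
  have h0 : 0 ≤ |m x| ^ D.q / (D.q * D.a x) := by positivity
  rw [den_eq hx, abs_mul, abs_of_nonneg h0, abs_div, abs_of_pos ha]
  have h1 := S.kin_le x
  have h2 := D.a'bd x hx
  have h3 := D.lo x hx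
  have h4 := D.A_nonneg
  have h5 := D.amin_pos
  unfold Env.rate
  gcongr

lemma gronwall (S : Sol D ε u m θ) {x : ℝ} (hx : x ∈ Icc (0:ℝ) 1) :
    en D.q D.F D.a u m x ≤ D.W0 - D.gap ∧ D.W0 - en D.q D.F D.a u m x ≤ D.top := by
  have h := gronwall_two_sided (g := fun x => D.W0 - en D.q D.F D.a u m x) (C := D.rate)
    (fun x hx => (S.den hx).const_sub D.W0) (fun x hx => by rw [abs_neg]; exact S.abs_den_le hx)
    (left_mem_Icc.2 zero_le_one) hx hx.1
  have hr := D.rate_nonneg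
  have h0 : 0 ≤ en D.q D.F D.a u m 0 := by
    rw [en, S.m0, abs_zero, zero_rpow D.q0.ne', zero_div, sub_zero]; exact D.w.F_nonneg _
  have h1 := S.e0
  have hγ := D.γ_pos
  constructor
  · have : D.gap ≤ (D.W0 - en D.q D.F D.a u m 0) * exp (-(D.rate * (x - 0))) := by
      have h2 : D.rate * (x - 0) ≤ D.rate := by nlinarith [hx.2]
      unfold Env.gap; gcongr <;> linarith
    linarith [h.1]
  · have : (D.W0 - en D.q D.F D.a u m 0) * exp (D.rate * (x - 0)) ≤ D.top := by
      unfold Env.top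
      have := D.w.W0pos
      gcongr
      · linarith
      · nlinarith [hx.2]
    linarith [h.2]

lemma kin_le_top (S : Sol D ε u m θ) {x : ℝ} (hx : x ∈ Icc (0:ℝ) 1) :
    |m x| ^ D.q / (D.q * D.a x) ≤ D.top := (S.kin_le x).trans (S.gronwall hx).2

lemma abs_m_le (S : Sol D ε u m θ) {x : ℝ} (hx : x ∈ Icc (0:ℝ) 1) : |m x| ≤ D.mB := by
  have h1 := S.kin_le_top hx
  have ha := D.a_pos hx
  have hq := D.q0
  have ht := D.top_pos
  have hi := D.hi x hx
  rw [div_le_iff₀ (by positivity)] at h1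
  have ham := D.amax_pos
  rw [Env.mB, one_div, le_rpow_inv_iff_of_pos (abs_nonneg _) (by positivity) hq]
  refine h1.trans ?_
  rw [mul_comm, mul_assoc, mul_assoc]; gcongr

lemma e_lip (S : Sol D ε u m θ) : ∀ x ∈ Icc (0:ℝ) 1, ∀ y ∈ Icc (0:ℝ) 1,
    |en D.q D.F D.a u m x - en D.q D.F D.a u m y| ≤ D.rate * D.top * |x - y| := by
  refine lipschitz_of_deriv_bound (fun x hx => S.den hx) fun x hx => (S.abs_den_le hx).trans ?_
  have := D.rate_nonneg
  have := (S.gronwall hx).2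
  gcongr

end Sol

lemma exists_speed_bound (D : Env) : ∃ Λ, 0 < Λ ∧ ∀ ε u m θ, 0 < ε → Sol D ε u m θ →
    ∀ x ∈ Icc (0:ℝ) 1, ∀ y ∈ Icc (0:ℝ) 1, |ε * θ x - ε * θ y| ≤ Λ * |x - y| := by
  obtain ⟨c, hc, hrad⟩ := D.w.exists_radius D.amin_pos D.gap_pos
  obtain ⟨C, hC0, hC⟩ := D.w.exists_bound_f
  have hq := D.q0
  refine ⟨(D.mB ^ D.q + D.amax * C) / c + 1, ?_, fun ε u m θ hε S => ?_⟩
  · have : 0 ≤ D.mB ^ D.q := rpow_nonneg (rpow_nonneg (by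
      have := D.amax_pos; have := D.top_pos; positivity) _) _
    have := D.amax_pos
    positivity
  refine lipschitz_of_deriv_bound (fun x hx => (S.dθ x hx).const_mul ε) fun x hx => ?_
  have hn := hrad _ _ _ (D.lo x hx) (S.gronwall hx).1
  have h1 : ε * ((m x * (phip D.q (m x) / ε) - D.a x / ε * (u x * D.f (u x))) / (u x ^ 2 + m x ^ 2))
      = (|m x| ^ D.q - D.a x * (u x * D.f (u x))) / (u x ^ 2 + m x ^ 2) := by
    rw [← phip_mul_self D.w.q1]; field_simp
  rw [h1, abs_div, abs_of_pos (hc.trans_le hn)]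
  have h2 := S.abs_m_le hx
  have h3 : |u x * D.f (u x)| ≤ C := by
    by_cases h : 1 ≤ |u x|
    · rw [D.w.fout _ h]; simpa using hC0.le
    · rw [abs_mul]
      calc |u x| * |D.f (u x)| ≤ 1 * C := by gcongr; · linarith
                                             · exact hC _
        _ = C := one_mul C
  have h4 : |(|m x| ^ D.q - D.a x * (u x * D.f (u x)))| ≤ D.mB ^ D.q + D.amax * C := by
    refine (abs_sub _ _).trans ?_
    have h5 := D.hi x hx
    have h6 := D.a_pos hx
    have h8 := D.amax_pos
    rw [abs_mul, abs_of_pos h6, abs_of_nonneg (by positivity : 0 ≤ |m x| ^ D.q)]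
    gcongr
  have h7 : 0 ≤ D.mB ^ D.q + D.amax * C := (abs_nonneg _).trans h4
  have : |(|m x| ^ D.q - D.a x * (u x * D.f (u x)))| / (u x ^ 2 + m x ^ 2) ≤
      (D.mB ^ D.q + D.amax * C) / c := by gcongr
  linarith

/-- Derivative of a limit of equi-Lipschitz functions from difference quotients over shrinking
windows. -/
lemma hasDerivWithinAt_of_windows {g : ℕ → ℝ → ℝ} {G : ℝ → ℝ} {L μ x0 : ℝ}
    (hg : ContConv g G (Icc 0 1)) (hx0 : x0 ∈ Icc (0:ℝ) 1)
    (hL : ∀ n, ∀ x ∈ Icc (0:ℝ) 1, ∀ y ∈ Icc (0:ℝ) 1, |g n x - g n y| ≤ L * |x - y|)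
    (hwin : ∀ ρ, 0 < ρ → ∃ τ : ℕ → ℝ, (∀ n, 0 < τ n) ∧ Tendsto τ atTop (𝓝 0) ∧
      ∀ (ns : ℕ → ℕ) (xs : ℕ → ℝ), Tendsto ns atTop atTop → Tendsto xs atTop (𝓝 x0) →
        (∀ n, xs n ∈ Icc (0:ℝ) 1 ∧ xs n + τ (ns n) ≤ 1) →
        ∃ n, |g (ns n) (xs n + τ (ns n)) - g (ns n) (xs n) - τ (ns n) * μ| ≤ ρ * τ (ns n)) :
    HasDerivWithinAt G μ (Icc 0 1) x0 := by
  rw [hasDerivWithinAt_iff_isLittleO, isLittleO_iff]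
  intro ρ hρ
  obtain ⟨τ, hτ, hτ0, hw⟩ := hwin ρ hρ
  have hev : ∀ᶠ z : ℕ × ℝ in atTop ×ˢ 𝓝[Icc 0 1] x0, z.2 + τ z.1 ≤ 1 →
      |g z.1 (z.2 + τ z.1) - g z.1 z.2 - τ z.1 * μ| ≤ ρ * τ z.1 := by
    by_contra hcon
    rw [not_eventually] at hcon
    have hfr := hcon.and_eventually
      (tendsto_snd.eventually (eventually_mem_nhdsWithin (a := x0) (s := Icc (0:ℝ) 1)))
    obtain ⟨zs, hzs, hbad⟩ := exists_seq_forall_of_frequently hfr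
    have h1 : Tendsto (fun n => (zs n).1) atTop atTop := tendsto_fst.comp hzs
    have h2 : Tendsto (fun n => (zs n).2) atTop (𝓝 x0) :=
      (tendsto_snd.comp hzs).mono_right nhdsWithin_le_nhds
    obtain ⟨n, hn⟩ := hw _ _ h1 h2 fun n => by
      have := hbad n
      push Not at this
      exact ⟨this.2, this.1.1⟩
    exact (hbad n).1 fun _ => hn
  obtain ⟨N, δ, hδ, hev⟩ : ∃ N : ℕ, ∃ δ > 0, ∀ n ≥ N, ∀ x ∈ Icc (0:ℝ) 1, |x - x0| < δ →
      x + τ n ≤ 1 → |g n (x + τ n) - g n x - τ n * μ| ≤ ρ * τ n := by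
    obtain ⟨P, hP, Q, hQ, h⟩ := eventually_prod_iff.1 hev
    obtain ⟨N, hN⟩ := eventually_atTop.1 hP
    obtain ⟨δ, hδ, hb⟩ := Metric.mem_nhdsWithin_iff.1 hQ
    exact ⟨N, δ, hδ, fun n hn x hx hxd => h (hN n hn) (hb ⟨hxd, hx⟩)⟩
  have hL0 : 0 ≤ L := by
    have := (abs_nonneg _).trans (hL 0 0 (by simp) 1 (by simp))
    simpa using this
  have key : ∀ x ∈ Icc (0:ℝ) 1, ∀ y ∈ Icc (0:ℝ) 1, |x - x0| < δ → |y - x0| < δ → x ≤ y →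
      |G y - G x - (y - x) * μ| ≤ ρ * (y - x) := by
    intro x hx y hy hxd hyd hxy
    have hn : ∀ n ≥ N, |g n y - g n x - (y - x) * μ| ≤ ρ * (y - x) + (L + |μ|) * τ n := by
      intro n hn
      have hτn := hτ n
      set k := ⌊(y - x) / τ n⌋₊
      have hk1 : k * τ n ≤ y - x := (le_div_iff₀ hτn).1 (Nat.floor_le (by
        have : 0 ≤ y - x := by linarith
        positivity))
      have hk2 : y - x < (k + 1) * τ n := (div_lt_iff₀ hτn).1 (Nat.lt_floor_add_one _)
      have ind : ∀ j : ℕ, j ≤ k → |g n (x + j * τ n) - g n x - j * τ n * μ| ≤ ρ * (j * τ n) := by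
        intro j
        induction j with
        | zero => intro _; simp
        | succ j ih =>
          intro hj
          have h1 := ih (by omega)
          have hjk : ((j : ℝ) + 1) * τ n ≤ k * τ n := by
            gcongr; exact_mod_cast hj
          have hj0 : 0 ≤ j * τ n := by positivity
          have hmem : x + j * τ n ∈ Icc (0:ℝ) 1 := ⟨by linarith [hx.1], by nlinarith [hy.2]⟩
          have h2 := hev n hn (x + j * τ n) hmem (by
            rw [abs_lt] at hxd hyd ⊢; constructor <;> nlinarith) (by nlinarith [hy.2])
          push_cast
          rw [show x + ((j : ℝ) + 1) * τ n = x + j * τ n + τ n by ring,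
            show g n (x + j * τ n + τ n) - g n x - (↑j + 1) * τ n * μ =
              (g n (x + j * τ n + τ n) - g n (x + j * τ n) - τ n * μ) +
              (g n (x + j * τ n) - g n x - j * τ n * μ) by ring]
          refine (abs_add_le _ _).trans ?_
          linarith
      have h1 := ind k le_rfl
      have hk0 : 0 ≤ k * τ n := by positivity
      have h2 := hL n y hy (x + k * τ n) ⟨by linarith [hx.1], by linarith [hy.2]⟩
      have h3 : |y - (x + k * τ n)| ≤ τ n := by rw [abs_of_nonneg (by linarith)]; linarith
      have h4 : |(y - (x + k * τ n)) * μ| ≤ τ n * |μ| := by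
        rw [abs_mul]; gcongr
      have h5 : |g n y - g n (x + k * τ n)| ≤ L * τ n := h2.trans (by gcongr)
      rw [show g n y - g n x - (y - x) * μ = (g n y - g n (x + k * τ n)) +
        (g n (x + k * τ n) - g n x - k * τ n * μ) - (y - (x + k * τ n)) * μ by ring]
      refine (abs_sub _ _).trans ((add_le_add_left (abs_add_le _ _) _).trans ?_)
      nlinarith
    have hl : Tendsto (fun n => |g n y - g n x - (y - x) * μ|) atTop
        (𝓝 |G y - G x - (y - x) * μ|) :=
      (((hg.pointwise hy).sub (hg.pointwise hx)).sub_const _).abs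
    have hr : Tendsto (fun n => ρ * (y - x) + (L + |μ|) * τ n) atTop
        (𝓝 (ρ * (y - x) + (L + |μ|) * 0)) := (hτ0.const_mul _).const_add _
    rw [mul_zero, add_zero] at hr
    exact le_of_tendsto_of_tendsto hl hr (eventually_atTop.2 ⟨N, hn⟩)
  filter_upwards [self_mem_nhdsWithin, mem_nhdsWithin_of_mem_nhds (Metric.ball_mem_nhds x0 hδ)]
    with x hx hxd
  rw [Metric.mem_ball, dist_eq] at hxd
  simp only [norm_eq_abs, smul_eq_mul]
  rcases le_total x0 x with h | h
  · rw [abs_of_nonneg (sub_nonneg.2 h)]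
    exact key x0 hx0 x hx (by simpa using hδ) hxd h
  · have := key x hx x0 hx0 hxd (by simpa using hδ) h
    rw [abs_of_nonpos (sub_nonpos.2 h), neg_sub, ← abs_neg]
    convert this using 2
    ring

lemma ContConv.window {g : ℕ → ℝ → ℝ} {G : ℝ → ℝ} {xs ε : ℕ → ℝ} {x0 R : ℝ}
    (hg : ContConv g G (Icc 0 1)) (hx0 : x0 ∈ Icc (0:ℝ) 1) (hxs : Tendsto xs atTop (𝓝 x0))
    (hε : Tendsto ε atTop (𝓝 0)) (hmem : ∀ n, ∀ y ∈ Icc 0 R, xs n + ε n * y ∈ Icc (0:ℝ) 1) :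
    ContConv (fun n y => g n (xs n + ε n * y)) (fun _ => G x0) (Icc 0 R) := fun y hy => by
  refine Tendsto.comp (g := fun z : ℕ × ℝ => g z.1 z.2) (f := fun z : ℕ × ℝ => (z.1, xs z.1 + ε z.1 * z.2))
    (hg x0 hx0) (tendsto_fst.prodMk (tendsto_nhdsWithin_iff.2 ⟨?_, ?_⟩))
  · have h1 : Tendsto (fun z : ℕ × ℝ => z.2) (atTop ×ˢ 𝓝[Icc 0 R] y) (𝓝 y) :=
      tendsto_snd.mono_right nhdsWithin_le_nhds
    have := (hxs.comp tendsto_fst).add ((hε.comp tendsto_fst).mul h1)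
    simpa using this
  · filter_upwards [tendsto_snd.eventually (eventually_mem_nhdsWithin (a := y) (s := Icc 0 R))]
      with z hz using hmem _ _ hz

namespace Sol

variable {D : Env} {ε : ℝ} {u m θ : ℝ → ℝ}

lemma window (S : Sol D ε u m θ) (hε : 0 < ε) {x0 R : ℝ} (hl : 0 ≤ x0) (hr : x0 + ε * R ≤ 1) :
    Traj (phip D.q) D.f (fun y => D.a (x0 + ε * y)) 0 R (fun y => u (x0 + ε * y))
      (fun y => m (x0 + ε * y)) (fun y => θ (x0 + ε * y)) := by
  have hmap : MapsTo (fun y => x0 + ε * y) (Icc 0 R) (Icc 0 1) := fun y hy =>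
    ⟨by nlinarith [hy.1], by nlinarith [hy.2]⟩
  refine ⟨S.sys.rescale hε hl hr, fun y hy => S.nz _ (hmap hy), fun y hy => ?_,
    fun y hy => S.polu _ (hmap hy), fun y hy => S.polm _ (hmap hy)⟩
  have h1 : HasDerivWithinAt (fun y => x0 + ε * y) ε (Icc 0 R) y := by
    simpa using (((hasDerivAt_id y).const_mul ε).const_add x0).hasDerivWithinAt
  refine ((S.dθ _ (hmap hy)).scomp y h1 hmap).congr_deriv ?_
  simp only [smul_eq_mul]
  field_simp

lemma θ_mono (S : Sol D ε u m θ) (hε : 0 < ε) : MonotoneOn θ (Icc 0 1) := by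
  refine monotoneOn_Icc_of_deriv S.dθ fun x hx => div_nonneg ?_ (S.nz x (Ioo_subset_Icc_self hx)).le
  have h1 := D.w.mul_f_nonpos (u x)
  have h2 := D.a_pos (Ioo_subset_Icc_self hx)
  have h3 : 0 ≤ m x * (phip D.q (m x) / ε) := by
    rw [← mul_div_assoc, phip_mul_self D.w.q1]; positivity
  have h4 : D.a x / ε * (u x * D.f (u x)) ≤ 0 :=
    mul_nonpos_of_nonneg_of_nonpos (by positivity) h1
  linarith

lemma θcont (S : Sol D ε u m θ) : ContinuousOn θ (Icc 0 1) := fun x hx => (S.dθ x hx).continuousWithinAt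

end Sol

/-- A continuous angle that gains `π` passes through a zero of the cosine. -/
lemma exists_cos_zero {θ : ℝ → ℝ} {l r : ℝ} (hlr : l ≤ r) (hθ : ContinuousOn θ (Icc l r))
    (h : π ≤ θ r - θ l) : ∃ x ∈ Icc l r, cos (θ x) = 0 := by
  set n := ⌈(θ l - π / 2) / π⌉
  have h1 := Int.le_ceil ((θ l - π / 2) / π)
  have h2 := Int.ceil_lt_add_one ((θ l - π / 2) / π)
  rw [div_le_iff₀ pi_pos] at h1
  rw [← sub_lt_iff_lt_add, lt_div_iff₀ pi_pos] at h2
  obtain ⟨x, hx, hx'⟩ := intermediate_value_Icc hlr hθ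
    (show n * π + π / 2 ∈ Icc (θ l) (θ r) from ⟨by linarith, by nlinarith⟩)
  exact ⟨x, hx, by rw [hx', cos_add_pi_div_two, sin_int_mul_pi, neg_zero]⟩

lemma Traj.rotation_lt {ψ f b : ℝ → ℝ} {l r : ℝ} {u m θ : ℝ → ℝ} (t : Traj ψ f b l r u m θ)
    (hlr : l ≤ r) (hm : ∀ x ∈ Icc l r, m x ≠ 0) : θ r - θ l < π := by
  by_contra! h
  obtain ⟨x, hx, hx0⟩ := exists_cos_zero hlr (fun x hx => (t.dθ x hx).continuousWithinAt) h
  exact hm x hx (by rw [t.polm x hx, hx0, mul_zero])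

/-- Zero-energy trajectories turn by less than half a turn. -/
lemma Well.rotation_zero_energy {p q W0 : ℝ} {f F : ℝ → ℝ} (w : Well p q W0 f F) {β R : ℝ}
    (hβ : 0 < β) (hR : 0 ≤ R) {u m θ : ℝ → ℝ} (t : Traj (phip q) f (fun _ => β) 0 R u m θ)
    (he : ∀ y ∈ Icc 0 R, F (u y) - |m y| ^ q / (q * β) = 0) : θ R - θ 0 < π := by
  have hq0 : 0 < q := by linarith [w.q1]
  have hp0 : 0 < p := by linarith [w.hp]
  by_cases hm : ∀ x ∈ Icc 0 R, m x ≠ 0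
  · exact t.rotation_lt hR hm
  push Not at hm
  obtain ⟨y0, hy0, hmy⟩ := hm
  have hFu : F (u y0) = 0 := by
    have := he y0 hy0
    rwa [hmy, abs_zero, zero_rpow hq0.ne', zero_div, sub_zero] at this
  have hu1 : 1 ≤ |u y0| := by
    by_contra! h
    exact (w.F_pos h).ne' hFu
  obtain ⟨C, hC, hup⟩ := w.upper
  have hqp : (q - 1) / q = 1 / p := by
    rw [w.hq]; have : 0 < p - 1 := by linarith [w.hp]
    field_simp; ring
  set Λ := (q * β * C) ^ (1 / p)
  have hΛ : 0 ≤ Λ := by positivity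
  have hspeed : ∀ y ∈ Icc 0 R, |phip q (m y)| ≤ Λ * |u y - u y0| := by
    intro y hy
    have h1 : |m y| ^ q = q * β * F (u y) := by
      have := he y hy
      rw [sub_eq_zero, eq_div_iff (by positivity)] at this
      linarith
    have h2 : |phip q (m y)| = (q * β * F (u y)) ^ (1 / p) := by
      rw [abs_phip w.q1, ← h1, ← rpow_mul (abs_nonneg _), ← hqp, mul_div_cancel₀ _ hq0.ne']
    rw [h2]
    by_cases h : 1 ≤ |u y|
    · rw [w.Fout _ h, mul_zero, zero_rpow (by positivity)]; positivity
    · have h3 := hup (u y) (by linarith)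
      have h4 : 0 ≤ 1 - |u y| := by linarith
      have h0 := w.F_nonneg (u y)
      calc (q * β * F (u y)) ^ (1 / p) ≤ (q * β * (C * (1 - |u y|) ^ p)) ^ (1 / p) := by gcongr
        _ = Λ * (1 - |u y|) := by
          rw [← mul_assoc, mul_rpow (by positivity) (by positivity), ← rpow_mul h4,
            mul_one_div_cancel hp0.ne', rpow_one]
        _ ≤ Λ * |u y - u y0| := by
          gcongr
          have := abs_sub_abs_le_abs_sub (u y0) (u y)
          rw [abs_sub_comm] at this
          linarith
  have hconst : ∀ y ∈ Icc 0 R, u y = u y0 := by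
    intro y hy
    have hgr := fun {x y} hx hy hxy => gronwall_two_sided (g := fun x => (u x - u y0) ^ 2)
      (C := 2 * Λ) (l := 0) (r := R)
      (fun x hx => (((t.du x hx).sub_const (u y0)).pow 2)) (fun x hx => ?_) (x := x) (y := y) hx hy hxy
    · have hsq : (u y - u y0) ^ 2 ≤ 0 := by
        rcases le_total y y0 with h | h
        · have := (hgr hy hy0 h).1
          simp only [sub_self, ne_eq, OfNat.ofNat_ne_zero, not_false_eq_true, zero_pow] at this
          exact nonpos_of_mul_nonpos_left this (exp_pos _)
        · have := (hgr hy0 hy h).2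
          simpa using this
      exact sub_eq_zero.1 (pow_eq_zero_iff two_ne_zero |>.1 (le_antisymm hsq (sq_nonneg _)))
    · have := hspeed x hx
      simp only [Nat.cast_ofNat, Nat.add_one_sub_one, pow_one, abs_mul, abs_two]
      rw [← sq_abs (u x - u y0)]
      nlinarith [abs_nonneg (u x - u y0)]
  have hzero : ∀ y ∈ Icc 0 R, phip q (m y) = 0 := fun y hy => by
    have := hspeed y hy
    rw [hconst y hy, sub_self, abs_zero, mul_zero] at this
    exact abs_nonpos_iff.1 this
  have : θ R = θ 0 := by
    refine const_of_deriv_zero t.dθ (fun x hx => ?_) (right_mem_Icc.2 hR) (left_mem_Icc.2 hR)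
    have hx' := Ioo_subset_Icc_self hx
    rw [hzero x hx', hconst x hx', w.fout _ hu1]
    simp
  rw [this, sub_self]; exact pi_pos

section windows

variable {D : Env} {ε : ℕ → ℝ} {u m θ : ℕ → ℝ → ℝ} {E : ℝ → ℝ} {xs : ℕ → ℝ} {x0 : ℝ}

lemma window_mem {ε x y R : ℝ} (hε : 0 < ε) (hx : 0 ≤ x) (hxR : x + ε * R ≤ 1)
    (hy : y ∈ Icc 0 R) : x + ε * y ∈ Icc (0:ℝ) 1 :=
  ⟨by nlinarith [hy.1], by nlinarith [hy.2]⟩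

/-- Behaviour over one period at positive limiting energy. -/
lemma window_pos (hε : ∀ n, 0 < ε n) (hε0 : Tendsto ε atTop (𝓝 0))
    (S : ∀ n, Sol D (ε n) (u n) (m n) (θ n))
    (hE : ContConv (fun n => en D.q D.F D.a (u n) (m n)) E (Icc 0 1)) (hx0 : x0 ∈ Icc (0:ℝ) 1)
    (hpos : 0 < E x0) {P : ℝ} (hP : P = D.T (E x0) / D.a x0 ^ (1 / D.p))
    (hxs : Tendsto xs atTop (𝓝 x0)) (hx : ∀ n, xs n ∈ Icc (0:ℝ) 1 ∧ xs n + ε n * P ≤ 1) :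
    Tendsto (fun n => θ n (xs n + ε n * P) - θ n (xs n)) atTop (𝓝 (2 * π)) ∧
    Tendsto (fun n => (en D.q D.F D.a (u n) (m n) (xs n + ε n * P) -
      en D.q D.F D.a (u n) (m n) (xs n)) / ε n) atTop
      (𝓝 (D.a' x0 / D.a x0 * D.K (E x0) * P)) := by
  have hq := D.q0
  have hEW : E x0 ≤ D.W0 - D.gap := le_of_tendsto' (hE.pointwise hx0) fun n => ((S n).gronwall hx0).1
  have hξ : E x0 ∈ Ioo 0 D.W0 := ⟨hpos, by linarith [D.gap_pos]⟩
  have ha0 := D.a_pos hx0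
  have hP0 : 0 < P := by rw [hP]; exact div_pos (D.k.Tpos _ hξ) (by positivity)
  have hmem : ∀ n, ∀ y ∈ Icc 0 P, xs n + ε n * y ∈ Icc (0:ℝ) 1 := fun n y hy =>
    window_mem (hε n) (hx n).1.1 (hx n).2 hy
  have hew := hE.window hx0 hxs hε0 hmem
  have haw := (ContConv.const D.a_cont).window hx0 hxs hε0 hmem
  obtain ⟨N, hN⟩ := eventually_atTop.1 (hew.eventually_forall isCompact_Icc isOpen_Ioi
    (U := Ioi 0) fun _ _ => hpos)
  have hu1 : ∀ n ≥ N, ∀ y ∈ Icc 0 P, |u n (xs n + ε n * y)| ≤ 1 := fun n hn y hy => by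
    have h1 : 0 < en D.q D.F D.a (u n) (m n) (xs n + ε n * y) := hN n hn y hy
    have h2 : 0 ≤ |m n (xs n + ε n * y)| ^ D.q / (D.q * D.a (xs n + ε n * y)) := by
      have := D.a_pos (hmem n y hy); positivity
    rw [en] at h1
    exact (D.w.abs_lt_one_of_pos (by linarith)).le
  have hsh := tendsto_add_atTop_nat N
  obtain ⟨l1, l2⟩ := D.k.limit D.w (B := max 1 D.mB) (amin := D.amin) (amax := D.amax) (g := D.gap) hξ
    ha0 hP D.amin_pos D.gap_pos
    (fun n => (S (n + N)).window (hε (n + N)) (hx (n + N)).1.1 (hx (n + N)).2)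
    (haw.subseq hsh)
    (fun n y hy => ⟨D.lo _ (hmem _ y hy), D.hi _ (hmem _ y hy)⟩)
    (fun n y hy => (hu1 _ (by omega) y hy).trans (le_max_left _ _))
    (fun n y hy => ((S _).abs_m_le (hmem _ y hy)).trans (le_max_right _ _))
    (fun n y hy => ((S _).gronwall (hmem _ y hy)).1)
    (fun y hy => (hew.subseq hsh).pointwise hy)
  constructor
  · rw [← tendsto_add_atTop_iff_nat N]
    simpa using l1
  rw [← tendsto_add_atTop_iff_nat N]
  set γ := D.a' x0 / D.a x0 ^ 2
  have hγw : ContConv (fun n y => D.a' (xs n + ε n * y) / D.a (xs n + ε n * y) ^ 2) (fun _ => γ)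
      (Icc 0 P) := (ContConv.const (G := fun x => D.a' x / D.a x ^ 2)
      (D.a'cont.div (D.a_cont.pow 2) fun x hx => (pow_pos (D.a_pos hx) 2).ne')).window
      hx0 hxs hε0 hmem
  have hlim : Tendsto (fun n => γ * ∫ y in (0:ℝ)..P, |m (n + N) (xs (n + N) + ε (n + N) * y)| ^ D.q / D.q)
      atTop (𝓝 (D.a' x0 / D.a x0 * D.K (E x0) * P)) := by
    convert l2.const_mul γ using 2
    simp only [γ]; field_simp
  have hdiff : Tendsto (fun n => (en D.q D.F D.a (u n) (m n) (xs n + ε n * P) -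
      en D.q D.F D.a (u n) (m n) (xs n)) / ε n -
      γ * ∫ y in (0:ℝ)..P, |m n (xs n + ε n * y)| ^ D.q / D.q) atTop (𝓝 0) := by
    rw [Metric.tendsto_atTop]
    intro ρ hρ
    set Z := D.mB ^ D.q / D.q + 1
    have hmB : 0 ≤ D.mB := (abs_nonneg _).trans ((S 0).abs_m_le hx0)
    have hZ : 0 < Z := by positivity
    obtain ⟨N', hN'⟩ := eventually_atTop.1 (hγw.eventually_forall isCompact_Icc
      (Metric.isOpen_ball (x := γ) (ε := ρ / (2 * Z * P)))
      fun _ _ => Metric.mem_ball_self (by positivity))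
    refine ⟨N', fun n hn => ?_⟩
    have hεn := hε n
    have t := (S n).window hεn (hx n).1.1 (hx n).2
    have hc : ContinuousOn (fun y => |m n (xs n + ε n * y)| ^ D.q / D.q) (Icc 0 P) :=
      (continuous_kinetic D.w).comp_continuousOn t.mcont
    have hI : ∀ y ∈ Icc 0 P, HasDerivWithinAt (fun y => ∫ s in (0:ℝ)..y,
        |m n (xs n + ε n * s)| ^ D.q / D.q) (|m n (xs n + ε n * y)| ^ D.q / D.q) (Icc 0 P) y := by
      intro y hy
      have : Fact (y ∈ Icc 0 P) := ⟨hy⟩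
      refine integral_hasDerivWithinAt_right ?_
        (hc.stronglyMeasurableAtFilter_nhdsWithin measurableSet_Icc y) (hc y hy)
      exact ((hc.mono (Icc_subset_Icc_right hy.2)).intervalIntegrable_of_Icc hy.1)
    have hd : ∀ y ∈ Icc 0 P, HasDerivWithinAt
        (fun y => en D.q D.F D.a (u n) (m n) (xs n + ε n * y) / ε n) (D.a' (xs n + ε n * y) *
        |m n (xs n + ε n * y)| ^ D.q / (D.q * D.a (xs n + ε n * y) ^ 2)) (Icc 0 P) y := by
      intro y hy
      have h1 : HasDerivWithinAt (fun y => xs n + ε n * y) (ε n) (Icc 0 P) y := by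
        simpa using (((hasDerivAt_id y).const_mul (ε n)).const_add (xs n)).hasDerivWithinAt
      refine ((((S n).den (hmem n y hy)).scomp y h1 (fun z hz => hmem n z hz)).div_const _).congr_deriv ?_
      simp only [smul_eq_mul]; field_simp
    have hb := lipschitz_of_deriv_bound (B := ρ / (2 * P))
      (fun y hy => (hd y hy).sub ((hI y hy).const_mul γ)) (fun y hy => ?_)
      P (right_mem_Icc.2 hP0.le) 0 (left_mem_Icc.2 hP0.le)
    · simp only [Pi.sub_apply, mul_zero, add_zero, integral_same, sub_zero] at hb
      rw [dist_eq, sub_zero]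
      rw [abs_of_pos hP0, show ρ / (2 * P) * P = ρ / 2 by field_simp] at hb
      refine lt_of_le_of_lt (le_of_eq_of_le ?_ hb) (half_lt_self hρ)
      congr 1; ring
    · have h1 := hN' n hn y hy
      rw [Metric.mem_ball, dist_eq] at h1
      have h2 := (S n).abs_m_le (hmem n y hy)
      have ha := D.a_pos (hmem n y hy)
      have h3 : |m n (xs n + ε n * y)| ^ D.q / D.q ≤ Z := by
        have : |m n (xs n + ε n * y)| ^ D.q / D.q ≤ D.mB ^ D.q / D.q := by gcongr
        simp only [Z]; linarith
      have h4 : D.a' (xs n + ε n * y) * |m n (xs n + ε n * y)| ^ D.q /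
          (D.q * D.a (xs n + ε n * y) ^ 2) - γ * (|m n (xs n + ε n * y)| ^ D.q / D.q) =
          (D.a' (xs n + ε n * y) / D.a (xs n + ε n * y) ^ 2 - γ) *
          (|m n (xs n + ε n * y)| ^ D.q / D.q) := by field_simp
      rw [h4, abs_mul, abs_of_nonneg (by positivity : 0 ≤ |m n (xs n + ε n * y)| ^ D.q / D.q)]
      calc _ ≤ ρ / (2 * Z * P) * Z := by gcongr
        _ = ρ / (2 * P) := by field_simp
  have := (hdiff.comp hsh).add hlim
  rw [zero_add] at this
  refine this.congr fun n => ?_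
  simp

/-- Behaviour over a long window at vanishing limiting energy. -/
lemma window_zero (hε : ∀ n, 0 < ε n) (hε0 : Tendsto ε atTop (𝓝 0))
    (S : ∀ n, Sol D (ε n) (u n) (m n) (θ n))
    (hE : ContConv (fun n => en D.q D.F D.a (u n) (m n)) E (Icc 0 1)) (hx0 : x0 ∈ Icc (0:ℝ) 1)
    (hz : E x0 = 0) {R : ℝ} (hR : 0 ≤ R)
    (hxs : Tendsto xs atTop (𝓝 x0)) (hx : ∀ n, xs n ∈ Icc (0:ℝ) 1 ∧ xs n + ε n * R ≤ 1) :
    ∃ n, θ n (xs n + ε n * R) - θ n (xs n) < π := by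
  have hmem : ∀ n, ∀ y ∈ Icc 0 R, xs n + ε n * y ∈ Icc (0:ℝ) 1 := fun n y hy =>
    window_mem (hε n) (hx n).1.1 (hx n).2 hy
  have t := fun n => (S n).window (hε n) (hx n).1.1 (hx n).2
  by_cases hex : ∃ n, 1 < |u n (xs n)|
  · obtain ⟨n, hn⟩ := hex
    refine ⟨n, ?_⟩
    have h1 := (S n).sys.after_exit D.w (hε n) (hx n).1 (S n).u0 hn
    have := (t n).rotation_lt hR fun y hy h => by
      have := (h1 (xs n + ε n * y) ⟨by nlinarith [hy.1, hε n], (hmem n y hy).2⟩).2.2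
      rw [h, mul_zero] at this
      exact this.false
    simpa using this
  push Not at hex
  have hew := hE.window hx0 hxs hε0 hmem
  have haw := (ContConv.const D.a_cont).window hx0 hxs hε0 hmem
  rw [hz] at hew
  obtain ⟨C, hC⟩ := (isCompact_Icc (a := -D.mB) (b := D.mB)).exists_bound_of_continuousOn
    (continuous_phip D.w.q1).continuousOn
  obtain ⟨φ, hφ, U, N, Θ, -, -, hΘ, t', he⟩ := D.w.blowup (B := max (1 + C * R) D.mB)
    (amin := D.amin) (amax := D.amax) (g := D.gap) hR D.amin_pos D.gap_pos t haw
    (fun n y hy => ⟨D.lo _ (hmem _ y hy), D.hi _ (hmem _ y hy)⟩)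
    (fun n y hy => by
      refine le_trans ?_ (le_max_left _ _)
      have h1 := lipschitz_of_deriv_bound (t n).du
        (fun y hy => hC _ (abs_le.1 ((S n).abs_m_le (hmem n y hy)))) y hy 0 (left_mem_Icc.2 hR)
      simp only [mul_zero, add_zero, sub_zero] at h1
      have hC0 : 0 ≤ C := (norm_nonneg _).trans (hC _ (abs_le.1 ((S n).abs_m_le (hmem n y hy))))
      have h2 : C * |y| ≤ C * R := by gcongr; rw [abs_of_nonneg hy.1]; exact hy.2
      have h3 := abs_sub_abs_le_abs_sub (u n (xs n + ε n * y)) (u n (xs n))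
      linarith [hex n])
    (fun n y hy => ((S _).abs_m_le (hmem _ y hy)).trans (le_max_right _ _))
    (fun n y hy => ((S _).gronwall (hmem _ y hy)).1)
    (fun y hy => hew.pointwise hy)
  have hlt := D.w.rotation_zero_energy (D.a_pos hx0) hR t' he
  obtain ⟨n, hn⟩ := ((hΘ R (right_mem_Icc.2 hR)).eventually (gt_mem_nhds hlt)).exists
  exact ⟨φ n, by simpa using hn⟩

end windows

section limits

variable {D : Env} {ε : ℕ → ℝ} {u m θ : ℕ → ℝ → ℝ} {E : ℝ → ℝ}

/-- With energy at most `-κ` on an interval that is long compared to `ε`, the state leaves the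
well. -/
lemma Sol.exit_of_neg {D : Env} {ε : ℝ} {u m θ : ℝ → ℝ} (S : Sol D ε u m θ) (hε : 0 < ε)
    {x y m0 : ℝ} (hx : 0 ≤ x) (hy : y ≤ 1) (hm0 : 0 < m0)
    (hxy : y - x = 3 * ε / phip D.q m0) (hm : ∀ t ∈ Icc x y, m0 ≤ |m t|) : 1 < |u y| := by
  have hψ : 0 < phip D.q m0 := phip_pos hm0
  have hle : x ≤ y := by
    have : 0 < 3 * ε / phip D.q m0 := by positivity
    linarith
  have hxm : x ∈ Icc (0:ℝ) 1 := ⟨hx, by linarith⟩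
  have t := S.toTraj0.mono hx hy
  by_contra! huy
  have hux : |u x| ≤ 1 := by
    by_contra! h
    have := (S.sys.after_exit D.w hε hxm S.u0 h y ⟨hle, hy⟩).2.1
    linarith
  rw [abs_le] at hux huy
  have key : phip D.q m0 / ε * (y - x) = 3 := by rw [hxy]; field_simp
  have hne : ∀ t ∈ Icc x y, m t ≠ 0 := fun t ht h => by
    have := hm t ht; rw [h, abs_zero] at this; linarith
  have hmonoψ := (phip_strictMono D.w.q1).monotone
  rcases lt_or_gt_of_ne (hne x (left_mem_Icc.2 hle)) with h | h
  · have hneg : ∀ t ∈ Icc x y, 0 < -m t := fun t' ht => pos_of_ne_zero_on (g := fun t => -m t)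
      t.mcont.neg (by simpa using h) (fun t ht => neg_ne_zero.2 (hne t ht)) ht
    have := mul_sub_le_of_deriv (c := phip D.q m0 / ε) (fun t' ht => (t.du t' ht).neg)
      (fun t' ht => ?_) (left_mem_Icc.2 hle) (right_mem_Icc.2 hle) hle
    · simp only [Pi.neg_apply] at this
      linarith
    · have h1 := hm t' (Ioo_subset_Icc_self ht)
      rw [abs_of_neg (by linarith [hneg t' (Ioo_subset_Icc_self ht)])] at h1
      rw [← neg_div, ← phip_neg]
      exact div_le_div_of_nonneg_right (hmonoψ h1) hε.le
  · have hpos : ∀ t ∈ Icc x y, 0 < m t := fun t' ht => pos_of_ne_zero_on t.mcont h hne ht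
    have := mul_sub_le_of_deriv (c := phip D.q m0 / ε) t.du
      (fun t' ht => ?_) (left_mem_Icc.2 hle) (right_mem_Icc.2 hle) hle
    · linarith
    · have h1 := hm t' (Ioo_subset_Icc_self ht)
      rw [abs_of_pos (hpos t' (Ioo_subset_Icc_self ht))] at h1
      exact div_le_div_of_nonneg_right (hmonoψ h1) hε.le

/-- Where the limiting energy is negative, `a e` is constant. -/
lemma limit_const_of_neg (hε : ∀ n, 0 < ε n) (hε0 : Tendsto ε atTop (𝓝 0))
    (S : ∀ n, Sol D (ε n) (u n) (m n) (θ n))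
    (hE : ContConv (fun n => en D.q D.F D.a (u n) (m n)) E (Icc 0 1)) {x y : ℝ} (hx : 0 ≤ x)
    (hxy : x < y) (hy : y ≤ 1) (hneg : ∀ t ∈ Icc x y, E t < 0) : D.a x * E x = D.a y * E y := by
  have hq := D.q0
  have hsub : Icc x y ⊆ Icc 0 1 := Icc_subset_Icc hx hy
  have hxm : x ∈ Icc (0:ℝ) 1 := hsub (left_mem_Icc.2 hxy.le)
  have hym : y ∈ Icc (0:ℝ) 1 := hsub (right_mem_Icc.2 hxy.le)
  obtain ⟨x2, hx2, hmax⟩ := isCompact_Icc.exists_isMaxOn (nonempty_Icc.2 hxy.le)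
    (hE.continuousOn.mono hsub)
  set κ := -(E x2) / 2
  have hκ : 0 < κ := by have := hneg x2 hx2; simp only [κ]; linarith
  have hev := (hE.mono hsub).eventually_forall isCompact_Icc isOpen_Iio (U := Iio (-κ))
    fun t ht => show E t < -κ from (hmax ht).trans_lt (by have := hneg x2 hx2; simp only [κ]; linarith)
  set m0 := (D.q * D.amin * κ) ^ (1 / D.q)
  have hqa : 0 < D.q * D.amin * κ := by have := D.amin_pos; positivity
  have hm0 : 0 < m0 := rpow_pos_of_pos hqa _
  set ψ0 := phip D.q m0
  have hψ0 : 0 < ψ0 := phip_pos hm0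
  have hh : Tendsto (fun n => x + 3 * ε n / ψ0) atTop (𝓝 x) := by
    simpa using ((hε0.const_mul 3).div_const ψ0).const_add x
  have hev2 := hh.eventually_lt_const hxy
  have hexit : ∀ᶠ n in atTop, D.a (min (x + 3 * ε n / ψ0) y) *
      en D.q D.F D.a (u n) (m n) (min (x + 3 * ε n / ψ0) y) =
      D.a y * en D.q D.F D.a (u n) (m n) y := by
    filter_upwards [hev, hev2] with n hn hn2
    rw [min_eq_left hn2.le]
    have hεn := hε n
    have hpos : 0 < 3 * ε n / ψ0 := by positivity
    have hm : ∀ t ∈ Icc x y, m0 ≤ |m n t| := fun t ht => by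
      have h1 : en D.q D.F D.a (u n) (m n) t < -κ := hn t ht
      have h2 := D.w.F_nonneg (u n t)
      have ha := D.a_pos (hsub ht)
      rw [en] at h1
      have h3 : κ ≤ |m n t| ^ D.q / (D.q * D.a t) := by linarith
      rw [le_div_iff₀ (by positivity)] at h3
      simp only [m0]
      rw [one_div, rpow_inv_le_iff_of_pos hqa.le (abs_nonneg _) hq]
      refine le_trans ?_ h3
      have := D.lo t (hsub ht)
      rw [mul_comm κ]; gcongr
    set x' := x + 3 * ε n / ψ0
    have hx'm : x' ∈ Icc (0:ℝ) 1 := ⟨by linarith, by linarith⟩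
    have hex := (S n).exit_of_neg hεn hx hx'm.2 hm0 (by simp only [x', ψ0]; ring)
      (fun t ht => hm t ⟨ht.1, ht.2.trans hn2.le⟩)
    have haf := (S n).sys.after_exit D.w hεn hx'm (S n).u0 hex
    have hval : ∀ t ∈ Icc x' 1, D.a t * en D.q D.F D.a (u n) (m n) t = -(|m n x'| ^ D.q / D.q) := by
      intro t ht
      obtain ⟨h1, h2, -⟩ := haf t ht
      have ha := D.a_pos (show t ∈ Icc (0:ℝ) 1 from ⟨by linarith [ht.1, hx'm.1], ht.2⟩)
      rw [en, D.w.Fout _ (by linarith), h1]; field_simp; ring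
    rw [hval x' ⟨le_rfl, hx'm.2⟩, hval y ⟨hn2.le, hy⟩]
  have hmin : Tendsto (fun n => min (x + 3 * ε n / ψ0) y) atTop (𝓝 x) := by
    have := hh.min (tendsto_const_nhds (x := y))
    rwa [min_eq_left hxy.le] at this
  have hminm : ∀ n, min (x + 3 * ε n / ψ0) y ∈ Icc (0:ℝ) 1 := fun n => by
    have hpos : 0 < 3 * ε n / ψ0 := by have := hε n; positivity
    exact ⟨le_min (by linarith) (by linarith), (min_le_right _ _).trans hy⟩
  refine tendsto_nhds_unique_of_eventuallyEq (((ContConv.const D.a_cont).seq hxm hminm hmin).mul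
    (hE.seq hxm hminm hmin)) (tendsto_const_nhds.mul (hE.pointwise hym)) hexit

lemma limit_nonneg (hε : ∀ n, 0 < ε n) (hε0 : Tendsto ε atTop (𝓝 0))
    (S : ∀ n, Sol D (ε n) (u n) (m n) (θ n))
    (hE : ContConv (fun n => en D.q D.F D.a (u n) (m n)) E (Icc 0 1)) {x0 : ℝ}
    (hx0 : x0 ∈ Icc (0:ℝ) 1) : 0 ≤ E x0 := by
  by_contra! hneg
  have h00 : (0:ℝ) ∈ Icc (0:ℝ) 1 := by simp
  have hE0 : 0 ≤ E 0 := ge_of_tendsto' (hE.pointwise h00) fun n => by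
    rw [en, (S n).m0, abs_zero, zero_rpow D.q0.ne', zero_div, sub_zero]; exact D.w.F_nonneg _
  have hsub : Icc 0 x0 ⊆ Icc (0:ℝ) 1 := Icc_subset_Icc_right hx0.2
  have hcl : IsCompact (Icc 0 x0 ∩ E ⁻¹' Ici 0) :=
    isCompact_Icc.of_isClosed_subset
      ((hE.continuousOn.mono hsub).preimage_isClosed_of_isClosed isClosed_Icc isClosed_Ici)
      inter_subset_left
  obtain ⟨x1, ⟨hx1, hE1⟩, hgr⟩ := hcl.exists_isGreatest ⟨0, left_mem_Icc.2 hx0.1, hE0⟩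
  have hx1m := hsub hx1
  have hlt : x1 < x0 := lt_of_le_of_ne hx1.2 fun h => by rw [h] at hE1; exact absurd hE1 (not_le.2 hneg)
  have hc : ∀ x ∈ Ioo x1 x0, D.a x * E x = D.a x0 * E x0 := fun x hx =>
    limit_const_of_neg hε hε0 S hE (hx1.1.trans hx.1.le) hx.2 hx0.2 fun t ht => by
      by_contra! h
      have := hgr ⟨⟨hx1.1.trans (hx.1.le.trans ht.1), ht.2⟩, h⟩
      linarith [hx.1, ht.1]
  have hcl2 : ContinuousOn (fun x => D.a x * E x) (Icc x1 x0) :=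
    (D.a_cont.mul hE.continuousOn).mono (Icc_subset_Icc hx1.1 hx0.2)
  have hlim : D.a x1 * E x1 = D.a x0 * E x0 := by
    have h1 : Tendsto (fun x => D.a x * E x) (𝓝[Ioo x1 x0] x1) (𝓝 (D.a x1 * E x1)) :=
      (hcl2 x1 (left_mem_Icc.2 hlt.le)).mono Ioo_subset_Icc_self
    have : (𝓝[Ioo x1 x0] x1).NeBot := left_nhdsWithin_Ioo_neBot hlt
    exact tendsto_nhds_unique_of_eventuallyEq h1 tendsto_const_nhds
      (eventually_mem_nhdsWithin.mono hc)
  have h1 : 0 ≤ D.a x1 * E x1 := mul_nonneg (D.a_pos hx1m).le hE1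
  have h2 := mul_neg_of_pos_of_neg (D.a_pos hx0) hneg
  linarith

end limits

/-- Solutions of the limit equation, below the maximal energy. -/
structure Prof (D : Env) (E : ℝ → ℝ) : Prop where
  cont : ContinuousOn E (Icc 0 1)
  nonneg : ∀ x ∈ Icc (0:ℝ) 1, 0 ≤ E x
  lt : ∀ x ∈ Icc (0:ℝ) 1, E x < D.W0
  dE : ∀ x ∈ Icc (0:ℝ) 1, 0 < E x →
    HasDerivWithinAt E (D.a' x / D.a x * D.K (E x)) (Icc 0 1) x

/-- Limits of the energies and of the rescaled angles. -/
structure Lim (D : Env) (E Θ : ℝ → ℝ) : Prop extends Prof D E where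
  dΘ : ∀ x ∈ Icc (0:ℝ) 1, 0 < E x →
    HasDerivWithinAt Θ (2 * π * D.a x ^ (1 / D.p) / D.T (E x)) (Icc 0 1) x
  dΘ0 : ∀ x ∈ Icc (0:ℝ) 1, E x = 0 → HasDerivWithinAt Θ 0 (Icc 0 1) x

lemma exists_limit {D : Env} {ε : ℕ → ℝ} {u m θ : ℕ → ℝ → ℝ}
    (hε : ∀ n, 0 < ε n) (hε1 : ∀ n, ε n ≤ 1) (hε0 : Tendsto ε atTop (𝓝 0))
    (S : ∀ n, Sol D (ε n) (u n) (m n) (θ n)) :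
    ∃ φ : ℕ → ℕ, StrictMono φ ∧ ∃ E Θ,
      ContConv (fun n => en D.q D.F D.a (u (φ n)) (m (φ n))) E (Icc 0 1) ∧
      ContConv (fun n x => ε (φ n) * θ (φ n) x) Θ (Icc 0 1) ∧ Lim D E Θ := by
  obtain ⟨φ1, hφ1, E, hE, -⟩ := exists_subseq_contConv
    (fun n => en D.q D.F D.a (u n) (m n)) (M := D.W0 + D.top) (fun n => (S n).e_lip) fun n x hx => by
      have h1 := (S n).gronwall hx
      have := D.gap_pos
      have := D.top_pos
      have := D.w.W0pos
      rw [abs_le]; constructor <;> linarith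
  obtain ⟨Λ, hΛ0, hΛ⟩ := exists_speed_bound D
  obtain ⟨φ2, hφ2, Θ, hΘ, -⟩ := exists_subseq_contConv
    (fun n x => ε (φ1 n) * θ (φ1 n) x) (M := Λ + π / 2) (fun n => hΛ _ _ _ _ (hε _) (S (φ1 n)))
    fun n x hx => by
      have h1 := hΛ _ _ _ _ (hε _) (S (φ1 n)) x hx 0 (by simp)
      have h2 : |x - 0| ≤ 1 := by rw [sub_zero, abs_of_nonneg hx.1]; exact hx.2
      have h3 := abs_sub_abs_le_abs_sub (ε (φ1 n) * θ (φ1 n) x) (ε (φ1 n) * θ (φ1 n) 0)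
      have h4 : |ε (φ1 n) * θ (φ1 n) 0| ≤ π / 2 := by
        rw [(S _).θ0, abs_of_nonneg (by have := hε (φ1 n); have := pi_pos; positivity)]
        nlinarith [hε1 (φ1 n), pi_pos]
      nlinarith
  obtain ⟨φ, hφφ⟩ : ∃ φ, φ = φ1 ∘ φ2 := ⟨_, rfl⟩
  have hφ : StrictMono φ := hφφ ▸ hφ1.comp hφ2
  have hE' : ContConv (fun n => en D.q D.F D.a (u (φ n)) (m (φ n))) E (Icc 0 1) := by
    subst hφφ; exact hE.subseq hφ2.tendsto_atTop
  replace hΘ : ContConv (fun n x => ε (φ n) * θ (φ n) x) Θ (Icc 0 1) := by subst hφφ; exact hΘ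
  have hεφ : Tendsto (fun n => ε (φ n)) atTop (𝓝 0) := hε0.comp hφ.tendsto_atTop
  have hS := fun n => S (φ n)
  have hlt : ∀ x ∈ Icc (0:ℝ) 1, E x < D.W0 := fun x hx => by
    have : E x ≤ D.W0 - D.gap := le_of_tendsto' (hE'.pointwise hx) fun n => ((hS n).gronwall hx).1
    linarith [D.gap_pos]
  refine ⟨φ, hφ, E, Θ, hE', hΘ, ⟨hE'.continuousOn, fun x hx => limit_nonneg (fun n => hε _) hεφ hS hE' hx,
    hlt, fun x0 hx0 hpos => ?_⟩, fun x0 hx0 hpos => ?_, fun x0 hx0 hz => ?_⟩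
  · set P := D.T (E x0) / D.a x0 ^ (1 / D.p) with hP
    have hP0 : 0 < P := div_pos (D.k.Tpos _ ⟨hpos, hlt x0 hx0⟩) (rpow_pos_of_pos (D.a_pos hx0) _)
    refine hasDerivWithinAt_of_windows hE' hx0 (fun n => (hS n).e_lip) fun ρ hρ =>
      ⟨fun n => ε (φ n) * P, fun n => mul_pos (hε _) hP0, by simpa using hεφ.mul_const P,
        fun ns xs hns hxs hmem => ?_⟩
    have := (window_pos (fun n => hε (φ (ns n))) (hεφ.comp hns) (fun n => hS (ns n)) (hE'.subseq hns)
      hx0 hpos hP hxs hmem).2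
    obtain ⟨n, hn⟩ := (this.eventually (Metric.ball_mem_nhds _ (mul_pos hρ hP0))).exists
    refine ⟨n, ?_⟩
    have hεn := hε (φ (ns n))
    rw [Real.dist_eq] at hn
    have h1 := mul_le_mul_of_nonneg_left hn.le hεn.le
    rw [← abs_of_pos hεn, ← abs_mul, abs_of_pos hεn, mul_sub, mul_div_cancel₀ _ hεn.ne'] at h1
    beta_reduce
    rw [mul_left_comm ρ]
    refine le_of_eq_of_le ?_ h1
    congr 1; ring
  · set P := D.T (E x0) / D.a x0 ^ (1 / D.p) with hP
    have hT0 := D.k.Tpos _ ⟨hpos, hlt x0 hx0⟩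
    have hap := rpow_pos_of_pos (D.a_pos hx0) (1 / D.p)
    have hP0 : 0 < P := div_pos hT0 hap
    refine hasDerivWithinAt_of_windows hΘ hx0 (fun n => hΛ _ _ _ _ (hε _) (hS n)) fun ρ hρ =>
      ⟨fun n => ε (φ n) * P, fun n => mul_pos (hε _) hP0, by simpa using hεφ.mul_const P,
        fun ns xs hns hxs hmem => ?_⟩
    have := (window_pos (fun n => hε (φ (ns n))) (hεφ.comp hns) (fun n => hS (ns n)) (hE'.subseq hns)
      hx0 hpos hP hxs hmem).1
    obtain ⟨n, hn⟩ := (this.eventually (Metric.ball_mem_nhds _ (mul_pos hρ hP0))).exists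
    refine ⟨n, ?_⟩
    have hεn := hε (φ (ns n))
    rw [Real.dist_eq] at hn
    have h1 := mul_le_mul_of_nonneg_left hn.le hεn.le
    rw [← abs_of_pos hεn, ← abs_mul, abs_of_pos hεn] at h1
    beta_reduce
    rw [mul_left_comm ρ]
    refine le_of_eq_of_le ?_ h1
    congr 1
    have : ε (φ (ns n)) * P * (2 * π * D.a x0 ^ (1 / D.p) / D.T (E x0)) = ε (φ (ns n)) * (2 * π) := by
      rw [hP]; field_simp
    rw [this]; ring
  · refine hasDerivWithinAt_of_windows hΘ hx0 (fun n => hΛ _ _ _ _ (hε _) (hS n)) fun ρ hρ =>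
      ⟨fun n => ε (φ n) * (π / ρ), fun n => mul_pos (hε _) (by positivity),
        by simpa using hεφ.mul_const (π / ρ), fun ns xs hns hxs hmem => ?_⟩
    obtain ⟨n, hn⟩ := window_zero (fun n => hε (φ (ns n))) (hεφ.comp hns) (fun n => hS (ns n))
      (hE'.subseq hns) hx0 hz (R := π / ρ) (by positivity) hxs hmem
    refine ⟨n, ?_⟩
    have hεn := hε (φ (ns n))
    have hR : 0 < ε (φ (ns n)) * (π / ρ) := by positivity
    have hmo := (hS (ns n)).θ_mono hεn (hmem n).1 ⟨by linarith [(hmem n).1.1], (hmem n).2⟩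
      (show xs n ≤ xs n + ε (φ (ns n)) * (π / ρ) by linarith)
    rw [mul_zero, sub_zero, ← mul_sub, abs_of_nonneg (mul_nonneg hεn.le (by linarith))]
    have : ρ * (ε (φ (ns n)) * (π / ρ)) = ε (φ (ns n)) * π := by field_simp
    rw [this]
    gcongr

def Env.G (D : Env) : ℝ → ℝ := Gfun D.W0 D.K
def Env.lg (D : Env) (x : ℝ) : ℝ := log (D.a x)

lemma Env.lg_cont (D : Env) : ContinuousOn D.lg (Icc 0 1) :=
  D.a_cont.log fun _ hx => (D.a_pos hx).ne'

lemma Env.G_lt_iff (D : Env) {ξ η : ℝ} (hξ : ξ ∈ Ioo 0 D.W0) (hη : η ∈ Ioo 0 D.W0) :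
    D.G ξ < D.G η ↔ ξ < η := (D.k.G_strictMono D.w).lt_iff_lt hξ hη

lemma Env.G_le_iff (D : Env) {ξ η : ℝ} (hξ : ξ ∈ Ioo 0 D.W0) (hη : η ∈ Ioo 0 D.W0) :
    D.G ξ ≤ D.G η ↔ ξ ≤ η := (D.k.G_strictMono D.w).le_iff_le hξ hη

/-- Reversal of the space variable. -/
def Env.reflect (D : Env) : Env where
  p := D.p
  q := D.q
  W0 := D.W0
  amin := D.amin
  amax := D.amax
  A := D.A
  γ := D.γ
  f := D.f
  F := D.F
  T := D.T
  K := D.K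
  a := fun x => D.a (1 - x)
  a' := fun x => -D.a' (1 - x)
  w := D.w
  k := D.k
  amin_pos := D.amin_pos
  γ_pos := D.γ_pos
  lo := fun x hx => D.lo _ ⟨by linarith [hx.2], by linarith [hx.1]⟩
  hi := fun x hx => D.hi _ ⟨by linarith [hx.2], by linarith [hx.1]⟩
  da := fun x hx => by
    have h := D.da (1 - x) ⟨by linarith [hx.2], by linarith [hx.1]⟩
    exact (h.comp x ((hasDerivAt_id x).const_sub 1)).congr_deriv (by ring)
  a'cont := (D.a'cont.comp (by fun_prop) fun x hx =>
    ⟨by linarith [hx.2], by linarith [hx.1]⟩).neg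
  a'bd := fun x hx => by
    rw [abs_neg]; exact D.a'bd _ ⟨by linarith [hx.2], by linarith [hx.1]⟩

namespace Prof
variable {D : Env} {E : ℝ → ℝ}

lemma reflect (P : Prof D E) : Prof D.reflect (fun x => E (1 - x)) where
  cont := P.cont.comp (by fun_prop) fun x hx => ⟨by linarith [hx.2], by linarith [hx.1]⟩
  nonneg := fun x hx => P.nonneg _ ⟨by linarith [hx.2], by linarith [hx.1]⟩
  lt := fun x hx => P.lt _ ⟨by linarith [hx.2], by linarith [hx.1]⟩
  dE := fun x hx h => by
    have := hasDerivWithinAt_reflect (P.dE (1 - x) ⟨by linarith [hx.2], by linarith [hx.1]⟩ h)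
    rw [sub_self, sub_zero] at this
    refine this.congr_deriv ?_
    simp only [Env.reflect]; ring

lemma mem (P : Prof D E) {x : ℝ} (hx : x ∈ Icc (0:ℝ) 1) (h : 0 < E x) : E x ∈ Ioo 0 D.W0 :=
  ⟨h, P.lt x hx⟩

lemma invariant (P : Prof D E) {α β : ℝ} (h0 : 0 ≤ α) (h1 : α ≤ β) (h2 : β ≤ 1)
    (h : ∀ x ∈ Icc α β, 0 < E x) : D.G (E β) - D.lg β = D.G (E α) - D.lg α := by
  have hsub : Icc α β ⊆ Icc (0:ℝ) 1 := Icc_subset_Icc h0 h2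
  refine const_of_deriv_zero (g := fun x => D.G (E x) - D.lg x) (d := fun _ => 0) (fun x hx => ?_)
    (fun _ _ => rfl) (right_mem_Icc.2 h1) (left_mem_Icc.2 h1)
  have hm := P.mem (hsub hx) (h x hx)
  have d1 := (D.k.G_deriv D.w hm).comp_hasDerivWithinAt x ((P.dE x (hsub hx) (h x hx)).mono hsub)
  have d2 := ((D.da x (hsub hx)).log (D.a_pos (hsub hx)).ne').hasDerivWithinAt (s := Icc α β)
  refine (d1.sub d2).congr_deriv ?_
  have := (D.k.K_pos D.w hm).ne'
  field_simp
  ring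

lemma le_of_profile (P : Prof D E) {x β μ : ℝ} (h0 : 0 ≤ x) (h2 : β ≤ 1)
    (hx : 0 < E x) (hμ : μ ∈ Ioo 0 D.W0)
    (h : ∀ t ∈ Icc x β, D.G μ ≤ D.G (E x) + D.lg t - D.lg x) : ∀ t ∈ Icc x β, μ ≤ E t := by
  intro t0 ht0
  by_contra! hlt
  have hsub : Icc x t0 ⊆ Icc (0:ℝ) 1 := Icc_subset_Icc h0 (ht0.2.trans h2)
  have hxm : x ∈ Icc (0:ℝ) 1 := hsub (left_mem_Icc.2 ht0.1)
  have hμx : μ ≤ E x := by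
    rw [← D.G_le_iff hμ (P.mem hxm hx)]
    have := h x ⟨le_rfl, ht0.1.trans ht0.2⟩
    linarith
  have hE0 := P.nonneg t0 (hsub (right_mem_Icc.2 ht0.1))
  have hcont := P.cont.mono hsub
  set ν := (E t0 + μ) / 2 with hν
  have hμ0 := hμ.1
  obtain ⟨t1, ht1, hz, -, hp⟩ := exists_first_zero (g := fun t => E t - ν)
    (hcont.sub continuousOn_const) (by linarith) (by
      obtain ⟨t, ht, he⟩ := intermediate_value_Icc' ht0.1 hcont
        (show ν ∈ Icc (E t0) (E x) from ⟨by linarith, by linarith⟩)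
      exact ⟨t, ht, by rw [he, sub_self]⟩)
  have hpos : ∀ y ∈ Icc x t1, 0 < E y := fun y hy => by
    rcases hy.2.lt_or_eq with hl | rfl
    · have := hp y ⟨hy.1, hl⟩; linarith
    · linarith
  have hc := P.invariant h0 ht1.1 (ht1.2.trans (ht0.2.trans h2)) hpos
  have h3 := h t1 ⟨ht1.1, ht1.2.trans ht0.2⟩
  have : μ ≤ E t1 := by
    rw [← D.G_le_iff hμ (P.mem (hsub ht1) (hpos t1 (right_mem_Icc.2 ht1.1)))]
    linarith
  linarith

lemma zero_of_antitone (P : Prof D E) {α β : ℝ} (h0 : 0 ≤ α) (h2 : β ≤ 1)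
    (ha : AntitoneOn D.a (Icc α β)) (hz : E α = 0) : ∀ t ∈ Icc α β, E t = 0 := by
  intro t ht
  by_contra hne
  have hsub : Icc α t ⊆ Icc (0:ℝ) 1 := Icc_subset_Icc h0 (ht.2.trans h2)
  have htm := hsub (right_mem_Icc.2 ht.1)
  have hpt : 0 < E t := lt_of_le_of_ne (P.nonneg t htm) (Ne.symm hne)
  have hαt : α < t := lt_of_le_of_ne ht.1 fun h => by rw [← h, hz] at hpt; exact lt_irrefl _ hpt
  have hcont := P.cont.mono hsub
  have hle : ∀ s ∈ Icc α t, (∀ y ∈ Icc s t, 0 < E y) → E t ≤ E s := fun s hs hp => by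
    have hc := P.invariant (h0.trans hs.1) hs.2 (ht.2.trans h2) hp
    have hl : D.lg t ≤ D.lg s := log_le_log (D.a_pos htm) (ha ⟨hs.1, hs.2.trans ht.2⟩ ht hs.2)
    rw [← D.G_le_iff (P.mem htm hpt) (P.mem (hsub hs) (hp s (left_mem_Icc.2 hs.2)))]
    linarith
  have hcl : IsCompact (Icc α t ∩ E ⁻¹' {E t / 2}) :=
    isCompact_Icc.of_isClosed_subset
      (hcont.preimage_isClosed_of_isClosed isClosed_Icc isClosed_singleton) inter_subset_left
  obtain ⟨s0, hs0, he0⟩ := intermediate_value_Icc ht.1 hcont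
    (show E t / 2 ∈ Icc (E α) (E t) by rw [hz]; exact ⟨by linarith, by linarith⟩)
  obtain ⟨s, ⟨hs, hes⟩, hgr⟩ := hcl.exists_isGreatest ⟨s0, hs0, he0⟩
  simp only [mem_preimage, mem_singleton_iff] at hes
  have hpos : ∀ y ∈ Icc s t, 0 < E y := fun y hy => by
    by_contra! hneg
    obtain ⟨v, hv, hev⟩ := intermediate_value_Icc hy.2
      (hcont.mono (Icc_subset_Icc_left (hs.1.trans hy.1)))
      (show E t / 2 ∈ Icc (E y) (E t) from ⟨by linarith, by linarith⟩)
    have h3 := hgr ⟨⟨hs.1.trans (hy.1.trans hv.1), hv.2⟩, hev⟩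
    have : y = s := le_antisymm (hv.1.trans h3) hy.1
    rw [this, hes] at hneg; linarith
  have := hle s hs hpos
  linarith

end Prof

lemma Env.speed_pos (D : Env) {x ξ : ℝ} (hx : x ∈ Icc (0:ℝ) 1) (hξ : ξ ∈ Ioo 0 D.W0) :
    0 < 2 * π * D.a x ^ (1 / D.p) / D.T ξ := by
  have := rpow_pos_of_pos (D.a_pos hx) (1 / D.p)
  have := D.k.Tpos ξ hξ
  have := pi_pos
  positivity

lemma Lim.zero_of_const {D : Env} {E Θ : ℝ → ℝ} (L : Lim D E Θ) {α β : ℝ} (h0 : 0 ≤ α)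
    (h1 : α < β) (h2 : β ≤ 1) (hc : ∀ x ∈ Icc α β, Θ x = Θ α) : ∀ x ∈ Icc α β, E x = 0 := by
  intro x hx
  by_contra hne
  have hsub : Icc α β ⊆ Icc (0:ℝ) 1 := Icc_subset_Icc h0 h2
  have hp : 0 < E x := lt_of_le_of_ne (L.nonneg x (hsub hx)) (Ne.symm hne)
  have d1 := (L.dΘ x (hsub hx) hp).mono hsub
  have d2 : HasDerivWithinAt Θ 0 (Icc α β) x :=
    (hasDerivWithinAt_const x (Icc α β) (Θ α)).congr hc (hc x hx)
  have := (uniqueDiffOn_Icc h1 x hx).eq_deriv _ d1 d2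
  exact (D.speed_pos (hsub hx) (L.toProf.mem (hsub hx) hp)).ne' this

namespace Prof
variable {D : Env} {E1 E2 : ℝ → ℝ}

lemma compare (P1 : Prof D E1) (P2 : Prof D E2) {x t : ℝ} (h0 : 0 ≤ x) (h1 : x ≤ t) (h2 : t ≤ 1)
    (hp : ∀ s ∈ Icc x t, 0 < E1 s) (h : E1 x ≤ E2 x) :
    (∀ s ∈ Icc x t, 0 < E2 s) ∧ D.G (E2 t) - D.G (E1 t) = D.G (E2 x) - D.G (E1 x) := by
  have hsub : Icc x t ⊆ Icc (0:ℝ) 1 := Icc_subset_Icc h0 h2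
  have hx := left_mem_Icc.2 h1
  obtain ⟨s0, hs0, hmin⟩ := isCompact_Icc.exists_isMinOn (nonempty_Icc.2 h1) (P1.cont.mono hsub)
  have hp2 : 0 < E2 x := (hp x hx).trans_le h
  have hpos : ∀ s ∈ Icc x t, 0 < E2 s := fun s hs => by
    refine (hp s0 hs0).trans_le (P2.le_of_profile h0 h2 hp2 (P1.mem (hsub hs0) (hp s0 hs0))
      (fun s hs => ?_) s hs)
    have hi := P1.invariant h0 hs.1 (hs.2.trans h2) fun y hy => hp y ⟨hy.1, hy.2.trans hs.2⟩
    have h3 := (D.G_le_iff (P1.mem (hsub hx) (hp x hx)) (P2.mem (hsub hx) hp2)).2 h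
    have h4 := (D.G_le_iff (P1.mem (hsub hs0) (hp s0 hs0)) (P1.mem (hsub hs) (hp s hs))).2 (hmin hs)
    linarith
  have i1 := P1.invariant h0 h1 h2 hp
  have i2 := P2.invariant h0 h1 h2 hpos
  exact ⟨hpos, by linarith⟩

end Prof

/-- An interval on which the profile makes an excursion away from zero. -/
structure Hill (D : Env) (E : ℝ → ℝ) (δ z1 y1 xs y2 z2 lo hi μ : ℝ) : Prop where
  h0 : 0 ≤ z1
  h1 : z1 ≤ y1
  h2 : y1 ≤ xs
  h3 : xs ≤ y2
  h4 : y2 ≤ z2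
  h5 : z2 ≤ 1
  hy : y1 < y2
  mono : MonotoneOn D.a (Icc z1 y1)
  anti : AntitoneOn D.a (Icc y2 z2)
  lo_pos : 0 < lo
  lohi : lo < hi
  hiE : hi ≤ E xs
  hμ : μ ∈ Ioo 0 D.W0
  mid : ∀ x ∈ Icc y1 y2, D.G μ ≤ D.G lo + D.lg x - D.lg xs
  close : D.W0 * (D.G (E xs) - D.G lo) ≤ δ / 4
  left_small : ∀ x ∈ Ico z1 y1, E x ≤ δ / 4
  right_small : ∀ x ∈ Ioc y2 z2, E x ≤ δ / 4

namespace Hill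
variable {D : Env} {E E1 E2 : ℝ → ℝ} {δ z1 y1 xs y2 z2 lo hi μ : ℝ}

lemma reflect (H : Hill D E δ z1 y1 xs y2 z2 lo hi μ) :
    Hill D.reflect (fun x => E (1 - x)) δ (1 - z2) (1 - y2) (1 - xs) (1 - y1) (1 - z1) lo hi μ where
  h0 := by linarith [H.h5]
  h1 := by linarith [H.h4]
  h2 := by linarith [H.h3]
  h3 := by linarith [H.h2]
  h4 := by linarith [H.h1]
  h5 := by linarith [H.h0]
  hy := by linarith [H.hy]
  mono := fun x hx y hy h => H.anti ⟨by linarith [hy.2], by linarith [hy.1]⟩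
    ⟨by linarith [hx.2], by linarith [hx.1]⟩ (by linarith)
  anti := fun x hx y hy h => H.mono ⟨by linarith [hy.2], by linarith [hy.1]⟩
    ⟨by linarith [hx.2], by linarith [hx.1]⟩ (by linarith)
  lo_pos := H.lo_pos
  lohi := H.lohi
  hiE := by simpa using H.hiE
  hμ := H.hμ
  mid := fun x hx => by
    have := H.mid (1 - x) ⟨by linarith [hx.2], by linarith [hx.1]⟩
    simpa [Env.reflect, Env.G, Env.lg] using this
  close := by simpa [Env.reflect, Env.G] using H.close
  left_small := fun x hx => H.right_small _ ⟨by linarith [hx.2], by linarith [hx.1]⟩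
  right_small := fun x hx => H.left_small _ ⟨by linarith [hx.2], by linarith [hx.1]⟩

lemma xs_mem (H : Hill D E δ z1 y1 xs y2 z2 lo hi μ) : xs ∈ Icc (0:ℝ) 1 :=
  ⟨H.h0.trans (H.h1.trans H.h2), H.h3.trans (H.h4.trans H.h5)⟩

lemma pos_mid_right (H : Hill D E δ z1 y1 xs y2 z2 lo hi μ) (hlo : lo < D.W0) (P : Prof D E1)
    (h : lo ≤ E1 xs) : ∀ t ∈ Icc xs y2, 0 < E1 t := fun t ht => by
  have hp := H.lo_pos.trans_le h
  refine H.hμ.1.trans_le (P.le_of_profile H.xs_mem.1 (H.h4.trans H.h5) hp H.hμ (fun s hs => ?_) t ht)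
  have h1 := H.mid s ⟨H.h2.trans hs.1, hs.2⟩
  have h2 := (D.G_le_iff ⟨H.lo_pos, hlo⟩ (P.mem H.xs_mem hp)).2 h
  linarith

lemma pos_right (H : Hill D E δ z1 y1 xs y2 z2 lo hi μ) (hlo : lo < D.W0) (P : Prof D E1)
    (h : lo ≤ E1 xs) {t : ℝ} (ht : t ∈ Icc xs z2) (hpt : 0 < E1 t) : ∀ s ∈ Icc xs t, 0 < E1 s := by
  intro s hs
  rcases le_total s y2 with hsy | hsy
  · exact H.pos_mid_right hlo P h s ⟨hs.1, hsy⟩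
  · have h0 := H.xs_mem.1
    refine lt_of_le_of_ne (P.nonneg s ⟨h0.trans hs.1, hs.2.trans (ht.2.trans H.h5)⟩) fun h0' => ?_
    have := P.zero_of_antitone (h0.trans hs.1) (ht.2.trans H.h5)
      (H.anti.mono (Icc_subset_Icc hsy ht.2)) h0'.symm t ⟨hs.2, le_rfl⟩
    exact hpt.ne' this

lemma le_right (H : Hill D E δ z1 y1 xs y2 z2 lo hi μ) (hlo : lo < D.W0) (P1 : Prof D E1)
    (P2 : Prof D E2) (h : lo ≤ E1 xs) (h12 : E1 xs ≤ E2 xs) {t : ℝ} (ht : t ∈ Icc xs z2) :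
    E1 t ≤ E2 t := by
  have h0 := H.xs_mem.1
  have htm : t ∈ Icc (0:ℝ) 1 := ⟨h0.trans ht.1, ht.2.trans H.h5⟩
  rcases (P1.nonneg t htm).eq_or_lt with he | hp
  · rw [← he]; exact P2.nonneg t htm
  · have hpos := H.pos_right hlo P1 h ht hp
    obtain ⟨h1, h2⟩ := P1.compare P2 h0 ht.1 htm.2 hpos h12
    rw [← D.G_le_iff (P1.mem htm hp) (P2.mem htm (h1 t (right_mem_Icc.2 ht.1)))]
    have h3 := (D.G_le_iff (P1.mem H.xs_mem (hpos _ (left_mem_Icc.2 ht.1)))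
      (P2.mem H.xs_mem (h1 _ (left_mem_Icc.2 ht.1)))).2 h12
    linarith

lemma mid_right (H : Hill D E δ z1 y1 xs y2 z2 lo hi μ) (hlo : lo < D.W0) (P1 : Prof D E1)
    (P2 : Prof D E2) (h : lo ≤ E1 xs) (h12 : E1 xs ≤ E2 xs) {t : ℝ} (ht : t ∈ Icc xs y2) :
    0 < E1 t ∧ 0 < E2 t ∧ D.G (E2 t) - D.G (E1 t) = D.G (E2 xs) - D.G (E1 xs) := by
  have h0 := H.xs_mem.1
  have hpos : ∀ s ∈ Icc xs t, 0 < E1 s := fun s hs =>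
    H.pos_mid_right hlo P1 h s ⟨hs.1, hs.2.trans ht.2⟩
  obtain ⟨h1, h2⟩ := P1.compare P2 h0 ht.1 (ht.2.trans (H.h4.trans H.h5)) hpos h12
  exact ⟨hpos t (right_mem_Icc.2 ht.1), h1 t (right_mem_Icc.2 ht.1), h2⟩

lemma le_all (H : Hill D E δ z1 y1 xs y2 z2 lo hi μ) (hlo : lo < D.W0) (P1 : Prof D E1)
    (P2 : Prof D E2) (h : lo ≤ E1 xs) (h12 : E1 xs ≤ E2 xs) {t : ℝ} (ht : t ∈ Icc z1 z2) :
    E1 t ≤ E2 t := by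
  rcases le_total xs t with hx | hx
  · exact H.le_right hlo P1 P2 h h12 ⟨hx, ht.2⟩
  · simpa using H.reflect.le_right hlo P1.reflect P2.reflect (by simpa using h) (by simpa using h12)
      (t := 1 - t) ⟨by linarith, by linarith [ht.1]⟩

lemma mid_all (H : Hill D E δ z1 y1 xs y2 z2 lo hi μ) (hlo : lo < D.W0) (P1 : Prof D E1)
    (P2 : Prof D E2) (h : lo ≤ E1 xs) (h12 : E1 xs ≤ E2 xs) {t : ℝ} (ht : t ∈ Icc y1 y2) :
    0 < E1 t ∧ 0 < E2 t ∧ D.G (E2 t) - D.G (E1 t) = D.G (E2 xs) - D.G (E1 xs) := by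
  rcases le_total xs t with hx | hx
  · exact H.mid_right hlo P1 P2 h h12 ⟨hx, ht.2⟩
  · simpa [Env.reflect, Env.G] using H.reflect.mid_right hlo P1.reflect P2.reflect
      (by simpa using h) (by simpa using h12) (t := 1 - t) ⟨by linarith, by linarith [ht.1]⟩

lemma lo_lt (H : Hill D E δ z1 y1 xs y2 z2 lo hi μ) (P : Prof D E) : lo < D.W0 :=
  H.lohi.trans_le (H.hiE.trans (P.lt xs H.xs_mem).le)

lemma dist_le (H : Hill D E δ z1 y1 xs y2 z2 lo hi μ) (P : Prof D E) (P1 : Prof D E1)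
    (h : lo ≤ E1 xs) (h' : E1 xs ≤ hi) {t : ℝ} (ht : t ∈ Icc z1 z2) : |E1 t - E t| ≤ δ / 4 := by
  have hlo := H.lo_lt P
  have htm : t ∈ Icc (0:ℝ) 1 := ⟨H.h0.trans ht.1, ht.2.trans H.h5⟩
  have hle := H.le_all hlo P1 P h (h'.trans H.hiE) ht
  have hnn := P1.nonneg t htm
  have out : E t ≤ δ / 4 → |E1 t - E t| ≤ δ / 4 := fun h => by
    rw [abs_le]; constructor <;> linarith
  rcases lt_or_ge t y1 with h1 | h1
  · exact out (H.left_small t ⟨ht.1, h1⟩)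
  rcases lt_or_ge y2 t with h2 | h2
  · exact out (H.right_small t ⟨h2, ht.2⟩)
  obtain ⟨p1, p2, hG⟩ := H.mid_all hlo P1 P h (h'.trans H.hiE) ⟨h1, h2⟩
  have hW := D.w.W0pos
  have hGlo := (D.G_le_iff ⟨H.lo_pos, hlo⟩ (P1.mem H.xs_mem (H.lo_pos.trans_le h))).2 h
  have hG1 := (D.G_le_iff (P1.mem htm p1) (P.mem htm p2)).2 hle
  refine (D.k.G_dist D.w (P1.mem htm p1) (P.mem htm p2)).trans ?_
  change D.W0 * |D.G (E1 t) - D.G (E t)| ≤ _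
  rw [abs_sub_comm, abs_of_nonneg (by linarith)]
  nlinarith [H.close]

end Hill

/-- Angular speed of the limit problem. -/
def Env.speed (D : Env) (ξ x : ℝ) : ℝ := if 0 < ξ then 2 * π * D.a x ^ (1 / D.p) / D.T ξ else 0

lemma Env.speed_le (D : Env) {x ξ η : ℝ} (hx : x ∈ Icc (0:ℝ) 1) (h0 : 0 ≤ ξ) (h : ξ ≤ η)
    (hη : η < D.W0) : D.speed ξ x ≤ D.speed η x := by
  unfold Env.speed
  rcases h0.eq_or_lt with rfl | h0
  · rw [if_neg (lt_irrefl _)]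
    split_ifs with h1
    · exact (D.speed_pos hx ⟨h1, hη⟩).le
    · exact le_rfl
  · rw [if_pos h0, if_pos (h0.trans_le h)]
    have := rpow_pos_of_pos (D.a_pos hx) (1 / D.p)
    have := D.k.Tpos η ⟨h0.trans_le h, hη⟩
    have h3 := (D.k.T_strictAnti D.w).antitoneOn ⟨h0, h.trans_lt hη⟩ ⟨h0.trans_le h, hη⟩ h
    have := pi_pos
    gcongr

lemma Env.speed_lt (D : Env) {x ξ η : ℝ} (hx : x ∈ Icc (0:ℝ) 1) (h0 : 0 < ξ) (h : ξ < η)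
    (hη : η < D.W0) : D.speed ξ x < D.speed η x := by
  unfold Env.speed
  rw [if_pos h0, if_pos (h0.trans h)]
  have := rpow_pos_of_pos (D.a_pos hx) (1 / D.p)
  have := D.k.Tpos η ⟨h0.trans h, hη⟩
  have h3 := D.k.T_strictAnti D.w ⟨h0, h.trans hη⟩ ⟨h0.trans h, hη⟩ h
  have := pi_pos
  gcongr

lemma Lim.deriv {D : Env} {E Θ : ℝ → ℝ} (L : Lim D E Θ) {x : ℝ} (hx : x ∈ Icc (0:ℝ) 1) :
    HasDerivWithinAt Θ (D.speed (E x) x) (Icc 0 1) x := by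
  unfold Env.speed
  split_ifs with h
  · exact L.dΘ x hx h
  · exact L.dΘ0 x hx (le_antisymm (not_lt.1 h) (L.nonneg x hx))

namespace Hill
variable {D : Env} {E E1 E2 Θ1 Θ2 : ℝ → ℝ} {δ z1 y1 xs y2 z2 lo hi μ : ℝ}

lemma rotation_lt (H : Hill D E δ z1 y1 xs y2 z2 lo hi μ) (hlo : lo < D.W0) (L1 : Lim D E1 Θ1)
    (L2 : Lim D E2 Θ2) (h1 : E1 xs = lo) (h2 : E2 xs = hi) :
    Θ1 z2 - Θ1 z1 < Θ2 z2 - Θ2 z1 := by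
  have hsub : Icc z1 z2 ⊆ Icc (0:ℝ) 1 := Icc_subset_Icc H.h0 H.h5
  have h12 : E1 xs ≤ E2 xs := by rw [h1, h2]; exact H.lohi.le
  have hder : ∀ x ∈ Icc (0:ℝ) 1, HasDerivWithinAt (fun y => Θ2 y - Θ1 y)
    (D.speed (E2 x) x - D.speed (E1 x) x) (Icc 0 1) x := fun x hx => (L2.deriv hx).sub (L1.deriv hx)
  have hmono : MonotoneOn (fun y => Θ2 y - Θ1 y) (Icc z1 z2) :=
    monotoneOn_Icc_of_deriv (fun x hx => (hder x (hsub hx)).mono hsub) fun x hx => by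
      have hx' := Ioo_subset_Icc_self hx
      have := D.speed_le (hsub hx') (L1.nonneg x (hsub hx'))
        (H.le_all hlo L1.toProf L2.toProf h1.ge h12 hx') (L2.lt x (hsub hx'))
      linarith
  have hsub2 : Icc y1 y2 ⊆ Icc (0:ℝ) 1 := Icc_subset_Icc (H.h0.trans H.h1) (H.h4.trans H.h5)
  have hs : StrictMonoOn (fun y => Θ2 y - Θ1 y) (Icc y1 y2) :=
    strictMonoOn_Icc_of_deriv (fun x hx => (hder x (hsub2 hx)).mono hsub2) fun x hx => by
      have hx' := Ioo_subset_Icc_self hx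
      obtain ⟨p1, p2, hG⟩ := H.mid_all hlo L1.toProf L2.toProf h1.ge h12 hx'
      have hlt : E1 x < E2 x := by
        rw [← D.G_lt_iff (L1.toProf.mem (hsub2 hx') p1) (L2.toProf.mem (hsub2 hx') p2)]
        have := (D.G_lt_iff (ξ := E1 xs) (η := E2 xs) (by rw [h1]; exact ⟨H.lo_pos, hlo⟩)
          ⟨by rw [h2]; exact H.lo_pos.trans H.lohi, L2.lt _ H.xs_mem⟩).2 (by rw [h1, h2]; exact H.lohi)
        linarith
      have := D.speed_lt (hsub2 hx') p1 hlt (L2.lt x (hsub2 hx'))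
      linarith
  have hz1 : z1 ∈ Icc z1 z2 := left_mem_Icc.2 (by linarith [H.h1, H.h2, H.h3, H.h4])
  have hz2 : z2 ∈ Icc z1 z2 := right_mem_Icc.2 (by linarith [H.h1, H.h2, H.h3, H.h4])
  have a1 := hmono hz1 ⟨H.h1, H.hy.le.trans H.h4⟩ H.h1
  have a2 := hs (left_mem_Icc.2 H.hy.le) (right_mem_Icc.2 H.hy.le) H.hy
  have a3 := hmono ⟨H.h1.trans H.hy.le, H.h4⟩ hz2 H.h4
  simp only at a1 a2 a3
  linarith

end Hill

/-- The hill ends strictly before `z2` by hitting zero energy. -/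
structure RightEnd (D : Env) (xs y2 z2 hi η lam d : ℝ) : Prop where
  η_pos : 0 < η
  lam_pos : 0 < lam
  d_pos : 0 < d
  le_one : z2 + η ≤ 1
  y_le : y2 ≤ z2 - η
  slope : ∀ x ∈ Icc (z2 - η) (z2 + η), D.a' x ≤ -lam
  low : ∀ ξ ∈ Ioo 0 D.W0, D.G hi + D.lg z2 - D.lg xs + d < D.G ξ

/-- The hill starts strictly after `z1` from zero energy. -/
structure LeftEnd (D : Env) (z1 y1 xs hi η lam d : ℝ) : Prop where
  η_pos : 0 < η
  lam_pos : 0 < lam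
  d_pos : 0 < d
  nonneg : 0 ≤ z1 - η
  le_y : z1 + η ≤ y1
  slope : ∀ x ∈ Icc (z1 - η) (z1 + η), lam ≤ D.a' x
  low : ∀ ξ ∈ Ioo 0 D.W0, D.G hi + D.lg z1 - D.lg xs + d < D.G ξ
  above : ∀ t ∈ Icc y1 xs, D.a z1 < D.a t

namespace Hill
variable {D : Env} {E E1 : ℝ → ℝ} {δ z1 y1 xs y2 z2 lo hi μ η lam d : ℝ}

lemma hits_zero (H : Hill D E δ z1 y1 xs y2 z2 lo hi μ) (P : Prof D E)
    (R : RightEnd D xs y2 z2 hi η lam d)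
    (P1 : Prof D E1) (h : lo ≤ E1 xs) (h' : E1 xs ≤ hi) : ∃ h, 0 < h ∧ h ≤ η ∧ E1 (z2 - h) = 0 := by
  have hη := R.η_pos
  have hz2 : z2 ∈ Icc (0:ℝ) 1 := ⟨by linarith [H.xs_mem.1, H.h3, H.h4], H.h5⟩
  have hcont : ContinuousOn (fun s => D.lg (z2 - s)) (Icc 0 η) :=
    D.lg_cont.comp (by fun_prop) fun s hs =>
      ⟨by linarith [H.xs_mem.1, H.h3, R.y_le, hs.2], by linarith [hz2.2, hs.1]⟩
  have h0 : Tendsto (fun s => D.lg (z2 - s)) (𝓝[Ioc 0 η] 0) (𝓝 (D.lg z2)) := by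
    have := (hcont 0 (left_mem_Icc.2 hη.le)).mono Ioc_subset_Icc_self
    simpa [ContinuousWithinAt] using this
  have : (𝓝[Ioc 0 η] (0:ℝ)).NeBot := by
    rw [nhdsWithin_Ioc_eq_nhdsGT hη]; infer_instance
  obtain ⟨s, hs, hss⟩ := ((h0.eventually_lt_const (show D.lg z2 < D.lg z2 + d by linarith [R.d_pos])).and
    eventually_mem_nhdsWithin).exists
  refine ⟨s, hss.1, hss.2, ?_⟩
  by_contra hne
  have ht : z2 - s ∈ Icc xs z2 := ⟨by linarith [H.h3, R.y_le, hss.2], by linarith [hss.1]⟩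
  have htm : z2 - s ∈ Icc (0:ℝ) 1 := ⟨H.xs_mem.1.trans ht.1, ht.2.trans H.h5⟩
  have hp := lt_of_le_of_ne (P1.nonneg _ htm) (Ne.symm hne)
  have hpos := H.pos_right (H.lo_lt P) P1 h ht hp
  have hi := P1.invariant H.xs_mem.1 ht.1 htm.2 hpos
  have h1 := R.low _ (P1.mem htm hp)
  have h2 := (D.G_le_iff (P1.mem H.xs_mem (H.lo_pos.trans_le h))
    ⟨H.lo_pos.trans H.lohi, H.hiE.trans_lt (P.lt _ H.xs_mem)⟩).2 h'
  linarith

lemma hi_lt (H : Hill D E δ z1 y1 xs y2 z2 lo hi μ) (P : Prof D E)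
    (R : LeftEnd D z1 y1 xs hi η lam d) (P1 : Prof D E1) (h : ∀ s ∈ Ioc 0 η, 0 < E1 (z1 + s)) :
    hi < E1 xs := by
  have hη := R.η_pos
  have hz1 : z1 ∈ Icc (0:ℝ) 1 := ⟨H.h0, by linarith [H.xs_mem.2, H.h1, H.h2]⟩
  have hmap : ∀ s ∈ Icc 0 η, z1 + s ∈ Icc (0:ℝ) 1 := fun s hs =>
      ⟨by linarith [hz1.1, hs.1], by linarith [H.xs_mem.2, H.h2, R.le_y, hs.2]⟩
  have hl : Tendsto (fun s => D.lg (z1 + s)) (𝓝[Ioc 0 η] 0) (𝓝 (D.lg z1)) := by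
    have := ((D.lg_cont.comp (f := fun s => z1 + s) (by fun_prop) hmap) 0
      (left_mem_Icc.2 hη.le)).mono Ioc_subset_Icc_self
    simpa [ContinuousWithinAt, Function.comp_def] using this
  have ha : Tendsto (fun s => D.a (z1 + s)) (𝓝[Ioc 0 η] 0) (𝓝 (D.a z1)) := by
    have := ((D.a_cont.comp (f := fun s => z1 + s) (by fun_prop) hmap) 0
      (left_mem_Icc.2 hη.le)).mono Ioc_subset_Icc_self
    simpa [ContinuousWithinAt, Function.comp_def] using this
  have : (𝓝[Ioc 0 η] (0:ℝ)).NeBot := by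
    rw [nhdsWithin_Ioc_eq_nhdsGT hη]; infer_instance
  obtain ⟨t0, ht0, hmin⟩ := isCompact_Icc.exists_isMinOn (nonempty_Icc.2 H.h2)
    (D.a_cont.mono (Icc_subset_Icc (H.h0.trans H.h1) H.xs_mem.2))
  obtain ⟨s, ⟨hs1, hs2⟩, hss⟩ :=
    (((hl.eventually_lt_const (show D.lg z1 < D.lg z1 + d by linarith [R.d_pos])).and
      (ha.eventually_lt_const (R.above t0 ht0))).and eventually_mem_nhdsWithin).exists
  have hsm := hmap s (Ioc_subset_Icc_self hss)
  have hp := h s hss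
  have hsx : z1 + s ≤ xs := by linarith [R.le_y, hss.2, H.h2]
  have hpos : ∀ t ∈ Icc (z1 + s) xs, E1 (z1 + s) ≤ E1 t :=
    P1.le_of_profile hsm.1 H.xs_mem.2 hp (P1.mem hsm hp) fun t ht => by
      have : D.lg (z1 + s) ≤ D.lg t := by
        refine log_le_log (D.a_pos hsm) ?_
        rcases le_total t y1 with hty | hty
        · exact H.mono ⟨by linarith [hss.1], ht.1.trans hty⟩ ⟨by linarith [hss.1, ht.1], hty⟩ ht.1
        · exact hs2.le.trans (hmin ⟨hty, ht.2⟩)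
      linarith
  have hi' := P1.invariant hsm.1 hsx H.xs_mem.2 fun t ht => hp.trans_le (hpos t ht)
  have h1 := R.low _ (P1.mem hsm hp)
  rw [← D.G_lt_iff ⟨H.lo_pos.trans H.lohi, H.hiE.trans_lt (P.lt _ H.xs_mem)⟩
    (P1.mem H.xs_mem (hp.trans_le (hpos xs (right_mem_Icc.2 hsx))))]
  linarith

end Hill

/-- A sequence of solutions with vanishing parameter together with its limit. -/
structure LimSeq (D : Env) (ε : ℕ → ℝ) (u m θ : ℕ → ℝ → ℝ) (E Θ : ℝ → ℝ) : Prop where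
  pos : ∀ n, 0 < ε n
  tend : Tendsto ε atTop (𝓝 0)
  sol : ∀ n, Sol D (ε n) (u n) (m n) (θ n)
  hE : ContConv (fun n => en D.q D.F D.a (u n) (m n)) E (Icc 0 1)
  hΘ : ContConv (fun n x => ε n * θ n x) Θ (Icc 0 1)
  lim : Lim D E Θ

lemma exists_bad_seq {X : Type*} {P : ℝ → X → Prop} (h : ¬ ∀ᶠ ε in 𝓝[>] (0:ℝ), ∀ x, P ε x) :
    ∃ (ε : ℕ → ℝ) (x : ℕ → X), (∀ n, 0 < ε n) ∧ (∀ n, ε n ≤ 1) ∧ Tendsto ε atTop (𝓝 0) ∧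
      ∀ n, ¬ P (ε n) (x n) := by
  have hf : ∃ᶠ ε in 𝓝[>] (0:ℝ), (¬ ∀ x, P ε x) ∧ 0 < ε ∧ ε ≤ 1 :=
    (not_eventually.1 h).and_eventually
      (eventually_mem_nhdsWithin.and
        ((eventually_le_nhds (show (0:ℝ) < 1 by norm_num)).filter_mono nhdsWithin_le_nhds))
  obtain ⟨ε, hε, hh⟩ := exists_seq_forall_of_frequently hf
  choose x hx using fun n => not_forall.1 (hh n).1
  exact ⟨ε, x, fun n => (hh n).2.1, fun n => (hh n).2.2, hε.mono_right nhdsWithin_le_nhds, hx⟩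

lemma eventually_pair {D : Env} (P : (ℝ → ℝ) → (ℝ → ℝ) → (ℝ → ℝ) → (ℝ → ℝ) → Prop)
    (h : ∀ ε u m θ E Θ u' m' θ' E' Θ', LimSeq D ε u m θ E Θ → LimSeq D ε u' m' θ' E' Θ' →
      (∀ n, ¬ P (θ n) (en D.q D.F D.a (u n) (m n)) (θ' n) (en D.q D.F D.a (u' n) (m' n))) → False) :
    ∀ᶠ ε in 𝓝[>] (0:ℝ), ∀ u m θ u' m' θ', Sol D ε u m θ → Sol D ε u' m' θ' →
      P θ (en D.q D.F D.a u m) θ' (en D.q D.F D.a u' m') := by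
  by_contra hc
  have hc' : ¬ ∀ᶠ ε in 𝓝[>] (0:ℝ), ∀ x : Fin 6 → ℝ → ℝ, Sol D ε (x 0) (x 1) (x 2) →
      Sol D ε (x 3) (x 4) (x 5) →
      P (x 2) (en D.q D.F D.a (x 0) (x 1)) (x 5) (en D.q D.F D.a (x 3) (x 4)) := fun hh =>
    hc (hh.mono fun ε hε u m θ u' m' θ' => hε ![u, m, θ, u', m', θ'])
  obtain ⟨ε, x, hp, hl, ht, hb⟩ := exists_bad_seq hc'
  push Not at hb
  obtain ⟨φ, hφ, E, Θ, hE, hΘ, hL⟩ := exists_limit hp hl ht fun n => (hb n).1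
  obtain ⟨φ', hφ', E', Θ', hE', hΘ', hL'⟩ := exists_limit (fun n => hp (φ n)) (fun n => hl (φ n))
    (ht.comp hφ.tendsto_atTop) fun n => (hb (φ n)).2.1
  exact h (fun n => ε (φ (φ' n))) _ _ _ E Θ _ _ _ E' Θ'
    ⟨fun n => hp _, ht.comp (hφ.comp hφ').tendsto_atTop, fun n => (hb (φ (φ' n))).1,
      hE.subseq hφ'.tendsto_atTop, hΘ.subseq hφ'.tendsto_atTop, hL⟩
    ⟨fun n => hp _, ht.comp (hφ.comp hφ').tendsto_atTop, fun n => (hb (φ (φ' n))).2.1,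
      hE', hΘ', hL'⟩ fun n => (hb (φ (φ' n))).2.2

lemma eventually_single {D : Env} (P : (ℝ → ℝ) → (ℝ → ℝ) → Prop)
    (h : ∀ ε u m θ E Θ, LimSeq D ε u m θ E Θ →
      (∀ n, ¬ P (θ n) (en D.q D.F D.a (u n) (m n))) → False) :
    ∀ᶠ ε in 𝓝[>] (0:ℝ), ∀ u m θ, Sol D ε u m θ → P θ (en D.q D.F D.a u m) :=
  (eventually_pair (fun θ e _ _ => P θ e) fun ε u m θ E Θ _ _ _ _ _ L _ hP =>
    h ε u m θ E Θ L hP).mono fun _ hε u m θ S => hε u m θ u m θ S S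

lemma en_reflect (q : ℝ) (F a u m : ℝ → ℝ) (c x : ℝ) :
    en q F (fun x => a (c - x)) (fun x => u (c - x)) (fun x => -m (c - x)) x =
      en q F a u m (c - x) := by simp [en]

namespace LimSeq
variable {D : Env} {ε : ℕ → ℝ} {u m θ : ℕ → ℝ → ℝ} {E Θ : ℝ → ℝ}

lemma zero_of_gap (L : LimSeq D ε u m θ E Θ) {α β C : ℝ} (h0 : 0 ≤ α) (h1 : α < β) (h2 : β ≤ 1)
    (h : ∀ n, θ n β - θ n α ≤ C) : ∀ x ∈ Icc α β, E x = 0 := by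
  refine L.lim.zero_of_const h0 h1 h2 fun x hx => ?_
  have hxm : x ∈ Icc (0:ℝ) 1 := ⟨h0.trans hx.1, hx.2.trans h2⟩
  have hαm : α ∈ Icc (0:ℝ) 1 := ⟨h0, h1.le.trans h2⟩
  have hβm : β ∈ Icc (0:ℝ) 1 := ⟨h0.trans h1.le, h2⟩
  have t1 := (L.hΘ.pointwise hxm).sub (L.hΘ.pointwise hαm)
  have t2 : Tendsto (fun n => ε n * C) atTop (𝓝 0) := by simpa using L.tend.mul_const C
  have key : Tendsto (fun n => ε n * θ n x - ε n * θ n α) atTop (𝓝 0) := by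
    refine squeeze_zero (fun n => ?_) (fun n => ?_) t2
    · have := (L.sol n).θ_mono (L.pos n) hαm hxm hx.1
      rw [← mul_sub]; exact mul_nonneg (L.pos n).le (by linarith)
    · have := (L.sol n).θ_mono (L.pos n) hxm hβm hx.2
      have h3 := h n
      rw [← mul_sub]; exact mul_le_mul_of_nonneg_left (by linarith) (L.pos n).le
  linarith [tendsto_nhds_unique t1 key]

lemma eventually_lt (L : LimSeq D ε u m θ E Θ) {ε1 : ℝ} (h : 0 < ε1) : ∀ᶠ n in atTop, ε n < ε1 :=
  L.tend.eventually_lt_const h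

lemma not_le_neg (L : LimSeq D ε u m θ E Θ) {z η lam : ℝ} (hη : 0 < η) (hlam : 0 < lam)
    (h0 : 0 ≤ z - η) (h1 : z ≤ 1) (hs : ∀ x ∈ Icc (z - η) z, lam ≤ D.a' x) (hu : ∀ n, u n z = 0) :
    ∀ᶠ n in atTop, 0 < en D.q D.F D.a (u n) (m n) z := by
  obtain ⟨ε1, hε1, hN⟩ := D.w.exists_no_return D.amin_pos D.amin_le_amax hlam hη
  filter_upwards [L.eventually_lt hε1] with n hn
  by_contra! hneg
  have hsys := Sys.reflect ((L.sol n).sys.mono le_rfl h1) z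
  have := hN _ (fun x => -D.a' (z - x)) (ε n) (z - z) (z - 0) _ _ (L.pos n) hn (by linarith) hsys
    (fun x hx => by
      have hx1 : z - x ∈ Icc (z - η) z := ⟨by linarith [hx.2], by linarith [hx.1]⟩
      have hx2 : z - x ∈ Icc (0:ℝ) 1 := ⟨h0.trans hx1.1, hx1.2.trans h1⟩
      refine ⟨D.lo _ hx2, D.hi _ hx2, ?_, neg_le_neg (hs _ hx1)⟩
      exact ((D.da _ hx2).comp x ((hasDerivAt_id x).const_sub z)).congr_deriv (by ring))
    (by simpa using hu n) (by rw [en_reflect]; simpa using hneg) (z - 0)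
    ⟨by linarith, le_rfl⟩
  simp [(L.sol n).m0] at this

lemma pos_after (L : LimSeq D ε u m θ E Θ) {z η lam : ℝ} (hη : 0 < η) (hlam : 0 < lam)
    (h0 : 0 ≤ z) (h1 : z + η ≤ 1) (hs : ∀ x ∈ Icc z (z + η), lam ≤ D.a' x) (hu : ∀ n, u n z = 0)
    (he : ∀ᶠ n in atTop, 0 < en D.q D.F D.a (u n) (m n) z) : 0 < E (z + η) := by
  obtain ⟨ε1, κ, hε1, hκ, hG⟩ := D.w.exists_growth D.amin_pos D.amin_le_amax hlam hη D.gap_pos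
  have hsub : Icc z (z + η) ⊆ Icc (0:ℝ) 1 := Icc_subset_Icc h0 h1
  refine hκ.trans_le (ge_of_tendsto (L.hE.pointwise (hsub (right_mem_Icc.2 (by linarith)))) ?_)
  filter_upwards [L.eventually_lt hε1, he] with n hn hen
  exact hG _ D.a' (ε n) z _ _ (L.pos n) hn ((L.sol n).sys.mono h0 h1)
    (fun x hx => ⟨D.lo _ (hsub hx), D.hi _ (hsub hx), D.da _ (hsub hx), hs x hx⟩)
    (fun x hx => ((L.sol n).gronwall (hsub hx)).1) (hu n) hen.le

lemma nonpos_of_zero_before (L : LimSeq D ε u m θ E Θ) {z η lam : ℝ} (hη : 0 < η) (hlam : 0 < lam)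
    (h0 : 0 ≤ z - η) (h1 : z ≤ 1) (hs : ∀ x ∈ Icc (z - η) z, D.a' x ≤ -lam)
    (hu : ∀ n, u n z = 0) (hE : E (z - η) = 0) :
    ∀ᶠ n in atTop, en D.q D.F D.a (u n) (m n) z ≤ 0 := by
  obtain ⟨ε1, κ, hε1, hκ, hG⟩ := D.w.exists_growth D.amin_pos D.amin_le_amax hlam hη D.gap_pos
  have hsub : Icc (z - η) z ⊆ Icc (0:ℝ) 1 := Icc_subset_Icc h0 h1
  have ht := L.hE.pointwise (hsub (left_mem_Icc.2 (show z - η ≤ z by linarith)))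
  rw [hE] at ht
  filter_upwards [L.eventually_lt hε1, ht.eventually_lt_const hκ] with n hn hlt
  by_contra! hpos
  have hmem : ∀ x ∈ Icc (z - z) (z - z + η), z - x ∈ Icc (z - η) z := fun x hx =>
    ⟨by linarith [hx.2], by linarith [hx.1]⟩
  have hsys := Sys.reflect ((L.sol n).sys.mono h0 h1) z
  rw [show z - (z - η) = z - z + η by ring] at hsys
  have := hG _ (fun x => -D.a' (z - x)) (ε n) (z - z) _ _ (L.pos n) hn hsys
    (fun x hx => by
      have hx2 := hsub (hmem x hx)
      refine ⟨D.lo _ hx2, D.hi _ hx2, ?_, le_neg_of_le_neg (hs _ (hmem x hx))⟩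
      exact ((D.da _ hx2).comp x ((hasDerivAt_id x).const_sub z)).congr_deriv (by ring))
    (fun x hx => by rw [en_reflect]; exact ((L.sol n).gronwall (hsub (hmem x hx))).1)
    (by simpa using hu n) (by rw [en_reflect]; simpa using hpos.le)
  rw [en_reflect, show z - (z - z + η) = z - η by ring] at this
  linarith

lemma uniform (L : LimSeq D ε u m θ E Θ) {ρ : ℝ} (hρ : 0 < ρ) :
    ∀ᶠ n in atTop, ∀ x ∈ Icc (0:ℝ) 1, |en D.q D.F D.a (u n) (m n) x - E x| < ρ := by
  have := Metric.tendstoUniformlyOn_iff.1 (L.hE.tendstoUniformlyOn isCompact_Icc) ρ hρ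
  filter_upwards [this] with n hn x hx
  have := hn x hx
  rwa [Real.dist_eq, abs_sub_comm] at this

end LimSeq

lemma Sol.zero_of_sin {D : Env} {ε : ℝ} {u m θ : ℝ → ℝ} (S : Sol D ε u m θ) {z : ℝ}
    (hz : z ∈ Icc (0:ℝ) 1) (h : sin (θ z) = 0) : u z = 0 := by rw [S.polu z hz, h, mul_zero]

lemma Sol.lt_of_ne {D : Env} {ε : ℝ} {u m θ : ℝ → ℝ} (S : Sol D ε u m θ) {z : ℝ}
    (hz : z ∈ Icc (0:ℝ) 1) (h : sin (θ z) = 0) (hm : ∀ x ∈ Icc z 1, m x ≠ 0) :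
    θ 1 < θ z + π / 2 := by
  by_contra! hge
  have hp := pi_pos
  obtain ⟨x, hx, hθ⟩ := intermediate_value_Icc hz.2 (S.θcont.mono (Icc_subset_Icc_left hz.1))
    (show θ z + π / 2 ∈ Icc (θ z) (θ 1) from ⟨by linarith, hge⟩)
  refine hm x hx ?_
  rw [S.polm x ⟨hz.1.trans hx.1, hx.2⟩, hθ, cos_add_pi_div_two, h, neg_zero, mul_zero]

section Closeness
variable {D : Env} {E : ℝ → ℝ} {δ z1 y1 xs y2 z2 lo hi μ η lam d : ℝ}

lemma claim_leave (P : Prof D E) (H : Hill D E δ z1 y1 xs y2 z2 lo hi μ)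
    (R : RightEnd D xs y2 z2 hi η lam d) :
    ∀ᶠ ε in 𝓝[>] (0:ℝ), ∀ u m θ, Sol D ε u m θ → sin (θ z2) = 0 →
      en D.q D.F D.a u m xs ∈ Icc lo hi → θ 1 < θ z2 + π / 2 := by
  refine eventually_single (fun θ e => sin (θ z2) = 0 → e xs ∈ Icc lo hi → θ 1 < θ z2 + π / 2) ?_
  intro ε u m θ E1 Θ L hP
  simp only [not_forall, not_lt] at hP
  have hz2 : z2 ∈ Icc (0:ℝ) 1 := ⟨by linarith [H.xs_mem.1, H.h3, H.h4], H.h5⟩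
  have hu : ∀ n, u n z2 = 0 := fun n => (L.sol n).zero_of_sin hz2 (hP n).1
  have hx := L.hE.pointwise H.xs_mem
  obtain ⟨s, hs0, hsη, hz⟩ := H.hits_zero P R L.lim.toProf
    (ge_of_tendsto' hx fun n => (hP n).2.1.1) (le_of_tendsto' hx fun n => (hP n).2.1.2)
  have hnp := L.nonpos_of_zero_before hs0 R.lam_pos
    (by linarith [H.xs_mem.1, H.h3, R.y_le]) H.h5
    (fun x hx => R.slope x ⟨by linarith [hx.1], by linarith [hx.2, R.η_pos]⟩) hu hz
  obtain ⟨ε1, hε1, hN⟩ := D.w.exists_no_return D.amin_pos D.amin_le_amax R.lam_pos R.η_pos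
  obtain ⟨n, hn, hlt⟩ := (hnp.and (L.eventually_lt hε1)).exists
  have hm := hN D.a D.a' (ε n) z2 1 _ _ (L.pos n) hlt R.le_one ((L.sol n).sys.mono hz2.1 le_rfl)
    (fun x hx => by
      have hxm : x ∈ Icc (0:ℝ) 1 := ⟨hz2.1.trans hx.1, hx.2.trans R.le_one⟩
      exact ⟨D.lo _ hxm, D.hi _ hxm, D.da _ hxm, R.slope x ⟨by linarith [hx.1, R.η_pos], hx.2⟩⟩)
    (hu n) hn
  exact absurd ((L.sol n).lt_of_ne hz2 (hP n).1 hm) (not_lt.2 (hP n).2.2)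

lemma claim_enter (P : Prof D E) (H : Hill D E δ z1 y1 xs y2 z2 lo hi μ)
    (R : LeftEnd D z1 y1 xs hi η lam d) :
    ∀ᶠ ε in 𝓝[>] (0:ℝ), ∀ u m θ, Sol D ε u m θ → sin (θ z1) = 0 → hi < en D.q D.F D.a u m xs := by
  refine eventually_single (fun θ e => sin (θ z1) = 0 → hi < e xs) ?_
  intro ε u m θ E1 Θ L hP
  simp only [not_forall, not_lt] at hP
  have hz1 : z1 ∈ Icc (0:ℝ) 1 := ⟨H.h0, by linarith [H.xs_mem.2, H.h1, H.h2]⟩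
  have hu : ∀ n, u n z1 = 0 := fun n => (L.sol n).zero_of_sin hz1 (hP n).1
  have he := L.not_le_neg R.η_pos R.lam_pos R.nonneg hz1.2
    (fun x hx => R.slope x ⟨hx.1, by linarith [hx.2, R.η_pos]⟩) hu
  have := H.hi_lt P R L.lim.toProf fun s hs => L.pos_after hs.1 R.lam_pos H.h0
    (by linarith [hs.2, R.le_y, H.h2, H.xs_mem.2])
    (fun x hx => R.slope x ⟨by linarith [hx.1, R.η_pos], by linarith [hx.2, hs.2]⟩) hu he
  exact absurd (le_of_tendsto' (L.hE.pointwise H.xs_mem) fun n => (hP n).2) (not_le.2 this)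

lemma claim_stay (H : Hill D E δ z1 y1 xs y2 z2 lo hi μ) {z : ℝ} (hz : 0 ≤ z) (hz1 : z < 1)
    (hzx : z ≤ xs) :
    ∀ᶠ ε in 𝓝[>] (0:ℝ), ∀ u m θ, Sol D ε u m θ → θ 1 - θ z ≤ π → en D.q D.F D.a u m xs < lo := by
  refine eventually_single (fun θ e => θ 1 - θ z ≤ π → e xs < lo) ?_
  intro ε u m θ E1 Θ L hP
  simp only [not_forall, not_lt] at hP
  have h1 := L.zero_of_gap hz hz1 le_rfl (fun n => (hP n).1) xs ⟨hzx, H.xs_mem.2⟩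
  have h2 := ge_of_tendsto' (L.hE.pointwise H.xs_mem) fun n => (hP n).2
  linarith [H.lo_pos]

lemma claim_rotation (P : Prof D E) (H : Hill D E δ z1 y1 xs y2 z2 lo hi μ) :
    ∀ᶠ ε in 𝓝[>] (0:ℝ), ∀ u m θ u' m' θ', Sol D ε u m θ → Sol D ε u' m' θ' →
      en D.q D.F D.a u m xs = lo → en D.q D.F D.a u' m' xs = hi → |θ z1 - θ' z1| ≤ π →
      θ z2 + 3 * π < θ' z2 := by
  refine eventually_pair (fun θ e θ' e' => e xs = lo → e' xs = hi → |θ z1 - θ' z1| ≤ π →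
      θ z2 + 3 * π < θ' z2) ?_
  intro ε u m θ E1 Θ1 u' m' θ' E2 Θ2 L1 L2 hP
  simp only [not_forall, not_lt] at hP
  choose h1 h2 h3 h4 using hP
  have e1 : E1 xs = lo := tendsto_nhds_unique (L1.hE.pointwise H.xs_mem) (by
    simpa only [h1] using tendsto_const_nhds)
  have e2 : E2 xs = hi := tendsto_nhds_unique (L2.hE.pointwise H.xs_mem) (by
    simpa only [h2] using tendsto_const_nhds)
  have hlt := H.rotation_lt (H.lo_lt P) L1.lim L2.lim e1 e2
  have hz1 : z1 ∈ Icc (0:ℝ) 1 := ⟨H.h0, by linarith [H.xs_mem.2, H.h1, H.h2]⟩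
  have hz2 : z2 ∈ Icc (0:ℝ) 1 := ⟨by linarith [H.xs_mem.1, H.h3, H.h4], H.h5⟩
  have t := ((L2.hΘ.pointwise hz2).sub (L2.hΘ.pointwise hz1)).sub
    ((L1.hΘ.pointwise hz2).sub (L1.hΘ.pointwise hz1))
  have t2 : Tendsto (fun n => ε n * (4 * π)) atTop (𝓝 0) := by simpa using L1.tend.mul_const (4 * π)
  have := le_of_tendsto_of_tendsto' t t2 fun n => by
    have := L1.pos n
    have h5 := (abs_le.1 (h3 n)).2
    have h6 := h4 n
    have : θ' n z2 - θ' n z1 - (θ n z2 - θ n z1) ≤ 4 * π := by linarith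
    nlinarith
  linarith

lemma claim_close (P : Prof D E) (hδ : 0 < δ) (H : Hill D E δ z1 y1 xs y2 z2 lo hi μ) {z : ℝ}
    (hz : 0 ≤ z) (hz1 : z ≤ z1) (hE : ∀ x ∈ Icc z z1, E x ≤ δ / 2 ∨ z = z1) :
    ∀ᶠ ε in 𝓝[>] (0:ℝ), ∀ u m θ, Sol D ε u m θ → θ z1 - θ z ≤ π →
      en D.q D.F D.a u m xs ∈ Icc lo hi → ∀ x ∈ Icc z z2, |en D.q D.F D.a u m x - E x| < δ := by
  refine eventually_single (fun θ e => θ z1 - θ z ≤ π → e xs ∈ Icc lo hi →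
    ∀ x ∈ Icc z z2, |e x - E x| < δ) ?_
  intro ε u m θ E1 Θ L hP
  simp only [not_forall, not_lt] at hP
  have hz11 : z1 ≤ 1 := by linarith [H.xs_mem.2, H.h1, H.h2]
  have hx := L.hE.pointwise H.xs_mem
  have key : ∀ x ∈ Icc z z2, |E1 x - E x| ≤ δ / 2 := fun x hxz => by
    have hxm : x ∈ Icc (0:ℝ) 1 := ⟨hz.trans hxz.1, hxz.2.trans H.h5⟩
    rcases le_or_gt z1 x with h1 | h1
    · have := H.dist_le P L.lim.toProf (ge_of_tendsto' hx fun n => (hP n).2.1.1)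
        (le_of_tendsto' hx fun n => (hP n).2.1.2) (t := x) ⟨h1, hxz.2⟩
      linarith
    · have hlt : z < z1 := hxz.1.trans_lt h1
      rw [L.zero_of_gap hz hlt hz11 (fun n => (hP n).1) x ⟨hxz.1, h1.le⟩, zero_sub, abs_neg,
        abs_of_nonneg (P.nonneg x hxm)]
      exact (hE x ⟨hxz.1, h1.le⟩).resolve_right hlt.ne
  obtain ⟨n, hn⟩ := (L.uniform (half_pos hδ)).exists
  obtain ⟨x, hxz, hb⟩ := (hP n).2.2
  have h1 := hn x ⟨hz.trans hxz.1, hxz.2.trans H.h5⟩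
  have h2 := key x hxz
  have h3 := abs_sub_le (en D.q D.F D.a (u n) (m n) x) (E1 x) (E x)
  linarith

lemma claim_flat (P : Prof D E) (hδ : 0 < δ) {z : ℝ} (hz : 0 ≤ z) (hz1 : z < 1)
    (hE : ∀ x ∈ Icc z 1, E x ≤ δ / 2) :
    ∀ᶠ ε in 𝓝[>] (0:ℝ), ∀ u m θ, Sol D ε u m θ → θ 1 - θ z ≤ π →
      ∀ x ∈ Icc z 1, |en D.q D.F D.a u m x - E x| < δ := by
  refine eventually_single (fun θ e => θ 1 - θ z ≤ π → ∀ x ∈ Icc z 1, |e x - E x| < δ) ?_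
  intro ε u m θ E1 Θ L hP
  simp only [not_forall, not_lt] at hP
  obtain ⟨n, hn⟩ := (L.uniform (half_pos hδ)).exists
  obtain ⟨x, hxz, hb⟩ := (hP n).2
  have hxm : x ∈ Icc (0:ℝ) 1 := ⟨hz.trans hxz.1, hxz.2⟩
  have h1 := hn x hxm
  rw [L.zero_of_gap hz hz1 le_rfl (fun n => (hP n).1) x hxz, sub_zero] at h1
  have h4 := P.nonneg x hxm
  have h5 := hE x hxz
  rw [abs_lt] at h1
  rcases le_abs.1 hb with h | h <;> linarith

lemma claim_start (D : Env) (hγ : D.γ < D.W0) {y : ℝ} (hy : 0 < y) (hy1 : y ≤ 1) :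
    ∀ᶠ ε in 𝓝[>] (0:ℝ), ∀ u m θ, Sol D ε u m θ → en D.q D.F D.a u m 0 = D.W0 - D.γ → π < θ y := by
  refine eventually_single (fun θ e => e 0 = D.W0 - D.γ → π < θ y) ?_
  intro ε u m θ E1 Θ L hP
  simp only [not_forall, not_lt] at hP
  choose h1 h2 using hP
  have h0 := L.zero_of_gap (C := π) le_rfl hy hy1 (fun n => by
    rw [(L.sol n).θ0]; linarith [h2 n, pi_pos]) 0 ⟨le_rfl, hy.le⟩
  have := tendsto_nhds_unique (L.hE.pointwise (show (0:ℝ) ∈ Icc (0:ℝ) 1 by simp)) (by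
    simpa only [h1] using tendsto_const_nhds)
  linarith

end Closeness

/-- `h` is a bounded Lipschitz regularization of `g` which keeps its signs and zeros. -/
structure Shadow (g h : ℝ → ℝ) : Prop where
  lip : ∃ L, 0 ≤ L ∧ ∀ x y, |h x - h y| ≤ L * |x - y|
  bdd : ∃ B, 0 ≤ B ∧ ∀ x, |h x| ≤ B
  shadow : ∀ x, ∃ y, |y| ≤ |x| ∧ 0 ≤ x * y ∧ (|x| ≤ 1 → y = x) ∧ |h x| ≤ |g y| ∧ 0 ≤ h x * g y

/-- Truncation to the interval `[-M, M]`. -/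
def clip (M x : ℝ) : ℝ := max (-M) (min M x)

lemma clip_mem {M : ℝ} (hM : 0 ≤ M) (x : ℝ) : clip M x ∈ Icc (-M) M :=
  ⟨le_max_left _ _, max_le (by linarith) (min_le_left _ _)⟩

lemma clip_eq {M x : ℝ} (hx : x ∈ Icc (-M) M) : clip M x = x := by
  rw [clip, min_eq_right hx.2, max_eq_right hx.1]

lemma clip_lip (M x y : ℝ) : |clip M x - clip M y| ≤ |x - y| := by
  have h1 := abs_max_sub_max_le_max (-M) (min M x) (-M) (min M y)
  have h2 := abs_min_sub_min_le_max M x M y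
  simp only [sub_self, abs_zero] at h1 h2
  rw [max_eq_right (a := (0:ℝ)) (abs_nonneg _)] at h1 h2
  exact h1.trans h2

lemma clip_cases {M : ℝ} (hM : 0 ≤ M) (x : ℝ) : (x ∈ Icc (-M) M ∧ clip M x = x) ∨
    (M < x ∧ clip M x = M) ∨ (x < -M ∧ clip M x = -M) := by
  rcases lt_or_ge M x with h | h
  · right; left
    exact ⟨h, by rw [clip, min_eq_left h.le, max_eq_right (by linarith)]⟩
  rcases lt_or_ge x (-M) with h' | h'
  · right; right
    exact ⟨h', by rw [clip, min_eq_right h, max_eq_left h'.le]⟩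
  · exact Or.inl ⟨⟨h', h⟩, clip_eq ⟨h', h⟩⟩

lemma shrink_spec {δ t g : ℝ} (hδ : 0 ≤ δ) (h : |t - g| ≤ δ) :
    |t - clip δ t| ≤ |g| ∧ 0 ≤ (t - clip δ t) * g ∧ |t - clip δ t - g| ≤ 2 * δ := by
  have h' := abs_le.1 h
  rcases clip_cases hδ t with ⟨h1, h2⟩ | ⟨h1, h2⟩ | ⟨h1, h2⟩ <;> rw [h2]
  · simp only [sub_self, abs_zero, zero_mul, zero_sub, abs_neg]
    refine ⟨abs_nonneg _, le_rfl, ?_⟩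
    rw [abs_le]; exact ⟨by linarith [h1.1], by linarith [h1.2]⟩
  · have hg : 0 < g := by linarith
    refine ⟨?_, mul_nonneg (by linarith) hg.le, ?_⟩
    · rw [abs_of_pos (by linarith), abs_of_pos hg]; linarith
    · rw [abs_le]; constructor <;> linarith
  · have hg : g < 0 := by linarith
    refine ⟨?_, mul_nonneg_of_nonpos_of_nonpos (by linarith) hg.le, ?_⟩
    · rw [abs_of_neg (by linarith), abs_of_neg hg]; linarith
    · rw [abs_le]; constructor <;> linarith

lemma exists_shadow_near {g : ℝ → ℝ} (hg : Continuous g) {M δ : ℝ} (hM : 1 ≤ M) (hδ : 0 < δ) :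
    ∃ h, Shadow g h ∧ ∀ x ∈ Icc (-M) M, |h x - g x| ≤ 2 * δ := by
  have hM0 : 0 ≤ M := by linarith
  obtain ⟨P, hP⟩ := exists_polynomial_near_of_continuousOn (-M) M g hg.continuousOn δ hδ
  obtain ⟨L, hL⟩ := (isCompact_Icc (a := -M) (b := M)).exists_bound_of_continuousOn
    (Polynomial.continuous (Polynomial.derivative P)).continuousOn
  obtain ⟨B, hB⟩ := (isCompact_Icc (a := -M) (b := M)).exists_bound_of_continuousOn
    hg.continuousOn
  have hL0 : 0 ≤ L := (norm_nonneg _).trans (hL 0 ⟨by linarith, hM0⟩)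
  have hB0 : 0 ≤ B := (norm_nonneg _).trans (hB 0 ⟨by linarith, hM0⟩)
  have hlip := lipschitz_of_deriv_bound (l := -M) (r := M)
    (fun x _ => (P.hasDerivAt x).hasDerivWithinAt) hL
  have hs := fun x => shrink_spec hδ.le (hP _ (clip_mem hM0 x)).le
  refine ⟨fun x => P.eval (clip M x) - clip δ (P.eval (clip M x)),
    ⟨⟨2 * L, by positivity, fun x y => ?_⟩, ⟨B, hB0, fun x => ?_⟩, fun x => ?_⟩, fun x hx => ?_⟩
  · have h1 := hlip _ (clip_mem hM0 x) _ (clip_mem hM0 y)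
    have h2 := clip_lip δ (P.eval (clip M x)) (P.eval (clip M y))
    have h3 := mul_le_mul_of_nonneg_left (clip_lip M x y) hL0
    calc _ = |(P.eval (clip M x) - P.eval (clip M y)) -
          (clip δ (P.eval (clip M x)) - clip δ (P.eval (clip M y)))| := by ring_nf
      _ ≤ _ := (abs_sub _ _).trans (by linarith)
  · exact (hs x).1.trans (hB _ (clip_mem hM0 x))
  · refine ⟨clip M x, ?_, ?_, fun hx => clip_eq (abs_le.1 (hx.trans hM)), (hs x).1, (hs x).2.1⟩
    · rcases clip_cases hM0 x with ⟨h1, h2⟩ | ⟨h1, h2⟩ | ⟨h1, h2⟩ <;> rw [h2]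
      · rw [abs_of_nonneg hM0, abs_of_pos (by linarith)]; exact h1.le
      · rw [abs_neg, abs_of_nonneg hM0, abs_of_neg (by linarith)]; linarith
    · rcases clip_cases hM0 x with ⟨h1, h2⟩ | ⟨h1, h2⟩ | ⟨h1, h2⟩ <;> rw [h2]
      · exact mul_self_nonneg x
      · exact mul_nonneg (by linarith) hM0
      · exact mul_nonneg_of_nonpos_of_nonpos (by linarith) (by linarith)
  · have := (hs x).2.2
    beta_reduce
    rwa [clip_eq hx] at this ⊢

lemma exists_shadow_seq {g : ℝ → ℝ} (hg : Continuous g) :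
    ∃ h : ℕ → ℝ → ℝ, (∀ n, Shadow g (h n)) ∧ ContConv h g univ := by
  choose h h1 h2 using fun n : ℕ => exists_shadow_near hg (M := (n:ℝ) + 1) (δ := 1 / ((n:ℝ) + 1))
    (by linarith [Nat.cast_nonneg (α := ℝ) n]) (by positivity)
  refine ⟨h, h1, fun x _ => ?_⟩
  rw [nhdsWithin_univ]
  have hfar : ∀ᶠ z : ℕ × ℝ in atTop ×ˢ 𝓝 x, z.2 ∈ Icc (-((z.1:ℝ) + 1)) ((z.1:ℝ) + 1) := by
    obtain ⟨N, hN⟩ := exists_nat_gt |x|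
    have e1 : ∀ᶠ z : ℕ × ℝ in atTop ×ˢ 𝓝 x, N ≤ z.1 := tendsto_fst.eventually (eventually_ge_atTop N)
    have e2 : ∀ᶠ z : ℕ × ℝ in atTop ×ˢ 𝓝 x, |z.2| < N :=
      tendsto_snd.eventually ((continuous_abs.tendsto x).eventually_lt_const hN)
    filter_upwards [e1, e2] with z hz1 hz2
    have : (N:ℝ) ≤ z.1 := by exact_mod_cast hz1
    have := abs_lt.1 hz2
    constructor <;> linarith
  have hz : Tendsto (fun z : ℕ × ℝ => h z.1 z.2 - g z.2) (atTop ×ˢ 𝓝 x) (𝓝 0) := by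
    refine squeeze_zero_norm' (a := fun z : ℕ × ℝ => 2 * (1 / ((z.1:ℝ) + 1))) ?_ ?_
    · filter_upwards [hfar] with z hz
      exact h2 _ _ hz
    · have := (tendsto_one_div_add_atTop_nhds_zero_nat (𝕜 := ℝ)).const_mul 2
      rw [mul_zero] at this
      exact this.comp tendsto_fst
  have := hz.add ((hg.tendsto x).comp (tendsto_snd (f := atTop (α := ℕ))))
  simpa [Function.comp_def] using this

namespace Shadow

variable {g h : ℝ → ℝ}

lemma zero (H : Shadow g h) {x : ℝ} (hx : |x| ≤ 1) (hg : g x = 0) : h x = 0 := by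
  obtain ⟨y, -, -, h3, h4, -⟩ := H.shadow x
  rw [h3 hx, hg, abs_zero] at h4
  exact abs_nonpos_iff.1 h4

lemma mul_nonneg (H : Shadow g h) (h0 : g 0 = 0) (hg : ∀ x, 0 ≤ x * g x) (x : ℝ) :
    0 ≤ x * h x := by
  obtain ⟨y, -, h2, -, h4, h5⟩ := H.shadow x
  by_cases hgy : g y = 0
  · rw [hgy, abs_zero] at h4
    rw [abs_nonpos_iff.1 h4, mul_zero]
  have hy : 0 < y * g y := lt_of_le_of_ne (hg y) (Ne.symm (mul_ne_zero (by
    rintro rfl; exact hgy h0) hgy))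
  have : 0 ≤ (x * h x) * (y * g y) := by
    have := _root_.mul_nonneg h2 h5
    linarith
  exact nonneg_of_mul_nonneg_left this hy

lemma neg (H : Shadow g h) : Shadow (fun x => -g x) (fun x => -h x) where
  lip := by
    obtain ⟨L, h0, h1⟩ := H.lip
    exact ⟨L, h0, fun x y => by rw [neg_sub_neg, abs_sub_comm]; exact h1 x y⟩
  bdd := by simpa using H.bdd
  shadow := by simpa using H.shadow

lemma mul_nonpos (H : Shadow g h) (h0 : g 0 = 0) (hg : ∀ x, x * g x ≤ 0) (x : ℝ) :
    x * h x ≤ 0 := by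
  have := H.neg.mul_nonneg (by simp [h0]) (fun x => by simpa using hg x) x
  simpa using this

lemma cont (H : Shadow g h) : Continuous h := by
  obtain ⟨L, h0, h1⟩ := H.lip
  exact (LipschitzWith.of_dist_le_mul (K := ⟨L, h0⟩) (fun x y => h1 x y)).continuous

end Shadow

/-- A trajectory of the regularized problem, with polar angle. -/
structure RSol (D : Env) (ε : ℝ) (ψ h : ℝ → ℝ) (s : ℝ) (u m θ : ℝ → ℝ) : Prop extends
    Traj (fun t => ψ t / ε) h (fun x => D.a x / ε) 0 1 u m θ where
  u0 : u 0 = s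
  m0 : m 0 = 0
  θ0 : θ 0 = π / 2

section Flow

variable {D : Env} {ε : ℝ} {ψ h : ℝ → ℝ}

lemma exists_stability (hε : 0 < ε) (Hψ : Shadow (phip D.q) ψ) (Hh : Shadow D.f h) :
    ∃ C, ∀ u m u' m', Traj0 (fun t => ψ t / ε) h (fun x => D.a x / ε) 0 1 u m →
      Traj0 (fun t => ψ t / ε) h (fun x => D.a x / ε) 0 1 u' m' → ∀ x ∈ Icc (0:ℝ) 1,
      ((u 0 - u' 0) ^ 2 + (m 0 - m' 0) ^ 2) * exp (-C) ≤ (u x - u' x) ^ 2 + (m x - m' x) ^ 2 ∧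
      (u x - u' x) ^ 2 + (m x - m' x) ^ 2 ≤ ((u 0 - u' 0) ^ 2 + (m 0 - m' 0) ^ 2) * exp C := by
  obtain ⟨L, hL0, hL⟩ := Hψ.lip
  obtain ⟨N, hN0, hN⟩ := Hh.lip
  have ham := D.amax_pos
  set C := L / ε + D.amax / ε * N with hC
  have hC0 : 0 ≤ C := by positivity
  refine ⟨C, fun u m u' m' t t' x hx => ?_⟩
  have key := gronwall_two_sided (l := 0) (r := 1) (C := C)
    (g := fun x => (u x - u' x) ^ 2 + (m x - m' x) ^ 2)
    (fun x hx => (((t.du x hx).sub (t'.du x hx)).pow 2).add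
      (((t.dm x hx).sub (t'.dm x hx)).pow 2)) (fun x hx => ?_) (left_mem_Icc.2 zero_le_one) hx hx.1
  · rw [sub_zero] at key
    have hxC : C * x ≤ C := by nlinarith [hx.2]
    have hρ : 0 ≤ (u 0 - u' 0) ^ 2 + (m 0 - m' 0) ^ 2 := by positivity
    exact ⟨(mul_le_mul_of_nonneg_left (exp_le_exp.2 (by linarith)) hρ).trans key.1,
      key.2.trans (mul_le_mul_of_nonneg_left (exp_le_exp.2 hxC) hρ)⟩
  · have ha := D.a_pos hx
    have hai := D.hi x hx
    set U := |u x - u' x|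
    set M := |m x - m' x|
    have hU : 0 ≤ U := abs_nonneg _
    have hM : 0 ≤ M := abs_nonneg _
    have e1 : |ψ (m x) / ε - ψ (m' x) / ε| ≤ L / ε * M := by
      rw [← sub_div, abs_div, abs_of_pos hε, div_mul_eq_mul_div]
      gcongr; exact hL _ _
    have e2 : |D.a x / ε * h (u x) - D.a x / ε * h (u' x)| ≤ D.amax / ε * N * U := by
      rw [← mul_sub, abs_mul, abs_of_pos (by positivity), mul_assoc]
      gcongr; exact hN _ _
    have e3 : |(u x - u' x) * (ψ (m x) / ε - ψ (m' x) / ε)| ≤ U * (L / ε * M) := by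
      rw [abs_mul]; gcongr
    have e4 : |(m x - m' x) * (D.a x / ε * h (u x) - D.a x / ε * h (u' x))| ≤
        M * (D.amax / ε * N * U) := by
      rw [abs_mul]; gcongr
    have e5 : 2 * (U * M) ≤ (u x - u' x) ^ 2 + (m x - m' x) ^ 2 := by
      rw [← sq_abs (u x - u' x), ← sq_abs (m x - m' x)]
      nlinarith [sq_nonneg (U - M)]
    simp only [Nat.cast_ofNat, pow_one, Nat.add_one_sub_one, Pi.sub_apply]
    calc _ = |2 * ((u x - u' x) * (ψ (m x) / ε - ψ (m' x) / ε)) +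
          2 * ((m x - m' x) * (D.a x / ε * h (u x) - D.a x / ε * h (u' x)))| := by ring_nf
      _ ≤ 2 * (U * (L / ε * M)) + 2 * (M * (D.amax / ε * N * U)) := by
          refine (abs_add_le _ _).trans ?_
          rw [abs_mul 2, abs_mul 2, abs_two]
          linarith
      _ = C * (2 * (U * M)) := by rw [hC]; ring
      _ ≤ _ := by gcongr

lemma traj0_zero (Hψ : Shadow (phip D.q) ψ) (Hh : Shadow D.f h) {u0 : ℝ} (h0 : |u0| ≤ 1)
    (hf : D.f u0 = 0) :
    Traj0 (fun t => ψ t / ε) h (fun x => D.a x / ε) 0 1 (fun _ => u0) (fun _ => 0) where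
  du x _ := by
    simpa [Hψ.zero (x := 0) (by simp) (phip_zero _)] using hasDerivWithinAt_const x _ u0
  dm x _ := by
    simpa [Hh.zero h0 hf] using hasDerivWithinAt_const x _ (0:ℝ)

lemma exists_traj0 (hε : 0 < ε) (Hψ : Shadow (phip D.q) ψ) (Hh : Shadow D.f h) (s : ℝ) :
    ∃ u m, Traj0 (fun t => ψ t / ε) h (fun x => D.a x / ε) 0 1 u m ∧ u 0 = s ∧ m 0 = 0 := by
  obtain ⟨L, hL0, hL⟩ := Hψ.lip
  obtain ⟨N, hN0, hN⟩ := Hh.lip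
  obtain ⟨B, hB0, hB⟩ := Hψ.bdd
  obtain ⟨C, hC0, hC⟩ := Hh.bdd
  have ham := D.amax_pos
  set K := max (L / ε) (D.amax / ε * N)
  set R := max (B / ε) (D.amax / ε * C)
  have hK : 0 ≤ K := le_max_of_le_left (by positivity)
  have hR : 0 ≤ R := le_max_of_le_left (by positivity)
  have pl : IsPicardLindelof (fun x (z : ℝ × ℝ) => (ψ z.2 / ε, D.a x / ε * h z.1))
      (tmin := 0) (tmax := 1) ⟨0, left_mem_Icc.2 zero_le_one⟩ (s, 0) ⟨R, hR⟩ 0 ⟨R, hR⟩ ⟨K, hK⟩ := by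
    refine ⟨fun x hx => (LipschitzWith.of_dist_le_mul fun z z' => ?_).lipschitzOnWith,
      fun z _ => ?_, fun x hx z _ => ?_, ?_⟩
    · have ha := D.a_pos hx
      have hai := D.hi x hx
      have d1 : |z.1 - z'.1| ≤ dist z z' := by
        rw [Prod.dist_eq, Real.dist_eq]; exact le_max_left _ _
      have d2 : |z.2 - z'.2| ≤ dist z z' := by
        rw [Prod.dist_eq]; exact le_max_right _ _
      rw [Prod.dist_eq, Real.dist_eq, Real.dist_eq]
      refine max_le ?_ ?_
      · rw [← sub_div, abs_div, abs_of_pos hε]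
        calc _ ≤ L * |z.2 - z'.2| / ε := by gcongr; exact hL _ _
          _ = L / ε * |z.2 - z'.2| := by ring
          _ ≤ K * dist z z' := by gcongr; exact le_max_left _ _
      · rw [← mul_sub, abs_mul, abs_of_pos (by positivity)]
        calc _ ≤ D.amax / ε * (N * |z.1 - z'.1|) := by gcongr; exact hN _ _
          _ = D.amax / ε * N * |z.1 - z'.1| := by ring
          _ ≤ K * dist z z' := by gcongr; exact le_max_right _ _
    · exact continuousOn_const.prodMk ((D.a_cont.div_const _).mul continuousOn_const)
    · have ha := D.a_pos hx
      have hai := D.hi x hx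
      rw [Prod.norm_def, Real.norm_eq_abs, Real.norm_eq_abs]
      refine max_le ?_ ?_
      · rw [abs_div, abs_of_pos hε]
        exact le_max_of_le_left (by gcongr; exact hB _)
      · rw [abs_mul, abs_of_pos (by positivity)]
        exact le_max_of_le_right (by gcongr; exact hC _)
    · simp
  obtain ⟨α, h0, hα⟩ := pl.exists_eq_forall_mem_Icc_hasDerivWithinAt₀
  refine ⟨fun x => (α x).1, fun x => (α x).2, ⟨fun x hx => ?_, fun x hx => ?_⟩, by simp [h0],
    by simp [h0]⟩
  · exact (hα x hx).fst
  · exact (hα x hx).snd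

lemma nz_of_lipschitz (hε : 0 < ε) (Hψ : Shadow (phip D.q) ψ) (Hh : Shadow D.f h) {s : ℝ}
    (hs : 0 < s) {u m : ℝ → ℝ} (t : Traj0 (fun t => ψ t / ε) h (fun x => D.a x / ε) 0 1 u m)
    (h0 : u 0 = s) (h1 : m 0 = 0) : ∀ x ∈ Icc (0:ℝ) 1, 0 < u x ^ 2 + m x ^ 2 := fun x hx => by
  obtain ⟨C, hC⟩ := exists_stability hε Hψ Hh
  have := (hC _ _ _ _ t (traj0_zero Hψ Hh (u0 := 0) (by simp) D.w.f0) x hx).1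
  simp only [h0, h1, sub_zero] at this
  exact lt_of_lt_of_le (by positivity) this

lemma exists_rsol (hε : 0 < ε) (Hψ : Shadow (phip D.q) ψ) (Hh : Shadow D.f h) {s : ℝ} (hs : 0 < s) :
    ∃ u m θ, RSol D ε ψ h s u m θ := by
  obtain ⟨u, m, t, h0, h1⟩ := exists_traj0 hε Hψ Hh s
  have hnz := nz_of_lipschitz hε Hψ Hh hs t h0 h1
  set v := fun x => (m x * (ψ (m x) / ε) - D.a x / ε * (u x * h (u x))) / (u x ^ 2 + m x ^ 2)
  have hv : ContinuousOn v (Icc 0 1) := by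
    have c1 := t.ucont
    have c2 := t.mcont
    refine ContinuousOn.div ?_ ((c1.pow 2).add (c2.pow 2)) fun x hx => (hnz x hx).ne'
    exact (c2.mul ((Hψ.cont.comp_continuousOn c2).div_const _)).sub
      ((D.a_cont.div_const _).mul (c1.mul (Hh.cont.comp_continuousOn c1)))
  have hθ : ∀ x ∈ Icc (0:ℝ) 1, HasDerivWithinAt (fun x => π / 2 + ∫ y in (0:ℝ)..x, v y) (v x)
      (Icc 0 1) x := fun x hx => by
    have : HasDerivWithinAt (fun x => ∫ y in (0:ℝ)..x, v y) (v x) (Icc 0 1) x := by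
      have : Fact (x ∈ Icc (0:ℝ) 1) := ⟨hx⟩
      refine integral_hasDerivWithinAt_right ?_ ?_ (hv x hx)
      · exact (hv.mono (by rw [uIcc_of_le hx.1]; exact Icc_subset_Icc_right hx.2)).intervalIntegrable
      · exact hv.stronglyMeasurableAtFilter_nhdsWithin measurableSet_Icc x
    exact this.const_add _
  have hpol := polar_propagate (convex_Icc (0:ℝ) 1) (left_mem_Icc.2 zero_le_one) t.du t.dm hnz
    (θ := fun x => π / 2 + ∫ y in (0:ℝ)..x, v y) (fun x hx => (hθ x hx).congr_deriv (by
      simp only [v]; ring)) (by simp [h0, h1, hs.le]) (by simp [h1])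
  exact ⟨u, m, _, ⟨⟨t, hnz, hθ, fun x hx => (hpol x hx).1, fun x hx => (hpol x hx).2⟩, h0, h1,
    by simp⟩⟩

lemma RSol.θ_mono {s : ℝ} {u m θ : ℝ → ℝ} (S : RSol D ε ψ h s u m θ) (hε : 0 < ε)
    (Hψ : Shadow (phip D.q) ψ) (Hh : Shadow D.f h) : MonotoneOn θ (Icc 0 1) := by
  refine monotoneOn_Icc_of_deriv S.dθ fun x hx => div_nonneg ?_ (S.nz x (Ioo_subset_Icc_self hx)).le
  have h1 := Hh.mul_nonpos D.w.f0 D.w.mul_f_nonpos (u x)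
  have h2 := D.a_pos (Ioo_subset_Icc_self hx)
  have h3 : 0 ≤ m x * (ψ (m x) / ε) := by
    rw [← mul_div_assoc]
    exact div_nonneg (Hψ.mul_nonneg (phip_zero _) (fun t => by
      rw [phip_mul_self D.w.q1]; positivity) _) hε.le
  have h4 : D.a x / ε * (u x * h (u x)) ≤ 0 :=
    mul_nonpos_of_nonneg_of_nonpos (by positivity) h1
  linarith

lemma exists_rsol_bounds (D : Env) (hε : 0 < ε) : ∃ M B, ∀ ψ h, Shadow (phip D.q) ψ → Shadow D.f h →
    ∀ s ∈ Icc (0:ℝ) 1, ∀ u m θ, RSol D ε ψ h s u m θ → ∀ x ∈ Icc (0:ℝ) 1,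
      |u x| ≤ M ∧ |m x| ≤ M ∧ |ψ (m x) / ε| ≤ B ∧ |D.a x / ε * h (u x)| ≤ B ∧ |θ 0| ≤ M := by
  obtain ⟨C, hC0, hC⟩ := D.w.exists_bound_f
  have ham := D.amax_pos
  set M := D.amax / ε * C with hM
  have hM0 : 0 < M := by positivity
  obtain ⟨B, hB⟩ := (isCompact_Icc (a := -M) (b := M)).exists_bound_of_continuousOn
    (continuous_phip D.w.q1).continuousOn
  have hB0 : 0 ≤ B := (norm_nonneg _).trans (hB 0 ⟨by linarith, hM0.le⟩)
  refine ⟨M + 1 + B / ε + π / 2, M + B / ε, fun ψ h Hψ Hh s hs u m θ S => ?_⟩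
  have p0 := pi_pos
  have q0 : 0 ≤ B / ε := by positivity
  have hh : ∀ x ∈ Icc (0:ℝ) 1, |D.a x / ε * h (u x)| ≤ M := fun x hx => by
    have ha := D.a_pos hx
    have hai := D.hi x hx
    obtain ⟨y, -, -, -, h4, -⟩ := Hh.shadow (u x)
    rw [abs_mul, abs_of_pos (by positivity)]
    have := h4.trans (hC y)
    rw [hM]; gcongr
  have hm : ∀ x ∈ Icc (0:ℝ) 1, |m x| ≤ M := fun x hx => by
    have := lipschitz_of_deriv_bound S.dm hh x hx 0 (by simp)
    rw [S.m0, sub_zero, sub_zero, abs_of_nonneg hx.1] at this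
    nlinarith [hx.2]
  have hψ : ∀ x ∈ Icc (0:ℝ) 1, |ψ (m x) / ε| ≤ B / ε := fun x hx => by
    obtain ⟨y, h1, -, -, h4, -⟩ := Hψ.shadow (m x)
    rw [abs_div, abs_of_pos hε]
    have := h4.trans (hB y (abs_le.1 (h1.trans (hm x hx))))
    gcongr
  have hu : ∀ x ∈ Icc (0:ℝ) 1, |u x| ≤ 1 + B / ε := fun x hx => by
    have := lipschitz_of_deriv_bound S.du hψ x hx 0 (by simp)
    rw [S.u0, sub_zero, abs_of_nonneg hx.1] at this
    have h3 := abs_sub_abs_le_abs_sub (u x) s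
    rw [abs_of_nonneg hs.1] at h3
    nlinarith [hx.2, hs.2]
  intro x hx
  refine ⟨by linarith [hu x hx], by linarith [hm x hx], by linarith [hψ x hx],
    by linarith [hh x hx], ?_⟩
  rw [S.θ0, abs_of_pos (by positivity)]
  linarith

lemma RSol.compact {ψ h u m θ : ℕ → ℝ → ℝ} {s : ℕ → ℝ} {Ψ H : ℝ → ℝ} {S : ℝ} (hε : 0 < ε)
    (Hψ : ∀ n, Shadow (phip D.q) (ψ n)) (Hh : ∀ n, Shadow D.f (h n)) (hs : ∀ n, s n ∈ Icc (0:ℝ) 1)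
    (R : ∀ n, RSol D ε (ψ n) (h n) (s n) (u n) (m n) (θ n))
    (hψ : ContConv ψ Ψ univ) (hh : ContConv h H univ) (hsS : Tendsto s atTop (𝓝 S))
    (hnz : ∀ U N, Traj0 (fun t => Ψ t / ε) H (fun x => D.a x / ε) 0 1 U N → U 0 = S → N 0 = 0 →
      ∀ x ∈ Icc (0:ℝ) 1, 0 < U x ^ 2 + N x ^ 2) :
    ∃ φ : ℕ → ℕ, StrictMono φ ∧ ∃ U N Θ, RSol D ε Ψ H S U N Θ ∧
      ContConv (fun n => u (φ n)) U (Icc 0 1) ∧ ContConv (fun n => m (φ n)) N (Icc 0 1) ∧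
      ContConv (fun n => θ (φ n)) Θ (Icc 0 1) := by
  obtain ⟨M, B, hMB⟩ := exists_rsol_bounds D hε
  have bd := fun n => hMB _ _ (Hψ n) (Hh n) _ (hs n) _ _ _ (R n)
  have hψε : ContConv (fun n t => ψ n t / ε) (fun t => Ψ t / ε) univ := fun x hx =>
    (hψ x hx).div_const ε
  have hb : ContConv (fun _ x => D.a x / ε) (fun x => D.a x / ε) (Icc 0 1) :=
    ContConv.const (D.a_cont.div_const ε)
  have m0 : (0:ℝ) ∈ Icc (0:ℝ) 1 := by simp
  obtain ⟨φ, hφ, U, N, cU, cN, tr⟩ := Traj0.compact (fun n => (R n).toTraj0) hψε hh hb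
    (fun n x hx => (bd n x hx).1) (fun n x hx => (bd n x hx).2.1)
    (fun n x hx => (bd n x hx).2.2.1) (fun n x hx => (bd n x hx).2.2.2.1)
  have hU0 : U 0 = S := by
    refine tendsto_nhds_unique (cU.pointwise m0) ?_
    simpa [(R _).u0, Function.comp_def] using hsS.comp hφ.tendsto_atTop
  have hN0 : N 0 = 0 := by
    refine tendsto_nhds_unique (cN.pointwise m0) ?_
    simp [(R _).m0]
  have hnz' := hnz U N tr hU0 hN0
  have hco : ContinuousOn (fun x => U x ^ 2 + N x ^ 2) (Icc 0 1) :=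
    (cU.continuousOn.pow 2).add (cN.continuousOn.pow 2)
  obtain ⟨z, hz, hmin⟩ := isCompact_Icc.exists_isMinOn ⟨_, m0⟩ hco
  have hc := hnz' z hz
  have cUN : ContConv (fun n x => u (φ n) x ^ 2 + m (φ n) x ^ 2) (fun x => U x ^ 2 + N x ^ 2)
      (Icc 0 1) := fun x hx => ((cU x hx).pow 2).add ((cN x hx).pow 2)
  obtain ⟨n0, hn0⟩ := eventually_atTop.1 (cUN.eventually_forall isCompact_Icc
    (isOpen_Ioi (a := (U z ^ 2 + N z ^ 2) / 2)) fun x hx => by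
      have : U z ^ 2 + N z ^ 2 ≤ U x ^ 2 + N x ^ 2 := hmin hx
      rw [mem_Ioi]; linarith)
  have hsh : Tendsto (fun n => n + n0) atTop atTop := tendsto_add_atTop_nat n0
  have hφs : Tendsto (fun n => φ (n + n0)) atTop atTop := hφ.tendsto_atTop.comp hsh
  obtain ⟨χ, hχ, Θ, cΘ, trΘ⟩ := Traj.compact zero_le_one
    (fun n => (R (φ (n + n0))).toTraj) (hψε.subseq hφs) (hh.subseq hφs) (hb.subseq hφs)
    (fun n x hx => (bd _ x hx).1) (fun n x hx => (bd _ x hx).2.1)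
    (fun n x hx => (bd _ x hx).2.2.1) (fun n x hx => (bd _ x hx).2.2.2.1)
    (c := (U z ^ 2 + N z ^ 2) / 2) (by linarith)
    (fun n x hx => (hn0 (n + n0) (by omega) x hx).le)
    (fun n => (bd _ 0 m0).2.2.2.2) (cU.subseq hsh) (cN.subseq hsh)
  refine ⟨fun n => φ (χ n + n0), fun i j hij => hφ (by have := hχ hij; omega), U, N, Θ,
    ⟨trΘ, hU0, hN0, ?_⟩, (cU.subseq hsh).subseq hχ.tendsto_atTop,
    (cN.subseq hsh).subseq hχ.tendsto_atTop, cΘ⟩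
  refine tendsto_nhds_unique (cΘ.pointwise m0) ?_
  simp [(R _).θ0]

lemma RSol.unique (hε : 0 < ε) (Hψ : Shadow (phip D.q) ψ) (Hh : Shadow D.f h) {s : ℝ}
    {u m θ u' m' θ' : ℝ → ℝ} (S : RSol D ε ψ h s u m θ) (S' : RSol D ε ψ h s u' m' θ') :
    ∀ x ∈ Icc (0:ℝ) 1, u x = u' x ∧ m x = m' x ∧ θ x = θ' x := by
  obtain ⟨C, hC⟩ := exists_stability hε Hψ Hh
  have key : ∀ x ∈ Icc (0:ℝ) 1, u x = u' x ∧ m x = m' x := fun x hx => by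
    have := (hC _ _ _ _ S.toTraj0 S'.toTraj0 x hx).2
    simp only [S.u0, S'.u0, S.m0, S'.m0, sub_self] at this
    have e1 : (u x - u' x) ^ 2 ≤ 0 := by nlinarith [sq_nonneg (m x - m' x)]
    have e2 : (m x - m' x) ^ 2 ≤ 0 := by nlinarith [sq_nonneg (u x - u' x)]
    have := pow_eq_zero_iff (two_ne_zero) |>.1 (le_antisymm e1 (sq_nonneg _))
    have := pow_eq_zero_iff (two_ne_zero) |>.1 (le_antisymm e2 (sq_nonneg _))
    constructor <;> linarith
  intro x hx
  refine ⟨(key x hx).1, (key x hx).2, ?_⟩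
  have := const_of_deriv_zero (fun x hx => (S.dθ x hx).sub (S'.dθ x hx)) (fun x hx => by
    obtain ⟨e1, e2⟩ := key x (Ioo_subset_Icc_self hx)
    rw [e1, e2, sub_self]) hx (left_mem_Icc.2 zero_le_one)
  simp only [Pi.sub_apply, S.θ0, S'.θ0, sub_self] at this
  linarith

lemma rsol_one (D : Env) (Hψ : Shadow (phip D.q) ψ) (Hh : Shadow D.f h) :
    RSol D ε ψ h 1 (fun _ => 1) (fun _ => 0) (fun _ => π / 2) where
  toTraj0 := traj0_zero Hψ Hh (by simp) (D.w.fout 1 (by simp))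
  nz := by simp
  dθ x _ := by
    simpa [Hh.zero (x := 1) (by simp) (D.w.fout 1 (by simp))] using
      hasDerivWithinAt_const x _ (π / 2)
  polu := by simp
  polm := by simp
  u0 := rfl
  m0 := rfl
  θ0 := rfl

lemma RSol.continuousOn_param (hε : 0 < ε) (Hψ : Shadow (phip D.q) ψ) (Hh : Shadow D.f h)
    {u m θ : ℝ → ℝ → ℝ} (R : ∀ s ∈ Ioc (0:ℝ) 1, RSol D ε ψ h s (u s) (m s) (θ s)) {x : ℝ}
    (hx : x ∈ Icc (0:ℝ) 1) : ContinuousOn (fun s => u s x) (Ioc 0 1) ∧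
      ContinuousOn (fun s => m s x) (Ioc 0 1) ∧ ContinuousOn (fun s => θ s x) (Ioc 0 1) := by
  have key : ∀ (S : ℝ), S ∈ Ioc (0:ℝ) 1 → ∀ s : ℕ → ℝ, (∀ n, s n ∈ Ioc (0:ℝ) 1) →
      Tendsto s atTop (𝓝 S) → ∃ φ : ℕ → ℕ, Tendsto (fun n => u (s (φ n)) x) atTop (𝓝 (u S x)) ∧
      Tendsto (fun n => m (s (φ n)) x) atTop (𝓝 (m S x)) ∧
      Tendsto (fun n => θ (s (φ n)) x) atTop (𝓝 (θ S x)) := fun S hS s hs hsS => by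
    obtain ⟨φ, -, U, N, Θ, R', cU, cN, cΘ⟩ := RSol.compact hε (fun _ => Hψ) (fun _ => Hh)
      (fun n => Ioc_subset_Icc_self (hs n)) (fun n => R (s n) (hs n))
      (ContConv.const Hψ.cont.continuousOn) (ContConv.const Hh.cont.continuousOn) hsS
      (fun U N t h0 h1 => nz_of_lipschitz hε Hψ Hh hS.1 t h0 h1)
    obtain ⟨e1, e2, e3⟩ := RSol.unique hε Hψ Hh R' (R S hS) x hx
    exact ⟨φ, e1 ▸ cU.pointwise hx, e2 ▸ cN.pointwise hx, e3 ▸ cΘ.pointwise hx⟩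
  have lift : ∀ g : ℝ → ℝ, (∀ (S : ℝ), S ∈ Ioc (0:ℝ) 1 → ∀ s : ℕ → ℝ, (∀ n, s n ∈ Ioc (0:ℝ) 1) →
      Tendsto s atTop (𝓝 S) → ∃ φ : ℕ → ℕ, Tendsto (fun n => g (s (φ n))) atTop (𝓝 (g S))) →
      ContinuousOn g (Ioc 0 1) := fun g hg S hS => by
    refine tendsto_of_subseq_tendsto fun s hs => ?_
    rw [tendsto_nhdsWithin_iff] at hs
    obtain ⟨n0, hn0⟩ := eventually_atTop.1 hs.2
    obtain ⟨φ, hφ⟩ := hg S hS (fun n => s (n + n0)) (fun n => hn0 _ (by omega))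
      (hs.1.comp (tendsto_add_atTop_nat n0))
    exact ⟨fun n => φ n + n0, hφ⟩
  refine ⟨lift _ fun S hS s hs h => ?_, lift _ fun S hS s hs h => ?_, lift _ fun S hS s hs h => ?_⟩
  · obtain ⟨φ, h1, -, -⟩ := key S hS s hs h
    exact ⟨φ, h1⟩
  · obtain ⟨φ, -, h1, -⟩ := key S hS s hs h
    exact ⟨φ, h1⟩
  · obtain ⟨φ, -, -, h1⟩ := key S hS s hs h
    exact ⟨φ, h1⟩

end Flow

lemma Sys.nz {D : Env} {ε : ℝ} {u m : ℝ → ℝ} (S : Sys D.q D.f D.a ε 0 1 u m)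
    (e0 : en D.q D.F D.a u m 0 < D.W0) : ∀ x ∈ Icc (0:ℝ) 1, 0 < u x ^ 2 + m x ^ 2 := by
  intro x hx
  have hbd : ∀ x ∈ Icc (0:ℝ) 1, |-(D.a' x * |m x| ^ D.q / (D.q * D.a x ^ 2))| ≤
      D.rate * (D.W0 - en D.q D.F D.a u m x) := fun x hx => by
    have ha := D.a_pos hx
    have hq := D.q0
    have h0 : 0 ≤ |m x| ^ D.q / (D.q * D.a x) := by positivity
    rw [abs_neg, Sol.den_eq hx, abs_mul, abs_of_nonneg h0, abs_div, abs_of_pos ha]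
    have h1 : |m x| ^ D.q / (D.q * D.a x) ≤ D.W0 - en D.q D.F D.a u m x := by
      have := D.w.F_le (u x)
      rw [en]; linarith
    have h2 := D.a'bd x hx
    have h3 := D.lo x hx
    have h4 := D.A_nonneg
    have h5 := D.amin_pos
    unfold Env.rate
    gcongr
  have h := (gronwall_two_sided (g := fun x => D.W0 - en D.q D.F D.a u m x) (C := D.rate)
    (fun x hx => (S.en_deriv D.w (fun _ h => D.a_pos h) D.da hx).const_sub D.W0) hbd
    (left_mem_Icc.2 zero_le_one) hx hx.1).1
  have h1 : 0 < (D.W0 - en D.q D.F D.a u m 0) * exp (-(D.rate * (x - 0))) :=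
    mul_pos (by linarith) (exp_pos _)
  by_contra hc
  have hu : u x = 0 := by nlinarith [sq_nonneg (u x), sq_nonneg (m x)]
  have hm : m x = 0 := by nlinarith [sq_nonneg (u x), sq_nonneg (m x)]
  have : en D.q D.F D.a u m x = D.W0 := by
    rw [en, hu, hm, D.w.F0, abs_zero, zero_rpow D.q0.ne', zero_div, sub_zero]
  linarith

lemma ContConv.energy {D : Env} {u m : ℕ → ℝ → ℝ} {U N : ℝ → ℝ} (cU : ContConv u U (Icc 0 1))
    (cN : ContConv m N (Icc 0 1)) :
    ContConv (fun n => en D.q D.F D.a (u n) (m n)) (en D.q D.F D.a U N) (Icc 0 1) := fun x hx => by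
  have ha := D.a_pos hx
  have hq := D.q0
  have h1 := (D.w.Fcont.tendsto (U x)).comp (cU x hx)
  have h2 := ((continuous_abs_rpow hq.le).tendsto (N x)).comp (cN x hx)
  have h3 := ((ContConv.const D.a_cont x hx).const_mul D.q)
  exact h1.sub (h2.div h3 (by positivity))

/-- Conditions on angles and energies that are open with respect to continuous convergence. -/
def OpenPred (P : (ℝ → ℝ) → (ℝ → ℝ) → (ℝ → ℝ) → (ℝ → ℝ) → Prop) : Prop :=
  ∀ (g e g' e' : ℕ → ℝ → ℝ) (G E G' E' : ℝ → ℝ), ContConv g G (Icc 0 1) → ContConv e E (Icc 0 1) →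
    ContConv g' G' (Icc 0 1) → ContConv e' E' (Icc 0 1) → P G E G' E' →
    ∃ n, P (g n) (e n) (g' n) (e' n)

/-- Angles and energies of the regularized flow as functions of the initial value. -/
structure Shoot (D : Env) (sa : ℝ) (th e : ℝ → ℝ → ℝ) : Prop where
  cth : ∀ x ∈ Icc (0:ℝ) 1, ContinuousOn (fun s => th s x) (Icc sa 1)
  ce : ∀ x ∈ Icc (0:ℝ) 1, ContinuousOn (fun s => e s x) (Icc sa 1)
  mono : ∀ s ∈ Icc sa 1, MonotoneOn (th s) (Icc 0 1)
  th0 : ∀ s ∈ Icc sa 1, th s 0 = π / 2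
  one : ∀ x ∈ Icc (0:ℝ) 1, th 1 x = π / 2
  e0 : ∀ s ∈ Icc sa 1, e s 0 = D.F s

lemma exists_subseq_of_mem {s : ℕ → ℝ} {α β : ℝ} (hs : ∀ n, s n ∈ Icc α β) :
    ∃ S ∈ Icc α β, ∃ φ : ℕ → ℕ, StrictMono φ ∧ Tendsto (fun n => s (φ n)) atTop (𝓝 S) :=
  isCompact_Icc.tendsto_subseq hs

lemma exists_shoot (D : Env) {sa : ℝ} (hsa : sa ∈ Ioo (0:ℝ) 1) (hF : D.F sa = D.W0 - D.γ) :
    ∃ th e : ℝ → ℕ → ℝ → ℝ → ℝ, ∀ ε, 0 < ε → (∀ n, Shoot D sa (th ε n) (e ε n)) ∧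
      ∀ P, OpenPred P → (∀ u m θ u' m' θ', Sol D ε u m θ → Sol D ε u' m' θ' →
        P θ (en D.q D.F D.a u m) θ' (en D.q D.F D.a u' m')) →
      ∀ᶠ n in atTop, ∀ s ∈ Icc sa 1, ∀ s' ∈ Icc sa 1,
        P (th ε n s) (e ε n s) (th ε n s') (e ε n s') := by
  obtain ⟨ψ, Hψ, cψ⟩ := exists_shadow_seq (continuous_phip D.w.q1)
  obtain ⟨h, Hh, ch⟩ := exists_shadow_seq D.w.fcont
  have ex : ∀ ε n s, ∃ u m θ, 0 < ε → 0 < s → RSol D ε (ψ n) (h n) s u m θ := fun ε n s => by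
    by_cases hε : 0 < ε
    · by_cases hs : 0 < s
      · obtain ⟨u, m, θ, H⟩ := exists_rsol (D := D) hε (Hψ n) (Hh n) hs
        exact ⟨u, m, θ, fun _ _ => H⟩
      · exact ⟨0, 0, 0, fun _ h => absurd h hs⟩
    · exact ⟨0, 0, 0, fun h => absurd h hε⟩
  choose u m th R using ex
  refine ⟨th, fun ε n s => en D.q D.F D.a (u ε n s) (m ε n s), fun ε hε => ⟨fun n => ?_, ?_⟩⟩
  · have hsub : Icc sa 1 ⊆ Ioc (0:ℝ) 1 := fun s hs => ⟨hsa.1.trans_le hs.1, hs.2⟩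
    have cont := fun x hx => RSol.continuousOn_param (D := D) (x := x) hε (Hψ n) (Hh n)
      (fun s hs => R ε n s hε hs.1) hx
    have hR := fun s (hs : s ∈ Icc sa 1) => R ε n s hε (hsub hs).1
    refine ⟨fun x hx => (cont x hx).2.2.mono hsub, fun x hx => ?_,
      fun s hs => (hR s hs).θ_mono hε (Hψ n) (Hh n), fun s hs => (hR s hs).θ0,
      fun x hx => (RSol.unique hε (Hψ n) (Hh n) (R ε n 1 hε one_pos) (rsol_one D (Hψ n) (Hh n))
        x hx).2.2, fun s hs => ?_⟩
    · refine ContinuousOn.mono ?_ hsub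
      exact (D.w.Fcont.comp_continuousOn (cont x hx).1).sub
        (((continuous_abs_rpow D.q0.le).comp_continuousOn (cont x hx).2.1).div_const _)
    · change en D.q D.F D.a (u ε n s) (m ε n s) 0 = D.F s
      rw [en, (hR s hs).u0, (hR s hs).m0, abs_zero, zero_rpow D.q0.ne', zero_div, sub_zero]
  · intro P hP hsol
    by_contra hc
    obtain ⟨φ, hφ, hbad⟩ := extraction_of_frequently_atTop (not_eventually.1 hc)
    push Not at hbad
    choose s hs s' hs' hbad using hbad
    have hI : ∀ {s}, s ∈ Icc sa 1 → s ∈ Icc (0:ℝ) 1 := fun h => ⟨hsa.1.le.trans h.1, h.2⟩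
    have hnz : ∀ S ∈ Icc sa 1, D.F S ≤ D.W0 - D.γ := fun S hS => by
      rw [← hF]
      exact D.w.antitoneOn hsa.1.le (hsa.1.le.trans hS.1) hS.1
    have hlim : ∀ (χ : ℕ → ℕ) (t : ℕ → ℝ), StrictMono χ → (∀ n, t n ∈ Icc sa 1) →
        ∃ ω : ℕ → ℕ, StrictMono ω ∧ ∃ U N Θ, Sol D ε U N Θ ∧
        ContConv (fun n => u ε (χ (ω n)) (t (ω n))) U (Icc 0 1) ∧
        ContConv (fun n => m ε (χ (ω n)) (t (ω n))) N (Icc 0 1) ∧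
        ContConv (fun n => th ε (χ (ω n)) (t (ω n))) Θ (Icc 0 1) := by
      intro χ t hχ ht
      obtain ⟨S, hS, ω, hω, hωS⟩ := exists_subseq_of_mem ht
      have hen : ∀ {U N : ℝ → ℝ}, U 0 = S → N 0 = 0 →
          en D.q D.F D.a U N 0 ≤ D.W0 - D.γ := fun h0 h1 => by
        rw [en, h0, h1, abs_zero, zero_rpow D.q0.ne', zero_div, sub_zero]
        exact hnz S hS
      have hχω := (hχ.comp hω).tendsto_atTop
      obtain ⟨ρ, hρ, U, N, Θ, RS, cU, cN, cΘ⟩ := RSol.compact (D := D) hε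
        (fun n => Hψ (χ (ω n))) (fun n => Hh (χ (ω n))) (fun n => hI (ht (ω n)))
        (fun n => R ε (χ (ω n)) (t (ω n)) hε (hsa.1.trans_le (ht _).1)) (cψ.subseq hχω)
        (ch.subseq hχω) hωS (fun U N tr h0 h1 => Sys.nz (ε := ε) tr (by
          have := hen h0 h1
          linarith [D.γ_pos]))
      exact ⟨fun n => ω (ρ n), hω.comp hρ, U, N, Θ, ⟨RS.toTraj, by
        rw [RS.u0, abs_of_nonneg (hI hS).1]; exact hS.2, RS.m0, RS.θ0, hen RS.u0 RS.m0⟩, cU, cN, cΘ⟩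
    obtain ⟨ω, hω, U, N, Θ, hS, cU, cN, cΘ⟩ := hlim φ s hφ hs
    obtain ⟨ω', hω', U', N', Θ', hS', cU', cN', cΘ'⟩ := hlim (fun n => φ (ω n)) (fun n => s' (ω n))
      (hφ.comp hω) (fun n => hs' _)
    obtain ⟨n, hn⟩ := hP _ _ _ _ _ _ _ _ (cΘ.subseq hω'.tendsto_atTop)
      ((cU.subseq hω'.tendsto_atTop).energy (D := D) (cN.subseq hω'.tendsto_atTop)) cΘ'
      (cU'.energy (D := D) cN') (hsol _ _ _ _ _ _ hS hS')
    exact hbad _ hn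

lemma eq_of_mem_uIcc_of_abs_le {t b s : ℝ} (hs : s ∈ uIcc t b) (h : |t - b| ≤ |s - b|) : s = t := by
  rcases le_total t b with htb | htb
  · rw [uIcc_of_le htb] at hs
    rw [abs_of_nonpos (by linarith), abs_of_nonpos (by linarith [hs.2])] at h
    linarith [hs.1]
  · rw [uIcc_of_ge htb] at hs
    rw [abs_of_nonneg (by linarith), abs_of_nonneg (by linarith [hs.1])] at h
    linarith [hs.2]

lemma exists_last_le {g : ℝ → ℝ} {α β c : ℝ} (hg : ContinuousOn g (uIcc α β)) (hα : g α ≤ c)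
    (hβ : c ≤ g β) : ∃ t ∈ uIcc α β, g t = c ∧ ∀ s ∈ uIcc t β, c ≤ g s := by
  have hcl : IsCompact {s ∈ uIcc α β | g s ≤ c} :=
    isCompact_uIcc.of_isClosed_subset
      (hg.preimage_isClosed_of_isClosed isClosed_Icc isClosed_Iic) fun s hs => hs.1
  obtain ⟨t, ht, hmin⟩ := hcl.exists_isMinOn ⟨α, left_mem_uIcc, hα⟩
    (f := fun s => |s - β|) (by fun_prop)
  have hsub : uIcc t β ⊆ uIcc α β := uIcc_subset_uIcc ht.1 right_mem_uIcc
  have hgt : g t = c := by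
    by_contra hne
    have hlt : g t < c := lt_of_le_of_ne ht.2 hne
    obtain ⟨r, hr, hrc⟩ := intermediate_value_uIcc (hg.mono hsub)
      (show c ∈ uIcc (g t) (g β) by rw [uIcc_of_le (hlt.le.trans hβ)]; exact ⟨hlt.le, hβ⟩)
    have : r = t := eq_of_mem_uIcc_of_abs_le hr (hmin ⟨hsub hr, hrc.le⟩)
    rw [this] at hrc
    exact hne hrc
  refine ⟨t, ht.1, hgt, fun s hs => ?_⟩
  by_contra hlt
  push Not at hlt
  have : s = t := eq_of_mem_uIcc_of_abs_le hs (hmin ⟨hsub hs, hlt.le⟩)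
  rw [this, hgt] at hlt
  exact lt_irrefl _ hlt

lemma exists_last_ge {g : ℝ → ℝ} {α β c : ℝ} (hg : ContinuousOn g (uIcc α β)) (hα : c ≤ g α)
    (hβ : g β ≤ c) : ∃ t ∈ uIcc α β, g t = c ∧ ∀ s ∈ uIcc t β, g s ≤ c := by
  obtain ⟨t, h1, h2, h3⟩ := exists_last_le (g := fun s => -g s) (c := -c) hg.neg (by linarith)
    (by linarith)
  exact ⟨t, h1, by linarith, fun s hs => by linarith [h3 s hs]⟩

/-- An arc of initial values on which the energy follows `E` up to `z`, one end turning soon after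
`z` and the other end being trapped. -/
structure Exit (sa : ℝ) (E : ℝ → ℝ) (δ z y : ℝ) (th e : ℝ → ℝ → ℝ) (σ τ : ℝ) (k : ℤ) : Prop where
  σ_mem : σ ∈ Icc sa 1
  τ_mem : τ ∈ Icc sa 1
  le : ∀ s ∈ uIcc σ τ, k * π ≤ th s z
  near : ∀ s ∈ uIcc σ τ, ∀ x ∈ Icc 0 z, |e s x - E x| ≤ δ
  turn : (k + 1) * π ≤ th σ y
  trap : th τ 1 ≤ k * π + π / 2

/-- An arc of initial values on which the energy follows `E` up to `z`, whose ends have rotations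
differing by more than three half turns. -/
structure Sweep (sa : ℝ) (E : ℝ → ℝ) (δ xs z lo hi : ℝ) (th e : ℝ → ℝ → ℝ) (α β : ℝ) : Prop where
  α_mem : α ∈ Icc sa 1
  β_mem : β ∈ Icc sa 1
  near : ∀ s ∈ uIcc α β, ∀ x ∈ Icc 0 z, |e s x - E x| ≤ δ
  mem : ∀ s ∈ uIcc α β, e s xs ∈ Icc lo hi
  gap : th α z + 3 * π < th β z

section

variable {D : Env} {sa δ z y z1 xs z2 lo hi σ τ α β : ℝ} {E : ℝ → ℝ} {th e : ℝ → ℝ → ℝ} {k : ℤ}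

lemma uIcc_sub (hσ : σ ∈ Icc sa 1) (hτ : τ ∈ Icc sa 1) : uIcc σ τ ⊆ Icc sa 1 :=
  uIcc_subset_Icc hσ hτ

/-- Reaching the neighbourhood of the level `[lo, hi]` from an arc whose ends lie on both sides. -/
lemma Shoot.sweep (S : Shoot D sa th e) (hσ : σ ∈ Icc sa 1) (hτ : τ ∈ Icc sa 1)
    (hxs : xs ∈ Icc (0:ℝ) 1)
    (hlh : lo ≤ hi) (hhi : hi < e σ xs) (hlo : e τ xs < lo)
    (hθ : ∀ s ∈ uIcc σ τ, ∀ s' ∈ uIcc σ τ, |th s z1 - th s' z1| ≤ π)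
    (hθz : ∀ s ∈ uIcc σ τ, th s z1 - th s z ≤ π)
    (hnear : ∀ s ∈ uIcc σ τ, ∀ x ∈ Icc 0 z, |e s x - E x| ≤ δ)
    (rot : ∀ s ∈ Icc sa 1, ∀ s' ∈ Icc sa 1, e s xs = lo → e s' xs = hi →
      |th s z1 - th s' z1| ≤ π → th s z2 + 3 * π < th s' z2)
    (close : ∀ s ∈ Icc sa 1, th s z1 - th s z ≤ π → e s xs ∈ Icc lo hi →
      ∀ x ∈ Icc z z2, |e s x - E x| < δ) :
    ∃ α β, Sweep sa E δ xs z2 lo hi th e α β := by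
  have c1 := (S.ce xs hxs).mono (uIcc_sub hσ hτ)
  obtain ⟨β, hβ, hβe, hβle⟩ := exists_last_ge c1 hhi.le (hlo.le.trans hlh)
  have s1 : uIcc β τ ⊆ uIcc σ τ := uIcc_subset_uIcc hβ right_mem_uIcc
  obtain ⟨α, hα, hαe, hαle⟩ := exists_last_le (α := τ) (β := β) (by rw [uIcc_comm]; exact c1.mono s1)
    hlo.le (by rw [hβe]; exact hlh)
  rw [uIcc_comm] at hα
  have s2 : uIcc α β ⊆ uIcc β τ := uIcc_subset_uIcc hα left_mem_uIcc
  have s3 := s2.trans s1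
  have s4 := s3.trans (uIcc_sub hσ hτ)
  have hmem : ∀ s ∈ uIcc α β, e s xs ∈ Icc lo hi := fun s hs => ⟨hαle s hs, hβle s (s2 hs)⟩
  refine ⟨α, β, s4 left_mem_uIcc, s4 right_mem_uIcc, fun s hs x hx => ?_, hmem, ?_⟩
  · rcases le_total x z with h | h
    · exact hnear s (s3 hs) x ⟨hx.1, h⟩
    · exact (close s (s4 hs) (hθz s (s3 hs)) (hmem s hs) x ⟨h, hx.2⟩).le
  · exact rot α (s4 left_mem_uIcc) β (s4 right_mem_uIcc) hαe hβe
      (hθ _ (s3 left_mem_uIcc) _ (s3 right_mem_uIcc))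

lemma sin_eq_zero_of_eq {t : ℝ} {k : ℤ} (h : t = k * π) : sin t = 0 := by
  rw [h]; exact sin_int_mul_pi k

/-- Entering a hill from an exit arc. -/
lemma Exit.sweep (S : Shoot D sa th e) (X : Exit sa E δ z z1 th e σ τ k)
    (hxs : xs ∈ Icc (0:ℝ) 1) (hz : 0 ≤ z) (h1 : z ≤ z1) (h1' : z1 ≤ 1)
    (hlh : lo ≤ hi)
    (enter : ∀ s ∈ Icc sa 1, sin (th s z1) = 0 → hi < e s xs)
    (stay : ∀ s ∈ Icc sa 1, th s 1 - th s z ≤ π → e s xs < lo)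
    (rot : ∀ s ∈ Icc sa 1, ∀ s' ∈ Icc sa 1, e s xs = lo → e s' xs = hi →
      |th s z1 - th s' z1| ≤ π → th s z2 + 3 * π < th s' z2)
    (close : ∀ s ∈ Icc sa 1, th s z1 - th s z ≤ π → e s xs ∈ Icc lo hi →
      ∀ x ∈ Icc z z2, |e s x - E x| < δ) :
    ∃ α β, Sweep sa E δ xs z2 lo hi th e α β := by
  have hp := pi_pos
  have hz1 : z1 ∈ Icc (0:ℝ) 1 := ⟨hz.trans h1, h1'⟩
  have hz' : z ∈ Icc (0:ℝ) 1 := ⟨hz, h1.trans h1'⟩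
  have sub := uIcc_sub X.σ_mem X.τ_mem
  have m1 : th τ z1 ≤ th τ 1 := S.mono τ X.τ_mem hz1 (right_mem_Icc.2 zero_le_one) h1'
  have htr := X.trap
  obtain ⟨σ', hσ', he, hle⟩ := exists_last_ge ((S.cth z1 hz1).mono sub) X.turn (by linarith)
  have s1 : uIcc σ' τ ⊆ uIcc σ τ := uIcc_subset_uIcc hσ' right_mem_uIcc
  have hzz : ∀ s ∈ uIcc σ' τ, k * π ≤ th s z1 := fun s hs =>
    (X.le s (s1 hs)).trans (S.mono s (sub (s1 hs)) hz' hz1 h1)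
  refine S.sweep (sub hσ') X.τ_mem hxs hlh
    (enter σ' (sub hσ') (sin_eq_zero_of_eq (k := k + 1) (by rw [he]; push_cast; ring)))
    (stay τ X.τ_mem ?_) (fun s hs s' hs' => ?_) (fun s hs => ?_) (fun s hs => X.near s (s1 hs))
    rot close
  · have := X.le τ right_mem_uIcc
    linarith
  · rw [abs_le]
    constructor <;> linarith [hzz s hs, hzz s' hs', hle s hs, hle s' hs']
  · linarith [X.le s (s1 hs), hle s hs]

/-- Entering a hill at the left end point of the interval. -/
lemma Shoot.sweep_start (S : Shoot D sa th e) (hsa : sa ≤ 1) (hlh : lo ≤ hi)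
    (hE : E 0 ∈ Ico hi (D.F sa)) (hlo : 0 < lo)
    (rot : ∀ s ∈ Icc sa 1, ∀ s' ∈ Icc sa 1, e s 0 = lo → e s' 0 = hi →
      |th s 0 - th s' 0| ≤ π → th s z2 + 3 * π < th s' z2)
    (close : ∀ s ∈ Icc sa 1, th s 0 - th s 0 ≤ π → e s 0 ∈ Icc lo hi →
      ∀ x ∈ Icc 0 z2, |e s x - E x| < δ) :
    ∃ α β, Sweep sa E δ 0 z2 lo hi th e α β := by
  have hp := pi_pos
  have m0 : sa ∈ Icc sa 1 := ⟨le_rfl, hsa⟩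
  have m1 : (1:ℝ) ∈ Icc sa 1 := ⟨hsa, le_rfl⟩
  have z0 : (0:ℝ) ∈ Icc (0:ℝ) 1 := by simp
  have c1 : ContinuousOn (fun s => e s 0) (uIcc sa 1) := (S.ce 0 z0).mono (uIcc_sub m0 m1)
  have e1 : e sa 0 = D.F sa := S.e0 sa m0
  have e2 : e 1 0 = 0 := by rw [S.e0 1 m1, D.w.Fout 1 (by simp)]
  obtain ⟨β, hβ, hβe, hβle⟩ := exists_last_ge c1 (c := hi) (by rw [e1]; linarith [hE.1, hE.2])
    (by rw [e2]; linarith)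
  have s1 : uIcc β 1 ⊆ uIcc sa 1 := uIcc_subset_uIcc hβ right_mem_uIcc
  obtain ⟨α, hα, hαe, hαle⟩ := exists_last_le (α := 1) (β := β) (by rw [uIcc_comm]; exact c1.mono s1)
    (c := lo) (by rw [e2]; exact hlo.le) (by rw [hβe]; exact hlh)
  rw [uIcc_comm] at hα
  have s2 : uIcc α β ⊆ uIcc β 1 := uIcc_subset_uIcc hα left_mem_uIcc
  have s4 := (s2.trans s1).trans (uIcc_sub m0 m1)
  have hmem : ∀ s ∈ uIcc α β, e s 0 ∈ Icc lo hi := fun s hs => ⟨hαle s hs, hβle s (s2 hs)⟩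
  refine ⟨α, β, s4 left_mem_uIcc, s4 right_mem_uIcc, fun s hs x hx => ?_, hmem, ?_⟩
  · exact (close s (s4 hs) (by linarith) (hmem s hs) x hx).le
  · refine rot α (s4 left_mem_uIcc) β (s4 right_mem_uIcc) hαe hβe ?_
    rw [S.th0 _ (s4 left_mem_uIcc), S.th0 _ (s4 right_mem_uIcc)]
    simpa using hp.le

/-- Leaving a hill. -/
lemma Sweep.exit (S : Shoot D sa th e) (B : Sweep sa E δ xs z2 lo hi th e α β)
    (hz2 : 0 ≤ z2) (hy : z2 ≤ y) (hy1 : y ≤ 1)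
    (leave : ∀ s ∈ Icc sa 1, sin (th s z2) = 0 → e s xs ∈ Icc lo hi → th s 1 < th s z2 + π / 2) :
    ∃ σ τ k, Exit sa E δ z2 y th e σ τ k := by
  have hp := pi_pos
  have sub := uIcc_sub B.α_mem B.β_mem
  have hz : z2 ∈ Icc (0:ℝ) 1 := ⟨hz2, hy.trans hy1⟩
  set k := ⌈th α z2 / π⌉ with hk
  have k1 : th α z2 ≤ k * π := by
    rw [← div_le_iff₀ hp]; exact Int.le_ceil _
  have k2 : k * π < th α z2 + π := by
    have := Int.ceil_lt_add_one (th α z2 / π)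
    calc k * π < (th α z2 / π + 1) * π := by gcongr
      _ = _ := by field_simp
  have g := B.gap
  obtain ⟨τ, hτ, hτe, hτle⟩ := exists_last_le ((S.cth z2 hz).mono sub) k1 (by linarith)
  have s1 : uIcc β τ ⊆ uIcc α β := by
    rw [uIcc_comm]; exact uIcc_subset_uIcc hτ right_mem_uIcc
  refine ⟨β, τ, k, B.β_mem, sub hτ, fun s hs => hτle s (by rwa [uIcc_comm]),
    fun s hs => B.near s (s1 hs), ?_, ?_⟩
  · have := S.mono β B.β_mem hz ⟨hz2.trans hy, hy1⟩ hy
    linarith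
  · have := leave τ (sub hτ) (sin_eq_zero_of_eq hτe) (B.mem τ hτ)
    rw [hτe] at this
    exact this.le

lemma cos_half_turn (k : ℤ) : cos (k * π + π / 2) = 0 := by
  rw [cos_add_pi_div_two, sin_int_mul_pi, neg_zero]

/-- Ending on a hill that touches the right end point. -/
lemma Sweep.finish (S : Shoot D sa th e) (B : Sweep sa E δ xs 1 lo hi th e α β) :
    ∃ s ∈ Icc sa 1, cos (th s 1) = 0 ∧ ∀ x ∈ Icc (0:ℝ) 1, |e s x - E x| ≤ δ := by
  have hp := pi_pos
  have sub := uIcc_sub B.α_mem B.β_mem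
  set k := ⌈th α 1 / π⌉ with hk
  have k1 : th α 1 ≤ k * π := by
    rw [← div_le_iff₀ hp]; exact Int.le_ceil _
  have k2 : k * π < th α 1 + π := by
    have := Int.ceil_lt_add_one (th α 1 / π)
    calc k * π < (th α 1 / π + 1) * π := by gcongr
      _ = _ := by field_simp
  have g := B.gap
  obtain ⟨τ, hτ, hτe, -⟩ := exists_last_le ((S.cth 1 (by simp)).mono sub) (c := k * π + π / 2)
    (by linarith) (by linarith)
  exact ⟨τ, sub hτ, by rw [hτe]; exact cos_half_turn k, B.near τ hτ⟩

/-- Ending in a region of small energy. -/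
lemma Exit.finish (S : Shoot D sa th e) (X : Exit sa E δ z 1 th e σ τ k)
    (flat : ∀ s ∈ Icc sa 1, th s 1 - th s z ≤ π → ∀ x ∈ Icc z 1, |e s x - E x| < δ) :
    ∃ s ∈ Icc sa 1, cos (th s 1) = 0 ∧ ∀ x ∈ Icc (0:ℝ) 1, |e s x - E x| ≤ δ := by
  have hp := pi_pos
  have sub := uIcc_sub X.σ_mem X.τ_mem
  obtain ⟨s, hs, hse, -⟩ := exists_last_ge ((S.cth 1 (by simp)).mono sub) (c := k * π + π / 2)
    (by linarith [X.turn]) X.trap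
  refine ⟨s, sub hs, by rw [hse]; exact cos_half_turn k, fun x hx => ?_⟩
  rcases le_total x z with h | h
  · exact X.near s hs x ⟨hx.1, h⟩
  · exact (flat s (sub hs) (by linarith [X.le s hs]) x ⟨h, hx.2⟩).le

lemma Shoot.exit_start (S : Shoot D sa th e) (hsa : sa ≤ 1) (hy : π < th sa y) (hE : E 0 = 0)
    (hF : D.F sa ≤ δ) (h0 : 0 ≤ sa) : ∃ σ τ k, Exit sa E δ 0 y th e σ τ k := by
  have hp := pi_pos
  have m0 : sa ∈ Icc sa 1 := ⟨le_rfl, hsa⟩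
  have m1 : (1:ℝ) ∈ Icc sa 1 := ⟨hsa, le_rfl⟩
  refine ⟨sa, 1, 0, m0, m1, fun s hs => ?_, fun s hs x hx => ?_, ?_, ?_⟩
  · rw [S.th0 s (uIcc_sub m0 m1 hs)]; push_cast; linarith
  · have hs' := uIcc_sub m0 m1 hs
    obtain rfl : x = 0 := le_antisymm hx.2 hx.1
    rw [S.e0 s hs', hE, sub_zero, abs_of_nonneg (D.w.F_nonneg s)]
    exact (D.w.antitoneOn h0 (h0.trans hs'.1) hs'.1).trans hF
  · push_cast; linarith
  · rw [S.one 1 (by simp)]; push_cast; linarith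

end

section Geometry
variable {D : Env} {E : ℝ → ℝ} {δ x1 xs z1 y1 y2 z2 c c' : ℝ}

lemma Env.G_cont (D : Env) : ContinuousOn D.G (Ioo 0 D.W0) := fun _ hξ =>
  (D.k.G_deriv D.w hξ).continuousAt.continuousWithinAt

lemma Env.exists_G_eq (D : Env) {ξ η g : ℝ} (hξ : ξ ∈ Ioo 0 D.W0) (hη : η ∈ Ioo 0 D.W0)
    (h1 : D.G ξ < g) (h2 : g < D.G η) : ∃ ζ ∈ Ioo 0 D.W0, D.G ζ = g := by
  have h := (D.G_lt_iff hξ hη).1 (h1.trans h2)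
  have hs : Icc ξ η ⊆ Ioo 0 D.W0 := Icc_subset_Ioo hξ.1 hη.2
  obtain ⟨ζ, hζ, e⟩ := intermediate_value_Icc h.le (D.G_cont.mono hs) ⟨h1.le, h2.le⟩
  exact ⟨ζ, hs hζ, e⟩

lemma Prof.floor_left (P : Prof D E) (h0 : 0 ≤ x1) (h1 : x1 < xs) (h2 : xs ≤ 1)
    (hz : E x1 = 0) (hpos : ∀ x ∈ Ioc x1 xs, 0 < E x) :
    (∀ g > D.G (E xs) - D.lg xs + D.lg x1, ∃ ξ ∈ Ioo 0 D.W0, D.G ξ < g) ∧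
    ∀ ξ ∈ Ioo 0 D.W0, D.G (E xs) - D.lg xs + D.lg x1 < D.G ξ := by
  have hx1 : x1 ∈ Icc (0:ℝ) 1 := ⟨h0, h1.le.trans h2⟩
  have hsub : Ioc x1 xs ⊆ Icc (0:ℝ) 1 := fun x hx => ⟨h0.trans hx.1.le, hx.2.trans h2⟩
  have hinv : ∀ x ∈ Ioc x1 xs, D.G (E x) = D.G (E xs) - D.lg xs + D.lg x := fun x hx => by
    linarith [P.invariant (hsub hx).1 hx.2 h2 fun y hy => hpos y ⟨hx.1.trans_le hy.1, hy.2⟩]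
  have hne : (𝓝[Ioc x1 xs] x1).NeBot := by
    rw [nhdsWithin_Ioc_eq_nhdsGT h1]; infer_instance
  have tl : Tendsto (fun x => D.G (E xs) - D.lg xs + D.lg x) (𝓝[Ioc x1 xs] x1)
      (𝓝 (D.G (E xs) - D.lg xs + D.lg x1)) :=
    ((D.lg_cont x1 hx1).mono hsub).tendsto.const_add _
  have te : Tendsto E (𝓝[Ioc x1 xs] x1) (𝓝 0) := hz ▸ ((P.cont x1 hx1).mono hsub).tendsto
  have hm : ∀ᶠ x in 𝓝[Ioc x1 xs] x1, x ∈ Ioc x1 xs := self_mem_nhdsWithin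
  refine ⟨fun g hg => ?_, fun ξ hξ => ?_⟩
  · obtain ⟨x, hx, hxg⟩ := (hm.and (tl.eventually_lt_const hg)).exists
    exact ⟨E x, P.mem (hsub hx) (hpos x hx), hinv x hx ▸ hxg⟩
  · have hξ2 : ξ / 2 ∈ Ioo 0 D.W0 := ⟨by linarith [hξ.1], by linarith [hξ.1, hξ.2]⟩
    refine lt_of_le_of_lt (le_of_tendsto tl ?_) ((D.G_lt_iff hξ2 hξ).2 (by linarith [hξ.1]))
    filter_upwards [hm, te.eventually_lt_const hξ2.1] with x hx hxe
    rw [← hinv x hx]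
    exact (D.G_le_iff (P.mem (hsub hx) (hpos x hx)) hξ2).2 hxe.le

/-- The part of a hill to the left of its base point `xs`, cut at the level `c` of `a`. -/
structure Cut (D : Env) (E : ℝ → ℝ) (δ xs c z y : ℝ) : Prop where
  nonneg : 0 ≤ z
  le : z ≤ y
  le_xs : y ≤ xs
  mono : MonotoneOn D.a (Icc z y)
  above : ∀ t ∈ Icc y xs, c < D.a t
  small : ∀ x ∈ Ico z y, E x ≤ δ / 4

/-- A cut at a regular value of `a`, to the right of a zero `x1` of the energy. -/
structure SteepCut (D : Env) (E : ℝ → ℝ) (δ x1 xs c z y η lam : ℝ) : Prop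
    extends Cut D E δ xs c z y where
  η_pos : 0 < η
  lam_pos : 0 < lam
  le_sub : x1 ≤ z - η
  add_le : z + η ≤ y
  lt_xs : y < xs
  val : D.a z = c
  slope : ∀ x ∈ Icc (z - η) (z + η), lam ≤ D.a' x
  flank : ∀ x ∈ Icc x1 z, E x ≤ δ / 4

lemma exists_steep_point {a a' : ℝ → ℝ} {x1 xs c2 : ℝ} (hx : x1 < xs)
    (da : ∀ x ∈ Icc x1 xs, HasDerivAt a (a' x) x) (ca : ContinuousOn a' (Icc x1 xs))
    (h : ∀ t ∈ Ioc x1 xs, a x1 < a t) (hc2 : a x1 < c2) :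
    ∃ c1 > a x1, ∀ c ∈ Ioo (a x1) c1, (∀ x ∈ Icc x1 xs, a x = c → a' x ≠ 0) →
      ∃ z η lam, 0 < η ∧ 0 < lam ∧ x1 ≤ z - η ∧ z + η < xs ∧ a z = c ∧
        (∀ t ∈ Ioc z xs, c < a t) ∧ (∀ x ∈ Icc (z - η) (z + η), lam ≤ a' x) ∧
        ∀ x ∈ Icc x1 (z + η), a x < c2 := by
  have hac : ContinuousOn a (Icc x1 xs) := fun x hx' => (da x hx').continuousAt.continuousWithinAt
  have hl : x1 ∈ Icc x1 xs := left_mem_Icc.2 hx.le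
  obtain ⟨ρ, hρ, hρa⟩ : ∃ ρ > 0, ∀ x ∈ Icc x1 (x1 + ρ), x ∈ Icc x1 xs → a x < c2 := by
    have h1 := (hac x1 hl).eventually_lt_const hc2
    obtain ⟨r, hr, h2⟩ := Metric.mem_nhdsWithin_iff.1 h1
    refine ⟨r / 2, by positivity, fun x hx1 hx2 => h2 ⟨?_, hx2⟩⟩
    rw [Metric.mem_ball, Real.dist_eq, abs_of_nonneg (by linarith [hx1.1])]
    linarith [hx1.2]
  set r := min ρ ((xs - x1) / 2) with hr
  have hr0 : 0 < r := lt_min hρ (by linarith)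
  have hr1 : r ≤ ρ := min_le_left _ _
  have hr2 : r ≤ (xs - x1) / 2 := min_le_right _ _
  obtain ⟨t0, ht0, hmin⟩ := (isCompact_Icc (a := x1 + r) (b := xs)).exists_isMinOn
    ⟨xs, by linarith, le_rfl⟩ (hac.mono (Icc_subset_Icc (by linarith) le_rfl))
  refine ⟨a t0, h t0 ⟨by linarith [ht0.1], ht0.2⟩, fun c hc hreg => ?_⟩
  have hclosed : IsClosed (Icc x1 xs ∩ a ⁻¹' {c}) :=
    hac.preimage_isClosed_of_isClosed isClosed_Icc isClosed_singleton
  have hS : (Icc x1 xs ∩ a ⁻¹' {c}).Nonempty := by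
    obtain ⟨z, hz, e⟩ := intermediate_value_Icc hx.le hac
      ⟨hc.1.le, (hc.2.trans_le (hmin (right_mem_Icc.2 (by linarith)))).le⟩
    exact ⟨z, hz, e⟩
  obtain ⟨z, ⟨hz, hzc⟩, hzmax⟩ :=
    (isCompact_Icc.of_isClosed_subset hclosed inter_subset_left).exists_isGreatest hS
  have hzc : a z = c := hzc
  have hzr : z < x1 + r := by
    by_contra! hcon
    have := hmin ⟨hcon, hz.2⟩
    simp only [mem_ofPred_eq, hzc] at this
    linarith [hc.2]
  have hz1 : x1 < z := lt_of_le_of_ne hz.1 fun e => by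
    rw [← e] at hzc; linarith [hc.1]
  have habove : ∀ t ∈ Ioc z xs, c < a t := fun t ht => by
    by_contra! hcon
    obtain ⟨s, hs, e⟩ := intermediate_value_Icc ht.2
      (hac.mono (Icc_subset_Icc (hz.1.trans ht.1.le) le_rfl))
      ⟨hcon, (hc.2.trans_le (hmin (right_mem_Icc.2 (by linarith)))).le⟩
    have := hzmax ⟨⟨by linarith [hs.1, ht.1], hs.2⟩, e⟩
    linarith [hs.1, ht.1]
  have hnn : 0 ≤ a' z := by
    have h1 := (hasDerivAt_iff_tendsto_slope.1 (da z hz)).mono_left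
      (nhdsWithin_mono z (fun x (hx : z < x) => hx.ne') : 𝓝[>] z ≤ 𝓝[≠] z)
    refine ge_of_tendsto h1 ?_
    filter_upwards [Ioc_mem_nhdsGT (show z < xs by linarith)] with t ht
    rw [slope_def_field]
    exact div_nonneg (by linarith [habove t ht]) (by linarith [ht.1])
  have hpos : 0 < a' z := lt_of_le_of_ne hnn (hreg z hz hzc).symm
  have hev := (ca z hz).eventually_const_lt (half_lt_self hpos)
  obtain ⟨σ, hσ, h2⟩ := Metric.mem_nhdsWithin_iff.1 hev
  set η := min (σ / 2) (min (z - x1) (x1 + r - z)) with hη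
  have hη1 : η ≤ σ / 2 := min_le_left _ _
  have hη2 : η ≤ z - x1 := (min_le_right _ _).trans (min_le_left _ _)
  have hη3 : η ≤ x1 + r - z := (min_le_right _ _).trans (min_le_right _ _)
  refine ⟨z, η, a' z / 2, lt_min (by positivity) (lt_min (by linarith) (by linarith)),
    by positivity, by linarith, by linarith, hzc, habove, fun x hx' => ?_, fun x hx' => ?_⟩
  · refine le_of_lt (h2 ⟨?_, ⟨by linarith [hx'.1], by linarith [hx'.2]⟩⟩)
    rw [Metric.mem_ball, Real.dist_eq]
    exact (abs_le.2 ⟨by linarith [hx'.1], by linarith [hx'.2]⟩).trans_lt (by linarith : η < σ)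
  · exact hρa x ⟨hx'.1, by linarith [hx'.2]⟩ ⟨hx'.1, by linarith [hx'.2]⟩

/-- A profile that is positive all the way to the boundary can be cut at the boundary. -/
lemma exists_cut_boundary (h1 : 0 ≤ xs) (h2 : xs ≤ 1)
    (h : ∀ t ∈ Icc 0 xs, c < D.a t) :
    ∃ c1 > c, ∀ c' < c1, Cut D E δ xs c' 0 0 := by
  obtain ⟨t0, ht0, hmin⟩ := (isCompact_Icc (a := 0) (b := xs)).exists_isMinOn
    ⟨xs, h1, le_rfl⟩ (D.a_cont.mono (Icc_subset_Icc le_rfl h2))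
  exact ⟨D.a t0, h t0 ht0, fun c' hc' => ⟨le_rfl, le_rfl, h1, by simp,
    fun t ht => hc'.trans_le (hmin ht), by simp⟩⟩

lemma Prof.exists_cut_zero (P : Prof D E) (hδ : 0 < δ) (h0 : 0 ≤ x1) (h1 : x1 < xs) (h2 : xs ≤ 1)
    (hz : E x1 = 0) (hpos : ∀ x ∈ Ioc x1 xs, 0 < E x) :
    ∃ c1 > D.a x1, ∀ c ∈ Ioo (D.a x1) c1, (∀ x ∈ Icc (0:ℝ) 1, D.a x = c → D.a' x ≠ 0) →
      ∃ z y η lam, SteepCut D E δ x1 xs c z y η lam := by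
  have hW := D.w.W0pos
  have hsub : Icc x1 xs ⊆ Icc (0:ℝ) 1 := Icc_subset_Icc h0 h2
  have hx1 : x1 ∈ Icc (0:ℝ) 1 := hsub (left_mem_Icc.2 h1.le)
  obtain ⟨ha, hb⟩ := P.floor_left h0 h1 h2 hz hpos
  have hinv : ∀ x ∈ Ioc x1 xs, D.G (E x) = D.G (E xs) - D.lg xs + D.lg x := fun x hx => by
    linarith [P.invariant (h0.trans hx.1.le) hx.2 h2 fun y hy => hpos y ⟨hx.1.trans_le hy.1, hy.2⟩]
  have hab : ∀ t ∈ Ioc x1 xs, D.a x1 < D.a t := fun t ht => by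
    have ht' := hsub ⟨ht.1.le, ht.2⟩
    have h3 := hb (E t) (P.mem ht' (hpos t ht))
    rw [hinv t ht] at h3
    exact (log_lt_log_iff (D.a_pos hx1) (D.a_pos ht')).1 (by simp only [Env.lg] at h3; linarith)
  have hgap : ∀ x ∈ Icc x1 xs, E x ≤ D.W0 * (D.lg x - D.lg x1) := fun x hx => by
    rcases hx.1.eq_or_lt with rfl | hlt
    · simp [hz]
    have hxm : x ∈ Ioc x1 xs := ⟨hlt, hx.2⟩
    have hE := P.mem (hsub hx) (hpos x hxm)
    refine le_of_forall_pos_le_add fun s hs => ?_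
    obtain ⟨ξ, hξ, hξg⟩ := ha (D.G (E xs) - D.lg xs + D.lg x1 + s / (2 * D.W0))
      (by linarith [show 0 < s / (2 * D.W0) by positivity])
    set ζ := min ξ (min (E x) (s / 2)) with hζ
    have hζ0 : 0 < ζ := lt_min hξ.1 (lt_min hE.1 (by positivity))
    have hζm : ζ ∈ Ioo 0 D.W0 := ⟨hζ0, (min_le_left _ _).trans_lt hξ.2⟩
    have h4 := D.k.G_gap D.w hζm hE ((min_le_right _ _).trans (min_le_left _ _))
    have h5 : ζ ≤ s / 2 := (min_le_right _ _).trans (min_le_right _ _)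
    have h6 := hb ζ hζm
    have h7 : D.G (E x) - D.G ζ ≤ D.lg x - D.lg x1 := by rw [hinv x hxm]; linarith
    have h8 := mul_le_mul_of_nonneg_left h7 hW.le
    simp only [Env.G] at h8
    linarith
  have hc2 : D.a x1 < D.a x1 * exp (δ / (4 * D.W0)) :=
    lt_mul_of_one_lt_right (D.a_pos hx1) (one_lt_exp_iff.2 (by positivity))
  obtain ⟨c1, hc1, H⟩ := exists_steep_point h1 (fun x hx => D.da x (hsub hx)) (D.a'cont.mono hsub)
    hab hc2
  refine ⟨c1, hc1, fun c hc hreg => ?_⟩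
  obtain ⟨z, η, lam, hη, hlam, k1, k2, k3, k4, k5, k6⟩ := H c hc fun x hx => hreg x (hsub hx)
  have hsmall : ∀ x ∈ Icc x1 (z + η), E x ≤ δ / 4 := fun x hx => by
    have hx' : x ∈ Icc x1 xs := ⟨hx.1, hx.2.trans k2.le⟩
    refine (hgap x hx').trans ?_
    have h3 := log_lt_log (D.a_pos (hsub hx')) (k6 x hx)
    rw [log_mul (D.a_pos hx1).ne' (exp_pos _).ne', log_exp] at h3
    have h4 : D.lg x - D.lg x1 ≤ δ / (4 * D.W0) := by simp only [Env.lg]; linarith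
    refine (mul_le_mul_of_nonneg_left h4 hW.le).trans (le_of_eq ?_)
    field_simp
  refine ⟨z, z + η, η, lam, ⟨by linarith, by linarith, k2.le, ?_, fun t ht =>
    k4 t ⟨by linarith [ht.1], ht.2⟩, fun x hx => hsmall x ⟨by linarith [hx.1], hx.2.le⟩⟩,
    hη, hlam, k1, le_rfl, k2, k3, k5, fun x hx => hsmall x ⟨hx.1, by linarith [hx.2]⟩⟩
  exact monotoneOn_Icc_of_deriv (d := D.a') (fun x hx => (D.da x (hsub ⟨by linarith [hx.1],
    by linarith [hx.2]⟩)).hasDerivWithinAt)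
    fun x hx => hlam.le.trans (k5 x ⟨by linarith [hx.1], by linarith [hx.2]⟩)

lemma Env.exists_regular (D : Env) {α β : ℝ} (h : α < β) :
    ∃ c ∈ Ioo α β, ∀ x ∈ Icc (0:ℝ) 1, D.a x = c → D.a' x ≠ 0 := by
  set S := {x ∈ Icc (0:ℝ) 1 | D.a' x = 0} with hS
  have h0 : volume (D.a '' S) = 0 := by
    refine addHaar_image_eq_zero_of_det_fderivWithin_eq_zero volume
      (f' := fun x => ContinuousLinearMap.toSpanSingleton ℝ (D.a' x))
      (fun x hx => (D.da x hx.1).hasDerivWithinAt.hasFDerivWithinAt) fun x hx => ?_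
    rw [hx.2]
    simp
  by_contra! hcon
  have hsub : Ioo α β ⊆ D.a '' S := fun c hc => by
    obtain ⟨x, hx, e, e'⟩ := hcon c hc
    exact ⟨x, ⟨hx, e'⟩, e⟩
  have := measure_mono_null hsub h0
  rw [Real.volume_Ioo, ENNReal.ofReal_eq_zero] at this
  linarith

lemma Prof.hill_of_cuts (P : Prof D E) (hδ : 0 < δ) (hxs : xs ∈ Icc (0:ℝ) 1) (hE : 0 < E xs)
    (hc : 0 < c) (hcc : c < c') (hsmall : log c' - log c < δ / (4 * D.W0))
    (hfl : ∀ g > D.G (E xs) - D.lg xs + log c, ∃ ξ ∈ Ioo 0 D.W0, D.G ξ < g)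
    (L : Cut D E δ xs c' z1 y1)
    (R : Cut D.reflect (fun x => E (1 - x)) δ (1 - xs) c' (1 - z2) (1 - y2)) (hy : y1 < y2) :
    ∃ lo hi μ, Hill D E δ z1 y1 xs y2 z2 lo hi μ ∧ D.G hi + log c' - log c < D.G (E xs) := by
  have hW := D.w.W0pos
  have hz1 := L.nonneg
  have hz1y := L.le
  have hyx := L.le_xs
  have hz2 := R.nonneg
  have hz2y := R.le
  have hyx2 := R.le_xs
  have hsub : Icc y1 y2 ⊆ Icc (0:ℝ) 1 := Icc_subset_Icc (by linarith) (by linarith)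
  have hxm : xs ∈ Icc y1 y2 := ⟨hyx, by linarith⟩
  obtain ⟨t0, ht0, hmin⟩ := (isCompact_Icc (a := y1) (b := y2)).exists_isMinOn
    ⟨xs, hxm⟩ (D.lg_cont.mono hsub)
  have hM : log c' < D.lg t0 := by
    refine log_lt_log (hc.trans hcc) ?_
    rcases le_total t0 xs with h | h
    · exact L.above t0 ⟨ht0.1, h⟩
    · have := R.above (1 - t0) ⟨by linarith [ht0.2], by linarith⟩
      simpa [Env.reflect] using this
  set B := min (D.lg t0 - log c) (δ / (4 * D.W0)) with hB
  set d0 := log c' - log c with hd0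
  have hB0 : d0 < B := lt_min (by linarith) hsmall
  have hd0p : 0 < d0 := by linarith [log_lt_log hc hcc]
  have hB1 : B ≤ D.lg t0 - log c := min_le_left _ _
  have hB2 : B ≤ δ / (4 * D.W0) := min_le_right _ _
  have hEm := P.mem hxs hE
  have hmx : D.lg t0 ≤ D.lg xs := hmin hxm
  have key : ∀ d, d0 < d → d < B → ∃ ζ ∈ Ioo 0 D.W0, D.G ζ = D.G (E xs) - d := fun d h1 h2 => by
    obtain ⟨ξ, hξ, h3⟩ := hfl (D.G (E xs) - d) (by linarith)
    exact D.exists_G_eq hξ hEm h3 (by linarith)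
  obtain ⟨hi, hhi, ehi⟩ := key (d0 + (B - d0) / 3) (by linarith) (by linarith)
  obtain ⟨lo, hlo, elo⟩ := key (d0 + 2 * (B - d0) / 3) (by linarith) (by linarith)
  obtain ⟨μ, hμ, hμg⟩ := hfl (D.G (E xs) - D.lg xs + D.lg t0 - (d0 + 2 * (B - d0) / 3))
    (by linarith)
  refine ⟨lo, hi, μ, ⟨hz1, hz1y, hyx, by linarith, by linarith, by linarith, hy, L.mono, ?_, hlo.1,
    (D.G_lt_iff hlo hhi).1 (by linarith), (D.G_le_iff hhi hEm).1 (by linarith), hμ,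
    fun x hx => ?_, ?_, L.small, fun x hx => ?_⟩, by linarith⟩
  · intro x hx y hy hxy
    have := R.mono (a := 1 - y) ⟨by linarith [hy.2], by linarith [hy.1]⟩ (b := 1 - x)
      ⟨by linarith [hx.2], by linarith [hx.1]⟩ (by linarith)
    simpa [Env.reflect] using this
  · have : D.lg t0 ≤ D.lg x := hmin hx
    linarith
  · have h1 : D.G (E xs) - D.G lo ≤ δ / (4 * D.W0) := by linarith
    refine (mul_le_mul_of_nonneg_left h1 hW.le).trans (le_of_eq ?_)
    field_simp
  · simpa using R.small (1 - x) ⟨by linarith [hx.2], by linarith [hx.1]⟩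

/-- The profile `E` leaves zero energy at `x1` and stays positive up to `xs`. -/
structure Rise (E : ℝ → ℝ) (x1 xs : ℝ) : Prop where
  nonneg : 0 ≤ x1
  lt : x1 < xs
  zero : E x1 = 0
  pos : ∀ x ∈ Ioc x1 xs, 0 < E x

lemma Prof.exists_level (P : Prof D E) {x3 : ℝ} (hxs : xs ∈ Icc (0:ℝ) 1) (hE : 0 < E xs)
    (hl : xs = 0 ∨ Rise E x1 xs)
    (hr : (∀ x ∈ Icc xs 1, 0 < E x) ∨ Rise (fun x => E (1 - x)) (1 - x3) (1 - xs)) :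
    ∃ c > 0, (∀ g > D.G (E xs) - D.lg xs + log c, ∃ ξ ∈ Ioo 0 D.W0, D.G ξ < g) ∧
      (Rise E x1 xs → D.a x1 = c) ∧
      (Rise (fun x => E (1 - x)) (1 - x3) (1 - xs) → D.a x3 = c) ∧
      (Rise E x1 xs ∨ Rise (fun x => E (1 - x)) (1 - x3) (1 - xs) →
        ∀ ξ ∈ Ioo 0 D.W0, D.G (E xs) - D.lg xs + log c < D.G ξ) ∧
      (¬ Rise E x1 xs → ∀ t ∈ Icc 0 xs, c < D.a t) ∧
      (¬ Rise (fun x => E (1 - x)) (1 - x3) (1 - xs) → ∀ t ∈ Icc xs 1, c < D.a t) := by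
  have hEm := P.mem hxs hE
  have fl : Rise E x1 xs → x1 ∈ Icc (0:ℝ) 1 ∧
      (∀ g > D.G (E xs) - D.lg xs + log (D.a x1), ∃ ξ ∈ Ioo 0 D.W0, D.G ξ < g) ∧
      ∀ ξ ∈ Ioo 0 D.W0, D.G (E xs) - D.lg xs + log (D.a x1) < D.G ξ := fun h =>
    ⟨⟨h.nonneg, h.lt.le.trans hxs.2⟩, P.floor_left h.nonneg h.lt hxs.2 h.zero h.pos⟩
  have fr : Rise (fun x => E (1 - x)) (1 - x3) (1 - xs) → x3 ∈ Icc (0:ℝ) 1 ∧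
      (∀ g > D.G (E xs) - D.lg xs + log (D.a x3), ∃ ξ ∈ Ioo 0 D.W0, D.G ξ < g) ∧
      ∀ ξ ∈ Ioo 0 D.W0, D.G (E xs) - D.lg xs + log (D.a x3) < D.G ξ := fun h => by
    have h1 := P.reflect.floor_left h.nonneg h.lt (by linarith [hxs.1]) h.zero h.pos
    have e1 := h.nonneg
    have e2 := h.lt
    refine ⟨⟨by linarith [hxs.1], by linarith⟩, ?_⟩
    have eG : D.reflect.G = D.G := rfl
    have eW : D.reflect.W0 = D.W0 := rfl
    have el : ∀ x, D.reflect.lg (1 - x) = D.lg x := fun x => by simp [Env.lg, Env.reflect]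
    simpa only [eG, eW, el, sub_sub_cancel] using! h1
  have right : ¬ Rise (fun x => E (1 - x)) (1 - x3) (1 - xs) → ∀ c > 0,
      (∀ t ∈ Icc xs 1, D.G (E xs) - D.lg xs + log c < D.G (E t)) →
      ∀ t ∈ Icc xs 1, c < D.a t := fun h c hc hg t ht => by
    have hpos := hr.resolve_right h
    have h1 := P.invariant hxs.1 ht.1 ht.2 fun x hx => hpos x ⟨hx.1, hx.2.trans ht.2⟩
    have h2 := hg t ht
    refine (log_lt_log_iff hc (D.a_pos ⟨hxs.1.trans ht.1, ht.2⟩)).1 ?_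
    simp only [Env.lg] at h1 h2
    linarith
  have left : ∀ c > 0, D.G (E xs) - D.lg xs + log c < D.G (E xs) →
      ¬ Rise E x1 xs → ∀ t ∈ Icc 0 xs, c < D.a t := fun c hc hg h t ht => by
    have e : xs = 0 := hl.resolve_right h
    have et : t = xs := le_antisymm ht.2 (e ▸ ht.1)
    rw [et]
    refine (log_lt_log_iff hc (D.a_pos hxs)).1 ?_
    simp only [Env.lg] at hg
    linarith
  by_cases h1 : Rise E x1 xs
  · obtain ⟨hx1, ha, hb⟩ := fl h1
    refine ⟨D.a x1, D.a_pos hx1, ha, fun _ => rfl, fun h3 => ?_, fun _ => hb, fun h => absurd h1 h,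
      fun h => right h _ (D.a_pos hx1) fun t ht => hb _ (P.mem ⟨hxs.1.trans ht.1, ht.2⟩
        (hr.resolve_right h t ht))⟩
    obtain ⟨hx3, ha', hb'⟩ := fr h3
    refine log_injOn_pos (D.a_pos hx3) (D.a_pos hx1) (le_antisymm ?_ ?_)
    · by_contra! hlt
      obtain ⟨ξ, hξ, hg⟩ := ha (D.G (E xs) - D.lg xs + log (D.a x3)) (by linarith)
      linarith [hb' ξ hξ]
    · by_contra! hlt
      obtain ⟨ξ, hξ, hg⟩ := ha' (D.G (E xs) - D.lg xs + log (D.a x1)) (by linarith)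
      linarith [hb ξ hξ]
  by_cases h3 : Rise (fun x => E (1 - x)) (1 - x3) (1 - xs)
  · obtain ⟨hx3, ha, hb⟩ := fr h3
    exact ⟨D.a x3, D.a_pos hx3, ha, fun h => absurd h h1, fun _ => rfl, fun _ => hb,
      left _ (D.a_pos hx3) (hb _ hEm), fun h => absurd h3 h⟩
  have hpos := hr.resolve_right h3
  have hsub : Icc xs 1 ⊆ Icc (0:ℝ) 1 := Icc_subset_Icc hxs.1 le_rfl
  obtain ⟨t0, ht0, hmin⟩ := (isCompact_Icc (a := xs) (b := 1)).exists_isMinOn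
    ⟨xs, le_rfl, hxs.2⟩ (P.cont.mono hsub)
  have hE0 := P.mem (hsub ht0) (hpos t0 ht0)
  have hν : E t0 / 2 ∈ Ioo 0 D.W0 := ⟨by linarith [hE0.1], by linarith [hE0.1, hE0.2]⟩
  have hlt : ∀ t ∈ Icc xs 1, D.G (E t0 / 2) < D.G (E t) := fun t ht =>
    (D.G_lt_iff hν (P.mem (hsub ht) (hpos t ht))).2 (by
      have : E t0 ≤ E t := hmin ht
      linarith [hE0.1])
  have e : D.G (E xs) - D.lg xs + log (exp (D.G (E t0 / 2) - (D.G (E xs) - D.lg xs))) =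
      D.G (E t0 / 2) := by rw [log_exp]; ring
  refine ⟨exp (D.G (E t0 / 2) - (D.G (E xs) - D.lg xs)), exp_pos _, ?_, fun h => absurd h h1,
    fun h => absurd h h3, fun h => (h.elim h1 h3).elim, left _ (exp_pos _) ?_,
    fun h => right h _ (exp_pos _) ?_⟩
  · rw [e]; exact fun g hg => ⟨_, hν, hg⟩
  · rw [e]; exact hlt xs ⟨le_rfl, hxs.2⟩
  · rw [e]; exact hlt

lemma Prof.exists_side (P : Prof D E) (hδ : 0 < δ) (hxs : xs ∈ Icc (0:ℝ) 1)
    (h1 : Rise E x1 xs → D.a x1 = c) (h2 : ¬ Rise E x1 xs → ∀ t ∈ Icc 0 xs, c < D.a t) :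
    ∃ c1 > c, ∀ c' ∈ Ioo c c1, (∀ x ∈ Icc (0:ℝ) 1, D.a x = c' → D.a' x ≠ 0) →
      ∃ z y, Cut D E δ xs c' z y ∧ (¬ Rise E x1 xs → z = 0 ∧ y = 0) ∧
        (Rise E x1 xs → ∃ η lam, SteepCut D E δ x1 xs c' z y η lam) := by
  by_cases h : Rise E x1 xs
  · have e := h1 h
    subst e
    obtain ⟨c1, hc1, H⟩ := P.exists_cut_zero hδ h.nonneg h.lt hxs.2 h.zero h.pos
    refine ⟨c1, hc1, fun c' hc' hreg => ?_⟩
    obtain ⟨z, y, η, lam, S⟩ := H c' hc' hreg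
    exact ⟨z, y, S.toCut, fun h' => absurd h h', fun _ => ⟨η, lam, S⟩⟩
  · obtain ⟨c1, hc1, H⟩ := exists_cut_boundary (E := E) (δ := δ) hxs.1 hxs.2 (h2 h)
    exact ⟨c1, hc1, fun c' hc' _ => ⟨0, 0, H c' hc'.2, fun _ => ⟨rfl, rfl⟩, fun h' => absurd h' h⟩⟩

theorem Prof.exists_hill (P : Prof D E) (hδ : 0 < δ) {x3 : ℝ} (hxs : xs ∈ Icc (0:ℝ) 1)
    (hE : 0 < E xs) (hl : xs = 0 ∨ Rise E x1 xs)
    (hr : (∀ x ∈ Icc xs 1, 0 < E x) ∨ Rise (fun x => E (1 - x)) (1 - x3) (1 - xs)) :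
    ∃ z1 y1 y2 z2 lo hi μ, Hill D E δ z1 y1 xs y2 z2 lo hi μ ∧
      (Rise E x1 xs → x1 < z1 ∧ ∃ η lam d, LeftEnd D z1 y1 xs hi η lam d) ∧
      (¬ Rise (fun x => E (1 - x)) (1 - x3) (1 - xs) → z2 = 1) ∧
      (Rise (fun x => E (1 - x)) (1 - x3) (1 - xs) → z2 < x3 ∧ (∀ x ∈ Icc z2 x3, E x ≤ δ / 4) ∧
        ∃ η lam d, RightEnd D xs y2 z2 hi η lam d) := by
  have hW := D.w.W0pos
  obtain ⟨c, hc, hfl, hL, hR, hiii, hL', hR'⟩ := P.exists_level hxs hE hl hr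
  have hxs' : 1 - xs ∈ Icc (0:ℝ) 1 := ⟨by linarith [hxs.2], by linarith [hxs.1]⟩
  obtain ⟨c1, hc1, H1⟩ := P.exists_side hδ hxs hL hL'
  obtain ⟨c2, hc2, H2⟩ := P.reflect.exists_side (c := c) (x1 := 1 - x3) hδ hxs'
    (fun h => by simpa [Env.reflect] using hR h)
    (fun h t ht => by
      simpa [Env.reflect] using hR' h (1 - t) ⟨by linarith [ht.2], by linarith [ht.1]⟩)
  have hc3 : c < c * exp (δ / (4 * D.W0)) :=
    lt_mul_of_one_lt_right hc (one_lt_exp_iff.2 (by positivity))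
  obtain ⟨c', hc', hreg⟩ := D.exists_regular (lt_min hc1 (lt_min hc2 hc3))
  have b1 : c' < c1 := hc'.2.trans_le (min_le_left _ _)
  have b2 : c' < c2 := hc'.2.trans_le ((min_le_right _ _).trans (min_le_left _ _))
  have b3 : c' < c * exp (δ / (4 * D.W0)) :=
    hc'.2.trans_le ((min_le_right _ _).trans (min_le_right _ _))
  obtain ⟨z1, y1, L, L1, L2⟩ := H1 c' ⟨hc'.1, b1⟩ hreg
  obtain ⟨z2, y2, R, R1, R2⟩ := H2 c' ⟨hc'.1, b2⟩ fun x hx e => by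
    have := hreg (1 - x) ⟨by linarith [hx.2], by linarith [hx.1]⟩ e
    simpa [Env.reflect] using this
  have hsmall : log c' - log c < δ / (4 * D.W0) := by
    have := log_lt_log (hc.trans hc'.1) b3
    rw [log_mul hc.ne' (exp_pos _).ne', log_exp] at this
    linarith
  have hle := L.le_xs
  have hle' := R.le_xs
  have hy : y1 < 1 - y2 := by
    by_cases h1 : Rise E x1 xs
    · obtain ⟨η, lam, S⟩ := L2 h1
      linarith [S.lt_xs]
    by_cases h3 : Rise (fun x => E (1 - x)) (1 - x3) (1 - xs)
    · obtain ⟨η, lam, S⟩ := R2 h3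
      linarith [S.lt_xs]
    rw [(L1 h1).2, (R1 h3).2]
    norm_num
  have R' : Cut D.reflect (fun x => E (1 - x)) δ (1 - xs) c' (1 - (1 - z2)) (1 - (1 - y2)) := by
    simpa only [sub_sub_cancel] using R
  obtain ⟨lo, hi, μ, H, hg⟩ := P.hill_of_cuts hδ hxs hE hc hc'.1 hsmall hfl L R' hy
  have hd : 0 < D.G (E xs) - (D.G hi + log c' - log c) := by linarith
  refine ⟨z1, y1, 1 - y2, 1 - z2, lo, hi, μ, H, fun h1 => ?_, fun h3 => ?_, fun h3 => ?_⟩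
  · obtain ⟨η, lam, S⟩ := L2 h1
    have e1 := S.η_pos
    have e2 := S.le_sub
    refine ⟨by linarith, η, lam, _, e1, S.lam_pos, hd, by linarith [h1.nonneg], S.add_le, S.slope,
      fun ξ hξ => ?_, fun t ht => ?_⟩
    · have := hiii (Or.inl h1) ξ hξ
      have e3 : D.lg z1 = log c' := by rw [Env.lg, S.val]
      linarith
    · rw [S.val]; exact L.above t ht
  · rw [(R1 h3).1]; norm_num
  · obtain ⟨η, lam, S⟩ := R2 h3
    have e1 := S.η_pos
    have e2 := S.le_sub
    have e4 := S.add_le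
    refine ⟨by linarith, fun x hx => ?_, η, lam, _, e1, S.lam_pos, hd, by linarith [h3.nonneg],
      by linarith, fun x hx => ?_, fun ξ hξ => ?_⟩
    · simpa using S.flank (1 - x) ⟨by linarith [hx.2], by linarith [hx.1]⟩
    · have := S.slope (1 - x) ⟨by linarith [hx.2], by linarith [hx.1]⟩
      simp only [Env.reflect, sub_sub_cancel] at this
      linarith
    · have := hiii (Or.inr h3) ξ hξ
      have e3 : D.lg (1 - z2) = log c' := by rw [← S.val]; rfl
      linarith

end Geometry

section Transfer

lemma eventually_imp_of_closed {x : ℕ → ℝ} {X : ℝ} {C : Set ℝ} {B : ℕ → Prop} {B' : Prop}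
    (hx : Tendsto x atTop (𝓝 X)) (hC : IsClosed C) (hB : B' → ∀ᶠ n in atTop, B n)
    (h : X ∈ C → B') : ∀ᶠ n in atTop, x n ∈ C → B n := by
  by_cases hX : X ∈ C
  · filter_upwards [hB (h hX)] with n hn _ using hn
  · filter_upwards [hx.eventually_mem (hC.isOpen_compl.mem_nhds hX)] with n hn hn' using
      absurd hn' hn

lemma eventually_near_of_contConv {g : ℕ → ℝ → ℝ} {G E : ℝ → ℝ} {δ α β : ℝ}
    (hg : ContConv g G (Icc 0 1)) (hE : ContinuousOn E (Icc 0 1)) (h0 : 0 ≤ α) (h1 : β ≤ 1)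
    (h : ∀ x ∈ Icc α β, |G x - E x| < δ) :
    ∀ᶠ n in atTop, ∀ x ∈ Icc α β, |g n x - E x| < δ := by
  have hsub : Icc α β ⊆ Icc (0:ℝ) 1 := Icc_subset_Icc h0 h1
  have hc : ContConv (fun n x => g n x - E x) (fun x => G x - E x) (Icc α β) := fun x hx =>
    (hg.mono hsub x hx).sub (ContConv.const (hE.mono hsub) x hx)
  filter_upwards [hc.eventually_forall isCompact_Icc isOpen_Ioo fun x hx => abs_lt.1 (h x hx)]
    with n hn x hx using abs_lt.2 (hn x hx)

/-- Approximate shooting families indexed by `ε` and an approximation index, together with the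
transfer of open properties from exact solutions. -/
structure Scheme (D : Env) (sa : ℝ) (th e : ℝ × ℕ → ℝ → ℝ → ℝ) : Prop where
  shoot : ∀ᶠ i in (𝓝[>] (0:ℝ)).curry atTop, Shoot D sa (th i) (e i)
  transfer : ∀ P, OpenPred P → (∀ᶠ ε in 𝓝[>] (0:ℝ), ∀ u m θ u' m' θ', Sol D ε u m θ →
      Sol D ε u' m' θ' → P θ (en D.q D.F D.a u m) θ' (en D.q D.F D.a u' m')) →
    ∀ᶠ i in (𝓝[>] (0:ℝ)).curry atTop, ∀ s ∈ Icc sa 1, ∀ s' ∈ Icc sa 1,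
      P (th i s) (e i s) (th i s') (e i s')

namespace Scheme
variable {D : Env} {sa : ℝ} {th e : ℝ × ℕ → ℝ → ℝ → ℝ} {E : ℝ → ℝ}
  {δ x1 xs z1 y1 y2 z2 lo hi μ η lam d z : ℝ}

lemma transfer_one (S : Scheme D sa th e) {P : (ℝ → ℝ) → (ℝ → ℝ) → Prop}
    (hP : ∀ (g e : ℕ → ℝ → ℝ) (G E : ℝ → ℝ), ContConv g G (Icc 0 1) → ContConv e E (Icc 0 1) →
      P G E → ∀ᶠ n in atTop, P (g n) (e n))
    (h : ∀ᶠ ε in 𝓝[>] (0:ℝ), ∀ u m θ, Sol D ε u m θ → P θ (en D.q D.F D.a u m)) :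
    ∀ᶠ i in (𝓝[>] (0:ℝ)).curry atTop, ∀ s ∈ Icc sa 1, P (th i s) (e i s) := by
  filter_upwards [S.transfer (fun g e _ _ => P g e)
    (fun g e _ _ G E _ _ hg he _ _ h => (hP g e G E hg he h).exists)
    (h.mono fun ε h u m θ _ _ _ hs _ => h u m θ hs)] with i hi s hs using hi s hs s hs

lemma leave (S : Scheme D sa th e) (P : Prof D E) (H : Hill D E δ z1 y1 xs y2 z2 lo hi μ)
    (R : RightEnd D xs y2 z2 hi η lam d) :
    ∀ᶠ i in (𝓝[>] (0:ℝ)).curry atTop, ∀ s ∈ Icc sa 1, sin (th i s z2) = 0 →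
      e i s xs ∈ Icc lo hi → th i s 1 < th i s z2 + π / 2 := by
  have hz2 : z2 ∈ Icc (0:ℝ) 1 := ⟨by linarith [H.xs_mem.1, H.h3, H.h4], H.h5⟩
  refine S.transfer_one (P := fun g e => sin (g z2) = 0 → e xs ∈ Icc lo hi →
    g 1 < g z2 + π / 2) (fun g e G E hg he => ?_) (claim_leave P H R)
  refine eventually_imp_of_closed ((continuous_sin.tendsto _).comp (hg.pointwise hz2))
    isClosed_singleton (eventually_imp_of_closed (he.pointwise H.xs_mem) isClosed_Icc fun h => ?_)
  exact (hg.pointwise (right_mem_Icc.2 zero_le_one)).eventually_lt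
    ((hg.pointwise hz2).add_const _) h

lemma enter (S : Scheme D sa th e) (P : Prof D E) (H : Hill D E δ z1 y1 xs y2 z2 lo hi μ)
    (R : LeftEnd D z1 y1 xs hi η lam d) :
    ∀ᶠ i in (𝓝[>] (0:ℝ)).curry atTop, ∀ s ∈ Icc sa 1, sin (th i s z1) = 0 → hi < e i s xs := by
  have hz1 : z1 ∈ Icc (0:ℝ) 1 := ⟨H.h0, by linarith [H.xs_mem.2, H.h1, H.h2]⟩
  refine S.transfer_one (P := fun g e => sin (g z1) = 0 → hi < e xs)
    (fun g e G E hg he => ?_) (claim_enter P H R)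
  exact eventually_imp_of_closed ((continuous_sin.tendsto _).comp (hg.pointwise hz1))
    isClosed_singleton fun h => (he.pointwise H.xs_mem).eventually_const_lt h

lemma stay (S : Scheme D sa th e) (H : Hill D E δ z1 y1 xs y2 z2 lo hi μ) (hz : 0 ≤ z)
    (hz1 : z < 1) (hzx : z ≤ xs) :
    ∀ᶠ i in (𝓝[>] (0:ℝ)).curry atTop, ∀ s ∈ Icc sa 1, th i s 1 - th i s z ≤ π → e i s xs < lo := by
  refine S.transfer_one (P := fun g e => g 1 - g z ≤ π → e xs < lo)
    (fun g e G E hg he => ?_) (claim_stay H hz hz1 hzx)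
  exact eventually_imp_of_closed ((hg.pointwise (right_mem_Icc.2 zero_le_one)).sub
    (hg.pointwise ⟨hz, hz1.le⟩)) isClosed_Iic fun h => (he.pointwise H.xs_mem).eventually_lt_const h

lemma rotation (S : Scheme D sa th e) (P : Prof D E) (H : Hill D E δ z1 y1 xs y2 z2 lo hi μ) :
    ∀ᶠ i in (𝓝[>] (0:ℝ)).curry atTop, ∀ s ∈ Icc sa 1, ∀ s' ∈ Icc sa 1, e i s xs = lo →
      e i s' xs = hi → |th i s z1 - th i s' z1| ≤ π → th i s z2 + 3 * π < th i s' z2 := by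
  have hz1 : z1 ∈ Icc (0:ℝ) 1 := ⟨H.h0, by linarith [H.xs_mem.2, H.h1, H.h2]⟩
  have hz2 : z2 ∈ Icc (0:ℝ) 1 := ⟨by linarith [H.xs_mem.1, H.h3, H.h4], H.h5⟩
  refine S.transfer (fun g e g' e' => e xs = lo → e' xs = hi → |g z1 - g' z1| ≤ π →
    g z2 + 3 * π < g' z2) (fun g e g' e' G E G' E' hg he hg' he' h => Eventually.exists (f := (atTop : Filter ℕ)) ?_) ?_
  · refine eventually_imp_of_closed (he.pointwise H.xs_mem) isClosed_singleton
      (eventually_imp_of_closed (he'.pointwise H.xs_mem) isClosed_singleton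
      (eventually_imp_of_closed ((hg.pointwise hz1).sub (hg'.pointwise hz1)).abs isClosed_Iic
      fun h => ?_)) h
    exact ((hg.pointwise hz2).add_const _).eventually_lt (hg'.pointwise hz2) h
  · exact claim_rotation P H

lemma close (S : Scheme D sa th e) (P : Prof D E) (hδ : 0 < δ)
    (H : Hill D E δ z1 y1 xs y2 z2 lo hi μ) (hz : 0 ≤ z) (hzz : z ≤ z1)
    (hE : ∀ x ∈ Icc z z1, E x ≤ δ / 2 ∨ z = z1) :
    ∀ᶠ i in (𝓝[>] (0:ℝ)).curry atTop, ∀ s ∈ Icc sa 1, th i s z1 - th i s z ≤ π →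
      e i s xs ∈ Icc lo hi → ∀ x ∈ Icc z z2, |e i s x - E x| < δ := by
  have hz1 : z1 ∈ Icc (0:ℝ) 1 := ⟨H.h0, by linarith [H.xs_mem.2, H.h1, H.h2]⟩
  refine S.transfer_one (P := fun g e => g z1 - g z ≤ π → e xs ∈ Icc lo hi →
    ∀ x ∈ Icc z z2, |e x - E x| < δ) (fun g e G E' hg he => ?_) (claim_close P hδ H hz hzz hE)
  exact eventually_imp_of_closed ((hg.pointwise hz1).sub (hg.pointwise ⟨hz, hzz.trans hz1.2⟩))
    isClosed_Iic (eventually_imp_of_closed (he.pointwise H.xs_mem) isClosed_Icc fun h =>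
    eventually_near_of_contConv he P.cont hz H.h5 h)

lemma flat (S : Scheme D sa th e) (P : Prof D E) (hδ : 0 < δ) (hz : 0 ≤ z) (hz1 : z < 1)
    (hE : ∀ x ∈ Icc z 1, E x ≤ δ / 2) :
    ∀ᶠ i in (𝓝[>] (0:ℝ)).curry atTop, ∀ s ∈ Icc sa 1, th i s 1 - th i s z ≤ π →
      ∀ x ∈ Icc z 1, |e i s x - E x| < δ := by
  refine S.transfer_one (P := fun g e => g 1 - g z ≤ π → ∀ x ∈ Icc z 1, |e x - E x| < δ)
    (fun g e G E' hg he => ?_) (claim_flat P hδ hz hz1 hE)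
  exact eventually_imp_of_closed ((hg.pointwise (right_mem_Icc.2 zero_le_one)).sub
    (hg.pointwise ⟨hz, hz1.le⟩)) isClosed_Iic fun h =>
    eventually_near_of_contConv he P.cont hz le_rfl h

lemma start (S : Scheme D sa th e) (hγ : D.γ < D.W0) {y : ℝ} (hy : 0 < y) (hy1 : y ≤ 1) :
    ∀ᶠ i in (𝓝[>] (0:ℝ)).curry atTop, ∀ s ∈ Icc sa 1, e i s 0 = D.W0 - D.γ → π < th i s y := by
  refine S.transfer_one (P := fun g e => e 0 = D.W0 - D.γ → π < g y)
    (fun g e G E' hg he => ?_) (claim_start D hγ hy hy1)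
  exact eventually_imp_of_closed (he.pointwise (left_mem_Icc.2 zero_le_one)) isClosed_singleton
    fun h => (hg.pointwise ⟨hy.le, hy1⟩).eventually_const_lt h

/-- The shooting family contains a member with the right end condition and energy close to `E`. -/
def Hits (sa : ℝ) (E : ℝ → ℝ) (δ : ℝ) (th e : ℝ × ℕ → ℝ → ℝ → ℝ) : Prop :=
  ∀ᶠ i in (𝓝[>] (0:ℝ)).curry atTop, ∃ s ∈ Icc sa 1, cos (th i s 1) = 0 ∧
    ∀ x ∈ Icc (0:ℝ) 1, |e i s x - E x| ≤ δ

/-- Control of the shooting family up to `z`, followed by low energy up to the zero `x2`. -/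
structure ExitAt (sa : ℝ) (E : ℝ → ℝ) (δ : ℝ) (th e : ℝ × ℕ → ℝ → ℝ → ℝ) (z x2 : ℝ) : Prop where
  nonneg : 0 ≤ z
  le : z ≤ x2
  le_one : x2 ≤ 1
  lt_one : z < 1
  zero : E x2 = 0
  small : ∀ x ∈ Icc z x2, E x ≤ δ / 4
  ex : ∀ y ∈ Ioc z 1, ∀ᶠ i in (𝓝[>] (0:ℝ)).curry atTop, ∃ σ τ k, Exit sa E δ z y (th i) (e i) σ τ k

lemma hill_step (S : Scheme D sa th e) (P : Prof D E) (hδ : 0 < δ) (hxs : xs ∈ Icc (0:ℝ) 1)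
    (hE : 0 < E xs) (hl : xs = 0 ∨ Rise E x1 xs)
    (hsw : ∀ z1 y1 y2 z2 lo hi μ, Hill D E δ z1 y1 xs y2 z2 lo hi μ →
      (Rise E x1 xs → x1 < z1 ∧ ∃ η lam d, LeftEnd D z1 y1 xs hi η lam d) →
      ∀ᶠ i in (𝓝[>] (0:ℝ)).curry atTop, ∃ α β, Sweep sa E δ xs z2 lo hi (th i) (e i) α β) :
    Hits sa E δ th e ∨ ∃ z x3, xs < x3 ∧ ExitAt sa E δ th e z x3 := by
  by_cases hr : ∀ x ∈ Icc xs 1, 0 < E x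
  · obtain ⟨z1, y1, y2, z2, lo, hi, μ, H, HL, H1, -⟩ := P.exists_hill (x3 := 0) hδ hxs hE hl
      (Or.inl hr)
    obtain rfl : z2 = 1 := H1 fun h => by linarith [h.lt, hxs.1]
    left
    filter_upwards [S.shoot, hsw _ _ _ _ _ _ _ H HL] with i Si ⟨α, β, B⟩ using B.finish Si
  push Not at hr
  obtain ⟨t, ht, hEt⟩ := hr
  have hsub : Icc xs 1 ⊆ Icc (0:ℝ) 1 := Icc_subset_Icc hxs.1 le_rfl
  obtain ⟨x3, hx3, hz3, hlt, hpos⟩ := exists_first_zero (P.cont.mono hsub) hE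
    ⟨t, ht, le_antisymm hEt (P.nonneg t (hsub ht))⟩
  have hR : Rise (fun x => E (1 - x)) (1 - x3) (1 - xs) := ⟨by linarith [hx3.2], by linarith,
    by simpa using hz3, fun x hx => hpos _ ⟨by linarith [hx.2], by linarith [hx.1]⟩⟩
  obtain ⟨z1, y1, y2, z2, lo, hi, μ, H, HL, -, H2⟩ := P.exists_hill hδ hxs hE hl (Or.inr hR)
  obtain ⟨hz2, hsm, η, lam, d, R⟩ := H2 hR
  have hz20 : 0 ≤ z2 := by linarith [H.h3, H.h4, hxs.1]
  refine Or.inr ⟨z2, x3, hlt, hz20, hz2.le, hx3.2, hz2.trans_le hx3.2, hz3, hsm, fun y hy => ?_⟩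
  filter_upwards [S.shoot, hsw _ _ _ _ _ _ _ H HL, S.leave P H R] with i Si ⟨α, β, B⟩ hlv using
    B.exit Si hz20 hy.1.le hy.2 hlv

lemma step (S : Scheme D sa th e) (P : Prof D E) (hδ : 0 < δ) {len : ℝ}
    (hlen : ∀ x ∈ Icc (0:ℝ) 1, ∀ y ∈ Icc (0:ℝ) 1, |x - y| < len → |E x - E y| < δ / 2)
    {x2 : ℝ} (X : ExitAt sa E δ th e z x2) :
    Hits sa E δ th e ∨ ∃ z' x3, x2 + len < x3 ∧ ExitAt sa E δ th e z' x3 := by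
  have e0 := X.nonneg
  have e1 := X.le
  have e2 := X.lt_one
  by_cases hf : ∀ x ∈ Icc x2 1, E x < δ / 2
  · left
    filter_upwards [S.shoot, X.ex 1 ⟨e2, le_rfl⟩, S.flat P hδ e0 e2 fun x hx => by
      rcases le_total x x2 with h | h
      · linarith [X.small x ⟨hx.1, h⟩]
      · exact (hf x ⟨h, hx.2⟩).le] with i Si ⟨σ, τ, k, Xi⟩ hflat using Xi.finish Si hflat
  push Not at hf
  obtain ⟨t, ht, hEt⟩ := hf
  have hsub : Icc x2 1 ⊆ Icc (0:ℝ) 1 := Icc_subset_Icc (e0.trans e1) le_rfl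
  have hg : ContinuousOn (fun x => δ / 2 - E x) (Icc x2 1) :=
    continuousOn_const.sub (P.cont.mono hsub)
  have hg2 : 0 < δ / 2 - E x2 := by rw [X.zero]; linarith
  obtain ⟨xs, hxs, hzs, hlt, hpos⟩ := exists_first_zero hg hg2 (by
    obtain ⟨s, hs, es⟩ := intermediate_value_Icc' ht.1 (hg.mono (Icc_subset_Icc le_rfl ht.2))
      (show (0:ℝ) ∈ _ from ⟨by linarith, hg2.le⟩)
    exact ⟨s, ⟨hs.1, hs.2.trans ht.2⟩, es⟩)
  have hEs : E xs = δ / 2 := by linarith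
  have hxs1 := hsub hxs
  obtain ⟨w, hw, hzw, hltw, hposw⟩ := exists_first_zero (l := -xs) (r := -x2)
    (g := fun t => E (-t)) (P.cont.comp (by fun_prop) fun t ht =>
      hsub ⟨by linarith [ht.2], by linarith [ht.1, hxs.2]⟩) (by rw [neg_neg, hEs]; linarith)
    ⟨-x2, ⟨by linarith, le_rfl⟩, by rw [neg_neg]; exact X.zero⟩
  have hR : Rise E (-w) xs := ⟨by linarith [hw.2], by linarith, hzw, fun x hx => by
    simpa using hposw (-x) ⟨by linarith [hx.2], by linarith [hx.1]⟩⟩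
  have hdist : -w + len ≤ xs := by
    by_contra! hcon
    have := hlen xs hxs1 (-w) ⟨hR.nonneg, by linarith [hxs.2]⟩ (by
      rw [abs_of_pos (by linarith)]; linarith)
    rw [hR.zero, hEs, sub_zero, abs_of_pos (by linarith)] at this
    exact lt_irrefl _ this
  have hstep := S.hill_step P hδ hxs1 (by rw [hEs]; linarith) (Or.inr hR) ?_
  · rcases hstep with h | ⟨z', x3, h3, X'⟩
    · exact Or.inl h
    · exact Or.inr ⟨z', x3, by linarith [hw.2], X'⟩
  intro z1 y1 y2 z2 lo hi μ H HL
  obtain ⟨hz1, η, lam, d, L⟩ := HL hR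
  have hzz : z < z1 := by linarith [hw.2]
  have hz1x : z1 < xs := by linarith [L.le_y, L.η_pos, H.h2]
  filter_upwards [S.shoot, X.ex z1 ⟨hzz, by linarith [hxs.2]⟩, S.enter P H L,
    S.stay H e0 e2 (by linarith), S.rotation P H, S.close P hδ H e0 hzz.le fun x hx => by
      refine Or.inl ?_
      rcases le_total x x2 with h | h
      · linarith [X.small x ⟨hx.1, h⟩]
      · linarith [hpos x ⟨h, hx.2.trans_lt hz1x⟩]]
    with i Si ⟨σ, τ, k, Xi⟩ henter hstay hrot hclose
  exact Xi.sweep Si hxs1 e0 hzz.le (by linarith [hxs.2]) H.lohi.le henter hstay hrot hclose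

lemma hits_of_exit (S : Scheme D sa th e) (P : Prof D E) (hδ : 0 < δ) {x2 : ℝ}
    (X : ExitAt sa E δ th e z x2) : Hits sa E δ th e := by
  obtain ⟨len, hl, hlen⟩ := Metric.uniformContinuousOn_iff.1
    (isCompact_Icc.uniformContinuousOn_of_continuous P.cont) (δ / 2) (by linarith)
  simp only [Real.dist_eq] at hlen
  have key : ∀ (N : ℕ) (z x2 : ℝ), ExitAt sa E δ th e z x2 → 1 - x2 ≤ N * len →
      Hits sa E δ th e := by
    intro N
    induction N with
    | zero =>
      intro z x2 X h
      rcases S.step P hδ hlen X with h' | ⟨z', x3, h3, X'⟩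
      · exact h'
      · have := X'.le_one
        push_cast at h
        linarith
    | succ N ih =>
      intro z x2 X h
      rcases S.step P hδ hlen X with h' | ⟨z', x3, h3, X'⟩
      · exact h'
      · refine ih z' x3 X' ?_
        push_cast at h
        linarith
  obtain ⟨N, hN⟩ := exists_nat_ge ((1 - x2) / len)
  exact key N z x2 X ((div_le_iff₀ hl).1 hN)

theorem hits (S : Scheme D sa th e) (P : Prof D E) (hδ : 0 < δ) (hsa : sa ∈ Ioo (0:ℝ) 1)
    (hF : D.F sa = D.W0 - D.γ) (hγ : D.γ < D.W0) (hE : E 0 < D.F sa)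
    (h0 : E 0 = 0 → D.F sa ≤ δ) : Hits sa E δ th e := by
  have m0 : (0:ℝ) ∈ Icc (0:ℝ) 1 := left_mem_Icc.2 zero_le_one
  rcases (P.nonneg 0 m0).eq_or_lt with hz | hpos
  · refine S.hits_of_exit P hδ (z := 0) (x2 := 0) ⟨le_rfl, le_rfl, zero_le_one, zero_lt_one, hz.symm,
      fun x hx => ?_, fun y hy => ?_⟩
    · rw [le_antisymm hx.2 hx.1, ← hz]; positivity
    · filter_upwards [S.shoot, S.start hγ hy.1 hy.2] with i Si hs
      have hm : sa ∈ Icc sa 1 := ⟨le_rfl, hsa.2.le⟩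
      exact Si.exit_start hsa.2.le (hs sa hm (by rw [Si.e0 sa hm, hF])) hz.symm (h0 hz.symm) hsa.1.le
  · have hstep := S.hill_step P hδ (x1 := 0) m0 hpos (Or.inl rfl) ?_
    · rcases hstep with h | ⟨z, x3, -, X⟩
      · exact h
      · exact S.hits_of_exit P hδ X
    intro z1 y1 y2 z2 lo hi μ H _
    obtain rfl : z1 = 0 := le_antisymm (H.h1.trans H.h2) H.h0
    filter_upwards [S.shoot, S.rotation P H, S.close P hδ H le_rfl le_rfl fun x _ => Or.inr rfl]
      with i Si hrot hclose
    exact Si.sweep_start hsa.2.le H.lohi.le ⟨H.hiE, hE⟩ H.lo_pos hrot hclose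

end Scheme

theorem exists_sol_near (D : Env) {E : ℝ → ℝ} (P : Prof D E) {sa δ : ℝ} (hδ : 0 < δ)
    (hsa : sa ∈ Ioo (0:ℝ) 1) (hF : D.F sa = D.W0 - D.γ) (hγ : D.γ < D.W0) (hE : E 0 < D.F sa)
    (h0 : E 0 = 0 → D.F sa ≤ δ) :
    ∀ᶠ ε in 𝓝[>] (0:ℝ), ∃ u m θ, Sol D ε u m θ ∧ m 1 = 0 ∧
      ∀ x ∈ Icc (0:ℝ) 1, |en D.q D.F D.a u m x - E x| ≤ δ := by
  obtain ⟨th, e, hsh⟩ := exists_shoot D hsa hF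
  have S : Scheme D sa (fun i => th i.1 i.2) (fun i => e i.1 i.2) := by
    refine ⟨?_, fun Q hQ h => ?_⟩
    · rw [eventually_curry_iff]
      filter_upwards [self_mem_nhdsWithin] with ε hε using .of_forall (hsh ε hε).1
    · rw [eventually_curry_iff]
      filter_upwards [self_mem_nhdsWithin, h] with ε hε h using (hsh ε hε).2 Q hQ h
  have hits := S.hits P hδ hsa hF hγ hE h0
  rw [Scheme.Hits, eventually_curry_iff] at hits
  filter_upwards [hits, self_mem_nhdsWithin] with ε hn hε
  by_contra! hcon
  have m1 : (1:ℝ) ∈ Icc (0:ℝ) 1 := right_mem_Icc.2 zero_le_one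
  have htr := (hsh ε hε).2 (fun g e _ _ => cos (g 1) = 0 → ∃ x ∈ Icc (0:ℝ) 1, δ < |e x - E x|)
    (fun g e _ _ G E' _ _ hg he _ _ h => Eventually.exists (f := (atTop : Filter ℕ)) ?_)
    fun u m θ _ _ _ hs _ hc => hcon u m θ hs (by rw [hs.polm 1 m1, hc, mul_zero])
  · obtain ⟨n, ⟨s, hs, hc, hle⟩, h2⟩ := (hn.and htr).exists
    obtain ⟨x, hx, hlt⟩ := h2 s hs s hs hc
    exact absurd (hle x hx) hlt.not_ge
  · refine eventually_imp_of_closed ((continuous_cos.tendsto _).comp (hg.pointwise m1))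
      isClosed_singleton (fun ⟨x, hx, hlt⟩ => ?_) h
    filter_upwards [((he.pointwise hx).sub_const (E x)).abs.eventually_const_lt hlt] with n hn
      using ⟨x, hx, hn⟩

end Transfer

section Existence

lemma exists_diagonal_family {X : Type*} [Nonempty X] (R : ℝ → X → ℝ → Prop)
    (hR : ∀ ε x δ δ', δ ≤ δ' → R ε x δ → R ε x δ')
    (h : ∀ δ > 0, ∀ᶠ ε in 𝓝[>] (0:ℝ), ∃ x, R ε x δ) :
    ∃ ε0 > 0, ∃ f : ℝ → X, (∀ ε, 0 < ε → ε < ε0 → R ε (f ε) 1) ∧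
      ∀ δ > 0, ∀ᶠ ε in 𝓝[>] (0:ℝ), R ε (f ε) δ := by
  classical
  obtain ⟨ε0, hε0, h1⟩ := mem_nhdsGT_iff_exists_Ioo_subset.1 (h 1 one_pos)
  have key : ∀ ε, ∃ x, (0 < ε → ε < ε0 → R ε x 1) ∧
      ∀ n : ℕ, 0 < ε → ε < ε0 → (n:ℝ) ≤ 1 / ε → (∃ x, R ε x (1 / (n + 1))) →
        R ε x (1 / (n + 1)) := fun ε => by
    by_cases hε : 0 < ε ∧ ε < ε0
    · set N := Nat.findGreatest (fun n : ℕ => ∃ x, R ε x (1 / (n + 1))) ⌊1 / ε⌋₊ with hN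
      obtain ⟨x, hx⟩ : ∃ x, R ε x (1 / (N + 1)) :=
        Nat.findGreatest_spec (P := fun n : ℕ => ∃ x, R ε x (1 / (n + 1))) (Nat.zero_le _)
          (by simpa using h1 hε)
      refine ⟨x, fun _ _ => hR _ _ _ _ ?_ hx, fun n _ _ hn he => hR _ _ _ _ ?_ hx⟩
      · rw [div_le_one (by positivity)]
        linarith [(Nat.cast_nonneg N : (0:ℝ) ≤ N)]
      · have : n ≤ N := Nat.le_findGreatest (Nat.le_floor hn) he
        gcongr
    · exact ⟨Classical.arbitrary X, fun h h' => absurd ⟨h, h'⟩ hε, fun _ h h' => absurd ⟨h, h'⟩ hε⟩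
  choose f hf hf' using key
  refine ⟨ε0, hε0, f, hf, fun δ hδ => ?_⟩
  obtain ⟨n, hn⟩ := exists_nat_one_div_lt hδ
  have hpos : (0:ℝ) < 1 / (n + 1) := by positivity
  filter_upwards [h _ hpos, Ioo_mem_nhdsGT hε0, Ioo_mem_nhdsGT hpos] with ε he h2 h3
  refine hR _ _ _ _ hn.le (hf' ε n h2.1 h2.2 ?_ he)
  rw [le_div_iff₀ h2.1]
  have h4 := (lt_div_iff₀ (by positivity)).1 h3.2
  nlinarith [h2.1]

lemma Sys.isNeumann {p W0 ε : ℝ} {a W u m : ℝ → ℝ} (hε : 0 < ε)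
    (w : Well p (p / (p - 1)) W0 (extZero (deriv W)) (extZero W)) (ha : ContinuousOn a (Icc 0 1))
    (S : Sys (p / (p - 1)) (extZero (deriv W)) a ε 0 1 u m) (hu : |u 0| ≤ 1) (h0 : m 0 = 0)
    (h1 : m 1 = 0) :
    IsNeumann p ε a W u (fun x => phip (p / (p - 1)) (m x) / ε) ∧
      ∀ x ∈ Icc (0:ℝ) 1, Ener p ε a W u (fun x => phip (p / (p - 1)) (m x) / ε) x =
        en (p / (p - 1)) (extZero W) a u m x := by
  have hle := S.abs_le_one_of_end w hε hu h1
  have hmul : ∀ x, ε * (phip (p / (p - 1)) (m x) / ε) = phip (p / (p - 1)) (m x) := fun x =>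
    mul_div_cancel₀ _ hε.ne'
  refine ⟨⟨⟨((continuous_phip w.q1).comp_continuousOn S.mcont).div_const ε, S.du,
    fun x => a x / ε * extZero (deriv W) (u x), (ha.div_const ε).mul
      (w.fcont.comp_continuousOn S.ucont), fun x hx => ?_, fun x hx => ?_⟩, ?_, ?_⟩, fun x hx => ?_⟩
  · simp only [hmul, phip_phip w.hp w.hq]
    exact S.dm x hx
  · beta_reduce
    rw [extZero_of_le (hle x hx)]
    field_simp
  · simp [h0, phip_zero]
  · simp [h1, phip_zero]
  · simp only [Ener, hmul, Lfun_phip w.hp w.hq, en]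
    rw [extZero_of_le (hle x hx)]
    ring

lemma exists_neumann_near {p W0 δ : ℝ} (hδ : 0 < δ) {a W T K E : ℝ → ℝ} (haC : ContDiff ℝ 1 a)
    (hapos : ∀ x ∈ Icc (0:ℝ) 1, 0 < a x)
    (w : Well p (p / (p - 1)) W0 (extZero (deriv W)) (extZero W))
    (k : PK p (p / (p - 1)) W0 (extZero (deriv W)) (extZero W) T K) (hK0 : K 0 = 0)
    (hKW0 : K W0 = 0) (hErange : ∀ x ∈ Icc (0:ℝ) 1, E x ∈ Icc 0 W0)
    (hEeq : ∀ x ∈ Icc (0:ℝ) 1, HasDerivWithinAt E (deriv a x / a x * K (E x)) (Icc 0 1) x) :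
    ∀ᶠ ε in 𝓝[>] (0:ℝ), ∃ U : (ℝ → ℝ) × (ℝ → ℝ), IsNeumann p ε a W U.1 U.2 ∧
      ∀ x ∈ Icc (0:ℝ) 1, |Ener p ε a W U.1 U.2 x - E x| ≤ δ := by
  have ha : ContinuousOn a (Icc 0 1) := haC.continuous.continuousOn
  have m0 : (0:ℝ) ∈ Icc (0:ℝ) 1 := left_mem_Icc.2 zero_le_one
  obtain ⟨tm, htm, hmin⟩ := isCompact_Icc.exists_isMinOn ⟨0, m0⟩ ha
  obtain ⟨tM, -, hmax⟩ := isCompact_Icc.exists_isMaxOn ⟨0, m0⟩ ha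
  have ha' : Continuous (deriv a) := haC.continuous_deriv le_rfl
  obtain ⟨A, hA⟩ := isCompact_Icc.exists_bound_of_continuousOn (s := Icc (0:ℝ) 1) ha'.continuousOn
  have hKle : ∀ ξ ∈ Icc 0 W0, |K ξ| ≤ W0 - ξ := fun ξ hξ => by
    rcases hξ.1.eq_or_lt with rfl | h1
    · simp [hK0, w.W0pos.le]
    rcases hξ.2.eq_or_lt with rfl | h2
    · simp [hKW0]
    rw [abs_of_pos (k.K_pos w ⟨h1, h2⟩)]
    exact k.K_le w ⟨h1, h2⟩
  by_cases htop : ∃ x ∈ Icc (0:ℝ) 1, E x = W0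
  · obtain ⟨x0, hx0, e0⟩ := htop
    have hA0 : 0 ≤ A := (norm_nonneg _).trans (hA 0 m0)
    have hg := fun {x y} => gronwall_two_sided (l := 0) (r := 1) (C := A / a tm)
      (g := fun x => W0 - E x) (fun x hx => (hEeq x hx).const_sub W0) (fun x hx => by
        rw [abs_neg, abs_mul, abs_div, abs_of_pos (hapos x hx)]
        have hpos := hapos tm htm
        have hle : a tm ≤ a x := hmin hx
        have hAx : |deriv a x| ≤ A := hA x hx
        have := hKle _ (hErange x hx)
        gcongr) (x := x) (y := y)
    have hE : ∀ x ∈ Icc (0:ℝ) 1, E x = W0 := fun x hx => by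
      refine le_antisymm (hErange x hx).2 ?_
      rcases le_total x x0 with h | h
      · have := (hg hx hx0 h).1
        simp only [e0, sub_self] at this
        nlinarith [exp_pos (-(A / a tm * (x0 - x)))]
      · have := (hg hx0 hx h).2
        simp only [e0, sub_self, zero_mul] at this
        linarith
    filter_upwards [self_mem_nhdsWithin] with ε hε
    have hq := w.q1
    have S : Sys (p / (p - 1)) (extZero (deriv W)) a ε 0 1 (fun _ => 0) (fun _ => 0) :=
      ⟨fun x _ => by simpa [phip_zero] using hasDerivWithinAt_const x (Icc (0:ℝ) 1) (0:ℝ),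
        fun x _ => by simpa [w.f0] using hasDerivWithinAt_const x (Icc (0:ℝ) 1) (0:ℝ)⟩
    obtain ⟨h1, h2⟩ := S.isNeumann hε w ha (by simp) rfl rfl
    refine ⟨⟨_, _⟩, h1, fun x hx => ?_⟩
    rw [h2 x hx, hE x hx, en, w.F0, abs_zero, zero_rpow (by linarith)]
    simpa using hδ.le
  push Not at htop
  have hlt : ∀ x ∈ Icc (0:ℝ) 1, E x < W0 := fun x hx => (hErange x hx).2.lt_of_ne (htop x hx)
  have hE0 := hlt 0 m0
  have hE0' := (hErange 0 m0).1
  set t := E 0 + min δ ((W0 - E 0) / 2) with ht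
  have t1 : E 0 < t := by
    have : 0 < min δ ((W0 - E 0) / 2) := lt_min hδ (by linarith)
    linarith
  have t2 : t < W0 := by linarith [min_le_right δ ((W0 - E 0) / 2)]
  have hF1 : extZero W 1 = 0 := w.Fout 1 (by simp)
  obtain ⟨sa, hsa, hFsa⟩ := intermediate_value_Icc' (zero_le_one (α := ℝ)) w.Fcont.continuousOn
    (show t ∈ Icc (extZero W 1) (extZero W 0) by
      rw [hF1, w.F0]; exact ⟨by linarith, t2.le⟩)
  have hsa' : sa ∈ Ioo (0:ℝ) 1 := by
    refine ⟨hsa.1.lt_of_ne fun e => ?_, hsa.2.lt_of_ne fun e => ?_⟩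
    · rw [← e, w.F0] at hFsa; linarith
    · rw [e, hF1] at hFsa; linarith
  let D : Env := ⟨p, p / (p - 1), W0, a tm, a tM, A, W0 - t, extZero (deriv W), extZero W, T, K, a,
    deriv a, w, k, hapos tm htm, by linarith, fun x hx => hmin hx, fun x hx => hmax hx,
    fun x _ => (haC.differentiable one_ne_zero x).hasDerivAt, ha'.continuousOn, hA⟩
  have P : Prof D E := ⟨fun x hx => (hEeq x hx).continuousWithinAt, fun x hx => (hErange x hx).1, hlt,
    fun x hx _ => hEeq x hx⟩
  have hFD : D.F sa = t := hFsa
  filter_upwards [exists_sol_near D P hδ hsa' (hFD.trans (by simp [D]))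
    (show W0 - t < W0 by linarith) (by rw [hFD]; exact t1) fun h => by
      rw [hFD, ht, h, zero_add]; exact min_le_left _ _, self_mem_nhdsWithin]
    with ε ⟨u, m, θ, hs, hm1, hnear⟩ hε
  obtain ⟨h1, h2⟩ := Sys.isNeumann hε w ha hs.sys hs.u0 hs.m0 hm1
  refine ⟨⟨u, _⟩, h1, fun x hx => ?_⟩
  rw [h2 x hx]
  exact hnear x hx

end Existence

theorem existence_of_solutions_with_prescribed_limit_energy
    (p : ℝ) (hp : 1 < p)
    (a : ℝ → ℝ) (haC : ContDiff ℝ 1 a) (hapos : ∀ x ∈ Set.Icc (0:ℝ) 1, 0 < a x)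
    (W : ℝ → ℝ) (hW : ContDiff ℝ 1 W)
    (Cm1 C0 C1 W0 : ℝ) (hW1 : W1cond p W Cm1 C0 C1 W0) (hW2 : W2cond p W)
    (T K : ℝ → ℝ)
    (hTK : ∀ ξ ∈ Set.Ioo 0 W0, ∃ v v' : ℝ → ℝ,
      IsSolAuto p 1 W v v' ∧ (∀ x, -(1 / 1) * Lfun p (v' x) + W (v x) = ξ) ∧
      v 0 = 0 ∧ 0 < v' 0 ∧
      IsLeast {c : ℝ | 0 < c ∧ Function.Periodic v c} (T ξ) ∧
      K ξ = (1 / T ξ) * ∫ y in (0:ℝ)..(T ξ), Lfun p (v' y))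
    (hK0 : K 0 = 0) (hKW0 : K W0 = 0)
    (E : ℝ → ℝ)
    (hErange : ∀ x ∈ Set.Icc (0:ℝ) 1, E x ∈ Set.Icc 0 W0)
    (hEeq : ∀ x ∈ Set.Icc (0:ℝ) 1,
      HasDerivWithinAt E (deriv a x / a x * K (E x)) (Set.Icc 0 1) x) :
    ∃ ε0 : ℝ, 0 < ε0 ∧ ∃ u u' : ℝ → ℝ → ℝ,
      (∀ ε : ℝ, 0 < ε → ε < ε0 → IsNeumann p ε a W (u ε) (u' ε)) ∧
      TendstoUniformlyOn (fun ε x => Ener p ε a W (u ε) (u' ε) x) E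
        (𝓝[>] (0:ℝ)) (Set.Icc 0 1) := by
  have w := well_of_conditions hp hW hW1 hW2
  have k := pk_of_hypothesis w hTK
  obtain ⟨ε0, hε0, U, hU, hnear⟩ := exists_diagonal_family
    (fun ε (U : (ℝ → ℝ) × (ℝ → ℝ)) δ => IsNeumann p ε a W U.1 U.2 ∧
      ∀ x ∈ Icc (0:ℝ) 1, |Ener p ε a W U.1 U.2 x - E x| ≤ δ)
    (fun ε U δ δ' hle h => ⟨h.1, fun x hx => (h.2 x hx).trans hle⟩)
    (fun δ hδ => exists_neumann_near hδ haC hapos w k hK0 hKW0 hErange hEeq)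
  refine ⟨ε0, hε0, fun ε => (U ε).1, fun ε => (U ε).2, fun ε h h' => (hU ε h h').1, ?_⟩
  rw [Metric.tendstoUniformlyOn_iff]
  intro δ hδ
  filter_upwards [hnear (δ / 2) (half_pos hδ)] with ε h x hx
  rw [dist_comm, Real.dist_eq]
  exact (h.2 x hx).trans_lt (half_lt_self hδ)
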